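/- Let n ≥ 3, let 2 ≤ i ≤ n−1, and let Φ_i : 𝒦ⁿ → 𝒦ⁿ be a C^∞₊ regular, translation invariant, even Minkowski valuation of degree i which commutes with SO(n). Then there exists ε > 0 with the following property: if K ∈ 𝒦ⁿ has a support function of class C² and satisfies ‖h_{γK} − h_{𝔹ⁿ}‖_{C²(𝕊^{n−1})} < ε for some γ > 0, then there exists a sequence of positive real numbers (γ_m)_{m=1}^∞ such that d_H(γ_m Φ_i^m K, 𝔹ⁿ) → 0 as m → ∞, where Φ_i^m denotes the m-fold iterate of Φ_i. -/

import Mathlib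

open scoped InnerProductSpace Pointwise
open MeasureTheory Metric Filter Topology

noncomputable section

/-- Euclidean space `ℝⁿ`. -/
abbrev En (n : ℕ) := EuclideanSpace ℝ (Fin n)

namespace MinkIter

variable {n : ℕ}

/-- The unit sphere `𝕊^{n-1}` as a subtype. -/
abbrev Sph (n : ℕ) := Metric.sphere (0 : En n) 1

/-- Spherical Lebesgue measure on `𝕊^{n-1}`. -/
def sphVol (n : ℕ) : Measure (Sph n) := (volume : Measure (En n)).toSphere

/-- A fixed pole `ē ∈ 𝕊^{n-1}`. -/
def pole (n : ℕ) : En n :=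
  if h : 0 < n then EuclideanSpace.single (⟨0, h⟩ : Fin n) 1 else 0

/-- The support function of a convex body, as a function on all of `ℝⁿ`. -/
def supp (K : ConvexBody (En n)) (x : En n) : ℝ :=
  sSup ((fun y => ⟪x, y⟫_ℝ) '' (K : Set (En n)))

/-- The Euclidean unit ball `𝔹ⁿ` as a convex body. -/
def ballB (n : ℕ) : ConvexBody (En n) :=
  ⟨closedBall 0 1, convex_closedBall 0 1, isCompact_closedBall 0 1, ⟨0, by simp⟩⟩

/-- The dilate `c • K` of a convex body. -/
def scale (c : ℝ) (K : ConvexBody (En n)) : ConvexBody (En n) :=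
  ⟨c • (K : Set (En n)), K.convex.smul c, K.isCompact.smul c, K.nonempty.smul_set⟩

/-- The translate `K + x` of a convex body. -/
def translate (K : ConvexBody (En n)) (x : En n) : ConvexBody (En n) :=
  ⟨(fun y => x + y) '' (K : Set (En n)), K.convex.translate x,
    K.isCompact.image (continuous_add_left x), K.nonempty.image _⟩

/-- A linear isometry of `ℝⁿ` is a rotation (element of `SO(n)`) if it preserves
orientation. -/
def IsRotation (ρ : En n ≃ₗᵢ[ℝ] En n) : Prop :=
  0 < LinearMap.det (ρ.toLinearEquiv.toLinearMap)

/-- The image `ρ K` of a convex body under a linear isometry. -/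
def rotate (ρ : En n ≃ₗᵢ[ℝ] En n) (K : ConvexBody (En n)) : ConvexBody (En n) :=
  ⟨ρ '' (K : Set (En n)), K.convex.linear_image ρ.toLinearEquiv.toLinearMap,
    K.isCompact.image ρ.continuous, K.nonempty.image _⟩

/-- `Φ` is a Minkowski valuation: `ΦK + ΦL = Φ(K ∪ L) + Φ(K ∩ L)` whenever `K ∪ L`
is convex (Minkowski addition on the left). -/
def IsMinkowskiValuation (Φ : ConvexBody (En n) → ConvexBody (En n)) : Prop :=
  ∀ (K L : ConvexBody (En n)) (hu : Convex ℝ ((K : Set (En n)) ∪ (L : Set (En n))))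
    (hi : ((K : Set (En n)) ∩ (L : Set (En n))).Nonempty),
    Φ K + Φ L =
      Φ ⟨(K : Set (En n)) ∪ (L : Set (En n)), hu, K.isCompact.union L.isCompact,
          K.nonempty.inl⟩ +
      Φ ⟨(K : Set (En n)) ∩ (L : Set (En n)), K.convex.inter L.convex,
          K.isCompact.inter_right L.isCompact.isClosed, hi⟩

/-- `Φ` is translation invariant. -/
def TranslationInvariant (Φ : ConvexBody (En n) → ConvexBody (En n)) : Prop :=
  ∀ (K : ConvexBody (En n)) (x : En n), Φ (translate K x) = Φ K

/-- `Φ` is (positively) homogeneous of degree `i`. -/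
def HasDegree (i : ℕ) (Φ : ConvexBody (En n) → ConvexBody (En n)) : Prop :=
  ∀ (K : ConvexBody (En n)) (c : ℝ), 0 ≤ c → Φ (scale c K) = scale (c ^ i) (Φ K)

/-- `Φ` commutes with `SO(n)`. -/
def RotationEquivariant (Φ : ConvexBody (En n) → ConvexBody (En n)) : Prop :=
  ∀ ρ : En n ≃ₗᵢ[ℝ] En n, IsRotation ρ → ∀ K, Φ (rotate ρ K) = rotate ρ (Φ K)

/-- `Φ` is even: `Φ(-K) = ΦK`. -/
def IsEven (Φ : ConvexBody (En n) → ConvexBody (En n)) : Prop :=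
  ∀ K, Φ (scale (-1) K) = Φ K

/-- `Φ` is monotone w.r.t. set inclusion. -/
def MonotoneVal (Φ : ConvexBody (En n) → ConvexBody (En n)) : Prop :=
  ∀ K L : ConvexBody (En n), (K : Set (En n)) ⊆ (L : Set (En n)) →
    (Φ K : Set (En n)) ⊆ (Φ L : Set (En n))

/-- `Φ` is non-trivial: `ΦK ≠ {o}` for some `K`. -/
def NontrivialVal (Φ : ConvexBody (En n) → ConvexBody (En n)) : Prop :=
  ∃ K : ConvexBody (En n), (Φ K : Set (En n)) ≠ {0}

/-- The mixed volume `V(K₁,…,Kₙ)`, via polarization of the volume. -/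
def mixedVol (Ks : Fin n → ConvexBody (En n)) : ℝ :=
  ((n.factorial : ℝ))⁻¹ *
    ∑ S : Finset (Fin n), (-1 : ℝ) ^ (n - S.card) *
      (volume ((∑ k ∈ S, Ks k : ConvexBody (En n)) : Set (En n))).toReal

/-- `κ_m`, the volume of the `m`-dimensional unit ball. -/
def kappa (m : ℕ) : ℝ := (volume (closedBall (0 : En m) 1)).toReal

/-- `ω_m`, the surface area of the `m`-dimensional unit ball. -/
def omegaS (m : ℕ) : ℝ := m * kappa m

/-- The `j`-th intrinsic volume `V_j(K) = binom(n,j) V(K[j],𝔹ⁿ[n-j]) / κ_{n-j}`. -/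
def intrinsicVol (j : ℕ) (K : ConvexBody (En n)) : ℝ :=
  (n.choose j : ℝ) / kappa (n - j) *
    mixedVol (fun k : Fin n => if (k : ℕ) < j then K else ballB n)

/-- `μ` is the area measure of order `i` of `K`: for every convex body `L`,
`∫ h_L dμ = n V(L, K[i], 𝔹ⁿ[n-1-i])`. -/
def IsAreaMeasure (i : ℕ) (K : ConvexBody (En n)) (μ : Measure (Sph n)) : Prop :=
  ∀ L : ConvexBody (En n),
    (∫ v : Sph n, supp L (v : En n) ∂μ) =
      n * mixedVol (fun k : Fin n =>
        if (k : ℕ) = 0 then L else if (k : ℕ) ≤ i then K else ballB n)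

/-- `Φ` is generated by the zonal function with profile `g : [-1,1] → ℝ`, i.e.
`h_{ΦK} = S_i(K,·) ∗ g` where `∗` is the spherical convolution. -/
def GeneratedBy (i : ℕ) (Φ : ConvexBody (En n) → ConvexBody (En n)) (g : ℝ → ℝ) : Prop :=
  ∀ (K : ConvexBody (En n)) (μ : Measure (Sph n)), IsAreaMeasure i K μ →
    ∀ u : En n, ‖u‖ = 1 →
      supp (Φ K) u = ∫ v : Sph n, g ⟪u, (v : En n)⟫_ℝ ∂μ

/-- `L` is a body of revolution: invariant under all rotations fixing the pole. -/
def IsZonalBody (L : ConvexBody (En n)) : Prop :=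
  ∀ ρ : En n ≃ₗᵢ[ℝ] En n, IsRotation ρ → ρ (pole n) = pole n → rotate ρ L = L

/-- The quadratic form of the Hessian of `F` at `u` in direction `w`. -/
def hessQ (F : En n → ℝ) (u w : En n) : ℝ := iteratedFDeriv ℝ 2 F u ![w, w]

/-- `(j,l)` entry of the Hessian of `F` at `u`. -/
def hessE (F : En n → ℝ) (u : En n) (j l : Fin n) : ℝ :=
  iteratedFDeriv ℝ 2 F u ![EuclideanSpace.single j 1, EuclideanSpace.single l 1]

/-- A convex body is of class `C^k₊` if its support function is of class `C^k`
away from the origin and the restriction of its Hessian to `u^⊥` is positive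
definite for every unit vector `u`. -/
def IsCkPlus (k : ℕ∞) (L : ConvexBody (En n)) : Prop :=
  ContDiffOn ℝ k (supp L) {0}ᶜ ∧
    ∀ u : En n, ‖u‖ = 1 → ∀ w : En n, w ≠ 0 → ⟪u, w⟫_ℝ = 0 → 0 < hessQ (supp L) u w

/-- `Φ` is a `C^∞₊` regular Minkowski valuation of degree `i`: it is generated by
the support function of a body of revolution of class `C^∞₊`. -/
def CInfRegular (i : ℕ) (Φ : ConvexBody (En n) → ConvexBody (En n)) : Prop :=
  ∃ (L : ConvexBody (En n)) (g : ℝ → ℝ), IsZonalBody L ∧ IsCkPlus ⊤ L ∧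
    (∀ u : En n, ‖u‖ = 1 → supp L u = g ⟪u, pole n⟫_ℝ) ∧ GeneratedBy i Φ g

/-- The `C²(𝕊^{n-1})` distance of two functions. -/
def C2dist (F G : En n → ℝ) : ℝ :=
  ⨆ u : Sph n, (|F (u : En n) - G (u : En n)| +
    ‖fderiv ℝ F (u : En n) - fderiv ℝ G (u : En n)‖ +
    ‖iteratedFDeriv ℝ 2 F (u : En n) - iteratedFDeriv ℝ 2 G (u : En n)‖)

/-- The Legendre polynomial of dimension `d` and degree `k` (Rodrigues formula). -/
def legendreP (d k : ℕ) (t : ℝ) : ℝ :=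
  (-1 : ℝ) ^ k *
    (Real.Gamma (((d : ℝ) - 1) / 2) / (2 ^ k * Real.Gamma (((d : ℝ) - 1) / 2 + k))) *
    (1 - t ^ 2) ^ (-(((d : ℝ) - 3) / 2)) *
    iteratedDeriv k (fun s : ℝ => (1 - s ^ 2) ^ ((((d : ℝ) - 3) / 2) + (k : ℝ))) t

/-- The multiplier `a_k^d[h]` of a zonal function with profile `h : [-1,1] → ℝ`. -/
def multInt (d k : ℕ) (h : ℝ → ℝ) : ℝ :=
  omegaS (d - 1) *
    ∫ t in (-1 : ℝ)..1, legendreP d k t * h t * (1 - t ^ 2) ^ (((d : ℝ) - 3) / 2)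

/-- The multiplier `a_k^n[f] = ∫_{𝕊^{n-1}} f(u) P_k^n(ē·u) du` of a zonal function
`f` on the sphere. -/
def multSph (k : ℕ) (f : En n → ℝ) : ℝ :=
  ∫ u : Sph n, f (u : En n) * legendreP n k ⟪pole n, (u : En n)⟫_ℝ ∂(sphVol n)

/-- The projection `π₀ f` of `f` onto the constants (its mean value). -/
def proj0 (f : En n → ℝ) : ℝ :=
  (omegaS n)⁻¹ * ∫ u : Sph n, f (u : En n) ∂(sphVol n)

/-- The `L²(𝕊^{n-1})` norm. -/
def sphL2 (f : En n → ℝ) : ℝ :=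
  Real.sqrt (∫ u : Sph n, (f (u : En n)) ^ 2 ∂(sphVol n))

/-- The sup norm on the sphere. -/
def supSph (f : En n → ℝ) : ℝ := ⨆ u : Sph n, |f (u : En n)|

/-- `M ∈ UBounds α f` iff `M` witnesses `‖f‖_{𝒰_α} ≤ M`: `‖f‖_∞ ≤ M` and for every
`k ≥ 1` there is a polynomial of degree at most `k` with `‖f - p_k‖_{L²} ≤ M k^{-α}`. -/
def UBounds (α : ℝ) (f : En n → ℝ) : Set ℝ :=
  {M | (∀ u : En n, ‖u‖ = 1 → |f u| ≤ M) ∧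
    ∀ k : ℕ, 0 < k → ∃ p : MvPolynomial (Fin n) ℝ, p.totalDegree ≤ k ∧
      sphL2 (fun x => f x - MvPolynomial.eval (fun j => x j) p) ≤ M * (k : ℝ) ^ (-α)}

/-- `f ∈ 𝒰_α`. -/
def MemU (α : ℝ) (f : En n → ℝ) : Prop := (UBounds α f).Nonempty

/-- The norm `‖f‖_{𝒰_α}`. -/
def UNorm (α : ℝ) (f : En n → ℝ) : ℝ := sInf (UBounds α f)

/-- The convolution transform `T_g f` with zonal kernel of profile `g`, extended
1-homogeneously to `ℝⁿ`: `(T_g f)(u) = ∫_{𝕊^{n-1}} g(u·v) f(v) dv` for unit `u`. -/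
def Tg (g : ℝ → ℝ) (f : En n → ℝ) (x : En n) : ℝ :=
  ‖x‖ * ∫ v : Sph n, g ⟪‖x‖⁻¹ • x, (v : En n)⟫_ℝ * f (v : En n) ∂(sphVol n)

/-- The 0-homogeneous extension of a function on the sphere. -/
def zeroExt (f : En n → ℝ) (x : En n) : ℝ := f (‖x‖⁻¹ • x)

/-- The spherical Laplacian `Δ_𝕊 f`, i.e. the Euclidean Laplacian of the
0-homogeneous extension. -/
def sphLap (f : En n → ℝ) (u : En n) : ℝ := ∑ j : Fin n, hessE (zeroExt f) u j j

/-- The operator `□_n f = f + Δ_𝕊 f /(n-1)`. -/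
def boxN (f : En n → ℝ) (u : En n) : ℝ := f u + ((n : ℝ) - 1)⁻¹ * sphLap f u

/-- The mixed discriminant of `m` symmetric `m × m` matrices, via polarization of
the determinant. -/
def mixedDisc {m : ℕ} (A : Fin m → Matrix (Fin m) (Fin m) ℝ) : ℝ :=
  ((m.factorial : ℝ))⁻¹ *
    ∑ S : Finset (Fin m), (-1 : ℝ) ^ (m - S.card) * (∑ k ∈ S, A k).det

/-- The rank one matrix `u ⊗ u`. -/
def outer (u : En n) : Matrix (Fin n) (Fin n) ℝ := Matrix.of fun j l => u j * u l

/-- The matrix of the orthogonal projection onto `u^⊥`. -/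
def projMat (u : En n) : Matrix (Fin n) (Fin n) ℝ := 1 - outer u

/-- The Hessian matrix of `F` at `u`. -/
def hessMat (F : En n → ℝ) (u : En n) : Matrix (Fin n) (Fin n) ℝ :=
  Matrix.of fun j l => hessE F u j l

/-- The mixed discriminant `D_{n-1}(B₁|_{u^⊥},…,B_{n-1}|_{u^⊥})` of the restrictions
to `u^⊥` of matrices annihilating `u`, computed via the identity
`D_{n-1}(B₁|_{u^⊥},…) = n · D_n(u ⊗ u, B₁,…,B_{n-1})`. -/
def restrDisc (u : En n) (B : Fin (n - 1) → Matrix (Fin n) (Fin n) ℝ) : ℝ :=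
  n * mixedDisc (fun k : Fin n =>
    if h : (k : ℕ) = 0 then outer u else B ⟨(k : ℕ) - 1, by have := k.isLt; omega⟩)

/-- Total variation distance between two Borel measures on the sphere. -/
def dTV (μ ν : Measure (Sph n)) : ℝ :=
  ⨆ A : {A : Set (Sph n) // MeasurableSet A}, |(μ A).toReal - (ν A).toReal|

/-- Lévy–Prokhorov distance between two Borel measures on the sphere. -/
def dLP (μ ν : Measure (Sph n)) : ℝ :=
  sInf {ε : ℝ | 0 < ε ∧ ∀ A : Set (Sph n), MeasurableSet A →
    μ A ≤ ν (Metric.thickening ε A) + ENNReal.ofReal ε ∧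
    ν A ≤ μ (Metric.thickening ε A) + ENNReal.ofReal ε}

/-- Two convex bodies are homothetic: one is a translate of a positive dilate of
the other. -/
def Homothetic (K L : ConvexBody (En n)) : Prop :=
  ∃ (c : ℝ) (x : En n), 0 < c ∧ (L : Set (En n)) = x +ᵥ c • (K : Set (En n))

/-- The dimension of a convex body (dimension of its affine hull). -/
def bodyDim (K : ConvexBody (En n)) : ℕ :=
  Module.finrank ℝ (vectorSpan ℝ (K : Set (En n)))

/-- `K` is a Euclidean ball. -/
def IsBall (K : ConvexBody (En n)) : Prop :=
  ∃ (c : En n) (r : ℝ), 0 < r ∧ (K : Set (En n)) = closedBall c r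

/-- The mean width `w(K) = (2/ω_n) ∫_{𝕊^{n-1}} h_K`. -/
def meanWidth (K : ConvexBody (En n)) : ℝ :=
  2 / omegaS n * ∫ u : Sph n, supp K (u : En n) ∂(sphVol n)

/-- `N(n,k)`, the dimension of the space of spherical harmonics of dimension `n`
and degree `k`. -/
def Nnk (n k : ℕ) : ℝ :=
  (((n : ℝ) + 2 * k - 2) / ((n : ℝ) + k - 2)) * (Nat.choose (n + k - 2) (n - 2) : ℝ)

/-! ### Support functions -/

theorem bddAbove_inner_image (K : ConvexBody (En n)) (x : En n) :
    BddAbove ((fun y => ⟪x, y⟫_ℝ) '' (K : Set (En n))) :=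
  (K.isCompact.image (by fun_prop)).bddAbove

theorem inner_le_supp (K : ConvexBody (En n)) (x : En n) {y : En n} (hy : y ∈ K) :
    ⟪x, y⟫_ℝ ≤ supp K x :=
  le_csSup (bddAbove_inner_image K x) ⟨y, hy, rfl⟩

theorem exists_supp_eq (K : ConvexBody (En n)) (x : En n) : ∃ y ∈ K, supp K x = ⟪x, y⟫_ℝ := by
  obtain ⟨y, hy, h⟩ := (K.isCompact.image (f := fun y => ⟪x, y⟫_ℝ) (by fun_prop)).sSup_mem
    (K.nonempty.image _)
  exact ⟨y, hy, h.symm⟩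

theorem supp_le_iff (K : ConvexBody (En n)) (x : En n) (c : ℝ) :
    supp K x ≤ c ↔ ∀ y ∈ K, ⟪x, y⟫_ℝ ≤ c := by
  constructor
  · intro h y hy
    exact (inner_le_supp K x hy).trans h
  · intro h
    obtain ⟨y, hy, e⟩ := exists_supp_eq K x
    rw [e]
    exact h y hy

theorem supp_add (K L : ConvexBody (En n)) (x : En n) :
    supp (K + L) x = supp K x + supp L x := by
  apply le_antisymm
  · rw [supp_le_iff]
    intro y hy
    change y ∈ ((K + L : ConvexBody (En n)) : Set (En n)) at hy
    rw [ConvexBody.coe_add] at hy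
    obtain ⟨a, ha, b, hb, rfl⟩ := hy
    rw [inner_add_right]
    exact add_le_add (inner_le_supp K x ha) (inner_le_supp L x hb)
  · obtain ⟨a, ha, ea⟩ := exists_supp_eq K x
    obtain ⟨b, hb, eb⟩ := exists_supp_eq L x
    rw [ea, eb, ← inner_add_right]
    apply inner_le_supp
    change a + b ∈ ((K + L : ConvexBody (En n)) : Set (En n))
    rw [ConvexBody.coe_add]
    exact Set.add_mem_add ha hb

theorem supp_zero_body (x : En n) : supp (0 : ConvexBody (En n)) x = 0 := by
  obtain ⟨y, hy, e⟩ := exists_supp_eq (0 : ConvexBody (En n)) x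
  have : y = 0 := hy
  rw [e, this, inner_zero_right]

theorem supp_sum {ι : Type*} (s : Finset ι) (K : ι → ConvexBody (En n)) (x : En n) :
    supp (∑ k ∈ s, K k) x = ∑ k ∈ s, supp (K k) x := by
  classical
  induction s using Finset.induction_on with
  | empty => simp [supp_zero_body]
  | insert a s ha ih => rw [Finset.sum_insert ha, Finset.sum_insert ha, supp_add, ih]

theorem supp_scale (c : ℝ) (K : ConvexBody (En n)) (x : En n) :
    supp (scale c K) x = supp K (c • x) := by
  have h : (fun y => ⟪x, y⟫_ℝ) '' (scale c K : Set (En n)) =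
      (fun y => ⟪c • x, y⟫_ℝ) '' (K : Set (En n)) := by
    ext t
    constructor
    · rintro ⟨_, ⟨y, hy, rfl⟩, rfl⟩
      exact ⟨y, hy, by simp [inner_smul_left, inner_smul_right]⟩
    · rintro ⟨y, hy, rfl⟩
      exact ⟨c • y, ⟨y, hy, rfl⟩, by simp [inner_smul_left, inner_smul_right]⟩
  simp only [supp, h]

theorem supp_smul (K : ConvexBody (En n)) {c : ℝ} (hc : 0 ≤ c) (x : En n) :
    supp K (c • x) = c * supp K x := by
  apply le_antisymm
  · rw [supp_le_iff]
    intro y hy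
    rw [inner_smul_left]
    exact mul_le_mul_of_nonneg_left (inner_le_supp K x hy) hc
  · obtain ⟨y, hy, e⟩ := exists_supp_eq K x
    rw [e]
    have := inner_le_supp K (c • x) hy
    rwa [inner_smul_left] at this

theorem supp_zero (K : ConvexBody (En n)) : supp K 0 = 0 := by
  simpa using supp_smul K le_rfl (0 : En n)

theorem supp_add_le (K : ConvexBody (En n)) (x y : En n) :
    supp K (x + y) ≤ supp K x + supp K y := by
  rw [supp_le_iff]
  intro z hz
  rw [inner_add_left]
  exact add_le_add (inner_le_supp K x hz) (inner_le_supp K y hz)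

theorem supp_ball (x : En n) : supp (ballB n) x = ‖x‖ := by
  apply le_antisymm
  · rw [supp_le_iff]
    intro y hy
    have hy' : ‖y‖ ≤ 1 := by simpa using (show y ∈ closedBall (0 : En n) 1 from hy)
    calc ⟪x, y⟫_ℝ ≤ ‖x‖ * ‖y‖ := real_inner_le_norm x y
      _ ≤ ‖x‖ * 1 := by gcongr
      _ = ‖x‖ := mul_one _
  · rcases eq_or_ne x 0 with rfl | hx
    · simp [supp_zero]
    · have h1 : (‖x‖⁻¹ • x) ∈ ballB n := by
        change (‖x‖⁻¹ • x) ∈ closedBall (0 : En n) 1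
        simp [norm_smul, hx]
      have := inner_le_supp (ballB n) x h1
      rw [inner_smul_right, real_inner_self_eq_norm_sq] at this
      have hx' : ‖x‖ ≠ 0 := by simpa using hx
      calc ‖x‖ = ‖x‖⁻¹ * ‖x‖ ^ 2 := by field_simp
        _ ≤ _ := this

theorem supp_translate (K : ConvexBody (En n)) (z x : En n) :
    supp (translate K z) x = supp K x + ⟪x, z⟫_ℝ := by
  apply le_antisymm
  · rw [supp_le_iff]
    rintro _ ⟨y, hy, rfl⟩
    simp only [inner_add_right]
    linarith [inner_le_supp K x hy]
  · obtain ⟨y, hy, e⟩ := exists_supp_eq K x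
    have := inner_le_supp (translate K z) x (y := z + y) ⟨y, hy, rfl⟩
    rw [inner_add_right] at this
    linarith

theorem mem_of_forall_inner_le {K : ConvexBody (En n)} {y : En n}
    (h : ∀ x, ⟪x, y⟫_ℝ ≤ supp K x) : y ∈ K := by
  by_contra hy
  obtain ⟨f, u, h1, h2⟩ := geometric_hahn_banach_closed_point K.convex K.isClosed hy
  set x := (InnerProductSpace.toDual ℝ (En n)).symm f
  have hf : ∀ z, f z = ⟪x, z⟫_ℝ := fun z => by simp [x]
  obtain ⟨z, hz, e⟩ := exists_supp_eq K x
  have := h x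
  have := h1 z hz
  rw [hf] at *
  linarith

theorem coe_subset_iff {K L : ConvexBody (En n)} :
    (K : Set (En n)) ⊆ L ↔ ∀ x, supp K x ≤ supp L x := by
  constructor
  · intro h x
    rw [supp_le_iff]
    exact fun y hy => inner_le_supp L x (h hy)
  · intro h y hy
    exact mem_of_forall_inner_le fun x => (inner_le_supp K x hy).trans (h x)

theorem supp_injective {K L : ConvexBody (En n)} (h : ∀ x, supp K x = supp L x) : K = L :=
  ConvexBody.ext (Set.Subset.antisymm (coe_subset_iff.2 fun x => (h x).le)
    (coe_subset_iff.2 fun x => (h x).ge))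

theorem exists_norm_bound (K : ConvexBody (En n)) : ∃ R > 0, ∀ y ∈ K, ‖y‖ ≤ R := by
  obtain ⟨R, h0, h⟩ := K.isBounded.exists_pos_norm_le
  exact ⟨R, h0, h⟩

theorem continuous_supp (K : ConvexBody (En n)) : Continuous (supp K) := by
  obtain ⟨R, h0, hR⟩ := exists_norm_bound K
  have hb : ∀ z, supp K z ≤ R * ‖z‖ := fun z => by
    rw [supp_le_iff]
    intro y hy
    calc ⟪z, y⟫_ℝ ≤ ‖z‖ * ‖y‖ := real_inner_le_norm z y
      _ ≤ ‖z‖ * R := by gcongr; exact hR y hy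
      _ = _ := mul_comm _ _
  have : LipschitzWith (Real.toNNReal R) (supp K) := by
    apply LipschitzWith.of_le_add_mul
    intro x y
    rw [Real.coe_toNNReal R h0.le]
    have := supp_add_le K y (x - y)
    rw [add_sub_cancel] at this
    have h3 := hb (x - y)
    rw [dist_eq_norm]
    linarith
  exact this.continuous

theorem subset_cthickening_of_supp_le {K L : ConvexBody (En n)} {ε : ℝ} (hε : 0 ≤ ε)
    (h : ∀ x, supp K x ≤ supp L x + ε * ‖x‖) :
    (K : Set (En n)) ⊆ cthickening ε (L : Set (En n)) := by
  rw [← L.isCompact.add_closedBall_zero hε]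
  have h1 : (K : Set (En n)) ⊆ ((L + scale ε (ballB n) : ConvexBody (En n)) : Set (En n)) := by
    rw [coe_subset_iff]
    intro x
    rw [supp_add, supp_scale, supp_ball, norm_smul, Real.norm_of_nonneg hε]
    exact h x
  refine h1.trans ?_
  rw [ConvexBody.coe_add]
  apply Set.add_subset_add_left
  change ε • closedBall (0 : En n) 1 ⊆ _
  rw [smul_unitClosedBall, Real.norm_of_nonneg hε]

theorem supp_le_of_unit {K L : ConvexBody (En n)} {ε : ℝ}
    (h : ∀ u : En n, ‖u‖ = 1 → supp K u ≤ supp L u + ε) (x : En n) :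
    supp K x ≤ supp L x + ε * ‖x‖ := by
  rcases eq_or_ne x 0 with rfl | hx
  · simp [supp_zero]
  · have hx' : 0 < ‖x‖ := by simpa using hx
    have e : x = ‖x‖ • (‖x‖⁻¹ • x) := by rw [smul_smul, mul_inv_cancel₀ hx'.ne', one_smul]
    have h1 := h (‖x‖⁻¹ • x) (by simp [norm_smul, hx])
    have h2 : supp K x = ‖x‖ * supp K (‖x‖⁻¹ • x) := by
      rw [← supp_smul K hx'.le, ← e]
    have h3 : supp L x = ‖x‖ * supp L (‖x‖⁻¹ • x) := by
      rw [← supp_smul L hx'.le, ← e]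
    rw [h2, h3]
    nlinarith

theorem hausdorffDist_le_of_supp {K L : ConvexBody (En n)} {ε : ℝ} (hε : 0 ≤ ε)
    (h : ∀ u : En n, ‖u‖ = 1 → |supp K u - supp L u| ≤ ε) :
    hausdorffDist (K : Set (En n)) (L : Set (En n)) ≤ ε := by
  have key : ∀ (A B : ConvexBody (En n)), (∀ u : En n, ‖u‖ = 1 → supp A u ≤ supp B u + ε) →
      ∀ y ∈ (A : Set (En n)), ∃ z ∈ (B : Set (En n)), dist y z ≤ ε := by
    intro A B hAB y hy
    have := subset_cthickening_of_supp_le hε (supp_le_of_unit hAB) hy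
    rw [B.isCompact.cthickening_eq_biUnion_closedBall hε] at this
    simpa using this
  apply hausdorffDist_le_of_mem_dist hε
  · exact key K L fun u hu => by linarith [(abs_le.1 (h u hu)).2]
  · exact key L K fun u hu => by linarith [(abs_le.1 (h u hu)).1]

theorem inner_gradient (f : En n → ℝ) (x w : En n) : ⟪gradient f x, w⟫_ℝ = fderiv ℝ f x w := by
  simp [gradient]

theorem inner_gradient_le_supp (K : ConvexBody (En n)) {x : En n}
    (hd : DifferentiableAt ℝ (supp K) x) (z : En n) :
    ⟪gradient (supp K) x, z⟫_ℝ ≤ supp K z := by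
  rw [inner_gradient]
  have hl : HasDerivAt (fun t : ℝ => supp K (x + t • z)) (fderiv ℝ (supp K) x z) 0 :=
    hd.hasFDerivAt.hasLineDerivAt z
  have h1 := hl.tendsto_slope_zero_right
  refine le_of_tendsto h1 ?_
  filter_upwards [self_mem_nhdsWithin] with t ht
  have ht : (0 : ℝ) < t := ht
  have h2 := supp_add_le K x (t • z)
  rw [supp_smul K ht.le] at h2
  simp only [zero_add, zero_smul, add_zero, smul_eq_mul]
  rw [inv_mul_le_iff₀ ht]
  linarith

/-- Sublinear functions are support functions. -/
theorem exists_supp_eq_of_sublinear {N : En n → ℝ}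
    (hd : ∀ x, x ≠ 0 → ∃ y : En n, ⟪x, y⟫_ℝ = N x ∧ ∀ z, ⟪z, y⟫_ℝ ≤ N z)
    (h0 : N 0 = 0) (hne : ∃ x : En n, x ≠ 0) : ∃ K : ConvexBody (En n), ∀ x, supp K x = N x := by
  have hy : ∀ x, ∃ y : En n, ⟪x, y⟫_ℝ = N x ∧ ∀ z, ⟪z, y⟫_ℝ ≤ N z := by
    intro x
    rcases eq_or_ne x 0 with rfl | hx
    · obtain ⟨x, hx⟩ := hne
      obtain ⟨y, -, h⟩ := hd x hx
      exact ⟨y, by simp [h0], h⟩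
    · exact hd x hx
  set S : Set (En n) := {y | ∀ z, ⟪z, y⟫_ℝ ≤ N z} with hS
  have hSi : S = ⋂ z, {y | ⟪z, y⟫_ℝ ≤ N z} := by ext; simp [hS]
  have hc : Convex ℝ S := by
    rw [hSi]
    refine convex_iInter fun z => ?_
    exact convex_halfSpace_le (innerSL ℝ z).isLinear _
  have hcl : IsClosed S := by
    rw [hSi]
    exact isClosed_iInter fun z => isClosed_le (by fun_prop) continuous_const
  have hb : Bornology.IsBounded S := by
    set B : ℝ := ∑ j : Fin n, max (N (EuclideanSpace.single j 1)) (N (-EuclideanSpace.single j 1))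
    refine isBounded_iff_forall_norm_le.2 ⟨B, fun y hy => ?_⟩
    have h1 : ‖y‖ ≤ ∑ j : Fin n, ‖y j‖ := by
      have := norm_sum_le (Finset.univ) fun j : Fin n => (EuclideanSpace.basisFun (Fin n) ℝ).repr y j •
        EuclideanSpace.basisFun (Fin n) ℝ j
      rw [(EuclideanSpace.basisFun (Fin n) ℝ).sum_repr] at this
      refine this.trans (le_of_eq ?_)
      refine Finset.sum_congr rfl fun j _ => ?_
      simp [norm_smul]
    refine h1.trans (Finset.sum_le_sum fun j _ => ?_)
    have a := hy (EuclideanSpace.single j 1)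
    have b := hy (-EuclideanSpace.single j 1)
    rw [inner_neg_left] at b
    rw [EuclideanSpace.inner_single_left] at a b
    simp only [map_one, one_mul] at a b
    rw [Real.norm_eq_abs]
    exact abs_le.2 ⟨by linarith [le_max_right (N (EuclideanSpace.single j 1)) (N (-EuclideanSpace.single j 1))],
      a.trans (le_max_left _ _)⟩
  have hne' : S.Nonempty := by
    obtain ⟨y, -, h⟩ := hy 0
    exact ⟨y, h⟩
  refine ⟨⟨S, hc, Metric.isCompact_of_isClosed_isBounded hcl hb, hne'⟩, fun x => ?_⟩
  apply le_antisymm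
  · rw [supp_le_iff]
    exact fun y hy => hy x
  · obtain ⟨y, h1, h2⟩ := hy x
    rw [← h1]
    exact inner_le_supp _ x (show y ∈ S from h2)

/-! ### One-homogeneous functions of class `C²` -/

/-- The Hessian of a function, as a linear map. -/
def hess (N : En n → ℝ) (x : En n) : En n →L[ℝ] En n := fderiv ℝ (gradient N) x

/-- Positively one-homogeneous functions which are `C²` off the origin. -/
structure IsC2Hom (N : En n → ℝ) : Prop where
  cd : ContDiffOn ℝ 2 N {0}ᶜ
  hom : ∀ c : ℝ, 0 < c → ∀ x, N (c • x) = c * N x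

theorem gradient_eq_comp (N : En n → ℝ) :
    gradient N = (InnerProductSpace.toDual ℝ (En n)).symm ∘ fderiv ℝ N := rfl

theorem gradient_add' {N M : En n → ℝ} {x : En n} (h1 : DifferentiableAt ℝ N x)
    (h2 : DifferentiableAt ℝ M x) :
    gradient (fun y => N y + M y) x = gradient N x + gradient M x := by
  rw [gradient_eq_comp, gradient_eq_comp, gradient_eq_comp]
  simp only [Function.comp]
  rw [fderiv_fun_add h1 h2, map_add]

theorem gradient_const_mul' {N : En n → ℝ} {x : En n} (c : ℝ) (h1 : DifferentiableAt ℝ N x) :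
    gradient (fun y => c * N y) x = c • gradient N x := by
  rw [gradient_eq_comp, gradient_eq_comp]
  simp only [Function.comp]
  rw [fderiv_const_mul h1, map_smul]

theorem inner_hess_eq_fderiv {N : En n → ℝ} {x : En n} (h : DifferentiableAt ℝ (fderiv ℝ N) x)
    (v w : En n) : ⟪hess N x v, w⟫_ℝ = fderiv ℝ (fderiv ℝ N) x v w := by
  rw [hess, gradient_eq_comp]
  have := ((InnerProductSpace.toDual ℝ (En n)).symm.toContinuousLinearEquiv).hasFDerivAt
    (x := fderiv ℝ N x) |>.comp x h.hasFDerivAt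
  have e := this.fderiv
  have e' : fderiv ℝ ((InnerProductSpace.toDual ℝ (En n)).symm ∘ fderiv ℝ N) x v =
      (InnerProductSpace.toDual ℝ (En n)).symm (fderiv ℝ (fderiv ℝ N) x v) :=
    congrArg (fun f => f v) e
  rw [e']
  simp

theorem supp_neg (K : ConvexBody (En n)) (x : En n) : supp (scale (-1) K) x = supp K (-x) := by
  rw [supp_scale, neg_one_smul]

namespace IsC2Hom

variable {N M : En n → ℝ}

theorem contDiffAt (h : IsC2Hom N) {x : En n} (hx : x ≠ 0) : ContDiffAt ℝ 2 N x :=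
  h.cd.contDiffAt (isOpen_compl_singleton.mem_nhds hx)

theorem differentiableAt (h : IsC2Hom N) {x : En n} (hx : x ≠ 0) : DifferentiableAt ℝ N x :=
  (h.contDiffAt hx).differentiableAt (by norm_num)

theorem contDiffAt_fderiv (h : IsC2Hom N) {x : En n} (hx : x ≠ 0) :
    ContDiffAt ℝ 1 (fderiv ℝ N) x :=
  (h.contDiffAt hx).fderiv_right (by norm_num)

theorem differentiableAt_fderiv (h : IsC2Hom N) {x : En n} (hx : x ≠ 0) :
    DifferentiableAt ℝ (fderiv ℝ N) x :=
  (h.contDiffAt_fderiv hx).differentiableAt (by norm_num)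

theorem contDiffAt_gradient (h : IsC2Hom N) {x : En n} (hx : x ≠ 0) :
    ContDiffAt ℝ 1 (gradient N) x :=
  ((InnerProductSpace.toDual ℝ (En n)).symm.toContinuousLinearEquiv).contDiff.contDiffAt.comp x
    (h.contDiffAt_fderiv hx)

theorem differentiableAt_gradient (h : IsC2Hom N) {x : En n} (hx : x ≠ 0) :
    DifferentiableAt ℝ (gradient N) x :=
  (h.contDiffAt_gradient hx).differentiableAt (by norm_num)

theorem hasFDerivAt_gradient (h : IsC2Hom N) {x : En n} (hx : x ≠ 0) :
    HasFDerivAt (gradient N) (hess N x) x :=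
  (h.differentiableAt_gradient hx).hasFDerivAt

theorem continuousAt_gradient (h : IsC2Hom N) {x : En n} (hx : x ≠ 0) :
    ContinuousAt (gradient N) x :=
  (h.contDiffAt_gradient hx).continuousAt

theorem continuousAt_hess (h : IsC2Hom N) {x : En n} (hx : x ≠ 0) :
    ContinuousAt (hess N) x :=
  ((h.contDiffAt_gradient hx).fderiv_right (m := 0) (by norm_num)).continuousAt

theorem inner_hess (h : IsC2Hom N) {x : En n} (hx : x ≠ 0) (v w : En n) :
    ⟪hess N x v, w⟫_ℝ = fderiv ℝ (fderiv ℝ N) x v w :=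
  inner_hess_eq_fderiv (h.differentiableAt_fderiv hx) v w

theorem inner_hess_eq_iterated (h : IsC2Hom N) {x : En n} (hx : x ≠ 0) (v w : En n) :
    ⟪hess N x v, w⟫_ℝ = iteratedFDeriv ℝ 2 N x ![v, w] := by
  rw [h.inner_hess hx, iteratedFDeriv_two_apply]
  simp

theorem hess_symm (h : IsC2Hom N) {x : En n} (hx : x ≠ 0) (v w : En n) :
    ⟪hess N x v, w⟫_ℝ = ⟪v, hess N x w⟫_ℝ := by
  rw [h.inner_hess hx, real_inner_comm, h.inner_hess hx]
  exact ((h.contDiffAt hx).isSymmSndFDerivAt (by simp)) v w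

theorem zero (h : IsC2Hom N) : N 0 = 0 := by
  have := h.hom 2 (by norm_num) 0
  rw [smul_zero] at this
  linarith

theorem gradient_smul (h : IsC2Hom N) {x : En n} (hx : x ≠ 0) {c : ℝ} (hc : 0 < c) :
    gradient N (c • x) = gradient N x := by
  have hcx : c • x ≠ 0 := smul_ne_zero hc.ne' hx
  have e : (fun y => N (c • y)) = fun y => c * N y := funext fun y => h.hom c hc y
  have d1 : fderiv ℝ (fun y => N (c • y)) x = c • fderiv ℝ N (c • x) := by
    have := (h.differentiableAt hcx).hasFDerivAt.comp x
      ((hasFDerivAt_id x).const_smul c)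
    have e2 : fderiv ℝ (fun y => N (c • y)) x = _ := this.fderiv
    rw [e2]
    ext v
    simp
  rw [e, fderiv_const_mul (h.differentiableAt hx)] at d1
  have d2 : fderiv ℝ N (c • x) = fderiv ℝ N x := (smul_right_injective _ hc.ne' d1).symm
  simp only [gradient, d2]

theorem inner_gradient_self (h : IsC2Hom N) {x : En n} (hx : x ≠ 0) :
    ⟪gradient N x, x⟫_ℝ = N x := by
  rw [inner_gradient]
  have h1 : HasDerivAt (fun t : ℝ => N (x + t • x)) (fderiv ℝ N x x) 0 :=
    (h.differentiableAt hx).hasFDerivAt.hasLineDerivAt x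
  have h2 : HasDerivAt (fun t : ℝ => (1 + t) * N x) (N x) 0 := by
    simpa using ((hasDerivAt_id (0 : ℝ)).const_add 1).mul_const (N x)
  refine h1.unique (h2.congr_of_eventuallyEq ?_)
  filter_upwards [lt_mem_nhds (show (-1 : ℝ) < 0 by norm_num)] with t ht
  rw [← h.hom (1 + t) (by linarith) x, add_smul, one_smul]

theorem hess_self (h : IsC2Hom N) {x : En n} (hx : x ≠ 0) : hess N x x = 0 := by
  have h1 : HasDerivAt (fun t : ℝ => gradient N (x + t • x)) (hess N x x) 0 :=
    (h.hasFDerivAt_gradient hx).hasLineDerivAt x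
  have h2 : HasDerivAt (fun _ : ℝ => gradient N x) 0 0 := hasDerivAt_const _ _
  refine h1.unique (h2.congr_of_eventuallyEq ?_)
  filter_upwards [lt_mem_nhds (show (-1 : ℝ) < 0 by norm_num)] with t ht
  rw [← h.gradient_smul hx (show 0 < 1 + t by linarith), add_smul, one_smul]

theorem hess_smul (h : IsC2Hom N) {x : En n} (hx : x ≠ 0) {c : ℝ} (hc : 0 < c) :
    hess N (c • x) = c⁻¹ • hess N x := by
  have hcx : c • x ≠ 0 := smul_ne_zero hc.ne' hx
  have d1 : HasFDerivAt (fun y => gradient N (c • y)) (c • hess N (c • x)) x := by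
    have := (h.hasFDerivAt_gradient hcx).comp x ((hasFDerivAt_id x).const_smul c)
    have e2 : c • hess N (c • x) = (hess N (c • x)).comp (c • ContinuousLinearMap.id ℝ (En n)) := by
      ext v
      simp
    rw [e2]
    exact this
  have d2 : HasFDerivAt (fun y => gradient N (c • y)) (hess N x) x := by
    refine (h.hasFDerivAt_gradient hx).congr_of_eventuallyEq ?_
    filter_upwards [isOpen_compl_singleton.mem_nhds (show x ∈ ({0}ᶜ : Set (En n)) from hx)] with y hy
    exact h.gradient_smul hy hc
  rw [d2.unique d1, smul_smul, inv_mul_cancel₀ hc.ne', one_smul]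

theorem add (h : IsC2Hom N) (h' : IsC2Hom M) : IsC2Hom (fun x => N x + M x) :=
  ⟨h.cd.add h'.cd, fun c hc x => by rw [h.hom c hc, h'.hom c hc, mul_add]⟩

theorem const_mul (h : IsC2Hom N) (a : ℝ) : IsC2Hom (fun x => a * N x) :=
  ⟨contDiffOn_const.mul h.cd, fun c hc x => by rw [h.hom c hc]; ring⟩

theorem sub (h : IsC2Hom N) (h' : IsC2Hom M) : IsC2Hom (fun x => N x - M x) :=
  ⟨h.cd.sub h'.cd, fun c hc x => by rw [h.hom c hc, h'.hom c hc, mul_sub]⟩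

theorem gradient_add (h : IsC2Hom N) (h' : IsC2Hom M) {x : En n} (hx : x ≠ 0) :
    gradient (fun y => N y + M y) x = gradient N x + gradient M x :=
  gradient_add' (h.differentiableAt hx) (h'.differentiableAt hx)

theorem hess_add (h : IsC2Hom N) (h' : IsC2Hom M) {x : En n} (hx : x ≠ 0) :
    hess (fun y => N y + M y) x = hess N x + hess M x := by
  refine HasFDerivAt.fderiv (((h.hasFDerivAt_gradient hx).add
    (h'.hasFDerivAt_gradient hx)).congr_of_eventuallyEq ?_)
  filter_upwards [isOpen_compl_singleton.mem_nhds (show x ∈ ({0}ᶜ : Set (En n)) from hx)] with y hy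
  exact h.gradient_add h' hy

theorem hess_const_mul (h : IsC2Hom N) (a : ℝ) {x : En n} (hx : x ≠ 0) :
    hess (fun y => a * N y) x = a • hess N x := by
  refine HasFDerivAt.fderiv (((h.hasFDerivAt_gradient hx).const_smul a).congr_of_eventuallyEq ?_)
  filter_upwards [isOpen_compl_singleton.mem_nhds (show x ∈ ({0}ᶜ : Set (En n)) from hx)] with y hy
  exact gradient_const_mul' a (h.differentiableAt hy)

theorem hess_sub (h : IsC2Hom N) (h' : IsC2Hom M) {x : En n} (hx : x ≠ 0) :
    hess (fun y => N y - M y) x = hess N x - hess M x := by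
  have := h.hess_add (h'.const_mul (-1)) hx
  rw [h'.hess_const_mul (-1) hx] at this
  have e : (-1 : ℝ) • hess M x = -hess M x := by
    ext v
    simp
  rw [e] at this
  simpa [sub_eq_add_neg] using this

theorem sum {ι : Type*} (s : Finset ι) {F : ι → En n → ℝ} (h : ∀ k ∈ s, IsC2Hom (F k)) :
    IsC2Hom (fun x => ∑ k ∈ s, F k x) :=
  ⟨ContDiffOn.sum fun k hk => (h k hk).cd, fun c hc x => by
    rw [Finset.mul_sum]
    exact Finset.sum_congr rfl fun k hk => (h k hk).hom c hc x⟩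

theorem hess_zero_fun (x : En n) : hess (fun _ : En n => (0 : ℝ)) x = 0 := by
  have : gradient (fun _ : En n => (0 : ℝ)) = fun _ => 0 := by
    funext y
    simp [gradient]
  rw [hess, this]
  simp

theorem hess_sum {ι : Type*} (s : Finset ι) {F : ι → En n → ℝ} (h : ∀ k ∈ s, IsC2Hom (F k))
    {x : En n} (hx : x ≠ 0) :
    hess (fun x => ∑ k ∈ s, F k x) x = ∑ k ∈ s, hess (F k) x := by
  classical
  induction s using Finset.induction_on with
  | empty => simpa using hess_zero_fun x
  | insert a s ha ih =>
    simp only [Finset.sum_insert ha]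
    rw [(h a (by simp)).hess_add (sum s fun k hk => h k (by simp [hk])) hx,
      ih fun k hk => h k (by simp [hk])]

theorem comp_isometry (h : IsC2Hom N) (ρ : En n ≃ₗᵢ[ℝ] En n) : IsC2Hom (fun x => N (ρ x)) :=
  ⟨h.cd.comp ρ.contDiff.contDiffOn fun x hx => by simpa using hx, fun c hc x => by
    rw [map_smul, h.hom c hc]⟩

theorem gradient_comp_isometry (h : IsC2Hom N) (ρ : En n ≃ₗᵢ[ℝ] En n) {x : En n} (hx : x ≠ 0) :
    gradient (fun x => N (ρ x)) x = ρ.symm (gradient N (ρ x)) := by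
  have hρ : ρ x ≠ 0 := by simpa using hx
  refine ext_inner_right ℝ fun v => ?_
  rw [inner_gradient]
  have := (h.differentiableAt hρ).hasFDerivAt.comp x ρ.toContinuousLinearEquiv.hasFDerivAt
  have e := this.fderiv
  have e' : fderiv ℝ (fun x => N (ρ x)) x v = fderiv ℝ N (ρ x) (ρ v) := congrArg (fun f => f v) e
  rw [e', ← inner_gradient, ← ρ.inner_map_map (ρ.symm _)]
  simp

theorem hess_comp_isometry (h : IsC2Hom N) (ρ : En n ≃ₗᵢ[ℝ] En n) {x : En n} (hx : x ≠ 0)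
    (v : En n) : hess (fun x => N (ρ x)) x v = ρ.symm (hess N (ρ x) (ρ v)) := by
  have hρ : ρ x ≠ 0 := by simpa using hx
  have := ρ.symm.toContinuousLinearEquiv.hasFDerivAt.comp x
    ((h.hasFDerivAt_gradient hρ).comp x ρ.toContinuousLinearEquiv.hasFDerivAt)
  have e : hess (fun x => N (ρ x)) x = _ := HasFDerivAt.fderiv (this.congr_of_eventuallyEq (by
    filter_upwards [isOpen_compl_singleton.mem_nhds (show x ∈ ({0}ᶜ : Set (En n)) from hx)] with y hy
    exact h.gradient_comp_isometry ρ hy))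
  rw [e]
  rfl

end IsC2Hom

theorem isC2Hom_norm : IsC2Hom (fun x : En n => ‖x‖) :=
  ⟨fun x hx => (contDiffAt_norm ℝ hx).contDiffWithinAt, fun c hc x => by
    rw [norm_smul, Real.norm_of_nonneg hc.le]⟩

theorem gradient_norm {x : En n} (hx : x ≠ 0) : gradient (fun x : En n => ‖x‖) x = ‖x‖⁻¹ • x := by
  refine ext_inner_right ℝ fun v => ?_
  rw [inner_gradient]
  have h0 : ‖x‖ ≠ 0 := by simpa using hx
  have h1 : HasFDerivAt (fun x : En n => ‖x‖) (fderiv ℝ (fun x : En n => ‖x‖) x) x :=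
    (isC2Hom_norm.differentiableAt hx).hasFDerivAt
  have h2 := h1.pow 2
  have h3 := (hasStrictFDerivAt_norm_sq x).hasFDerivAt
  have h4 := congrArg (fun f => f v) (h2.unique h3)
  simp at h4
  rw [inner_smul_left]
  simp only [conj_trivial]
  field_simp
  linarith

theorem hess_norm {x : En n} (hx : x ≠ 0) (v : En n) :
    hess (fun x : En n => ‖x‖) x v = ‖x‖⁻¹ • (v - (⟪x, v⟫_ℝ / ‖x‖ ^ 2) • x) := by
  have h0 : ‖x‖ ≠ 0 := by simpa using hx
  have h1 : HasFDerivAt (fun x : En n => ‖x‖) (fderiv ℝ (fun x : En n => ‖x‖) x) x :=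
    (isC2Hom_norm.differentiableAt hx).hasFDerivAt
  have h2 := ((hasDerivAt_inv h0).comp_hasFDerivAt x h1).smul (hasFDerivAt_id x)
  have h3 : hess (fun x : En n => ‖x‖) x = _ := HasFDerivAt.fderiv (h2.congr_of_eventuallyEq (by
    filter_upwards [isOpen_compl_singleton.mem_nhds (show x ∈ ({0}ᶜ : Set (En n)) from hx)] with y hy
    exact gradient_norm hy))
  rw [h3]
  have h4 : fderiv ℝ (fun x : En n => ‖x‖) x v = ‖x‖⁻¹ * ⟪x, v⟫_ℝ := by
    rw [← inner_gradient, gradient_norm hx, inner_smul_left]; simp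
  simp [h4, smul_smul, sub_eq_add_neg]
  congr 1
  field_simp

theorem isC2Hom_supp {K : ConvexBody (En n)} (h : ContDiffOn ℝ 2 (supp K) {0}ᶜ) :
    IsC2Hom (supp K) :=
  ⟨h, fun _ hc x => supp_smul K hc.le x⟩

theorem isC2Hom_supp_ball : IsC2Hom (supp (ballB n)) := by
  have : supp (ballB n) = fun x => ‖x‖ := funext supp_ball
  rw [this]
  exact isC2Hom_norm

theorem hess_supp_nonneg {K : ConvexBody (En n)} (h : IsC2Hom (supp K)) {x : En n} (hx : x ≠ 0)
    (v : En n) : 0 ≤ ⟪hess (supp K) x v, v⟫_ℝ := by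
  have hl : HasDerivAt (fun t : ℝ => gradient (supp K) (x + t • v)) (hess (supp K) x v) 0 :=
    (h.hasFDerivAt_gradient hx).hasLineDerivAt v
  have hl' : HasDerivAt (fun t : ℝ => ⟪gradient (supp K) (x + t • v), v⟫_ℝ)
      ⟪hess (supp K) x v, v⟫_ℝ 0 := by
    simpa using hl.inner ℝ (hasDerivAt_const (0 : ℝ) v)
  refine ge_of_tendsto hl'.tendsto_slope_zero_right ?_
  have hne : ∀ᶠ t : ℝ in 𝓝 0, x + t • v ≠ 0 := by
    have : ContinuousAt (fun t : ℝ => x + t • v) 0 := by fun_prop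
    exact this.eventually_ne (by simpa using hx)
  filter_upwards [self_mem_nhdsWithin, nhdsWithin_le_nhds hne] with t ht hne
  have ht : (0 : ℝ) < t := ht
  have a1 := inner_gradient_le_supp K (h.differentiableAt hx) (x + t • v)
  have a2 := inner_gradient_le_supp K (h.differentiableAt hne) x
  have a3 := h.inner_gradient_self hx
  have a4 := h.inner_gradient_self hne
  rw [inner_add_right, inner_smul_right] at a1 a4
  simp only [zero_add, zero_smul, add_zero, smul_eq_mul]
  have : 0 ≤ t * (⟪gradient (supp K) (x + t • v), v⟫_ℝ - ⟪gradient (supp K) x, v⟫_ℝ) := by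
    linarith
  have := nonneg_of_mul_nonneg_right this ht
  positivity

/-! ### Determinants and polar coordinates -/

/-- The rank one map `v ↦ ⟪a, v⟫ y`. -/
def rankOne (a y : En n) : En n →L[ℝ] En n := (innerSL ℝ a).smulRight y

@[simp] theorem rankOne_apply (a y v : En n) : rankOne a y v = ⟪a, v⟫_ℝ • y := by
  simp [rankOne]

theorem continuous_rankOne_self : Continuous fun u : En n => rankOne u u := by
  unfold rankOne
  exact ((ContinuousLinearMap.smulRightL ℝ (En n) (En n)).continuous₂).comp
    ((innerSL ℝ).continuous.prodMk continuous_id)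

theorem det_mul' (S T : En n →L[ℝ] En n) : (S * T).det = S.det * T.det :=
  LinearMap.det_comp (S : En n →ₗ[ℝ] En n) T

theorem det_one_add_rankOne (a y : En n) : (1 + rankOne a y : En n →L[ℝ] En n).det = 1 + ⟪a, y⟫_ℝ := by
  have := LinearMap.transvection.det (innerSL ℝ a : En n →ₗ[ℝ] ℝ) y
  rw [ContinuousLinearMap.det]
  have e : ((1 + rankOne a y : En n →L[ℝ] En n) : En n →ₗ[ℝ] En n) =
      LinearMap.transvection (innerSL ℝ a : En n →ₗ[ℝ] ℝ) y := by
    ext1 v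
    simp [LinearMap.transvection]
  rw [e, this]
  rfl

theorem det_smul' (c : ℝ) (T : En n →L[ℝ] En n) : (c • T).det = c ^ n * T.det := by
  have := LinearMap.det_smul c (T : En n →ₗ[ℝ] En n)
  rw [finrank_euclideanSpace_fin] at this
  exact this

theorem det_nonneg_of_psd {T : En n →L[ℝ] En n} (hs : ∀ v w, ⟪T v, w⟫_ℝ = ⟪v, T w⟫_ℝ)
    (hp : ∀ v, 0 ≤ ⟪T v, v⟫_ℝ) : 0 ≤ T.det := by
  have h1 : (T : En n →ₗ[ℝ] En n).IsPositive := (LinearMap.isPositive_iff _).2 ⟨hs, hp⟩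
  have := ((LinearMap.posSemidef_toMatrix_iff (EuclideanSpace.basisFun (Fin n) ℝ)).2 h1).det_nonneg
  rwa [LinearMap.det_toMatrix] at this

/-- The Jacobian of the map `x ↦ ∇m(x) + (‖x‖ - 1)∇l(x)`. -/
theorem det_shell {A : En n →L[ℝ] En n} {u y : En n} (hu : ‖u‖ = 1) (hA : A u = 0)
    (hs : ∀ v w, ⟪A v, w⟫_ℝ = ⟪v, A w⟫_ℝ) {r : ℝ} (hr : 0 < r) :
    (r⁻¹ • A + rankOne u y).det * r ^ (n - 1) = ⟪u, y⟫_ℝ * (A + rankOne u u).det := by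
  have hn : 0 < n := by
    rcases Nat.eq_zero_or_pos n with rfl | h
    · rw [Subsingleton.elim u 0] at hu
      simp at hu
    · exact h
  have huu : ⟪u, u⟫_ℝ = 1 := by rw [real_inner_self_eq_norm_sq, hu]; norm_num
  have hAu : ∀ v, ⟪u, A v⟫_ℝ = 0 := fun v => by rw [← hs, hA, inner_zero_left]
  have e1 : r⁻¹ • A + rankOne u y =
      (1 + rankOne u (y - u)) * (r⁻¹ • ((A + rankOne u u) * (1 + rankOne u ((r - 1) • u)))) := by
    ext1 v
    have hr' := hr.ne'
    have hm : ∀ (S T : En n →L[ℝ] En n) (v : En n), (S * T) v = S (T v) := fun _ _ _ => rfl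
    have h1 : ∀ v : En n, (1 : En n →L[ℝ] En n) v = v := fun _ => rfl
    simp only [add_apply, hm, smul_apply, h1, rankOne_apply,
      map_add, map_smul, hA, inner_zero_right, huu, hAu]
    match_scalars <;> field_simp <;> ring
  rw [e1, det_mul', det_smul', det_mul', det_one_add_rankOne, det_one_add_rankOne, inner_smul_right,
    inner_sub_right, huu]
  obtain ⟨m, rfl⟩ : ∃ m, n = m + 1 := ⟨n - 1, by omega⟩
  simp only [Nat.add_sub_cancel, pow_succ]
  have : r⁻¹ ^ m * r ^ m = 1 := by rw [← mul_pow, inv_mul_cancel₀ hr.ne', one_pow]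
  have h2 : r⁻¹ * r = 1 := inv_mul_cancel₀ hr.ne'
  linear_combination (⟪u, y⟫_ℝ * (A + rankOne u u).det) * this +
    (r⁻¹ ^ m * r ^ m) * (⟪u, y⟫_ℝ * (A + rankOne u u).det) * h2

theorem lintegral_shell (f : En n → ENNReal) (G : Sph n → ℝ → ENNReal)
    (hG : Measurable (Function.uncurry G))
    (hf : ∀ (u : Sph n) (r : ℝ), 1 < r → r ≤ 2 → f (r • (u : En n)) = G u r) :
    ∫⁻ x in {x : En n | 1 < ‖x‖ ∧ ‖x‖ ≤ 2}, f x =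
      ∫⁻ u, (∫⁻ r in Set.Ioc (1 : ℝ) 2, ENNReal.ofReal (r ^ (n - 1)) * G u r) ∂(sphVol n) := by
  set A := {x : En n | 1 < ‖x‖ ∧ ‖x‖ ≤ 2} with hA
  have hAm : MeasurableSet A := by
    have : MeasurableSet {x : En n | 1 < ‖x‖} := measurableSet_lt measurable_const measurable_norm
    have h2 : MeasurableSet {x : En n | ‖x‖ ≤ 2} := measurableSet_le measurable_norm measurable_const
    exact this.inter h2
  have hrank : Module.finrank ℝ (En n) = n := finrank_euclideanSpace_fin
  set G' : Sph n × Set.Ioi (0 : ℝ) → ENNReal := fun p =>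
    (Set.Ioc (1 : ℝ) 2).indicator (G p.1) p.2 with hG'
  have hG'm : Measurable G' := by
    have h1 : Measurable fun p : Sph n × Set.Ioi (0 : ℝ) => Function.uncurry G (p.1, (p.2 : ℝ)) :=
      hG.comp (measurable_fst.prodMk (measurable_subtype_coe.comp measurable_snd))
    have h2 : G' = ((fun p : Sph n × Set.Ioi (0 : ℝ) => (p.2 : ℝ)) ⁻¹' Set.Ioc 1 2).indicator
        fun p : Sph n × Set.Ioi (0 : ℝ) => Function.uncurry G (p.1, (p.2 : ℝ)) := by
      funext p
      simp [hG', Set.indicator, Function.uncurry]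
    rw [h2]
    exact h1.indicator ((measurable_subtype_coe.comp measurable_snd) measurableSet_Ioc)
  calc ∫⁻ x in A, f x = ∫⁻ x, A.indicator f x := (lintegral_indicator hAm f).symm
    _ = ∫⁻ x in {(0 : En n)}ᶜ, A.indicator f x := by
        rw [← lintegral_indicator (measurableSet_singleton _).compl]
        refine lintegral_congr fun x => ?_
        by_cases hx : x = 0
        · subst hx
          simp [hA]
        · simp [hx]
    _ = ∫⁻ x : ({(0 : En n)}ᶜ : Set (En n)), A.indicator f x ∂(volume.comap Subtype.val) :=
        (lintegral_subtype_comap (measurableSet_singleton _).compl _).symm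
    _ = ∫⁻ p, G' p ∂((sphVol n).prod (.volumeIoiPow (Module.finrank ℝ (En n) - 1))) := by
        rw [sphVol, ← (volume : Measure (En n)).measurePreserving_homeomorphUnitSphereProd.lintegral_comp_emb
          (Homeomorph.measurableEmbedding _)]
        refine lintegral_congr fun x => ?_
        have hx : 0 < ‖(x : En n)‖ := norm_pos_iff.2 x.2
        have e : (x : En n) = ‖(x : En n)‖ •
            (((homeomorphUnitSphereProd (En n) x).1 : Sph n) : En n) := by
          simp [smul_smul, hx.ne']
        have e2 : ((homeomorphUnitSphereProd (En n) x).2 : ℝ) = ‖(x : En n)‖ := by simp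
        simp only [hG']
        rw [e2]
        by_cases h : 1 < ‖(x : En n)‖ ∧ ‖(x : En n)‖ ≤ 2
        · rw [Set.indicator_of_mem (show (x : En n) ∈ A from h), Set.indicator_of_mem (by exact h),
            ← hf _ _ h.1 h.2, ← e]
        · rw [Set.indicator_of_notMem (show (x : En n) ∉ A from h), Set.indicator_of_notMem (by exact h)]
    _ = ∫⁻ u, (∫⁻ r : Set.Ioi (0 : ℝ), G' (u, r) ∂(.volumeIoiPow (n - 1))) ∂(sphVol n) := by
        rw [lintegral_prod _ hG'm.aemeasurable, hrank]
    _ = _ := by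
        refine lintegral_congr fun u => ?_
        rw [Measure.volumeIoiPow, lintegral_withDensity_eq_lintegral_mul]
        · simp only [Pi.mul_apply, hG']
          rw [lintegral_subtype_comap measurableSet_Ioi fun r : ℝ =>
            ENNReal.ofReal (r ^ (n - 1)) * (Set.Ioc (1 : ℝ) 2).indicator (G u) r]
          rw [← lintegral_indicator measurableSet_Ioc, ← lintegral_indicator measurableSet_Ioi]
          refine lintegral_congr fun r => ?_
          by_cases h : r ∈ Set.Ioc (1 : ℝ) 2
          · have h0 : r ∈ Set.Ioi (0 : ℝ) := lt_trans one_pos h.1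
            simp only [Set.indicator_of_mem h, Set.indicator_of_mem h0]
          · simp [Set.indicator_of_notMem h]
        · exact ((measurable_subtype_coe.pow_const _)).ennreal_ofReal
        · exact hG'm.comp (measurable_const.prodMk measurable_id)

/-! ### The volume of the shell between `M` and `M + L` -/

/-- Positive support functions of class `C²` with positive definite Hessian on `u^⊥`. -/
structure IsC2Plus (l : En n → ℝ) : Prop extends IsC2Hom l where
  pos : ∀ x, x ≠ 0 → 0 < l x
  strict : ∀ x, x ≠ 0 → ∀ w, (∀ c : ℝ, w ≠ c • x) → 0 < ⟪hess l x w, w⟫_ℝ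

/-- The map parametrizing the shell between `M` and `M + L`. -/
def shellMap (M L : ConvexBody (En n)) (x : En n) : En n :=
  gradient (supp M) x + (‖x‖ - 1) • gradient (supp L) x

section Shell

variable {M L : ConvexBody (En n)}

theorem hasFDerivAt_shellMap (hM : IsC2Hom (supp M)) (hL : IsC2Hom (supp L)) {u : En n}
    (hu : ‖u‖ = 1) {r : ℝ} (hr : 0 < r) :
    HasFDerivAt (shellMap M L) (r⁻¹ • (hess (supp M) u + (r - 1) • hess (supp L) u) +
      rankOne u (gradient (supp L) u)) (r • u) := by
  have hu0 : u ≠ 0 := fun h => by simp [h] at hu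
  have hx : r • u ≠ 0 := smul_ne_zero hr.ne' hu0
  have hn : ‖r • u‖ = r := by rw [norm_smul, hu, mul_one, Real.norm_of_nonneg hr.le]
  have h1 : HasFDerivAt (fun x : En n => ‖x‖) (fderiv ℝ (fun x : En n => ‖x‖) (r • u)) (r • u) :=
    (isC2Hom_norm.differentiableAt hx).hasFDerivAt
  have h2 := (hM.hasFDerivAt_gradient hx).add ((h1.sub_const 1).smul (hL.hasFDerivAt_gradient hx))
  refine h2.congr_fderiv ?_
  ext1 v
  have h4 : fderiv ℝ (fun x : En n => ‖x‖) (r • u) v = ⟪u, v⟫_ℝ := by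
    rw [← inner_gradient, gradient_norm hx, hn, smul_smul, inv_mul_cancel₀ hr.ne', one_smul]
  simp only [add_apply, smul_apply, ContinuousLinearMap.smulRight_apply, h4, rankOne_apply,
    hM.hess_smul hu0 hr, hL.hess_smul hu0 hr, hL.gradient_smul hu0 hr, hn]
  module

theorem shellMap_touch (hM : IsC2Hom (supp M)) (hL : IsC2Hom (supp L)) {x : En n} (hx : x ≠ 0)
    (h1 : 1 ≤ ‖x‖) : (∀ z, ⟪z, shellMap M L x⟫_ℝ ≤ supp M z + (‖x‖ - 1) * supp L z) ∧
      ⟪x, shellMap M L x⟫_ℝ = supp M x + (‖x‖ - 1) * supp L x := by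
  constructor
  · intro z
    rw [shellMap, inner_add_right, inner_smul_right]
    have a := inner_gradient_le_supp M (hM.differentiableAt hx) z
    have b := inner_gradient_le_supp L (hL.differentiableAt hx) z
    rw [real_inner_comm] at a b
    exact add_le_add a (mul_le_mul_of_nonneg_left b (by linarith))
  · rw [shellMap, inner_add_right, inner_smul_right, real_inner_comm, hM.inner_gradient_self hx,
      real_inner_comm, hL.inner_gradient_self hx]

theorem eq_gradient_of_touch {N : En n → ℝ} (hN : IsC2Hom N) {p x : En n} (hx : x ≠ 0)
    (h : ∀ z, ⟪z, p⟫_ℝ ≤ N z) (he : ⟪x, p⟫_ℝ = N x) : gradient N x = p := by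
  have hd : HasFDerivAt (fun z => N z - ⟪p, z⟫_ℝ) (fderiv ℝ N x - innerSL ℝ p) x :=
    (hN.differentiableAt hx).hasFDerivAt.sub (innerSL ℝ p).hasFDerivAt
  have hmin : IsLocalMin (fun z => N z - ⟪p, z⟫_ℝ) x := by
    refine Filter.Eventually.of_forall fun z => ?_
    have := h z
    rw [real_inner_comm] at this he
    change N x - ⟪p, x⟫_ℝ ≤ N z - ⟪p, z⟫_ℝ
    linarith
  have h0 := hmin.hasFDerivAt_eq_zero hd
  refine ext_inner_right ℝ fun v => ?_
  rw [inner_gradient]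
  have := congrArg (fun f => f v) h0
  simp at this
  linarith

theorem shellMap_injOn (hM : IsC2Hom (supp M)) (hL : IsC2Plus (supp L)) :
    Set.InjOn (shellMap M L) {x | 1 < ‖x‖ ∧ ‖x‖ ≤ 2} := by
  intro x hx y hy hxy
  have hx0 : x ≠ 0 := fun h => by
    have := hx.1
    simp [h] at this
    linarith
  have hy0 : y ≠ 0 := fun h => by
    have := hy.1
    simp [h] at this
    linarith
  obtain ⟨a1, a2⟩ := shellMap_touch hM hL.toIsC2Hom hx0 hx.1.le
  obtain ⟨b1, b2⟩ := shellMap_touch hM hL.toIsC2Hom hy0 hy.1.le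
  rw [← hxy] at b1 b2
  have c1 := a1 y
  have c2 := b1 x
  have hn : ‖x‖ = ‖y‖ := by
    apply le_antisymm
    · have := hL.pos x hx0
      nlinarith
    · have := hL.pos y hy0
      nlinarith
  set p := shellMap M L x
  set W : En n → ℝ := fun z => supp M z + (‖x‖ - 1) * supp L z with hW
  have hWC : IsC2Hom W := hM.add (hL.toIsC2Hom.const_mul _)
  have hsub : ∀ z w, W (z + w) ≤ W z + W w := fun z w => by
    have h1 := supp_add_le M z w
    have h2 := mul_le_mul_of_nonneg_left (supp_add_le L z w) (show 0 ≤ ‖x‖ - 1 by linarith [hx.1])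
    simp only [hW]
    linarith
  have hWx : ⟪x, p⟫_ℝ = W x := a2
  have hWy : ⟪y, p⟫_ℝ = W y := by rw [b2, hW, ← hn]
  have hseg : ∀ a b : ℝ, 0 < a → 0 < b → ⟪a • x + b • y, p⟫_ℝ = W (a • x + b • y) := by
    intro a b ha hb
    apply le_antisymm (a1 _)
    refine (hsub _ _).trans ?_
    rw [hWC.hom a ha, hWC.hom b hb, inner_add_left, inner_smul_left, inner_smul_left, hWx, hWy]
    simp
  have hxy0 : x + y ≠ 0 := by
    intro h
    have e : y = -x := (neg_eq_of_add_eq_zero_right h).symm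
    have h1 := supp_add_le M x (-x)
    rw [add_neg_cancel, supp_zero] at h1
    have h2 : W x + W (-x) = 0 := by
      rw [← hWx, ← e, ← hWy, ← inner_add_left, h, inner_zero_left]
    have h3 := hL.pos x hx0
    have h4 := hL.pos (-x) (by simpa using hx0)
    simp only [hW] at h2
    have h5 : 0 < (‖x‖ - 1) * supp L x := mul_pos (by linarith [hx.1]) h3
    have h6 : 0 < (‖x‖ - 1) * supp L (-x) := mul_pos (by linarith [hx.1]) h4
    linarith
  have hgrad : ∀ t : ℝ, |t| < 1 → gradient W ((x + y) + t • (y - x)) = p := by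
    intro t ht
    obtain ⟨t1, t2⟩ := abs_lt.1 ht
    have e : (x + y) + t • (y - x) = (1 - t) • x + (1 + t) • y := by module
    have hne : (x + y) + t • (y - x) ≠ 0 := by
      intro h
      have := hseg (1 - t) (1 + t) (by linarith) (by linarith)
      have hx' : x + (1 + t) • y + (-t) • x = 0 := by rw [← h]; module
      have hc : (1 - t) • x = -((1 + t) • y) := by
        rw [e] at h
        exact eq_neg_of_add_eq_zero_left h
      have hc2 := congrArg norm hc
      rw [norm_neg, norm_smul, norm_smul, Real.norm_of_nonneg (by linarith),
        Real.norm_of_nonneg (by linarith), hn] at hc2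
      have : 0 < ‖y‖ := norm_pos_iff.2 hy0
      have ht0 : t = 0 := by
        have := mul_right_cancel₀ this.ne' hc2
        linarith
      rw [ht0] at h
      simp at h
      exact hxy0 h
    apply eq_gradient_of_touch hWC hne (fun z => a1 z)
    rw [e]
    exact hseg _ _ (by linarith) (by linarith)
  have hz : hess W (x + y) (y - x) = 0 := by
    have h1 : HasDerivAt (fun t : ℝ => gradient W ((x + y) + t • (y - x)))
        (hess W (x + y) (y - x)) 0 := (hWC.hasFDerivAt_gradient hxy0).hasLineDerivAt _
    refine h1.unique ((hasDerivAt_const (0 : ℝ) p).congr_of_eventuallyEq ?_)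
    filter_upwards [Metric.ball_mem_nhds (0 : ℝ) one_pos] with t ht
    exact hgrad t (by simpa using ht)
  have hpar : ∃ c : ℝ, y - x = c • (x + y) := by
    by_contra hno
    push Not at hno
    have h1 := hL.strict _ hxy0 _ hno
    have h2 := hess_supp_nonneg hM hxy0 (y - x)
    have h3 : hess W (x + y) (y - x) = hess (supp M) (x + y) (y - x) +
        (‖x‖ - 1) • hess (supp L) (x + y) (y - x) := by
      rw [hW, hM.hess_add (hL.toIsC2Hom.const_mul _) hxy0, hL.toIsC2Hom.hess_const_mul _ hxy0]
      rfl
    have h4 : ⟪hess W (x + y) (y - x), y - x⟫_ℝ = 0 := by rw [hz, inner_zero_left]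
    rw [h3, inner_add_left, inner_smul_left] at h4
    have : 0 < (‖x‖ - 1) * ⟪hess (supp L) (x + y) (y - x), y - x⟫_ℝ :=
      mul_pos (by linarith [hx.1]) h1
    simp only [conj_trivial] at h4
    linarith
  obtain ⟨c, hc⟩ := hpar
  have h1 : ⟪y - x, x + y⟫_ℝ = 0 := by
    rw [add_comm x y, inner_sub_left, inner_add_right, inner_add_right, real_inner_self_eq_norm_sq,
      real_inner_self_eq_norm_sq, hn, real_inner_comm]
    ring
  rw [hc, inner_smul_left, real_inner_self_eq_norm_sq] at h1
  have h2 : 0 < ‖x + y‖ := norm_pos_iff.2 hxy0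
  have h3 : c = 0 := by
    simp at h1
    rcases h1 with h | h
    · exact h
    · exact absurd h hxy0
  rw [h3, zero_smul] at hc
  exact (sub_eq_zero.1 hc).symm

theorem shellMap_image [NeZero n] (hM : IsC2Hom (supp M)) (hL : IsC2Plus (supp L)) :
    shellMap M L '' {x | 1 < ‖x‖ ∧ ‖x‖ ≤ 2} =
      ((M + L : ConvexBody (En n)) : Set (En n)) \ (M : Set (En n)) := by
  have hLnn : ∀ z, 0 ≤ supp L z := fun z => by
    rcases eq_or_ne z 0 with rfl | hz
    · rw [supp_zero]
    · exact (hL.pos z hz).le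
  apply Set.Subset.antisymm
  · rintro _ ⟨x, hx, rfl⟩
    have hx0 : x ≠ 0 := fun h => by
      have := hx.1
      simp [h] at this
      linarith
    obtain ⟨a1, a2⟩ := shellMap_touch hM hL.toIsC2Hom hx0 hx.1.le
    constructor
    · refine mem_of_forall_inner_le fun z => (a1 z).trans ?_
      rw [supp_add]
      have := mul_le_mul_of_nonneg_right (show ‖x‖ - 1 ≤ 1 by linarith [hx.2]) (hLnn z)
      linarith
    · intro h
      have h1 := inner_le_supp M x h
      have := mul_pos (show 0 < ‖x‖ - 1 by linarith [hx.1]) (hL.pos x hx0)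
      linarith
  · rintro p ⟨hp1, hp2⟩
    have hp1 : p ∈ M + L := hp1
    have hp2 : ¬ p ∈ M := hp2
    have hcomp : IsCompact (sphere (0 : En n) 1) := isCompact_sphere 0 1
    have hcont : ContinuousOn (fun u => (⟪u, p⟫_ℝ - supp M u) / supp L u) (sphere (0 : En n) 1) := by
      apply ContinuousOn.div
      · exact ((by fun_prop : Continuous fun u : En n => ⟪u, p⟫_ℝ).sub
          (continuous_supp M)).continuousOn
      · exact (continuous_supp L).continuousOn
      · intro u hu
        exact (hL.pos u (ne_of_mem_sphere hu one_ne_zero)).ne'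
    have hne : (sphere (0 : En n) 1).Nonempty := NormedSpace.sphere_nonempty.2 zero_le_one
    obtain ⟨u, hu, hmax⟩ := hcomp.exists_isMaxOn hne hcont
    set s := (⟪u, p⟫_ℝ - supp M u) / supp L u with hs
    have hu1 : ‖u‖ = 1 := by simpa using hu
    have hu0 : u ≠ 0 := ne_of_mem_sphere hu one_ne_zero
    have hall : ∀ z, ⟪z, p⟫_ℝ ≤ supp M z + s * supp L z := by
      intro z
      rcases eq_or_ne z 0 with rfl | hz
      · simp [supp_zero]
      · have hz' : 0 < ‖z‖ := norm_pos_iff.2 hz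
        have h1 : (‖z‖⁻¹ • z) ∈ sphere (0 : En n) 1 := by simp [norm_smul, hz]
        have h2 : (⟪‖z‖⁻¹ • z, p⟫_ℝ - supp M (‖z‖⁻¹ • z)) / supp L (‖z‖⁻¹ • z) ≤ s := hmax h1
        rw [inner_smul_left, supp_smul M (by positivity), supp_smul L (by positivity)] at h2
        simp only [conj_trivial] at h2
        rw [← mul_sub, mul_div_mul_left _ _ (by positivity), div_le_iff₀ (hL.pos z hz)] at h2
        linarith
    have heq : ⟪u, p⟫_ℝ = supp M u + s * supp L u := by
      rw [hs, div_mul_cancel₀ _ (hL.pos u hu0).ne']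
      ring
    have hs1 : s ≤ 1 := by
      have := inner_le_supp (M + L) u hp1
      rw [supp_add, heq] at this
      have := hL.pos u hu0
      nlinarith
    have hs0 : 0 < s := by
      by_contra h
      apply hp2
      refine mem_of_forall_inner_le fun z => (hall z).trans ?_
      have := hLnn z
      nlinarith
    have hg := eq_gradient_of_touch (hM.add (hL.toIsC2Hom.const_mul s)) hu0 hall heq
    rw [gradient_add' (hM.differentiableAt hu0) ((hL.toIsC2Hom.const_mul s).differentiableAt hu0),
      gradient_const_mul' s (hL.differentiableAt hu0)] at hg
    have hnorm : ‖(1 + s) • u‖ = 1 + s := by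
      rw [norm_smul, hu1, mul_one, Real.norm_of_nonneg (by linarith)]
    refine ⟨(1 + s) • u, ⟨by rw [hnorm]; linarith, by rw [hnorm]; linarith⟩, ?_⟩
    rw [shellMap, hnorm, hM.gradient_smul hu0 (by linarith), hL.gradient_smul hu0 (by linarith), ← hg]
    simp

/-- The integrand of the shell formula. -/
def shellDet (M L : ConvexBody (En n)) (u : En n) (s : ℝ) : ℝ :=
  (hess (supp M) u + s • hess (supp L) u + rankOne u u).det

theorem ne_zero_of_sph (u : Sph n) : (u : En n) ≠ 0 := ne_of_mem_sphere u.2 one_ne_zero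

theorem norm_sph (u : Sph n) : ‖(u : En n)‖ = 1 := by simp

theorem IsC2Hom.continuous_hess_sph {N : En n → ℝ} (h : IsC2Hom N) :
    Continuous fun u : Sph n => hess N (u : En n) :=
  continuous_iff_continuousAt.2 fun u =>
    ContinuousAt.comp (g := hess N) (h.continuousAt_hess (ne_zero_of_sph u))
      continuous_subtype_val.continuousAt

theorem continuous_shellDet (hM : IsC2Hom (supp M)) (hL : IsC2Hom (supp L)) :
    Continuous fun p : Sph n × ℝ => shellDet M L (p.1 : En n) p.2 := by
  unfold shellDet
  refine ContinuousLinearMap.continuous_det.comp ?_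
  have h1 := hM.continuous_hess_sph.comp (continuous_fst (X := Sph n) (Y := ℝ))
  have h2 := hL.continuous_hess_sph.comp (continuous_fst (X := Sph n) (Y := ℝ))
  have h3 := continuous_rankOne_self.comp (continuous_subtype_val.comp (continuous_fst (X := Sph n) (Y := ℝ)))
  exact (h1.add (continuous_snd.smul h2)).add h3

theorem shellDet_nonneg (hM : IsC2Hom (supp M)) (hL : IsC2Hom (supp L)) (u : Sph n) {s : ℝ}
    (hs : 0 ≤ s) : 0 ≤ shellDet M L u s := by
  have hu := ne_zero_of_sph u
  apply det_nonneg_of_psd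
  · intro v w
    simp only [add_apply, smul_apply, rankOne_apply, inner_add_left, inner_add_right,
      inner_smul_left, inner_smul_right, hM.hess_symm hu v w, hL.hess_symm hu v w]
    simp only [conj_trivial, real_inner_comm]
    ring
  · intro v
    simp only [add_apply, smul_apply, rankOne_apply, inner_add_left, inner_smul_left]
    have := hess_supp_nonneg hM hu v
    have := mul_nonneg hs (hess_supp_nonneg hL hu v)
    have := mul_self_nonneg ⟪(u : En n), v⟫_ℝ
    simp only [conj_trivial]
    linarith

theorem isFiniteMeasure_sphVol : IsFiniteMeasure (sphVol n) := by
  unfold sphVol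
  infer_instance

instance : IsFiniteMeasure (sphVol n) := isFiniteMeasure_sphVol

theorem integrable_sph {E : Type*} [NormedAddCommGroup E] {f : Sph n → E} (hf : Continuous f) :
    Integrable f (sphVol n) := by
  obtain ⟨C, hC⟩ := isCompact_univ.exists_bound_of_continuousOn hf.continuousOn
  exact Integrable.of_bound hf.aestronglyMeasurable_of_compactSpace C
    (Eventually.of_forall fun u => hC u (Set.mem_univ u))

theorem continuous_integral_shellDet (hM : IsC2Hom (supp M)) (hL : IsC2Hom (supp L)) :
    Continuous fun u : Sph n => ∫ s in (0 : ℝ)..1, shellDet M L u s :=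
  intervalIntegral.continuous_parametric_intervalIntegral_of_continuous'
    (f := fun (u : Sph n) s => shellDet M L u s) (continuous_shellDet hM hL) 0 1

theorem shell_formula [NeZero n] (hM : IsC2Hom (supp M)) (hL : IsC2Plus (supp L)) :
    (volume ((M + L : ConvexBody (En n)) : Set (En n))).toReal - (volume (M : Set (En n))).toReal =
      ∫ u : Sph n, supp L u * (∫ s in (0 : ℝ)..1, shellDet M L u s) ∂(sphVol n) := by
  have hL' := hL.toIsC2Hom
  have hLnn : ∀ u : Sph n, 0 ≤ supp L u := fun u => (hL.pos u (ne_zero_of_sph u)).le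
  have hsub : (M : Set (En n)) ⊆ ((M + L : ConvexBody (En n)) : Set (En n)) := by
    rw [coe_subset_iff]
    intro x
    rw [supp_add]
    rcases eq_or_ne x 0 with rfl | hx
    · simp [supp_zero]
    · linarith [hL.pos x hx]
  have hfinM : volume (M : Set (En n)) ≠ ⊤ := M.isCompact.measure_lt_top.ne
  have hfinML : volume ((M + L : ConvexBody (En n)) : Set (En n)) ≠ ⊤ :=
    (M + L).isCompact.measure_lt_top.ne
  have h1 : (volume ((M + L : ConvexBody (En n)) : Set (En n))).toReal -
      (volume (M : Set (En n))).toReal =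
      (volume (((M + L : ConvexBody (En n)) : Set (En n)) \ (M : Set (En n)))).toReal := by
    rw [measure_sdiff hsub M.isCompact.isClosed.measurableSet.nullMeasurableSet hfinM,
      ENNReal.toReal_sub_of_le (measure_mono hsub) hfinML]
  have hAm : MeasurableSet {x : En n | 1 < ‖x‖ ∧ ‖x‖ ≤ 2} := by
    have h1 : MeasurableSet {x : En n | 1 < ‖x‖} := measurableSet_lt measurable_const measurable_norm
    have h2 : MeasurableSet {x : En n | ‖x‖ ≤ 2} := measurableSet_le measurable_norm measurable_const
    exact h1.inter h2
  set F : Sph n → ℝ → ℝ := fun u s => supp L u * shellDet M L u s with hF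
  have hFc : Continuous (Function.uncurry F) :=
    ((continuous_supp L).comp (continuous_subtype_val.comp continuous_fst)).mul
      (continuous_shellDet hM hL')
  set G : Sph n → ℝ → ENNReal := fun u r => ENNReal.ofReal ((r ^ (n - 1))⁻¹ * F u (r - 1)) with hG
  have hGm : Measurable (Function.uncurry G) := by
    have h1 : Measurable fun p : Sph n × ℝ => Function.uncurry F (p.1, p.2 - 1) :=
      (hFc.comp (continuous_fst.prodMk (continuous_snd.sub continuous_const))).measurable
    exact (((measurable_snd.pow_const _).inv).mul h1).ennreal_ofReal
  have hder : ∀ (u : Sph n) (r : ℝ), 1 < r → |(fderiv ℝ (shellMap M L) (r • (u : En n))).det| =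
      (r ^ (n - 1))⁻¹ * F u (r - 1) := by
    intro u r h1
    have hu := ne_zero_of_sph u
    have hr : 0 < r := by linarith
    rw [(hasFDerivAt_shellMap hM hL' (norm_sph u) hr).fderiv]
    have hA : (hess (supp M) (u : En n) + (r - 1) • hess (supp L) (u : En n)) (u : En n) = 0 := by
      rw [add_apply, smul_apply, hM.hess_self hu, hL'.hess_self hu, smul_zero, add_zero]
    have hs : ∀ v w, ⟪(hess (supp M) (u : En n) + (r - 1) • hess (supp L) (u : En n)) v, w⟫_ℝ =
        ⟪v, (hess (supp M) (u : En n) + (r - 1) • hess (supp L) (u : En n)) w⟫_ℝ := by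
      intro v w
      simp only [add_apply, smul_apply, inner_add_left, inner_add_right, inner_smul_left,
        inner_smul_right, hM.hess_symm hu v w, hL'.hess_symm hu v w, conj_trivial]
    have hd := det_shell (y := gradient (supp L) u) (norm_sph u) hA hs hr
    rw [real_inner_comm, hL'.inner_gradient_self hu] at hd
    have hd' : (r⁻¹ • (hess (supp M) (u : En n) + (r - 1) • hess (supp L) (u : En n)) +
        rankOne u (gradient (supp L) u)).det = (r ^ (n - 1))⁻¹ * F u (r - 1) := by
      rw [inv_mul_eq_div, eq_div_iff (by positivity), hd]
      rfl
    rw [hd', abs_of_nonneg]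
    exact mul_nonneg (by positivity)
      (mul_nonneg (hLnn u) (shellDet_nonneg hM hL' u (by linarith)))
  rw [h1, ← shellMap_image hM hL, ← lintegral_abs_det_fderiv_eq_addHaar_image volume hAm
    (f' := fderiv ℝ (shellMap M L)) _ (shellMap_injOn hM hL),
    lintegral_shell _ G hGm (fun u r h _ => by rw [hder u r h])]
  · have hin : ∀ u : Sph n, (∫⁻ r in Set.Ioc (1 : ℝ) 2, ENNReal.ofReal (r ^ (n - 1)) * G u r) =
        ENNReal.ofReal (supp L u * ∫ s in (0 : ℝ)..1, shellDet M L u s) := by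
      intro u
      have hFu : Continuous (F u) := hFc.comp (continuous_const.prodMk continuous_id)
      have e1 : ∫⁻ r in Set.Ioc (1 : ℝ) 2, ENNReal.ofReal (r ^ (n - 1)) * G u r =
          ∫⁻ r in Set.Ioc (1 : ℝ) 2, ENNReal.ofReal (F u (r - 1)) := by
        refine setLIntegral_congr_fun measurableSet_Ioc fun r hr => ?_
        have hr0 : 0 < r := lt_trans one_pos hr.1
        have := pow_pos hr0 (n - 1)
        simp only [hG]
        rw [← ENNReal.ofReal_mul this.le, mul_inv_cancel_left₀ this.ne']
      rw [e1, ← ofReal_integral_eq_lintegral_ofReal, ← intervalIntegral.integral_of_le (by norm_num),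
        intervalIntegral.integral_comp_sub_right (F u) 1]
      · congr 1
        rw [hF]
        norm_num [intervalIntegral.integral_const_mul]
      · exact (hFu.comp (continuous_id.sub continuous_const)).integrableOn_Ioc
      · filter_upwards [ae_restrict_mem measurableSet_Ioc] with r hr
        exact mul_nonneg (hLnn u) (shellDet_nonneg hM hL' u (by linarith [hr.1]))
    rw [lintegral_congr hin, ← ofReal_integral_eq_lintegral_ofReal, ENNReal.toReal_ofReal]
    · refine integral_nonneg fun u => mul_nonneg (hLnn u) ?_
      exact intervalIntegral.integral_nonneg zero_le_one fun s hs => shellDet_nonneg hM hL' u hs.1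
    · exact integrable_sph (((continuous_supp L).comp continuous_subtype_val).mul
        (continuous_integral_shellDet hM hL'))
    · refine Eventually.of_forall fun u => mul_nonneg (hLnn u) ?_
      exact intervalIntegral.integral_nonneg zero_le_one fun s hs => shellDet_nonneg hM hL' u hs.1
  · intro x hx
    have hx0 : 0 < ‖x‖ := lt_trans one_pos hx.1
    have e : x = ‖x‖ • (‖x‖⁻¹ • x) := by rw [smul_smul, mul_inv_cancel₀ hx0.ne', one_smul]
    have hn1 : ‖‖x‖⁻¹ • x‖ = 1 := by rw [norm_smul, norm_inv, norm_norm, inv_mul_cancel₀ hx0.ne']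
    have := hasFDerivAt_shellMap hM hL' hn1 hx0
    rw [← e] at this
    exact this.differentiableAt.hasFDerivAt.hasFDerivWithinAt

end Shell

/-! ### Finite differences and polarization of the determinant -/

/-- `DiffVanish d f`: all `d`-fold finite differences of `f` vanish. -/
def DiffVanish {V : Type*} [AddCommGroup V] : ℕ → (V → ℝ) → Prop
  | 0, f => ∀ x, f x = 0
  | d + 1, f => ∀ h, DiffVanish d fun x => f (x + h) - f x

namespace DiffVanish

variable {V : Type*} [AddCommGroup V]

theorem add {d : ℕ} {f g : V → ℝ} (hf : DiffVanish d f) (hg : DiffVanish d g) :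
    DiffVanish d fun x => f x + g x := by
  induction d generalizing f g with
  | zero => exact fun x => by simp [hf x, hg x]
  | succ d ih =>
    intro h
    have := ih (hf h) (hg h)
    convert this using 2
    ring

theorem const_mul {d : ℕ} {f : V → ℝ} (c : ℝ) (hf : DiffVanish d f) :
    DiffVanish d fun x => c * f x := by
  induction d generalizing f with
  | zero => exact fun x => by simp [hf x]
  | succ d ih =>
    intro h
    have := ih (hf h)
    convert this using 2
    ring

theorem shift {d : ℕ} {f : V → ℝ} (hf : DiffVanish d f) (h : V) :
    DiffVanish d fun x => f (x + h) := by
  induction d generalizing f with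
  | zero => exact fun x => hf _
  | succ d ih =>
    intro k
    have := ih (hf k)
    convert this using 3
    abel_nf

theorem zero_fun (d : ℕ) : DiffVanish d fun _ : V => (0 : ℝ) := by
  induction d with
  | zero => exact fun _ => rfl
  | succ d ih =>
    intro h
    simpa using ih

theorem mul {a b : ℕ} {f g : V → ℝ} (hf : DiffVanish (a + 1) f) (hg : DiffVanish (b + 1) g) :
    DiffVanish (a + b + 1) fun x => f x * g x := by
  induction hs : a + b generalizing a b f g with
  | zero =>
    obtain ⟨rfl, rfl⟩ : a = 0 ∧ b = 0 := by omega
    intro h x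
    have h1 := hf h x
    have h2 := hg h x
    simp only at h1 h2 ⊢
    rw [sub_eq_zero.1 h1, sub_eq_zero.1 h2, sub_self]
  | succ s ih =>
    intro h
    have e : (fun x => f (x + h) * g (x + h) - f x * g x) =
        fun x => (f (x + h) - f x) * g (x + h) + f x * (g (x + h) - g x) := by
      funext x
      ring
    simp only [e]
    refine add ?_ ?_
    · rcases a with _ | a
      · have : (fun x => (f (x + h) - f x) * g (x + h)) = fun _ => 0 := by
          funext x
          have := hf h x
          simp only at this
          rw [this, zero_mul]
        rw [this]
        exact zero_fun _
      · exact ih (hf h) (hg.shift h) (by omega)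
    · rcases b with _ | b
      · have : (fun x => f x * (g (x + h) - g x)) = fun _ => 0 := by
          funext x
          have := hg h x
          simp only at this
          rw [this, mul_zero]
        rw [this]
        exact zero_fun _
      · exact ih hf (hg h) (by omega)

theorem sum {ι : Type*} (s : Finset ι) {d : ℕ} {f : ι → V → ℝ} (hf : ∀ k ∈ s, DiffVanish d (f k)) :
    DiffVanish d fun x => ∑ k ∈ s, f k x := by
  classical
  induction s using Finset.induction_on with
  | empty => simpa using zero_fun d
  | insert a s ha ih =>
    simp only [Finset.sum_insert ha]
    exact (hf a (Finset.mem_insert_self a s)).add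
      (ih fun k hk => hf k (Finset.mem_insert_of_mem hk))

theorem prod_of_additive {ι : Type*} (s : Finset ι) (f : ι → V → ℝ)
    (hf : ∀ k x y, f k (x + y) = f k x + f k y) :
    DiffVanish (s.card + 1) fun x => ∏ k ∈ s, f k x := by
  classical
  induction s using Finset.induction_on with
  | empty => exact fun h x => by simp
  | insert a s ha ih =>
    simp only [Finset.prod_insert ha, Finset.card_insert_of_notMem ha]
    have h1 : DiffVanish (1 + 1) (f a) := fun h k x => by
      simp only [hf]
      ring
    rw [add_comm s.card 1]
    exact h1.mul ih

theorem alternating_sum {ι : Type*} [DecidableEq ι] (s : Finset ι) (a : ι → V) {d : ℕ} {f : V → ℝ}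
    (hf : DiffVanish (s.card + d) f) :
    DiffVanish d fun x => ∑ T ∈ s.powerset, (-1 : ℝ) ^ T.card * f (x + ∑ k ∈ T, a k) := by
  induction s using Finset.induction_on generalizing f with
  | empty => simpa using hf
  | insert b s hb ih =>
    rw [Finset.card_insert_of_notMem hb, show s.card + 1 + d = s.card + d + 1 by ring] at hf
    have := (ih (hf (a b))).const_mul (-1)
    convert this using 2 with x
    rw [Finset.sum_powerset_insert hb, Finset.mul_sum, ← Finset.sum_add_distrib]
    refine Finset.sum_congr rfl fun T hT => ?_
    have hbT : b ∉ T := fun h => hb (Finset.mem_powerset.1 hT h)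
    rw [Finset.sum_insert hbT, Finset.card_insert_of_notMem hbT, pow_succ,
      show x + (a b + ∑ k ∈ T, a k) = x + ∑ k ∈ T, a k + a b by abel]
    ring

end DiffVanish

theorem diffVanish_det : DiffVanish (n + 1) fun A : En n →L[ℝ] En n => A.det := by
  classical
  set b := (EuclideanSpace.basisFun (Fin n) ℝ).toBasis
  have e : (fun A : En n →L[ℝ] En n => A.det) = fun A : En n →L[ℝ] En n => ∑ σ : Equiv.Perm (Fin n),
      ((Equiv.Perm.sign σ : ℤ) : ℝ) *
        ∏ j ∈ Finset.univ, (LinearMap.toMatrix b b (A : En n →ₗ[ℝ] En n)) (σ j) j := by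
    funext A
    rw [ContinuousLinearMap.det, ← LinearMap.det_toMatrix b, Matrix.det_apply']
  rw [e]
  refine DiffVanish.sum _ fun σ _ => DiffVanish.const_mul _ ?_
  have := DiffVanish.prod_of_additive (V := En n →L[ℝ] En n) (Finset.univ : Finset (Fin n))
    (fun j A => (LinearMap.toMatrix b b (A : En n →ₗ[ℝ] En n)) (σ j) j) (fun k x y => by simp)
  rwa [Finset.card_univ, Fintype.card_fin] at this

theorem det_eq_zero_of_apply {T : En n →L[ℝ] En n} {u : En n} (hu : u ≠ 0) (h : T u = 0) :
    T.det = 0 := by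
  by_contra hd
  have h1 : IsUnit (T : En n →ₗ[ℝ] En n) := LinearMap.isUnit_iff_isUnit_det _ |>.2 (isUnit_iff_ne_zero.2 hd)
  have h2 := (Module.End.isUnit_iff _).1 h1
  exact hu (h2.1 (by simpa using h))

/-- Polarization: the alternating sum does not depend on the extra summand `X`. -/
theorem alternating_det {ι : Type*} [DecidableEq ι] (s : Finset ι) (hs : s.card + 1 = n)
    (A : ι → En n →L[ℝ] En n) (X : En n →L[ℝ] En n) {u : En n} (hu : u ≠ 0)
    (hA : ∀ k ∈ s, A k u = 0) (hX : X u = 0) :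
    ∑ T ∈ s.powerset, (-1 : ℝ) ^ T.card * ((∑ k ∈ T, A k) + X + rankOne u u).det =
      ∑ T ∈ s.powerset, (-1 : ℝ) ^ T.card * ((∑ k ∈ T, A k) + rankOne u u).det := by
  have h1 := diffVanish_det (n := n)
  rw [show n + 1 = s.card + 2 by omega] at h1
  have h2 := DiffVanish.alternating_sum s A h1 (rankOne u u) X 0
  have z : ∀ T ∈ s.powerset, ∀ Y : En n →L[ℝ] En n, Y u = 0 → (Y + ∑ k ∈ T, A k).det = 0 := by
    intro T hT Y hY
    apply det_eq_zero_of_apply hu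
    have : (∑ k ∈ T, A k) u = 0 := by
      rw [sum_apply]
      exact Finset.sum_eq_zero fun k hk => hA k (Finset.mem_powerset.1 hT hk)
    rw [add_apply, hY, this, add_zero]
  have z1 := Finset.sum_eq_zero (s := s.powerset)
      (f := fun T => (-1 : ℝ) ^ T.card * (X + ∑ k ∈ T, A k).det)
      (fun T hT => by rw [z T hT X hX, mul_zero])
  have z2 := Finset.sum_eq_zero (s := s.powerset)
      (f := fun T => (-1 : ℝ) ^ T.card * (0 + ∑ k ∈ T, A k : En n →L[ℝ] En n).det)
      (fun T hT => by rw [z T hT 0 rfl, mul_zero])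
  simp only [zero_add] at h2 z2
  rw [z1, z2, sub_zero, sub_zero, sub_eq_zero] at h2
  refine ((Finset.sum_congr rfl fun T _ => ?_).trans h2).trans (Finset.sum_congr rfl fun T _ => ?_)
  · rw [show (∑ k ∈ T, A k) + X + rankOne u u = X + rankOne u u + ∑ k ∈ T, A k by abel]
  · rw [add_comm]

/-! ### Mixed volumes as integrals -/

/-- The index set of the bodies `K₂,…,Kₙ`. -/
def tailIdx (n : ℕ) [NeZero n] : Finset (Fin n) := Finset.univ.erase 0

theorem card_tailIdx [NeZero n] : (tailIdx n).card + 1 = n := by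
  rw [tailIdx, Finset.card_erase_add_one (Finset.mem_univ _), Finset.card_univ, Fintype.card_fin]

/-- The density of the mixed area measure of `K₂,…,Kₙ` (with respect to `σ`). -/
def mixedDens [NeZero n] (Ks : Fin n → ConvexBody (En n)) (u : En n) : ℝ :=
  (((n - 1).factorial : ℝ))⁻¹ * ((-1) ^ (n - 1) * ∑ T ∈ (tailIdx n).powerset,
    (-1 : ℝ) ^ T.card * ((∑ k ∈ T, hess (supp (Ks k)) u) + rankOne u u).det)

theorem mixedVol_eq [NeZero n] (Ks : Fin n → ConvexBody (En n)) :
    n * mixedVol Ks = (((n - 1).factorial : ℝ))⁻¹ * ((-1) ^ (n - 1) *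
      ∑ T ∈ (tailIdx n).powerset, (-1 : ℝ) ^ T.card *
      ((volume ((∑ k ∈ T, Ks k + Ks 0 : ConvexBody (En n)) : Set (En n))).toReal -
        (volume ((∑ k ∈ T, Ks k : ConvexBody (En n)) : Set (En n))).toReal)) := by
  have hn : n ≠ 0 := NeZero.ne n
  obtain ⟨m, hm⟩ : ∃ m, n = m + 1 := ⟨n - 1, by omega⟩
  have hf : (n.factorial : ℝ) = n * ((n - 1).factorial : ℝ) := by
    rw [hm, Nat.factorial_succ]
    simp
  have hn' : (n : ℝ) ≠ 0 := by exact_mod_cast hn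
  have hu : (Finset.univ : Finset (Finset (Fin n))) = (insert 0 (tailIdx n)).powerset := by
    rw [tailIdx, Finset.insert_erase (Finset.mem_univ _), Finset.powerset_univ]
  have h0 : (0 : Fin n) ∉ tailIdx n := by simp [tailIdx]
  rw [mixedVol, hf, mul_inv, ← mul_assoc, ← mul_assoc, mul_inv_cancel₀ hn', one_mul, hu,
    Finset.sum_powerset_insert h0, ← Finset.sum_add_distrib, Finset.mul_sum _ _ ((-1 : ℝ) ^ (n - 1))]
  congr 1
  refine Finset.sum_congr rfl fun T hT => ?_
  have h0T : (0 : Fin n) ∉ T := fun h => h0 (Finset.mem_powerset.1 hT h)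
  have hc : T.card ≤ n - 1 := by
    have := Finset.card_le_card (Finset.mem_powerset.1 hT)
    have := card_tailIdx (n := n)
    omega
  rw [Finset.sum_insert h0T, Finset.card_insert_of_notMem h0T, add_comm (Ks 0)]
  have e2 : n - (T.card + 1) = n - 1 - T.card := by omega
  have e1 : n - T.card = (n - 1 - T.card) + 1 := by omega
  rw [e2, e1, pow_succ]
  have e3 : (-1 : ℝ) ^ (n - 1) * (-1) ^ T.card = (-1) ^ (n - 1 - T.card) := by
    rw [← pow_add, show n - 1 + T.card = (n - 1 - T.card) + 2 * T.card by omega, pow_add, pow_mul]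
    simp
  rw [← mul_assoc, e3]
  ring

theorem IsC2Hom.supp_sum {ι : Type*} {Ks : ι → ConvexBody (En n)} (T : Finset ι)
    (h : ∀ k ∈ T, IsC2Hom (supp (Ks k))) : IsC2Hom (supp (∑ k ∈ T, Ks k)) := by
  have : supp (∑ k ∈ T, Ks k) = fun x => ∑ k ∈ T, supp (Ks k) x :=
    funext fun x => MinkIter.supp_sum T Ks x
  rw [this]
  exact IsC2Hom.sum T h

theorem hess_supp_sum {ι : Type*} {Ks : ι → ConvexBody (En n)} (T : Finset ι)
    (h : ∀ k ∈ T, IsC2Hom (supp (Ks k))) {x : En n} (hx : x ≠ 0) :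
    hess (supp (∑ k ∈ T, Ks k)) x = ∑ k ∈ T, hess (supp (Ks k)) x := by
  have : supp (∑ k ∈ T, Ks k) = fun x => ∑ k ∈ T, supp (Ks k) x :=
    funext fun x => MinkIter.supp_sum T Ks x
  rw [this, IsC2Hom.hess_sum T h hx]

theorem continuous_mixedDens [NeZero n] {Ks : Fin n → ConvexBody (En n)}
    (h : ∀ k ∈ tailIdx n, IsC2Hom (supp (Ks k))) :
    Continuous fun u : Sph n => mixedDens Ks (u : En n) := by
  unfold mixedDens
  refine continuous_const.mul (continuous_const.mul (continuous_finsetSum _ fun T hT =>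
    continuous_const.mul (ContinuousLinearMap.continuous_det.comp ?_)))
  refine (continuous_finsetSum _ fun k hk => ?_).add
    (continuous_rankOne_self.comp continuous_subtype_val)
  exact (h k (Finset.mem_powerset.1 hT hk)).continuous_hess_sph

theorem continuous_shellDet_right (M L : ConvexBody (En n)) (u : En n) :
    Continuous fun s => shellDet M L u s :=
  ContinuousLinearMap.continuous_det.comp
    ((continuous_const.add (continuous_id.smul continuous_const)).add continuous_const)

theorem mixedVol_eq_integral_of_c2plus [NeZero n] {Ks : Fin n → ConvexBody (En n)}
    (h : ∀ k ∈ tailIdx n, IsC2Hom (supp (Ks k))) (h0 : IsC2Plus (supp (Ks 0))) :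
    n * mixedVol Ks = ∫ u : Sph n, supp (Ks 0) u * mixedDens Ks u ∂(sphVol n) := by
  have hT : ∀ T ∈ (tailIdx n).powerset, IsC2Hom (supp (∑ k ∈ T, Ks k)) := fun T hT =>
    IsC2Hom.supp_sum T fun k hk => h k (Finset.mem_powerset.1 hT hk)
  have h0' := h0.toIsC2Hom
  have hint : ∀ T ∈ (tailIdx n).powerset, Integrable (fun u : Sph n => (-1 : ℝ) ^ T.card *
      (supp (Ks 0) u * (∫ s in (0 : ℝ)..1, shellDet (∑ k ∈ T, Ks k) (Ks 0) u s))) (sphVol n) :=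
    fun T hT' => integrable_sph (continuous_const.mul
      (((continuous_supp _).comp continuous_subtype_val).mul
        (continuous_integral_shellDet (hT T hT') h0')))
  have hpt : ∀ u : Sph n, supp (Ks 0) u * mixedDens Ks u = (((n - 1).factorial : ℝ))⁻¹ *
      ((-1) ^ (n - 1) * ∑ T ∈ (tailIdx n).powerset, (-1 : ℝ) ^ T.card *
      (supp (Ks 0) u * (∫ s in (0 : ℝ)..1, shellDet (∑ k ∈ T, Ks k) (Ks 0) u s))) := by
    intro u
    have hu := ne_zero_of_sph u
    have e : ∀ T ∈ (tailIdx n).powerset, ∀ s : ℝ, shellDet (∑ k ∈ T, Ks k) (Ks 0) u s =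
        ((∑ k ∈ T, hess (supp (Ks k)) (u : En n)) + s • hess (supp (Ks 0)) (u : En n) +
          rankOne (u : En n) u).det := by
      intro T hT' s
      rw [shellDet, hess_supp_sum T (fun k hk => h k (Finset.mem_powerset.1 hT' hk)) hu]
    have key : ∑ T ∈ (tailIdx n).powerset, (-1 : ℝ) ^ T.card *
        (∫ s in (0 : ℝ)..1, shellDet (∑ k ∈ T, Ks k) (Ks 0) u s) =
        ∑ T ∈ (tailIdx n).powerset, (-1 : ℝ) ^ T.card *
          ((∑ k ∈ T, hess (supp (Ks k)) (u : En n)) + rankOne (u : En n) u).det := by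
      simp only [← intervalIntegral.integral_const_mul]
      rw [← intervalIntegral.integral_finsetSum]
      · rw [intervalIntegral.integral_congr (g := fun _ => ∑ T ∈ (tailIdx n).powerset,
          (-1 : ℝ) ^ T.card *
          ((∑ k ∈ T, hess (supp (Ks k)) (u : En n)) + rankOne (u : En n) u).det)]
        · simp
        · intro s _
          simp only
          rw [Finset.sum_congr rfl fun T hT' => by rw [e T hT' s]]
          apply alternating_det _ card_tailIdx _ _ hu
          · intro k hk
            exact (h k hk).hess_self hu
          · rw [smul_apply, h0'.hess_self hu, smul_zero]
      · intro T hT'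
        apply Continuous.intervalIntegrable
        exact continuous_const.mul (continuous_shellDet_right _ _ _)
    rw [mixedDens, ← key]
    have e2 : ∑ T ∈ (tailIdx n).powerset, (-1 : ℝ) ^ T.card *
        (supp (Ks 0) u * (∫ s in (0 : ℝ)..1, shellDet (∑ k ∈ T, Ks k) (Ks 0) u s)) =
        supp (Ks 0) u * ∑ T ∈ (tailIdx n).powerset, (-1 : ℝ) ^ T.card *
        (∫ s in (0 : ℝ)..1, shellDet (∑ k ∈ T, Ks k) (Ks 0) u s) := by
      rw [Finset.mul_sum]
      refine Finset.sum_congr rfl fun T _ => ?_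
      ring
    rw [e2]
    ring
  rw [mixedVol_eq, integral_congr_ae (Eventually.of_forall hpt), integral_const_mul,
    integral_const_mul, integral_finsetSum _ hint]
  congr 2
  refine Finset.sum_congr rfl fun T hT' => ?_
  rw [shell_formula (hT T hT') h0, integral_const_mul]

/-! ### Approximation by smooth bodies -/

theorem hasDerivAt_max_pow (k : ℕ) (t : ℝ) :
    HasDerivAt (fun t : ℝ => (max t 0) ^ (k + 2)) ((k + 2 : ℕ) * (max t 0) ^ (k + 1)) t := by
  rcases lt_trichotomy t 0 with h | h | h
  · have h1 : HasDerivAt (fun _ : ℝ => (0 : ℝ)) 0 t := hasDerivAt_const _ _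
    have e : ((k + 2 : ℕ) : ℝ) * (max t 0) ^ (k + 1) = 0 := by rw [max_eq_right h.le]; simp
    rw [e]
    refine h1.congr_of_eventuallyEq ?_
    filter_upwards [gt_mem_nhds h] with s hs
    rw [max_eq_right hs.le]
    simp
  · subst h
    have e : ((k + 2 : ℕ) : ℝ) * (max (0 : ℝ) 0) ^ (k + 1) = 0 := by simp
    rw [e, hasDerivAt_iff_isLittleO]
    simp only [max_self, sub_zero, smul_zero, ne_eq, Nat.add_eq_zero_iff, OfNat.ofNat_ne_zero,
      and_false, not_false_eq_true, zero_pow]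
    have h1 : (fun t : ℝ => (max t 0) ^ (k + 2)) =O[𝓝 0] fun t => t ^ (k + 2) := by
      refine Asymptotics.IsBigO.of_bound 1 (Eventually.of_forall fun s => ?_)
      rw [one_mul, norm_pow, norm_pow]
      refine pow_le_pow_left₀ (norm_nonneg _) ?_ _
      rw [Real.norm_eq_abs, Real.norm_eq_abs, abs_of_nonneg (le_max_right _ _)]
      exact max_le (le_abs_self s) (abs_nonneg s)
    refine h1.trans_isLittleO ?_
    have := Asymptotics.isLittleO_pow_pow (𝕜 := ℝ) (show 1 < k + 2 by omega)
    simpa using this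
  · have h1 := hasDerivAt_pow (k + 2) t
    rw [max_eq_left h.le]
    refine h1.congr_of_eventuallyEq ?_
    filter_upwards [lt_mem_nhds h] with s hs
    rw [max_eq_left hs.le]

theorem contDiff_max_pow (k : ℕ) : ContDiff ℝ k fun t : ℝ => (max t 0) ^ (k + 1) := by
  induction k with
  | zero =>
    rw [Nat.cast_zero, contDiff_zero]
    fun_prop
  | succ k ih =>
    rw [Nat.cast_succ, contDiff_succ_iff_deriv]
    refine ⟨fun t => (hasDerivAt_max_pow k t).differentiableAt, by simp, ?_⟩
    rw [show deriv (fun t : ℝ => (max t 0) ^ (k + 1 + 1)) =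
      fun t => ((k + 2 : ℕ) : ℝ) * (max t 0) ^ (k + 1) from
        funext fun t => (hasDerivAt_max_pow k t).deriv]
    exact contDiff_const.mul ih

theorem inner_hess_norm_pos {x w : En n} (hx : x ≠ 0) (hw : ∀ c : ℝ, w ≠ c • x) :
    0 < ⟪hess (fun x : En n => ‖x‖) x w, w⟫_ℝ := by
  have h0 : 0 < ‖x‖ := norm_pos_iff.2 hx
  have h1 : 0 < ‖w - (⟪x, w⟫_ℝ / ‖x‖ ^ 2) • x‖ ^ 2 :=
    pow_pos (norm_pos_iff.2 (sub_ne_zero.2 (hw _))) 2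
  rw [hess_norm hx, inner_smul_left]
  refine mul_pos (by simpa using h0) ?_
  rw [← real_inner_self_eq_norm_sq, inner_sub_left, inner_sub_right, inner_sub_right,
    inner_smul_left, inner_smul_right, inner_smul_left] at h1
  rw [inner_sub_left, inner_smul_left]
  simp only [conj_trivial, inner_smul_right, real_inner_self_eq_norm_sq] at h1 ⊢
  rw [show ⟪w, x⟫_ℝ = ⟪x, w⟫_ℝ from real_inner_comm _ _] at h1
  have h2 : ‖x‖ ^ 2 ≠ 0 := by positivity
  have h3 : ⟪x, w⟫_ℝ / ‖x‖ ^ 2 * ‖x‖ ^ 2 = ⟪x, w⟫_ℝ := div_mul_cancel₀ _ h2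
  linear_combination h1 + ⟪x, w⟫_ℝ / ‖x‖ ^ 2 * h3

theorem isC2Plus_add_norm {N : En n → ℝ} (h : IsC2Hom N) (h0 : ∀ x, 0 ≤ N x)
    (hc : ∀ x, x ≠ 0 → ∀ w, 0 ≤ ⟪hess N x w, w⟫_ℝ) {δ : ℝ} (hδ : 0 < δ) :
    IsC2Plus fun x => N x + δ * ‖x‖ where
  toIsC2Hom := h.add (isC2Hom_norm.const_mul δ)
  pos x hx := add_pos_of_nonneg_of_pos (h0 x) (mul_pos hδ (norm_pos_iff.2 hx))
  strict x hx w hw := by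
    rw [h.hess_add (isC2Hom_norm.const_mul δ) hx, isC2Hom_norm.hess_const_mul δ hx, add_apply,
      smul_apply, inner_add_left, inner_smul_left]
    exact add_pos_of_nonneg_of_pos (hc x hx w) (mul_pos hδ (inner_hess_norm_pos hx hw))

theorem exists_supp_eq_of_subadditive [NeZero n] {N : En n → ℝ} (h : IsC2Hom N)
    (hs : ∀ x y, N (x + y) ≤ N x + N y) : ∃ K : ConvexBody (En n), supp K = N := by
  have hne : ∃ x : En n, x ≠ 0 := ⟨EuclideanSpace.single 0 1, by simp⟩
  obtain ⟨K, hK⟩ := exists_supp_eq_of_sublinear (N := N) (fun x hx => ⟨gradient N x, by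
      rw [real_inner_comm, h.inner_gradient_self hx], fun z => by
      rw [real_inner_comm, inner_gradient]
      have hl : HasDerivAt (fun t : ℝ => N (x + t • z)) (fderiv ℝ N x z) 0 :=
        (h.differentiableAt hx).hasFDerivAt.hasLineDerivAt z
      have hl' := hl.tendsto_slope_zero_right
      refine le_of_tendsto hl' ?_
      filter_upwards [self_mem_nhdsWithin] with t ht
      have ht : 0 < t := ht
      simp only [zero_add, zero_smul, add_zero, smul_eq_mul]
      rw [inv_mul_le_iff₀ ht]
      have := hs x (t • z)
      rw [h.hom t ht] at this
      linarith⟩) h.zero hne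
  exact ⟨K, funext hK⟩

/-- The `ℓ^q`-type smoothing of the maximum of the linear functions given by `F`. -/
def lqFun (F : Finset (En n)) (δ : ℝ) (q : ℕ) (x : En n) : ℝ :=
  (∑ p ∈ F, (max ⟪p, x⟫_ℝ 0) ^ q + (δ * ‖x‖) ^ q) ^ ((1 : ℝ) / q)

section Lq

variable (F : Finset (En n)) {δ : ℝ} {q : ℕ}

theorem lqFun_inner_nonneg (hδ : 0 ≤ δ) (x : En n) :
    0 ≤ ∑ p ∈ F, (max ⟪p, x⟫_ℝ 0) ^ q + (δ * ‖x‖) ^ q :=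
  add_nonneg (Finset.sum_nonneg fun p _ => pow_nonneg (le_max_right _ _) _) (by positivity)

theorem lqFun_nonneg (hδ : 0 ≤ δ) (x : En n) : 0 ≤ lqFun F δ q x :=
  Real.rpow_nonneg (lqFun_inner_nonneg F hδ x) _

theorem isC2Hom_lqFun (hδ : 0 < δ) (hq : 3 ≤ q) : IsC2Hom (lqFun F δ q) where
  cd := by
    intro x hx
    have hx0 : x ≠ 0 := hx
    have hx' : 0 < ‖x‖ := norm_pos_iff.2 hx0
    have h1 : ContDiff ℝ 2 fun t : ℝ => (max t 0) ^ q := by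
      obtain ⟨k, rfl⟩ : ∃ k, q = k + 1 := ⟨q - 1, by omega⟩
      exact (contDiff_max_pow k).of_le (by exact_mod_cast (show 2 ≤ k by omega))
    refine ContDiffAt.contDiffWithinAt (ContDiffAt.rpow_const_of_ne (ContDiffAt.add
      (ContDiffAt.sum fun p _ => ?_) ?_) ?_)
    · exact h1.contDiffAt.comp x (contDiff_const.inner ℝ contDiff_id).contDiffAt
    · exact (contDiffAt_const.mul (contDiffAt_norm ℝ hx0)).pow q
    · exact (add_pos_of_nonneg_of_pos (Finset.sum_nonneg fun p _ => pow_nonneg (le_max_right _ _) _)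
        (by positivity)).ne'
  hom c hc x := by
    have hq0 : (q : ℝ) ≠ 0 := by exact_mod_cast (by omega : q ≠ 0)
    have e : ∑ p ∈ F, (max ⟪p, c • x⟫_ℝ 0) ^ q + (δ * ‖c • x‖) ^ q =
        c ^ q * (∑ p ∈ F, (max ⟪p, x⟫_ℝ 0) ^ q + (δ * ‖x‖) ^ q) := by
      rw [mul_add, Finset.mul_sum, norm_smul, Real.norm_of_nonneg hc.le]
      congr 1
      · refine Finset.sum_congr rfl fun p _ => ?_
        rw [inner_smul_right, ← mul_pow, mul_max_of_nonneg _ _ hc.le, mul_zero]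
      · ring
    rw [lqFun, e, Real.mul_rpow (by positivity) (lqFun_inner_nonneg F hδ.le x), ← Real.rpow_natCast,
      ← Real.rpow_mul hc.le, mul_one_div_cancel hq0, Real.rpow_one]
    rfl

theorem lqFun_add_le (hδ : 0 ≤ δ) (hq : 1 ≤ q) (x y : En n) :
    lqFun F δ q (x + y) ≤ lqFun F δ q x + lqFun F δ q y := by
  classical
  have key := Real.Lp_add_le_of_nonneg (s := insert none (F.image some))
    (f := fun o : Option (En n) => o.elim (δ * ‖x‖) fun p => max ⟪p, x⟫_ℝ 0)
    (g := fun o : Option (En n) => o.elim (δ * ‖y‖) fun p => max ⟪p, y⟫_ℝ 0) (p := q)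
    (by exact_mod_cast hq) (fun o _ => by cases o <;> simp [hδ, mul_nonneg])
    (fun o _ => by cases o <;> simp [hδ, mul_nonneg])
  have hs : ∀ f : Option (En n) → ℝ, ∑ o ∈ insert none (F.image some), f o ^ (q : ℝ) =
      ∑ p ∈ F, f (some p) ^ q + f none ^ q := by
    intro f
    rw [Finset.sum_insert (by simp), Finset.sum_image (by simp), add_comm]
    simp only [Real.rpow_natCast]
  rw [hs, hs, hs] at key
  refine le_trans ?_ key
  refine Real.rpow_le_rpow (lqFun_inner_nonneg F hδ _) (add_le_add (Finset.sum_le_sum fun p _ => ?_)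
    ?_) (by positivity)
  · refine pow_le_pow_left₀ (le_max_right _ _) (max_le ?_ ?_) _
    · rw [inner_add_right]
      exact add_le_add (le_max_left _ _) (le_max_left _ _)
    · exact add_nonneg (le_max_right _ _) (le_max_right _ _)
  · refine pow_le_pow_left₀ (by positivity) ?_ _
    simp only [Option.elim]
    rw [← mul_add]
    exact mul_le_mul_of_nonneg_left (norm_add_le x y) hδ

theorem inner_le_lqFun (hδ : 0 ≤ δ) (hq : 1 ≤ q) {p : En n} (hp : p ∈ F) (x : En n) :
    ⟪p, x⟫_ℝ ≤ lqFun F δ q x := by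
  have hq0 : (q : ℝ) ≠ 0 := by exact_mod_cast (by omega : q ≠ 0)
  refine (le_max_left _ 0).trans ?_
  have e : max ⟪p, x⟫_ℝ 0 = ((max ⟪p, x⟫_ℝ 0) ^ q) ^ ((1 : ℝ) / q) := by
    rw [← Real.rpow_natCast, ← Real.rpow_mul (le_max_right _ _), mul_one_div_cancel hq0,
      Real.rpow_one]
  rw [e, lqFun]
  refine Real.rpow_le_rpow (pow_nonneg (le_max_right _ _) _) ?_ (by positivity)
  have := Finset.single_le_sum (f := fun p => (max ⟪p, x⟫_ℝ 0) ^ q)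
    (fun p _ => pow_nonneg (le_max_right _ _) _) hp
  have h2 : 0 ≤ (δ * ‖x‖) ^ q := by positivity
  linarith

theorem lqFun_le (hδ : 0 ≤ δ) (hq : 1 ≤ q) {x : En n} {a : ℝ} (ha : δ * ‖x‖ ≤ a)
    (hF : ∀ p ∈ F, ⟪p, x⟫_ℝ ≤ a) : lqFun F δ q x ≤ ((F.card : ℝ) + 1) ^ ((1 : ℝ) / q) * a := by
  have hq0 : (q : ℝ) ≠ 0 := by exact_mod_cast (by omega : q ≠ 0)
  have ha0 : 0 ≤ a := le_trans (by positivity) ha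
  have h1 : ∑ p ∈ F, (max ⟪p, x⟫_ℝ 0) ^ q + (δ * ‖x‖) ^ q ≤ ((F.card : ℝ) + 1) * a ^ q := by
    rw [add_mul, one_mul, ← nsmul_eq_mul]
    refine add_le_add (Finset.sum_le_card_nsmul _ _ _ fun p hp => ?_) (pow_le_pow_left₀ (by positivity) ha _)
    exact pow_le_pow_left₀ (le_max_right _ _) (max_le (hF p hp) ha0) _
  refine (Real.rpow_le_rpow (lqFun_inner_nonneg F hδ x) h1 (by positivity)).trans ?_
  rw [Real.mul_rpow (by positivity) (by positivity), ← Real.rpow_natCast a, ← Real.rpow_mul ha0,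
    mul_one_div_cancel hq0, Real.rpow_one]

end Lq

theorem exists_smooth_approx [NeZero n] (L : ConvexBody (En n)) (h0 : (0 : En n) ∈ L) {ε : ℝ}
    (hε : 0 < ε) : ∃ L' : ConvexBody (En n), IsC2Plus (supp L') ∧
      (∀ x, supp L x ≤ supp L' x) ∧ ∀ x, supp L' x ≤ supp L x + ε * ‖x‖ := by
  obtain ⟨R, hR, hLR⟩ := exists_norm_bound L
  set δ := ε / 3 with hδ
  have hδ0 : 0 < δ := by positivity
  obtain ⟨t, htL, htf, hcov⟩ := L.isCompact.finite_cover_balls hδ0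
  set F := htf.toFinset
  have hlim : Tendsto (fun q : ℕ => (((F.card : ℝ) + 1) ^ ((1 : ℝ) / q) - 1) * (R + δ)) atTop (𝓝 0) := by
    have h1 : Tendsto (fun q : ℕ => ((F.card : ℝ) + 1) ^ ((1 : ℝ) / q)) atTop (𝓝 1) := by
      have := (tendsto_const_nhds (x := (F.card : ℝ) + 1)).rpow
        (tendsto_one_div_atTop_nhds_zero_nat (𝕜 := ℝ)) (Or.inl (by positivity))
      simpa using this
    have := (h1.sub_const 1).mul_const (R + δ)
    simpa using this
  obtain ⟨q, hq1, hq3⟩ := ((hlim.eventually (gt_mem_nhds hδ0)).and (eventually_ge_atTop 3)).exists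
  have hC := isC2Hom_lqFun F hδ0 hq3
  obtain ⟨K, hK⟩ := exists_supp_eq_of_subadditive hC (lqFun_add_le F hδ0.le (by omega))
  have hsupp : supp (K + scale δ (ballB n)) = fun x => lqFun F δ q x + δ * ‖x‖ := by
    funext x
    rw [supp_add, hK, supp_scale, supp_ball, norm_smul, Real.norm_of_nonneg hδ0.le]
  refine ⟨K + scale δ (ballB n), ?_, ?_, ?_⟩
  · rw [hsupp]
    refine isC2Plus_add_norm hC (lqFun_nonneg F hδ0.le) (fun x hx w => ?_) hδ0
    rw [← hK]
    exact hess_supp_nonneg (hK ▸ hC) hx w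
  · intro x
    rw [hsupp]
    simp only
    rw [supp_le_iff]
    intro y hy
    obtain ⟨p, hp, hyp⟩ := Set.mem_iUnion₂.1 (hcov hy)
    have h1 := inner_le_lqFun F hδ0.le (show 1 ≤ q by omega) (htf.mem_toFinset.2 hp) x
    have h2 : ⟪x, y - p⟫_ℝ ≤ ‖x‖ * δ := (real_inner_le_norm _ _).trans
      (mul_le_mul_of_nonneg_left (by rw [← dist_eq_norm]; exact (mem_ball.1 hyp).le) (norm_nonneg _))
    rw [inner_sub_right, real_inner_comm p x] at h2
    linarith
  · intro x
    rw [hsupp]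
    have hs0 : 0 ≤ supp L x := by simpa using inner_le_supp L x h0
    have hsR : supp L x ≤ R * ‖x‖ := by
      rw [supp_le_iff]
      intro y hy
      refine (real_inner_le_norm _ _).trans ?_
      rw [mul_comm]
      exact mul_le_mul_of_nonneg_right (hLR y hy) (norm_nonneg _)
    have h1 := lqFun_le F (q := q) hδ0.le (by omega) (x := x) (a := supp L x + δ * ‖x‖) (by linarith)
      (fun p hp => by
        have := inner_le_supp L x (htL (htf.mem_toFinset.1 hp))
        rw [real_inner_comm] at this
        have : 0 ≤ δ * ‖x‖ := by positivity
        linarith)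
    have h2 : (((F.card : ℝ) + 1) ^ ((1 : ℝ) / q) - 1) * (supp L x + δ * ‖x‖) ≤ δ * ‖x‖ := by
      have hge : 0 ≤ ((F.card : ℝ) + 1) ^ ((1 : ℝ) / q) - 1 := by
        rw [sub_nonneg]
        apply Real.one_le_rpow
        · have : (0 : ℝ) ≤ F.card := Nat.cast_nonneg _
          linarith
        · positivity
      calc _ ≤ (((F.card : ℝ) + 1) ^ ((1 : ℝ) / q) - 1) * ((R + δ) * ‖x‖) := by
            refine mul_le_mul_of_nonneg_left ?_ hge
            linarith
        _ = ((((F.card : ℝ) + 1) ^ ((1 : ℝ) / q) - 1) * (R + δ)) * ‖x‖ := by ring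
        _ ≤ δ * ‖x‖ := mul_le_mul_of_nonneg_right hq1.le (norm_nonneg _)
    simp only
    have h3 : ε * ‖x‖ = 3 * (δ * ‖x‖) := by rw [hδ]; ring
    rw [h3]
    linarith

/-! ### Area measures with continuous density -/

theorem tendsto_volume_of_supp {K : ConvexBody (En n)} {Kj : ℕ → ConvexBody (En n)} {e : ℕ → ℝ}
    (he : Tendsto e atTop (𝓝 0)) (he0 : ∀ j, 0 ≤ e j) (h1 : ∀ j x, supp K x ≤ supp (Kj j) x)
    (h2 : ∀ j x, supp (Kj j) x ≤ supp K x + e j * ‖x‖) :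
    Tendsto (fun j => (volume (Kj j : Set (En n))).toReal) atTop
      (𝓝 (volume (K : Set (En n))).toReal) := by
  refine (ENNReal.tendsto_toReal K.isCompact.measure_lt_top.ne).comp ?_
  have h3 := (tendsto_measure_cthickening_of_isCompact (μ := volume) K.isCompact).comp he
  exact tendsto_of_tendsto_of_tendsto_of_le_of_le tendsto_const_nhds h3
    (fun j => measure_mono (coe_subset_iff.2 (h1 j)))
    (fun j => measure_mono (subset_cthickening_of_supp_le (he0 j) (h2 j)))

theorem mixedDens_congr [NeZero n] {Ks Ks' : Fin n → ConvexBody (En n)}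
    (h : ∀ k ∈ tailIdx n, Ks k = Ks' k) (u : En n) : mixedDens Ks u = mixedDens Ks' u := by
  unfold mixedDens
  congr 2
  refine Finset.sum_congr rfl fun T hT => ?_
  rw [Finset.sum_congr rfl fun k hk => by rw [h k (Finset.mem_powerset.1 hT hk)]]

theorem update_tail [NeZero n] (Ks : Fin n → ConvexBody (En n)) (L : ConvexBody (En n)) {k : Fin n}
    (hk : k ∈ tailIdx n) : Function.update Ks 0 L k = Ks k :=
  Function.update_of_ne (Finset.mem_erase.1 hk).1 _ _

theorem mixedVol_update [NeZero n] (Ks : Fin n → ConvexBody (En n)) (L : ConvexBody (En n)) :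
    n * mixedVol (Function.update Ks 0 L) = (((n - 1).factorial : ℝ))⁻¹ * ((-1) ^ (n - 1) *
      ∑ T ∈ (tailIdx n).powerset, (-1 : ℝ) ^ T.card *
      ((volume ((∑ k ∈ T, Ks k + L : ConvexBody (En n)) : Set (En n))).toReal -
        (volume ((∑ k ∈ T, Ks k : ConvexBody (En n)) : Set (En n))).toReal)) := by
  rw [mixedVol_eq]
  congr 2
  refine Finset.sum_congr rfl fun T hT => ?_
  rw [Finset.sum_congr rfl fun k hk => update_tail Ks L (Finset.mem_powerset.1 hT hk),
    Function.update_self]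

theorem mixedVol_update_eq_integral_of_mem [NeZero n] {Ks : Fin n → ConvexBody (En n)}
    (h : ∀ k ∈ tailIdx n, IsC2Hom (supp (Ks k))) (L : ConvexBody (En n)) (h0 : (0 : En n) ∈ L) :
    n * mixedVol (Function.update Ks 0 L) =
      ∫ u : Sph n, supp L u * mixedDens Ks u ∂(sphVol n) := by
  set e : ℕ → ℝ := fun j => 1 / ((j : ℝ) + 1) with he
  have hpos : ∀ j, 0 < e j := fun j => by simp only [he]; positivity
  have hlim : Tendsto e atTop (𝓝 0) := tendsto_one_div_add_atTop_nhds_zero_nat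
  choose Lj hC h1 h2 using fun j => exists_smooth_approx L h0 (hpos j)
  have ha : ∀ j, n * mixedVol (Function.update Ks 0 (Lj j)) =
      ∫ u : Sph n, supp (Lj j) u * mixedDens Ks u ∂(sphVol n) := by
    intro j
    rw [mixedVol_eq_integral_of_c2plus (fun k hk => by rw [update_tail Ks _ hk]; exact h k hk)
      (by rw [Function.update_self]; exact hC j), Function.update_self]
    refine integral_congr_ae (Eventually.of_forall fun u => ?_)
    simp only
    rw [mixedDens_congr (fun k hk => update_tail Ks (Lj j) hk)]
  have hl : Tendsto (fun j => n * mixedVol (Function.update Ks 0 (Lj j))) atTop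
      (𝓝 (n * mixedVol (Function.update Ks 0 L))) := by
    simp only [mixedVol_update]
    refine tendsto_const_nhds.mul (tendsto_const_nhds.mul (tendsto_finsetSum _ fun T _ =>
      tendsto_const_nhds.mul (Tendsto.sub_const ?_ _)))
    refine tendsto_volume_of_supp hlim (fun j => (hpos j).le) (fun j x => ?_) (fun j x => ?_)
    · rw [supp_add, supp_add]
      linarith [h1 j x]
    · rw [supp_add, supp_add]
      linarith [h2 j x]
  have hD := continuous_mixedDens h
  have hsc : ∀ M : ConvexBody (En n), Continuous fun u : Sph n => supp M (u : En n) := fun M =>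
    (continuous_supp M).comp continuous_subtype_val
  have hI : ∀ M, Integrable (fun u : Sph n => supp M u * mixedDens Ks u) (sphVol n) := fun M =>
    integrable_sph ((hsc M).mul hD)
  have hr : Tendsto (fun j => ∫ u : Sph n, supp (Lj j) u * mixedDens Ks u ∂(sphVol n)) atTop
      (𝓝 (∫ u : Sph n, supp L u * mixedDens Ks u ∂(sphVol n))) := by
    rw [tendsto_iff_norm_sub_tendsto_zero]
    refine squeeze_zero (fun _ => norm_nonneg _) (g := fun j =>
      e j * ∫ u : Sph n, ‖mixedDens Ks u‖ ∂(sphVol n)) (fun j => ?_) (by simpa using hlim.mul_const _)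
    rw [← integral_sub (hI _) (hI _),
      ← integral_const_mul]
    refine norm_integral_le_of_norm_le (integrable_sph (continuous_const.mul hD.norm))
      (Eventually.of_forall fun u => ?_)
    rw [← sub_mul, norm_mul]
    refine mul_le_mul_of_nonneg_right ?_ (norm_nonneg _)
    have a1 := h1 j u
    have a2 := h2 j u
    rw [norm_sph, mul_one] at a2
    rw [Real.norm_eq_abs, abs_le]
    constructor <;> linarith [hpos j]
  simp only [ha] at hl
  exact tendsto_nhds_unique hl hr

theorem volume_translate (K : ConvexBody (En n)) (z : En n) :
    volume (translate K z : Set (En n)) = volume (K : Set (En n)) := by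
  change volume ((fun y => z + y) '' (K : Set (En n))) = _
  rw [Set.image_add_left, measure_preimage_add]

theorem mixedVol_update_translate [NeZero n] (Ks : Fin n → ConvexBody (En n))
    (L : ConvexBody (En n)) (z : En n) : n * mixedVol (Function.update Ks 0 (translate L z)) =
      n * mixedVol (Function.update Ks 0 L) := by
  rw [mixedVol_update, mixedVol_update]
  congr 2
  refine Finset.sum_congr rfl fun T _ => ?_
  have : ∑ k ∈ T, Ks k + translate L z = translate (∑ k ∈ T, Ks k + L) z :=
    supp_injective fun x => by
      rw [supp_add, supp_translate, supp_translate, supp_add, add_assoc]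
  rw [this, volume_translate]

theorem mixedVol_update_eq_integral [NeZero n] {Ks : Fin n → ConvexBody (En n)}
    (h : ∀ k ∈ tailIdx n, IsC2Hom (supp (Ks k))) (L : ConvexBody (En n)) :
    n * mixedVol (Function.update Ks 0 L) =
      ∫ u : Sph n, supp L u * mixedDens Ks u ∂(sphVol n) := by
  have hD := continuous_mixedDens h
  have hsc : ∀ M : ConvexBody (En n), Continuous fun u : Sph n => supp M (u : En n) := fun M =>
    (continuous_supp M).comp continuous_subtype_val
  have hI : ∀ M, Integrable (fun u : Sph n => supp M u * mixedDens Ks u) (sphVol n) := fun M =>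
    integrable_sph ((hsc M).mul hD)
  have hin : ∀ z : En n, Continuous fun u : Sph n => ⟪(u : En n), z⟫_ℝ := fun z =>
    continuous_subtype_val.inner continuous_const
  have hJ : ∀ z : En n, Integrable (fun u : Sph n => ⟪(u : En n), z⟫_ℝ * mixedDens Ks u)
      (sphVol n) := fun z => integrable_sph ((hin z).mul hD)
  have hz : ∀ z : En n, ∫ u : Sph n, ⟪(u : En n), z⟫_ℝ * mixedDens Ks u ∂(sphVol n) = 0 := by
    intro z
    set B := scale ‖z‖ (ballB n)
    have hB : ∀ x, supp B x = ‖z‖ * ‖x‖ := fun x => by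
      rw [supp_scale, supp_ball, norm_smul, norm_norm]
    have h1 := mixedVol_update_eq_integral_of_mem h B (mem_of_forall_inner_le fun x => by
      rw [hB, inner_zero_right]
      positivity)
    have h2 := mixedVol_update_eq_integral_of_mem h (translate B z) (mem_of_forall_inner_le fun x => by
      rw [supp_translate, hB, inner_zero_right]
      have := neg_le_of_abs_le (abs_real_inner_le_norm x z)
      linarith)
    rw [mixedVol_update_translate, h1, ← sub_eq_zero,
      ← integral_sub (hI _) (hI _)] at h2
    rw [← neg_eq_zero, ← integral_neg, ← h2]
    refine integral_congr_ae (Eventually.of_forall fun u => ?_)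
    simp only [supp_translate]
    ring
  obtain ⟨z, hzL⟩ := L.nonempty
  have h1 := mixedVol_update_eq_integral_of_mem h (translate L (-z)) (mem_of_forall_inner_le fun x => by
    rw [supp_translate, inner_zero_right, inner_neg_right]
    linarith [inner_le_supp L x hzL])
  rw [mixedVol_update_translate] at h1
  rw [h1, ← add_zero (∫ u : Sph n, supp L u * mixedDens Ks u ∂(sphVol n)), ← hz (-z),
    ← integral_add (hI _) (hJ _)]
  refine integral_congr_ae (Eventually.of_forall fun u => ?_)
  simp only [supp_translate]
  ring

/-! ### Expansion of area densities near the ball -/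

theorem alternating_pow_sum {ι : Type*} (s : Finset ι) (c : ℝ) :
    (-1 : ℝ) ^ s.card * ∑ T ∈ s.powerset, (-1 : ℝ) ^ T.card * ((T.card : ℝ) + c) ^ s.card =
      (s.card.factorial : ℝ) := by
  rw [Finset.sum_powerset_apply_card (fun m : ℕ => (-1 : ℝ) ^ m * ((m : ℝ) + c) ^ s.card)]
  have h1 := fwdDiff_iter_eq_sum_shift (h := (1 : ℝ)) (fun r : ℝ => r ^ s.card) s.card c
  rw [fwdDiff_iter_eq_factorial] at h1
  rw [Finset.mul_sum]
  refine Eq.trans ?_ h1.symm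
  refine Finset.sum_congr rfl fun m hm => ?_
  have hm : m ≤ s.card := Nat.lt_succ_iff.1 (Finset.mem_range.1 hm)
  obtain ⟨d, hd⟩ := Nat.exists_eq_add_of_le hm
  have hs : (-1 : ℝ) ^ s.card * (-1 : ℝ) ^ m = (-1) ^ (s.card - m) := by
    rw [hd, Nat.add_sub_cancel_left, pow_add]
    rw [show (-1 : ℝ) ^ m * (-1) ^ d * (-1) ^ m = ((-1) ^ m * (-1) ^ m) * (-1) ^ d by ring,
      ← mul_pow]
    simp
  simp only [nsmul_eq_mul, zsmul_eq_mul, smul_eq_mul, Int.cast_mul, Int.cast_pow, Int.cast_neg,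
    Int.cast_one, Int.cast_natCast, mul_one]
  rw [← hs, add_comm c]
  ring

theorem alternating_pow_weighted_sum {ι : Type*} [DecidableEq ι] (s : Finset ι) (χ : ι → ℝ) {m : ℕ}
    (hs : s.card = m + 1) :
    (-1 : ℝ) ^ s.card * ∑ T ∈ s.powerset, (-1 : ℝ) ^ T.card * ((T.card : ℝ) ^ m * ∑ k ∈ T, χ k) =
      (m.factorial : ℝ) * ∑ k ∈ s, χ k := by
  have h1 : ∀ T ∈ s.powerset, (-1 : ℝ) ^ T.card * ((T.card : ℝ) ^ m * ∑ k ∈ T, χ k) =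
      ∑ k ∈ s, χ k * (if k ∈ T then (-1 : ℝ) ^ T.card * (T.card : ℝ) ^ m else 0) := by
    intro T hT
    have hT := Finset.mem_powerset.1 hT
    simp only [mul_ite, mul_zero]
    rw [Finset.sum_ite_mem, Finset.inter_eq_right.2 hT, ← Finset.sum_mul]
    ring
  rw [Finset.sum_congr rfl h1, Finset.sum_comm, Finset.mul_sum, Finset.mul_sum]
  refine Finset.sum_congr rfl fun k hk => ?_
  rw [← Finset.mul_sum]
  have hk' : k ∉ s.erase k := Finset.notMem_erase k s
  have hc : (s.erase k).card = m := by rw [Finset.card_erase_of_mem hk, hs]; rfl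
  have h2 := alternating_pow_sum (s.erase k) 1
  rw [hc] at h2
  rw [← Finset.insert_erase hk, Finset.sum_powerset_insert hk', Finset.insert_erase hk, hs]
  have h3 : ∑ T ∈ (s.erase k).powerset, (if k ∈ T then (-1 : ℝ) ^ T.card * (T.card : ℝ) ^ m else 0) = 0 :=
    Finset.sum_eq_zero fun T hT => if_neg fun h => hk' (Finset.mem_powerset.1 hT h)
  have h4 : ∑ T ∈ (s.erase k).powerset, (if k ∈ insert k T then
      (-1 : ℝ) ^ (insert k T).card * ((insert k T).card : ℝ) ^ m else 0) =
      - ∑ T ∈ (s.erase k).powerset, (-1 : ℝ) ^ T.card * ((T.card : ℝ) + 1) ^ m := by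
    rw [← Finset.sum_neg_distrib]
    refine Finset.sum_congr rfl fun T hT => ?_
    rw [if_pos (Finset.mem_insert_self _ _), Finset.card_insert_of_notMem fun h =>
      hk' (Finset.mem_powerset.1 hT h)]
    push_cast
    ring
  rw [h3, h4, ← h2]
  ring

/-- The trace of a continuous linear map. -/
def trL (n : ℕ) : (En n →L[ℝ] En n) →L[ℝ] ℝ :=
  LinearMap.toContinuousLinearMap ((LinearMap.trace ℝ (En n)).comp (ContinuousLinearMap.coeLM ℝ))

theorem trL_apply (A : En n →L[ℝ] En n) : trL n A = LinearMap.trace ℝ (En n) A := rfl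

theorem trL_eq_sum (A : En n →L[ℝ] En n) {ι : Type*} [Fintype ι] (b : OrthonormalBasis ι ℝ (En n)) :
    trL n A = ∑ j, ⟪A (b j), b j⟫_ℝ := by
  rw [trL_apply, LinearMap.trace_eq_sum_inner _ b]
  exact Finset.sum_congr rfl fun j _ => real_inner_comm _ _

theorem contDiff_det : ContDiff ℝ 2 fun A : En n →L[ℝ] En n => A.det := by
  classical
  set b := (EuclideanSpace.basisFun (Fin n) ℝ).toBasis
  have e : (fun A : En n →L[ℝ] En n => A.det) = fun A : En n →L[ℝ] En n => ∑ σ : Equiv.Perm (Fin n),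
      ((Equiv.Perm.sign σ : ℤ) : ℝ) *
        ∏ j ∈ Finset.univ, (LinearMap.toMatrix b b (A : En n →ₗ[ℝ] En n)) (σ j) j := by
    funext A
    rw [ContinuousLinearMap.det, ← LinearMap.det_toMatrix b, Matrix.det_apply']
  rw [e]
  refine ContDiff.sum fun σ _ => contDiff_const.mul (contDiff_prod fun j _ => ?_)
  have : (fun A : En n →L[ℝ] En n => (LinearMap.toMatrix b b (A : En n →ₗ[ℝ] En n)) (σ j) j) =
      LinearMap.toContinuousLinearMap ((Matrix.entryLinearMap ℝ ℝ (σ j) j).comp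
        ((LinearMap.toMatrix b b).toLinearMap.comp (ContinuousLinearMap.coeLM ℝ))) := rfl
  rw [this]
  exact ContinuousLinearMap.contDiff _

theorem fderiv_det_one : fderiv ℝ (fun A : En n →L[ℝ] En n => A.det) 1 = trL n := by
  ext A
  have h1 : HasDerivAt (fun t : ℝ => (1 + t • A : En n →L[ℝ] En n).det)
      (fderiv ℝ (fun A : En n →L[ℝ] En n => A.det) 1 A) 0 :=
    ((contDiff_det.contDiffAt).differentiableAt (by norm_num)).hasFDerivAt.hasLineDerivAt A
  set b := (EuclideanSpace.basisFun (Fin n) ℝ).toBasis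
  set M := LinearMap.toMatrix b b (A : En n →ₗ[ℝ] En n)
  have e : (fun t : ℝ => (1 + t • A : En n →L[ℝ] En n).det) = fun t =>
      1 + M.trace * t + (1 + (Polynomial.X : Polynomial ℝ) •
        M.map Polynomial.C).det.divX.divX.eval t * t ^ 2 := by
    funext t
    rw [← Matrix.det_one_add_smul, ContinuousLinearMap.det, ← LinearMap.det_toMatrix b]
    congr 1
    simp only [M, ContinuousLinearMap.toLinearMap_add, ContinuousLinearMap.toLinearMap_smul, map_add,
      map_smul]
    congr 1
    exact LinearMap.toMatrix_one b
  set p := (1 + (Polynomial.X : Polynomial ℝ) • M.map Polynomial.C).det.divX.divX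
  have h2 : HasDerivAt (fun t => 1 + M.trace * t + p.eval t * t ^ 2) M.trace 0 := by
    have := (((hasDerivAt_id (0 : ℝ)).const_mul M.trace).const_add 1).add
      ((p.hasDerivAt 0).mul (hasDerivAt_pow 2 (0 : ℝ)))
    exact this.congr_deriv (by simp)
  rw [e] at h1
  rw [h1.unique h2, trL_apply, LinearMap.trace_eq_matrix_trace ℝ b]

theorem det_one_add_expansion (n : ℕ) : ∃ δ > (0 : ℝ), ∃ C ≥ (0 : ℝ), ∀ A : En n →L[ℝ] En n, ‖A‖ ≤ δ →
    |(1 + A).det - 1 - trL n A| ≤ C * ‖A‖ ^ 2 := by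
  set F : (En n →L[ℝ] En n) → ℝ := fun A => A.det
  have hd : Differentiable ℝ F := contDiff_det.differentiable (by norm_num)
  have h1 : ContDiffAt ℝ 1 (fderiv ℝ F) 1 := (contDiff_det.contDiffAt).fderiv_right (by norm_num)
  obtain ⟨K, s, hs, hl⟩ := h1.exists_lipschitzOnWith
  obtain ⟨r, hr, hrs⟩ := Metric.mem_nhds_iff.1 hs
  refine ⟨r / 2, by positivity, K, K.2, fun A hA => ?_⟩
  have hball : ∀ B ∈ Metric.closedBall (1 : En n →L[ℝ] En n) ‖A‖, ‖fderiv ℝ F B - trL n‖ ≤ K * ‖A‖ := by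
    intro B hB
    have hB' := Metric.mem_closedBall.1 hB
    rw [← fderiv_det_one]
    refine (hl.norm_sub_le (hrs (Metric.mem_ball.2 (by linarith)))
      (hrs (Metric.mem_ball_self hr))).trans ?_
    rw [← dist_eq_norm]
    exact mul_le_mul_of_nonneg_left hB' K.2
  have := (convex_closedBall (1 : En n →L[ℝ] En n) ‖A‖).norm_image_sub_le_of_norm_hasFDerivWithin_le'
    (f := F) (f' := fderiv ℝ F) (φ := trL n) (C := K * ‖A‖)
    (fun B _ => (hd B).hasFDerivAt.hasFDerivWithinAt) hball
    (Metric.mem_closedBall_self (norm_nonneg _)) (y := 1 + A)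
    (Metric.mem_closedBall.2 (by rw [dist_eq_norm, add_sub_cancel_left]))
  rw [add_sub_cancel_left] at this
  have h1 : F 1 = 1 := LinearMap.det_id
  rw [h1] at this
  rw [← Real.norm_eq_abs, sq, ← mul_assoc]
  exact this

theorem hess_norm_sph (u : Sph n) :
    hess (fun x : En n => ‖x‖) u = 1 - rankOne (u : En n) (u : En n) := by
  ext1 v
  rw [hess_norm (ne_zero_of_sph u), norm_sph, sub_apply, rankOne_apply]
  simp

theorem det_tangent {X : En n →L[ℝ] En n} (hn : 2 ≤ n) (u : Sph n) (hX : X u = 0)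
    (hX' : ∀ v, ⟪X v, (u : En n)⟫_ℝ = 0) {t j : ℝ} (ht : t ≠ 0 ∨ j = 0) :
    (t • (1 - rankOne (u : En n) u) + j • X + rankOne (u : En n) u).det =
      t ^ (n - 1) * (1 + (j / t) • X).det := by
  have hu : ⟪(u : En n), (u : En n)⟫_ℝ = 1 := by rw [real_inner_self_eq_norm_sq, norm_sph, one_pow]
  rcases eq_or_ne t 0 with h0 | h0
  · obtain rfl : j = 0 := ht.resolve_left (not_not.2 h0)
    subst h0
    have hz : ∀ A : En n →L[ℝ] En n, (0 : ℝ) • A = 0 := fun A => by ext1 v; simp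
    rw [hz, hz, zero_add, zero_add, zero_pow (by omega), zero_mul]
    obtain ⟨y, hy0, hy⟩ : ∃ y : En n, y ≠ 0 ∧ ⟪(u : En n), y⟫_ℝ = 0 := by
      by_contra! hcon
      have h2 : (ℝ ∙ (u : En n))ᗮ = ⊥ := by
        rw [Submodule.eq_bot_iff]
        intro y hy
        by_contra hy0
        exact hcon y hy0 (Submodule.mem_orthogonal_singleton_iff_inner_right.1 hy)
      have h3 := Submodule.finrank_add_finrank_orthogonal (ℝ ∙ (u : En n))
      rw [h2, finrank_bot, finrank_span_singleton (ne_zero_of_sph u), finrank_euclideanSpace_fin] at h3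
      omega
    exact det_eq_zero_of_apply hy0 (by rw [rankOne_apply, hy, zero_smul])
  · have e : t • (1 - rankOne (u : En n) u) + j • X + rankOne (u : En n) u =
        (t • (1 + rankOne (u : En n) ((t⁻¹ - 1) • (u : En n)))) * (1 + (j / t) • X) := by
      ext1 v
      have h1 : ∀ S T : En n →L[ℝ] En n, (S * T) v = S (T v) := fun _ _ => rfl
      rw [h1]
      have h2 : ⟪(u : En n), X v⟫_ℝ = 0 := by rw [real_inner_comm]; exact hX' v
      simp only [add_apply, smul_apply, sub_apply, rankOne_apply, one_apply_eq_self, inner_add_right,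
        inner_smul_right, h2]
      match_scalars <;> field_simp
      ring
    rw [e, det_mul', det_smul', det_one_add_rankOne, inner_smul_right, hu]
    congr 1
    obtain ⟨k, rfl⟩ : ∃ k, n = k + 1 := ⟨n - 1, by omega⟩
    rw [Nat.add_sub_cancel, pow_succ]
    field_simp
    ring

/-- The density of the area measure of order `i`. -/
def areaDens [NeZero n] (i : ℕ) (K : ConvexBody (En n)) (u : En n) : ℝ :=
  mixedDens (fun k : Fin n => if (k : ℕ) ≤ i then K else ballB n) u

theorem isC2Hom_areaFam {K : ConvexBody (En n)} (h : IsC2Hom (supp K)) (i : ℕ) (k : Fin n) :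
    IsC2Hom (supp (if (k : ℕ) ≤ i then K else ballB n)) := by
  split_ifs
  exacts [h, isC2Hom_supp_ball]

theorem continuous_areaDens [NeZero n] {K : ConvexBody (En n)} (h : IsC2Hom (supp K)) (i : ℕ) :
    Continuous fun u : Sph n => areaDens i K (u : En n) :=
  continuous_mixedDens fun k _ => isC2Hom_areaFam h i k

theorem sum_tailIdx_indicator [NeZero n] {i : ℕ} (hi : i ≤ n - 1) :
    ∑ k ∈ tailIdx n, (if (k : ℕ) ≤ i then (1 : ℝ) else 0) = i := by
  rw [Finset.sum_boole]
  congr 1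
  have : (tailIdx n).filter (fun k : Fin n => (k : ℕ) ≤ i) =
      (Finset.univ.filter fun k : Fin n => (k : ℕ) < i + 1).erase 0 := by
    ext k
    simp [tailIdx, Finset.mem_erase, Nat.lt_succ_iff]
  have hn := NeZero.pos n
  rw [this, Finset.card_erase_of_mem (by simp), Fin.card_filter_val_lt]
  omega

private theorem split_sum_aux (f A B t S p : ℝ) : f⁻¹ * (p * (A + B * t + S)) =
    f⁻¹ * (p * A) + f⁻¹ * (p * B) * t + f⁻¹ * (p * S) := by ring

private theorem cancel_aux (a b : ℝ) : 1 + a + b - 1 - a = b := by ring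

set_option maxHeartbeats 4000000 in
theorem areaDens_expansion [NeZero n] (hn : 2 ≤ n) {i : ℕ} (hi : i ≤ n - 1) :
    ∃ δ > (0 : ℝ), ∃ C ≥ (0 : ℝ), ∀ K : ConvexBody (En n), IsC2Hom (supp K) → ∀ u : Sph n,
      ‖hess (supp K) u - hess (fun x => ‖x‖) u‖ ≤ δ →
      |areaDens i K u - 1 - i / ((n : ℝ) - 1) * trL n (hess (supp K) u - hess (fun x => ‖x‖) u)| ≤
        C * ‖hess (supp K) u - hess (fun x => ‖x‖) u‖ ^ 2 := by
  classical
  obtain ⟨δ, hδ, C, hC, hdet⟩ := det_one_add_expansion n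
  set C' : ℝ := ((n - 1).factorial : ℝ)⁻¹ *
    ∑ T ∈ (tailIdx n).powerset, (T.card : ℝ) ^ (n - 1) * C with hC'
  have hC'0 : 0 ≤ C' := mul_nonneg (by positivity)
    (Finset.sum_nonneg fun T _ => mul_nonneg (by positivity) hC)
  refine ⟨δ, hδ, C', hC'0, fun K hK u hX => ?_⟩
  set X := hess (supp K) u - hess (fun x => ‖x‖) u with hXdef
  have hu0 := ne_zero_of_sph u
  have hXh : X = hess (fun x => supp K x - ‖x‖) u := (hK.hess_sub isC2Hom_norm hu0).symm
  have hφ := hK.sub isC2Hom_norm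
  have hXu : X u = 0 := by rw [hXh]; exact hφ.hess_self hu0
  have hXu' : ∀ v, ⟪X v, (u : En n)⟫_ℝ = 0 := fun v => by
    rw [hXh, hφ.hess_symm hu0, hφ.hess_self hu0, inner_zero_right]
  set χ : Fin n → ℝ := fun k => if (k : ℕ) ≤ i then 1 else 0 with hχ
  have hball : hess (supp (ballB n)) u = 1 - rankOne (u : En n) u := by
    rw [show supp (ballB n) = fun x => ‖x‖ from funext supp_ball, hess_norm_sph]
  have hterm : ∀ k : Fin n, hess (supp (if (k : ℕ) ≤ i then K else ballB n)) u =
      (1 - rankOne (u : En n) u) + χ k • X := by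
    intro k
    simp only [hχ]
    split_ifs
    · rw [one_smul, hXdef, hess_norm_sph]
      abel
    · rw [show (0 : ℝ) • X = 0 from by ext1 v; simp, add_zero, hball]
  have hcard : (tailIdx n).card = n - 1 := by have := card_tailIdx (n := n); omega
  have hdetT : ∀ T ∈ (tailIdx n).powerset,
      ((∑ k ∈ T, hess (supp (if (k : ℕ) ≤ i then K else ballB n)) u) + rankOne (u : En n) u).det =
      (T.card : ℝ) ^ (n - 1) * (1 + ((∑ k ∈ T, χ k) / T.card) • X).det := by
    intro T _
    rw [Finset.sum_congr rfl fun k _ => hterm k, Finset.sum_add_distrib, Finset.sum_const,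
      ← Finset.sum_smul, ← Nat.cast_smul_eq_nsmul ℝ]
    refine det_tangent hn u hXu hXu' ?_
    rcases T.eq_empty_or_nonempty with rfl | hT
    · right; simp
    · left
      exact_mod_cast hT.card_pos.ne'
  set R : Finset (Fin n) → ℝ := fun T => (1 + ((∑ k ∈ T, χ k) / T.card) • X).det - 1 -
    trL n (((∑ k ∈ T, χ k) / T.card) • X) with hR
  have hRle : ∀ T, |R T| ≤ C * ‖X‖ ^ 2 := by
    intro T
    have h0 : 0 ≤ ∑ k ∈ T, χ k := Finset.sum_nonneg fun k _ => by simp only [hχ]; split_ifs <;> norm_num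
    have h1 : ∑ k ∈ T, χ k ≤ T.card := by
      have := Finset.sum_le_card_nsmul T χ 1 fun k _ => by simp only [hχ]; split_ifs <;> norm_num
      simpa using this
    have h2 : ‖((∑ k ∈ T, χ k) / T.card) • X‖ ≤ ‖X‖ := by
      rw [norm_smul, Real.norm_of_nonneg (by positivity)]
      exact mul_le_of_le_one_left (norm_nonneg _) (div_le_one_of_le₀ h1 (by positivity))
    refine (hdet _ (h2.trans hX)).trans ?_
    gcongr
  have hn1 : n - 1 = (n - 2) + 1 := by omega
  have hmain : areaDens i K u = ((n - 1).factorial : ℝ)⁻¹ * ((-1) ^ (n - 1) *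
      ∑ T ∈ (tailIdx n).powerset, ((-1 : ℝ) ^ T.card * ((T.card : ℝ) + 0) ^ (n - 1) +
        (-1 : ℝ) ^ T.card * ((T.card : ℝ) ^ (n - 2) * ∑ k ∈ T, χ k) * trL n X +
        (-1 : ℝ) ^ T.card * ((T.card : ℝ) ^ (n - 1) * R T))) := by
    unfold areaDens mixedDens
    congr 2
    refine Finset.sum_congr rfl fun T hT => ?_
    rw [hdetT T hT]
    have : (1 + ((∑ k ∈ T, χ k) / T.card) • X).det = R T + 1 +
        (∑ k ∈ T, χ k) / T.card * trL n X := by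
      simp only [hR, map_smul, smul_eq_mul]
      ring
    rw [this]
    rcases T.eq_empty_or_nonempty with rfl | hTn
    · simp [show n - 1 ≠ 0 by omega]
    · have hc : (T.card : ℝ) ≠ 0 := by exact_mod_cast hTn.card_pos.ne'
      rw [hn1, pow_succ, add_zero]
      field_simp
      ring
  have h1 := alternating_pow_sum (tailIdx n) 0
  have h2 := alternating_pow_weighted_sum (tailIdx n) χ (m := n - 2) (by omega)
  rw [hcard] at h1 h2
  rw [sum_tailIdx_indicator hi] at h2
  have hf : ((n - 1).factorial : ℝ) = ((n : ℝ) - 1) * ((n - 2).factorial : ℝ) := by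
    rw [hn1, Nat.factorial_succ, ← hn1]
    push_cast [show 1 ≤ n by omega]
    rfl
  have hf0 : ((n - 1).factorial : ℝ) ≠ 0 := by positivity
  have hf2 : ((n - 2).factorial : ℝ) ≠ 0 := by positivity
  have hn1' : (n : ℝ) - 1 ≠ 0 := by
    have : (2 : ℝ) ≤ n := by exact_mod_cast hn
    linarith
  have hmain2 : areaDens i K u = 1 + i / ((n : ℝ) - 1) * trL n X +
      ((n - 1).factorial : ℝ)⁻¹ * ((-1) ^ (n - 1) *
        ∑ T ∈ (tailIdx n).powerset, (-1 : ℝ) ^ T.card * ((T.card : ℝ) ^ (n - 1) * R T)) := by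
    rw [hmain, Finset.sum_add_distrib, Finset.sum_add_distrib, ← Finset.sum_mul, split_sum_aux, h1, h2,
      inv_mul_cancel₀ hf0]
    congr 3
    rw [hf]
    field_simp
  rw [hmain2, cancel_aux, abs_mul, abs_mul, abs_pow, abs_neg, abs_one, one_pow, one_mul,
    abs_of_nonneg (inv_nonneg.2 (Nat.cast_nonneg _)), mul_assoc, Finset.sum_mul]
  refine mul_le_mul_of_nonneg_left ?_ (inv_nonneg.2 (Nat.cast_nonneg _))
  refine (Finset.abs_sum_le_sum_abs _ _).trans (Finset.sum_le_sum fun T _ => ?_)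
  rw [abs_mul, abs_mul, abs_pow, abs_neg, abs_one, one_pow, one_mul, abs_pow, Nat.abs_cast,
    mul_assoc]
  exact mul_le_mul_of_nonneg_left (hRle T) (pow_nonneg (Nat.cast_nonneg _) _)

/-! ### Area measures with densities, and symmetry of the trace pairing -/

theorem continuous_supp_sph (K : ConvexBody (En n)) : Continuous fun u : Sph n => supp K (u : En n) :=
  (continuous_supp K).comp continuous_subtype_val

theorem contMul {X : Type*} [TopologicalSpace X] {f g : X → ℝ} (hf : Continuous f)
    (hg : Continuous g) : Continuous fun x => f x * g x := hf.mul hg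

theorem contAdd {X : Type*} [TopologicalSpace X] {f g : X → ℝ} (hf : Continuous f)
    (hg : Continuous g) : Continuous fun x => f x + g x := hf.add hg

theorem contConstMul {X : Type*} [TopologicalSpace X] {f : X → ℝ} (c : ℝ) (hf : Continuous f) :
    Continuous fun x => c * f x := continuous_const.mul hf

theorem sph_integral_lin {f g : Sph n → ℝ} (hf : Continuous f) (hg : Continuous g) (a b : ℝ) :
    ∫ u, (a * f u + b * g u) ∂(sphVol n) =
      a * (∫ u, f u ∂(sphVol n)) + b * ∫ u, g u ∂(sphVol n) := by
  rw [integral_add (f := fun u => a * f u) (g := fun u => b * g u)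
    (integrable_sph (continuous_const.mul hf)) (integrable_sph (continuous_const.mul hg)),
    integral_const_mul, integral_const_mul]

theorem sph_integral_congr {f g : Sph n → ℝ} (h : ∀ u, f u = g u) :
    ∫ u, f u ∂(sphVol n) = ∫ u, g u ∂(sphVol n) :=
  integral_congr_ae (Eventually.of_forall h)

theorem areaFam_update [NeZero n] (i : ℕ) (K L : ConvexBody (En n)) :
    (fun k : Fin n => if (k : ℕ) = 0 then L else if (k : ℕ) ≤ i then K else ballB n) =
      Function.update (fun k : Fin n => if (k : ℕ) ≤ i then K else ballB n) 0 L := by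
  funext k
  by_cases hk : k = 0
  · subst hk; simp
  · have : (k : ℕ) ≠ 0 := fun h => hk (Fin.ext (by simpa using h))
    simp [Function.update_of_ne hk, this]

theorem integral_areaDensMeasure [NeZero n] {K : ConvexBody (En n)} (h : IsC2Hom (supp K)) {i : ℕ}
    (hpos : ∀ u : Sph n, 0 ≤ areaDens i K u) (f : Sph n → ℝ) :
    (∫ v, f v ∂((sphVol n).withDensity fun u => ENNReal.ofReal (areaDens i K u))) =
      ∫ v : Sph n, f v * areaDens i K v ∂(sphVol n) := by
  rw [integral_withDensity_eq_integral_toReal_smul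
    ((continuous_areaDens h i).measurable.ennreal_ofReal)
    (Eventually.of_forall fun _ => ENNReal.ofReal_lt_top)]
  refine integral_congr_ae (Eventually.of_forall fun v => ?_)
  simp only [ENNReal.toReal_ofReal (hpos v), smul_eq_mul]
  ring

theorem isAreaMeasure_withDensity [NeZero n] {K : ConvexBody (En n)} (h : IsC2Hom (supp K)) {i : ℕ}
    (hpos : ∀ u : Sph n, 0 ≤ areaDens i K u) :
    IsAreaMeasure i K ((sphVol n).withDensity fun u => ENNReal.ofReal (areaDens i K u)) := by
  intro L
  rw [integral_areaDensMeasure h hpos, areaFam_update,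
    mixedVol_update_eq_integral fun k _ => isC2Hom_areaFam h i k]
  rfl

theorem supp_eq_integral [NeZero n] {Φ : ConvexBody (En n) → ConvexBody (En n)} {g : ℝ → ℝ} {i : ℕ}
    (hgen : GeneratedBy i Φ g) {K : ConvexBody (En n)} (h : IsC2Hom (supp K))
    (hpos : ∀ u : Sph n, 0 ≤ areaDens i K u) {u : En n} (hu : ‖u‖ = 1) :
    supp (Φ K) u = ∫ v : Sph n, g ⟪u, (v : En n)⟫_ℝ * areaDens i K v ∂(sphVol n) := by
  rw [hgen K _ (isAreaMeasure_withDensity h hpos) u hu, integral_areaDensMeasure h hpos]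

theorem mixedVol_perm (Ks : Fin n → ConvexBody (En n)) (σ : Equiv.Perm (Fin n)) :
    mixedVol (Ks ∘ σ) = mixedVol Ks := by
  unfold mixedVol
  congr 1
  refine Fintype.sum_equiv σ.finsetCongr _ _ fun S => ?_
  simp [Finset.sum_map]

/-- The first order mixed area pairing is symmetric. -/
theorem integral_areaDens_one_comm [NeZero n] (hn : 2 ≤ n) {K L : ConvexBody (En n)}
    (hK : IsC2Hom (supp K)) (hL : IsC2Hom (supp L)) :
    ∫ u : Sph n, supp L u * areaDens 1 K u ∂(sphVol n) =
      ∫ u : Sph n, supp K u * areaDens 1 L u ∂(sphVol n) := by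
  have h1 := mixedVol_update_eq_integral (fun k _ => isC2Hom_areaFam hK 1 k) L
  have h2 := mixedVol_update_eq_integral (fun k _ => isC2Hom_areaFam hL 1 k) K
  refine h1.symm.trans (Eq.trans ?_ h2)
  congr 1
  set o : Fin n := ⟨1, by omega⟩ with ho
  have ho0 : o ≠ 0 := fun h => by simpa [ho] using congrArg Fin.val h
  rw [← mixedVol_perm _ (Equiv.swap 0 o)]
  congr 1
  funext k
  simp only [Function.comp]
  by_cases hk : k = 0
  · subst hk
    rw [Equiv.swap_apply_left, Function.update_of_ne ho0, Function.update_self]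
    simp [ho]
  · rw [Function.update_of_ne hk]
    by_cases hk1 : k = o
    · subst hk1
      rw [Equiv.swap_apply_right, Function.update_self]
      simp [ho]
    · rw [Equiv.swap_apply_of_ne_of_ne hk hk1, Function.update_of_ne hk]
      have h0 : (k : ℕ) ≠ 0 := fun h => hk (Fin.ext (by simpa using h))
      have h1 : (k : ℕ) ≠ 1 := fun h => hk1 (Fin.ext h)
      rw [if_neg (by omega), if_neg (by omega)]

theorem continuous_trL_hess {N : En n → ℝ} (h : IsC2Hom N) :
    Continuous fun u : Sph n => trL n (hess N u) :=
  (trL n).continuous.comp h.continuous_hess_sph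

theorem exists_sph_bound {E : Type*} [NormedAddCommGroup E] {f : Sph n → E} (hf : Continuous f) :
    ∃ C : ℝ, 0 ≤ C ∧ ∀ u, ‖f u‖ ≤ C := by
  obtain ⟨C, hC⟩ := isCompact_univ.exists_bound_of_continuousOn hf.continuousOn
  exact ⟨max C 0, le_max_right _ _, fun u => (hC u (Set.mem_univ u)).trans (le_max_left _ _)⟩

theorem abs_integral_sph_le {f : Sph n → ℝ} {C : ℝ} (hf : ∀ u, |f u| ≤ C) :
    |∫ u, f u ∂(sphVol n)| ≤ C * (sphVol n).real Set.univ := by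
  have := norm_integral_le_of_norm_le_const (μ := sphVol n) (f := f) (C := C)
    (Eventually.of_forall hf)
  simpa using this

theorem eq_zero_of_quadratic_bound {a b C : ℝ} {ε₀ : ℝ} (h0 : 0 < ε₀)
    (h : ∀ ε, 0 < ε → ε ≤ ε₀ → |a + ε * b| ≤ C * ε ^ 2) : a = 0 ∧ b = 0 := by
  have hmem : Set.Ioc 0 ε₀ ∈ 𝓝[>] (0 : ℝ) := Ioc_mem_nhdsGT h0
  have hid : Tendsto (fun ε : ℝ => ε) (𝓝[>] 0) (𝓝 0) := tendsto_id.mono_left nhdsWithin_le_nhds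
  have ha : a = 0 := by
    have h1 : Tendsto (fun ε : ℝ => |a + ε * b|) (𝓝[>] 0) (𝓝 |a + 0 * b|) :=
      ((hid.mul_const b).const_add a).abs
    have h2 : Tendsto (fun ε : ℝ => C * ε ^ 2) (𝓝[>] 0) (𝓝 (C * 0 ^ 2)) := (hid.pow 2).const_mul C
    have := le_of_tendsto_of_tendsto h1 h2 (by filter_upwards [hmem] with ε hε using h ε hε.1 hε.2)
    simpa using this
  refine ⟨ha, ?_⟩
  have h2 : Tendsto (fun ε : ℝ => C * ε) (𝓝[>] 0) (𝓝 (C * 0)) := hid.const_mul C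
  have := le_of_tendsto_of_tendsto (tendsto_const_nhds (x := |b|)) h2 (by
    filter_upwards [hmem] with ε hε
    have := h ε hε.1 hε.2
    rw [ha, zero_add, abs_mul, abs_of_pos hε.1] at this
    have h3 : ε * |b| ≤ ε * (C * ε) := by nlinarith
    exact le_of_mul_le_mul_left h3 hε.1)
  simpa using this

/-- The density of the first area measure, in integrated form. -/
theorem integral_mul_trL [NeZero n] (hn : 2 ≤ n) {K L : ConvexBody (En n)}
    (hK : IsC2Hom (supp K)) (hL : IsC2Hom (supp L)) :
    ((n : ℝ) - 1)⁻¹ * ∫ u : Sph n, supp L u * trL n (hess (supp K) u) ∂(sphVol n) =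
      ∫ u : Sph n, supp K u * areaDens 1 L u ∂(sphVol n) := by
  obtain ⟨δ, hδ, C, hC, hexp⟩ := areaDens_expansion (n := n) hn (i := 1) (by omega)
  obtain ⟨M, hM, hMb⟩ := exists_sph_bound hK.continuous_hess_sph
  obtain ⟨A, hA, hAb⟩ := exists_sph_bound (continuous_supp_sph L)
  have key : ∀ ε, 0 < ε → ε ≤ δ / (M + 1) →
      |((∫ u : Sph n, supp L u ∂(sphVol n)) - ∫ u : Sph n, areaDens 1 L u ∂(sphVol n)) +
        ε * (((n : ℝ) - 1)⁻¹ * (∫ u : Sph n, supp L u * trL n (hess (supp K) u) ∂(sphVol n)) -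
          ∫ u : Sph n, supp K u * areaDens 1 L u ∂(sphVol n))| ≤
        (A * (C * M ^ 2) * (sphVol n).real Set.univ) * ε ^ 2 := by
    intro ε hε hεδ
    set K' : ConvexBody (En n) := ballB n + scale ε K with hK'
    have hs : supp K' = fun x => ‖x‖ + ε * supp K x := by
      funext x
      rw [hK', supp_add, supp_ball, supp_scale, supp_smul K hε.le]
    have hK'2 : IsC2Hom (supp K') := by
      rw [hs]; exact isC2Hom_norm.add (hK.const_mul ε)
    have hX : ∀ u : Sph n, hess (supp K') u - hess (fun x => ‖x‖) u = ε • hess (supp K) u := by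
      intro u
      rw [hs, isC2Hom_norm.hess_add (hK.const_mul ε) (ne_zero_of_sph u),
        hK.hess_const_mul ε (ne_zero_of_sph u), add_sub_cancel_left]
    have hXn : ∀ u : Sph n, ‖ε • hess (supp K) (u : En n)‖ ≤ ε * M := fun u => by
      rw [norm_smul, Real.norm_of_nonneg hε.le]
      exact mul_le_mul_of_nonneg_left (hMb u) hε.le
    have hXd : ε * M ≤ δ := by
      rw [le_div_iff₀ (by positivity)] at hεδ
      nlinarith
    have hexp' : ∀ u : Sph n, |areaDens 1 K' u - 1 - ((n : ℝ) - 1)⁻¹ * (ε * trL n (hess (supp K) u))|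
        ≤ C * M ^ 2 * ε ^ 2 := by
      intro u
      have := hexp K' hK'2 u (by rw [hX]; exact (hXn u).trans hXd)
      rw [hX, map_smul, smul_eq_mul, Nat.cast_one, one_div] at this
      refine this.trans ?_
      have h3 : ‖ε • hess (supp K) (u : En n)‖ ^ 2 ≤ (ε * M) ^ 2 :=
        pow_le_pow_left₀ (norm_nonneg _) (hXn u) 2
      nlinarith
    have hcomm := integral_areaDens_one_comm hn hK'2 hL
    have cL := continuous_supp_sph L
    have cK := continuous_supp_sph K
    have cA := continuous_areaDens hL 1
    have cT := continuous_trL_hess hK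
    have cA' := continuous_areaDens hK'2 1
    have e1 : ∫ u : Sph n, supp K' u * areaDens 1 L u ∂(sphVol n) =
        (∫ u : Sph n, areaDens 1 L u ∂(sphVol n)) +
          ε * ∫ u : Sph n, supp K u * areaDens 1 L u ∂(sphVol n) := by
      rw [sph_integral_congr (g := fun u : Sph n => 1 * areaDens 1 L u +
        ε * (supp K u * areaDens 1 L u)) fun u => by simp only [hs, norm_sph]; ring,
        sph_integral_lin cA (contMul cK cA), one_mul]
    have e2 : ∫ u : Sph n, supp L u * (areaDens 1 K' u - 1 -
          ((n : ℝ) - 1)⁻¹ * (ε * trL n (hess (supp K) u))) ∂(sphVol n) =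
        (∫ u : Sph n, supp L u * areaDens 1 K' u ∂(sphVol n)) -
          (∫ u : Sph n, supp L u ∂(sphVol n)) -
          ε * (((n : ℝ) - 1)⁻¹ * ∫ u : Sph n, supp L u * trL n (hess (supp K) u) ∂(sphVol n)) := by
      rw [sph_integral_congr (g := fun u : Sph n => 1 * (1 * (supp L u * areaDens 1 K' u) +
        (-1) * supp L u) + (-(ε * ((n : ℝ) - 1)⁻¹)) * (supp L u * trL n (hess (supp K) u)))
        fun u => by ring,
        sph_integral_lin (contAdd (contConstMul 1 (contMul cL cA')) (contConstMul (-1) cL))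
        (contMul cL cT), sph_integral_lin (contMul cL cA') cL]
      ring
    have e3 : |∫ u : Sph n, supp L u * (areaDens 1 K' u - 1 -
          ((n : ℝ) - 1)⁻¹ * (ε * trL n (hess (supp K) u))) ∂(sphVol n)| ≤
        A * (C * M ^ 2 * ε ^ 2) * (sphVol n).real Set.univ := by
      refine abs_integral_sph_le fun u => ?_
      rw [abs_mul]
      exact mul_le_mul (hAb u) (hexp' u) (abs_nonneg _) hA
    rw [e2, hcomm, e1, abs_sub_comm] at e3
    rw [abs_sub_comm] at e3
    rw [← abs_neg]
    refine le_trans (le_of_eq ?_) (e3.trans (le_of_eq (by ring)))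
    congr 1
    ring
  have := (eq_zero_of_quadratic_bound (by positivity) key).2
  linarith

theorem integral_trL_comm [NeZero n] (hn : 2 ≤ n) {K L : ConvexBody (En n)}
    (hK : IsC2Hom (supp K)) (hL : IsC2Hom (supp L)) :
    ∫ u : Sph n, supp L u * trL n (hess (supp K) u) ∂(sphVol n) =
      ∫ u : Sph n, supp K u * trL n (hess (supp L) u) ∂(sphVol n) := by
  have h1 := integral_mul_trL hn hK hL
  have h2 := integral_mul_trL hn hL hK
  rw [integral_areaDens_one_comm hn hK hL] at h2
  have hn' : (n : ℝ) - 1 ≠ 0 := by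
    have : (2 : ℝ) ≤ n := by exact_mod_cast hn
    linarith
  exact mul_left_cancel₀ (inv_ne_zero hn') (h1.trans h2.symm)

theorem trL_hess_norm (u : Sph n) : trL n (hess (fun x : En n => ‖x‖) u) = (n : ℝ) - 1 := by
  rw [hess_norm_sph, trL_eq_sum _ (EuclideanSpace.basisFun (Fin n) ℝ)]
  have : ∀ j : Fin n, ⟪(1 - rankOne (u : En n) u) (EuclideanSpace.basisFun (Fin n) ℝ j),
      EuclideanSpace.basisFun (Fin n) ℝ j⟫_ℝ = 1 - (u : En n) j ^ 2 := by
    intro j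
    simp [inner_sub_left, inner_smul_left, EuclideanSpace.inner_single_right]
    ring
  rw [Finset.sum_congr rfl fun j _ => this j, Finset.sum_sub_distrib]
  have h1 : ∑ j, (u : En n) j ^ 2 = 1 := by
    have := EuclideanSpace.norm_sq_eq (u : En n)
    rw [norm_sph] at this
    simpa using this.symm
  rw [h1]
  simp

/-- Symmetry of the trace pairing for the deviation of a body from the unit ball. -/
theorem integral_trL_sub_norm_comm [NeZero n] (hn : 2 ≤ n) {K L : ConvexBody (En n)}
    (hK : IsC2Hom (supp K)) (hL : IsC2Hom (supp L)) :
    ∫ u : Sph n, supp L u * trL n (hess (fun x => supp K x - ‖x‖) u) ∂(sphVol n) =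
      ∫ u : Sph n, (supp K u - 1) * trL n (hess (supp L) u) ∂(sphVol n) := by
  have h1 := integral_trL_comm hn hK hL
  have h2 := integral_trL_comm hn isC2Hom_supp_ball hL
  rw [show supp (ballB n) = fun x => ‖x‖ from funext supp_ball] at h2
  have cL := continuous_supp_sph L
  have cK := continuous_supp_sph K
  have cTK := continuous_trL_hess hK
  have cTL := continuous_trL_hess hL
  have e1 : ∀ u : Sph n, supp L u * trL n (hess (fun x => supp K x - ‖x‖) u) =
      supp L u * trL n (hess (supp K) u) - supp L u * trL n (hess (fun x : En n => ‖x‖) u) := by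
    intro u
    rw [hK.hess_sub isC2Hom_norm (ne_zero_of_sph u), map_sub, mul_sub]
  have e2 : ∀ u : Sph n, (supp K u - 1) * trL n (hess (supp L) u) =
      supp K u * trL n (hess (supp L) u) - ‖(u : En n)‖ * trL n (hess (supp L) u) := by
    intro u
    rw [norm_sph]; ring
  simp only [e1, e2]
  rw [integral_sub (f := fun u : Sph n => supp L u * trL n (hess (supp K) u))
    (g := fun u : Sph n => supp L u * trL n (hess (fun x : En n => ‖x‖) u))
    (integrable_sph (cL.mul cTK))
    (integrable_sph (cL.mul (continuous_trL_hess isC2Hom_norm))),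
    integral_sub (f := fun u : Sph n => supp K u * trL n (hess (supp L) u))
    (g := fun u : Sph n => ‖(u : En n)‖ * trL n (hess (supp L) u)) (integrable_sph (cK.mul cTL))
    (integrable_sph (continuous_subtype_val.norm.mul cTL)), h1, h2]

/-! ### Invariance of the spherical measure and slicing -/

/-- The action of a linear isometry on the sphere. -/
def sphMap (ρ : En n ≃ₗᵢ[ℝ] En n) (u : Sph n) : Sph n :=
  ⟨ρ u, by rw [mem_sphere_zero_iff_norm, ρ.norm_map, norm_sph]⟩

theorem coe_sphMap (ρ : En n ≃ₗᵢ[ℝ] En n) (u : Sph n) : (sphMap ρ u : En n) = ρ u := rfl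

theorem continuous_sphMap (ρ : En n ≃ₗᵢ[ℝ] En n) : Continuous (sphMap ρ) :=
  (ρ.continuous.comp continuous_subtype_val).subtype_mk _

theorem measurePreserving_sphMap (ρ : En n ≃ₗᵢ[ℝ] En n) :
    MeasurePreserving (sphMap ρ) (sphVol n) (sphVol n) := by
  refine ⟨(continuous_sphMap ρ).measurable, ?_⟩
  ext s hs
  rw [Measure.map_apply (continuous_sphMap ρ).measurable hs, sphVol,
    Measure.toSphere_apply' _ hs,
    Measure.toSphere_apply' _ ((continuous_sphMap ρ).measurable hs)]
  congr 1
  have : Set.Ioo (0 : ℝ) 1 • ((↑) '' (sphMap ρ ⁻¹' s) : Set (En n)) =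
      ρ ⁻¹' (Set.Ioo (0 : ℝ) 1 • ((↑) '' s : Set (En n))) := by
    ext x
    simp only [Set.mem_smul, Set.mem_image, Set.mem_preimage]
    constructor
    · rintro ⟨r, hr, y, ⟨v, hv, rfl⟩, rfl⟩
      exact ⟨r, hr, ρ v, ⟨sphMap ρ v, hv, rfl⟩, by simp⟩
    · rintro ⟨r, hr, y, ⟨v, hv, rfl⟩, h⟩
      refine ⟨r, hr, ρ.symm v, ⟨sphMap ρ.symm v, ?_, rfl⟩, ?_⟩
      · have : sphMap ρ (sphMap ρ.symm v) = v := Subtype.ext (by simp [coe_sphMap])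
        rwa [this]
      · rw [← map_smul, h]; simp
  rw [this]
  exact ρ.measurePreserving.measure_preimage_emb ρ.toHomeomorph.measurableEmbedding _

theorem sph_integral_comp (ρ : En n ≃ₗᵢ[ℝ] En n) (f : En n → ℝ) :
    ∫ v : Sph n, f (ρ v) ∂(sphVol n) = ∫ v : Sph n, f v ∂(sphVol n) := by
  have hemb : MeasurableEmbedding (sphMap ρ) := by
    refine Topology.IsClosedEmbedding.measurableEmbedding ?_
    refine Topology.IsClosedEmbedding.of_continuous_injective_isClosedMap (continuous_sphMap ρ)
      (fun a b h => Subtype.ext (ρ.injective (congrArg Subtype.val h)))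
      (continuous_sphMap ρ).isClosedMap
  exact (measurePreserving_sphMap ρ).integral_comp hemb fun v : Sph n => f v

theorem exists_basis_pair {u e : En n} (hu : ‖u‖ = 1) (he : ‖e‖ = 1) (hue : ⟪u, e⟫_ℝ = 0)
    {i j : Fin n} (hij : i ≠ j) :
    ∃ b : OrthonormalBasis (Fin n) ℝ (En n), b i = u ∧ b j = e := by
  have hv : Orthonormal ℝ (({i, j} : Set (Fin n)).domRestrict
      fun k => if k = i then u else e) := by
    constructor
    · rintro ⟨k, hk⟩
      rcases hk with rfl | rfl
      · simpa using hu
      · simpa [hij.symm] using he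
    · rintro ⟨k, hk⟩ ⟨l, hl⟩ hkl
      rcases hk with rfl | rfl <;> rcases hl with rfl | rfl
      · exact absurd rfl hkl
      · simpa [hij.symm] using hue
      · simpa [hij.symm, real_inner_comm] using hue
      · exact absurd rfl hkl
  obtain ⟨b, hb⟩ := hv.exists_orthonormalBasis_extension_of_card_eq (by simp)
  refine ⟨b, ?_, ?_⟩
  · simpa using hb i (by simp)
  · simpa [hij.symm] using hb j (by simp)

theorem exists_isometry_pair (hn : 2 ≤ n) {u e u' e' : En n} (hu : ‖u‖ = 1) (he : ‖e‖ = 1)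
    (hue : ⟪u, e⟫_ℝ = 0) (hu' : ‖u'‖ = 1) (he' : ‖e'‖ = 1) (hue' : ⟪u', e'⟫_ℝ = 0) :
    ∃ ρ : En n ≃ₗᵢ[ℝ] En n, ρ u = u' ∧ ρ e = e' := by
  have hij : (⟨0, by omega⟩ : Fin n) ≠ ⟨1, by omega⟩ := by simp
  obtain ⟨b, hb0, hb1⟩ := exists_basis_pair hu he hue hij
  obtain ⟨c, hc0, hc1⟩ := exists_basis_pair hu' he' hue' hij
  refine ⟨b.equiv c (Equiv.refl _), ?_, ?_⟩
  · conv_lhs => rw [← hb0]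
    rw [OrthonormalBasis.equiv_apply_basis, Equiv.refl_apply, hc0]
  · conv_lhs => rw [← hb1]
    rw [OrthonormalBasis.equiv_apply_basis, Equiv.refl_apply, hc1]

theorem exists_unit_perp (hn : 2 ≤ n) (u : En n) : ∃ e : En n, ‖e‖ = 1 ∧ ⟪u, e⟫_ℝ = 0 := by
  have hlt : Module.finrank ℝ (ℝ ∙ u) < Module.finrank ℝ (En n) := by
    refine (finrank_span_le_card _).trans_lt ?_
    simp
    omega
  have hne : (ℝ ∙ u)ᗮ ≠ ⊥ := by
    intro h
    rw [Submodule.orthogonal_eq_bot_iff] at h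
    rw [h, finrank_top] at hlt
    exact lt_irrefl _ hlt
  obtain ⟨e, he, he0⟩ := Submodule.exists_mem_ne_zero_of_ne_bot hne
  refine ⟨‖e‖⁻¹ • e, ?_, ?_⟩
  · rw [norm_smul, norm_inv, norm_norm, inv_mul_cancel₀ (norm_ne_zero_iff.2 he0)]
  · rw [inner_smul_right, Submodule.mem_orthogonal_singleton_iff_inner_right.1 he, mul_zero]

/-- Decomposition of a unit vector along another one. -/
theorem exists_unit_decomp (hn : 2 ≤ n) {u w : En n} (hu : ‖u‖ = 1) (hw : ‖w‖ = 1) :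
    ∃ e : En n, ‖e‖ = 1 ∧ ⟪u, e⟫_ℝ = 0 ∧
      w = ⟪u, w⟫_ℝ • u + Real.sqrt (1 - ⟪u, w⟫_ℝ ^ 2) • e := by
  set t := ⟪u, w⟫_ℝ with ht
  have hnorm : ‖w - t • u‖ ^ 2 = 1 - t ^ 2 := by
    rw [norm_sub_sq_real, inner_smul_right, norm_smul, hw, hu, real_inner_comm, ← ht]
    simp
    ring
  have hs : Real.sqrt (1 - t ^ 2) = ‖w - t • u‖ := by
    rw [← hnorm, Real.sqrt_sq (norm_nonneg _)]
  by_cases h0 : w - t • u = 0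
  · obtain ⟨e, he, hue⟩ := exists_unit_perp hn u
    refine ⟨e, he, hue, ?_⟩
    rw [hs, h0, norm_zero, zero_smul, add_zero]
    exact sub_eq_zero.1 h0
  · refine ⟨‖w - t • u‖⁻¹ • (w - t • u), ?_, ?_, ?_⟩
    · rw [norm_smul, norm_inv, norm_norm, inv_mul_cancel₀ (norm_ne_zero_iff.2 h0)]
    · rw [inner_smul_right, inner_sub_right, inner_smul_right, real_inner_self_eq_norm_sq, hu, ← ht]
      simp
    · rw [hs, smul_smul, mul_inv_cancel₀ (norm_ne_zero_iff.2 h0), one_smul]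
      abel

theorem exists_isometry_single (hn : 2 ≤ n) {u u' : En n} (hu : ‖u‖ = 1) (hu' : ‖u'‖ = 1) :
    ∃ ρ : En n ≃ₗᵢ[ℝ] En n, ρ u = u' := by
  obtain ⟨e, he, hue⟩ := exists_unit_perp hn u
  obtain ⟨e', he', hue'⟩ := exists_unit_perp hn u'
  obtain ⟨ρ, h, -⟩ := exists_isometry_pair hn hu he hue hu' he' hue'
  exact ⟨ρ, h⟩

theorem sph_integral_pair (hn : 2 ≤ n) {u e u' e' : En n} (hu : ‖u‖ = 1) (he : ‖e‖ = 1)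
    (hue : ⟪u, e⟫_ℝ = 0) (hu' : ‖u'‖ = 1) (he' : ‖e'‖ = 1) (hue' : ⟪u', e'⟫_ℝ = 0)
    (F : ℝ → ℝ → ℝ) :
    ∫ v : Sph n, F ⟪u, (v : En n)⟫_ℝ ⟪e, (v : En n)⟫_ℝ ∂(sphVol n) =
      ∫ v : Sph n, F ⟪u', (v : En n)⟫_ℝ ⟪e', (v : En n)⟫_ℝ ∂(sphVol n) := by
  obtain ⟨ρ, h1, h2⟩ := exists_isometry_pair hn hu he hue hu' he' hue'
  rw [← sph_integral_comp ρ fun v => F ⟪u', v⟫_ℝ ⟪e', v⟫_ℝ]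
  refine sph_integral_congr fun v => ?_
  rw [← h1, ← h2, ρ.inner_map_map, ρ.inner_map_map]

theorem sph_integral_single (hn : 2 ≤ n) {u u' : En n} (hu : ‖u‖ = 1) (hu' : ‖u'‖ = 1)
    (F : ℝ → ℝ) :
    ∫ v : Sph n, F ⟪u, (v : En n)⟫_ℝ ∂(sphVol n) =
      ∫ v : Sph n, F ⟪u', (v : En n)⟫_ℝ ∂(sphVol n) := by
  obtain ⟨ρ, h1⟩ := exists_isometry_single hn hu hu'
  rw [← sph_integral_comp ρ fun v => F ⟪u', v⟫_ℝ]
  refine sph_integral_congr fun v => ?_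
  rw [← h1, ρ.inner_map_map]

theorem abs_inner_sph_le {u : En n} (hu : ‖u‖ = 1) (v : Sph n) : |⟪u, (v : En n)⟫_ℝ| ≤ 1 := by
  have := abs_real_inner_le_norm u (v : En n)
  rwa [hu, norm_sph, one_mul] at this

theorem continuous_inner_sph (u : En n) : Continuous fun v : Sph n => ⟪u, (v : En n)⟫_ℝ :=
  continuous_const.inner continuous_subtype_val

theorem contPow {X : Type*} [TopologicalSpace X] {f : X → ℝ} (hf : Continuous f) (k : ℕ) :
    Continuous fun x => f x ^ k := hf.pow k

theorem integral_mul_coord_sq (hn : 2 ≤ n) {u e : En n} (hu : ‖u‖ = 1) (he : ‖e‖ = 1)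
    (hue : ⟪u, e⟫_ℝ = 0) (p : ℕ) :
    ∫ v : Sph n, ⟪u, (v : En n)⟫_ℝ ^ (2 * p + 2) ∂(sphVol n) =
      (2 * p + 1) * ∫ v : Sph n, ⟪u, (v : En n)⟫_ℝ ^ (2 * p) * ⟪e, (v : En n)⟫_ℝ ^ 2 ∂(sphVol n) := by
  have ca := continuous_inner_sph u
  have cb := continuous_inner_sph e
  set M : ℕ → ℝ := fun k => ∫ v : Sph n, ⟪u, (v : En n)⟫_ℝ ^ (2 * p + 2 - k) *
    ⟪e, (v : En n)⟫_ℝ ^ k ∂(sphVol n) with hM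
  have h1 : ∀ s : ℝ, ∑ k ∈ Finset.range (2 * p + 3), s ^ k * (M k * ((2 * p + 2).choose k : ℝ)) =
      (1 + s ^ 2) ^ (p + 1) * M 0 := by
    intro s
    set r := Real.sqrt (1 + s ^ 2) with hr
    have hr2 : r ^ 2 = 1 + s ^ 2 := Real.sq_sqrt (by positivity)
    have hr0 : 0 < r := Real.sqrt_pos.2 (by positivity)
    have hus : ‖r⁻¹ • (u + s • e)‖ = 1 := by
      have : ‖u + s • e‖ ^ 2 = r ^ 2 := by
        rw [norm_add_sq_real, inner_smul_right, hue, norm_smul, hu, he, hr2]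
        simp
      have h : ‖u + s • e‖ = r := by
        rw [← Real.sqrt_sq (norm_nonneg (u + s • e)), this, Real.sqrt_sq hr0.le]
      rw [norm_smul, h, norm_inv, Real.norm_of_nonneg hr0.le, inv_mul_cancel₀ hr0.ne']
    have hrot := sph_integral_single hn hus hu fun t => t ^ (2 * p + 2)
    have hM0 : M 0 = ∫ v : Sph n, ⟪u, (v : En n)⟫_ℝ ^ (2 * p + 2) ∂(sphVol n) := by simp [hM]
    rw [hM0, ← hrot, ← hr2, ← pow_mul, ← integral_const_mul]
    have : ∀ v : Sph n, r ^ (2 * (p + 1)) * ⟪r⁻¹ • (u + s • e), (v : En n)⟫_ℝ ^ (2 * p + 2) =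
        ∑ k ∈ Finset.range (2 * p + 3), s ^ k * ((⟪u, (v : En n)⟫_ℝ ^ (2 * p + 2 - k) *
          ⟪e, (v : En n)⟫_ℝ ^ k) * ((2 * p + 2).choose k : ℝ)) := by
      intro v
      rw [inner_smul_left, inner_add_left, inner_smul_left, mul_pow, show 2 * (p + 1) = 2 * p + 2 by ring,
        ← mul_assoc, ← mul_pow]
      simp only [conj_trivial]
      rw [mul_inv_cancel₀ hr0.ne', one_pow, one_mul, add_comm, add_pow]
      refine Finset.sum_congr rfl fun k _ => ?_
      rw [mul_pow]; ring
    rw [sph_integral_congr this, integral_finsetSum]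
    · refine Finset.sum_congr rfl fun k _ => ?_
      rw [integral_const_mul, integral_mul_const]
    · intro k _
      exact integrable_sph (contConstMul _ (contMul (contMul (contPow ca _) (contPow cb _))
        continuous_const))
  have hpoly : (∑ k ∈ Finset.range (2 * p + 3),
      Polynomial.monomial k (M k * ((2 * p + 2).choose k : ℝ))) =
      (1 + Polynomial.X ^ 2) ^ (p + 1) * Polynomial.C (M 0) := by
    refine Polynomial.funext fun s => ?_
    have := h1 s
    simp only [Polynomial.eval_finsetSum, Polynomial.eval_monomial, Polynomial.eval_mul,
      Polynomial.eval_pow, Polynomial.eval_add, Polynomial.eval_one, Polynomial.eval_X,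
      Polynomial.eval_C]
    rw [← this]
    exact Finset.sum_congr rfl fun k _ => by ring
  have hc := congrArg (fun P => Polynomial.coeff P 2) hpoly
  simp only [Polynomial.finsetSum_coeff, Polynomial.coeff_monomial, Polynomial.coeff_mul_C] at hc
  have hc2 : ((1 + Polynomial.X ^ 2 : Polynomial ℝ) ^ (p + 1)).coeff 2 = p + 1 := by
    have : (1 + Polynomial.X ^ 2 : Polynomial ℝ) ^ (p + 1) =
        Polynomial.expand ℝ 2 ((1 + Polynomial.X) ^ (p + 1)) := by simp
    rw [this, show (2 : ℕ) = 1 * 2 by norm_num, Polynomial.coeff_expand_mul (by norm_num),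
      Polynomial.coeff_one_add_X_pow]
    simp
  rw [hc2, Finset.sum_ite_eq' _ 2, if_pos (by simp)] at hc
  have hch : ((2 * p + 2).choose 2 : ℝ) = (p + 1) * (2 * p + 1) := by
    rw [Nat.cast_choose_two]
    push_cast
    ring
  rw [hch] at hc
  have hM0 : M 0 = ∫ v : Sph n, ⟪u, (v : En n)⟫_ℝ ^ (2 * p + 2) ∂(sphVol n) := by simp [hM]
  have hM2 : M 2 = ∫ v : Sph n, ⟪u, (v : En n)⟫_ℝ ^ (2 * p) * ⟪e, (v : En n)⟫_ℝ ^ 2 ∂(sphVol n) := by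
    simp [hM]
  rw [← hM0, ← hM2]
  have hp : (p : ℝ) + 1 ≠ 0 := by positivity
  refine mul_left_cancel₀ hp ?_
  linarith

theorem sph_moment_succ (hn : 2 ≤ n) {u : En n} (hu : ‖u‖ = 1) (p : ℕ) :
    (2 * p + n) * ∫ v : Sph n, ⟪u, (v : En n)⟫_ℝ ^ (2 * p + 2) ∂(sphVol n) =
      (2 * p + 1) * ∫ v : Sph n, ⟪u, (v : En n)⟫_ℝ ^ (2 * p) ∂(sphVol n) := by
  obtain ⟨e, he, hue⟩ := exists_unit_perp hn u
  have hij : (⟨0, by omega⟩ : Fin n) ≠ ⟨1, by omega⟩ := by simp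
  obtain ⟨b, hb0, -⟩ := exists_basis_pair hu he hue hij
  have ca := continuous_inner_sph u
  set A := ∫ v : Sph n, ⟪u, (v : En n)⟫_ℝ ^ (2 * p + 2) ∂(sphVol n) with hA
  have hsum : ∀ v : Sph n, ⟪u, (v : En n)⟫_ℝ ^ (2 * p) =
      ∑ k, ⟪u, (v : En n)⟫_ℝ ^ (2 * p) * ⟪b k, (v : En n)⟫_ℝ ^ 2 := by
    intro v
    rw [← Finset.mul_sum, b.sum_sq_inner_right, norm_sph]
    simp
  rw [sph_integral_congr hsum, integral_finsetSum _ fun k _ =>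
    integrable_sph (contMul (contPow ca _) (contPow (continuous_inner_sph (b k)) _)),
    ← Finset.add_sum_erase _ _ (Finset.mem_univ (⟨0, by omega⟩ : Fin n)), hb0]
  have h0 : ∫ v : Sph n, ⟪u, (v : En n)⟫_ℝ ^ (2 * p) * ⟪u, (v : En n)⟫_ℝ ^ 2 ∂(sphVol n) = A :=
    sph_integral_congr fun v => by ring
  have hk : ∀ k ∈ Finset.univ.erase (⟨0, by omega⟩ : Fin n),
      ∫ v : Sph n, ⟪u, (v : En n)⟫_ℝ ^ (2 * p) * ⟪b k, (v : En n)⟫_ℝ ^ 2 ∂(sphVol n) =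
        A / (2 * p + 1) := by
    intro k hk
    have hk' : (⟨0, by omega⟩ : Fin n) ≠ k := (Finset.ne_of_mem_erase hk).symm
    rw [eq_div_iff (by positivity), mul_comm, hA]
    refine (integral_mul_coord_sq hn hu (b.norm_eq_one k) ?_ p).symm
    rw [← hb0, b.inner_eq_ite, if_neg hk']
  rw [h0, Finset.sum_congr rfl hk, Finset.sum_const, Finset.card_erase_of_mem (Finset.mem_univ _),
    Finset.card_univ, Fintype.card_fin, nsmul_eq_mul, Nat.cast_sub (by omega)]
  have : (2 * (p : ℝ) + 1) ≠ 0 := by positivity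
  field_simp
  push_cast
  ring

/-- The weighted integral of a profile over a quarter meridian. -/
def merid (n : ℕ) (f : ℝ → ℝ) : ℝ :=
  ∫ θ in (0 : ℝ)..(Real.pi / 2), f (Real.cos θ) * Real.sin θ ^ (n - 2)

theorem merid_intervalIntegrable {f : ℝ → ℝ} (hf : Continuous f) (k : ℕ) (a b : ℝ) :
    IntervalIntegrable (fun θ => f (Real.cos θ) * Real.sin θ ^ k) volume a b :=
  ((hf.comp Real.continuous_cos).mul (Real.continuous_sin.pow k)).intervalIntegrable a b

theorem merid_lin {f g : ℝ → ℝ} (hf : Continuous f) (hg : Continuous g) (a b : ℝ) :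
    merid n (fun t => a * f t + b * g t) = a * merid n f + b * merid n g := by
  unfold merid
  rw [← intervalIntegral.integral_const_mul, ← intervalIntegral.integral_const_mul,
    ← intervalIntegral.integral_add ((merid_intervalIntegrable hf _ _ _).const_mul a)
      ((merid_intervalIntegrable hg _ _ _).const_mul b)]
  refine intervalIntegral.integral_congr fun θ _ => ?_
  simp only
  ring

theorem merid_moment_succ (hn : 2 ≤ n) (p : ℕ) :
    (2 * p + n) * merid n (fun t => t ^ (2 * p + 2)) = (2 * p + 1) * merid n (fun t => t ^ (2 * p)) := by
  have hderiv : ∀ θ : ℝ, HasDerivAt (fun θ => Real.cos θ ^ (2 * p + 1) * Real.sin θ ^ (n - 1))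
      ((2 * p + n) * (Real.cos θ ^ (2 * p + 2) * Real.sin θ ^ (n - 2)) +
        (-(2 * p + 1 : ℝ)) * (Real.cos θ ^ (2 * p) * Real.sin θ ^ (n - 2))) θ := by
    intro θ
    refine (((Real.hasDerivAt_cos θ).pow (2 * p + 1)).mul
      ((Real.hasDerivAt_sin θ).pow (n - 1))).congr_deriv ?_
    obtain ⟨m, rfl⟩ : ∃ m, n = m + 2 := ⟨n - 2, by omega⟩
    have hs : Real.sin θ * Real.sin θ = 1 - Real.cos θ ^ 2 := by
      rw [← sq, Real.sin_sq]
    simp only [Nat.add_sub_cancel, show m + 2 - 1 = m + 1 by omega, Pi.pow_apply]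
    push_cast
    have e : Real.sin θ ^ (m + 1) * Real.sin θ = Real.sin θ ^ m * (1 - Real.cos θ ^ 2) := by
      rw [pow_succ, mul_assoc, hs]
    have e' : (2 * (p : ℝ) + 1) * Real.cos θ ^ (2 * p) * -Real.sin θ * Real.sin θ ^ (m + 1) =
        -((2 * (p : ℝ) + 1) * Real.cos θ ^ (2 * p)) * (Real.sin θ ^ m * (1 - Real.cos θ ^ 2)) := by
      rw [← e]; ring
    rw [e']
    ring
  have h := intervalIntegral.integral_eq_sub_of_hasDerivAt (a := 0) (b := Real.pi / 2)
    (fun θ _ => hderiv θ) (by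
      refine Continuous.intervalIntegrable ?_ _ _
      fun_prop)
  have h2 := merid_lin (n := n) (f := fun t => t ^ (2 * p + 2)) (g := fun t => t ^ (2 * p))
    (by fun_prop) (by fun_prop) (2 * p + n) (-(2 * p + 1))
  have h3 : merid n (fun t => (2 * p + n) * t ^ (2 * p + 2) + (-(2 * p + 1 : ℝ)) * t ^ (2 * p)) =
      ∫ θ in (0 : ℝ)..(Real.pi / 2), ((2 * p + n) * (Real.cos θ ^ (2 * p + 2) * Real.sin θ ^ (n - 2)) +
        (-(2 * p + 1 : ℝ)) * (Real.cos θ ^ (2 * p) * Real.sin θ ^ (n - 2))) := by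
    unfold merid
    refine intervalIntegral.integral_congr fun θ _ => ?_
    simp only
    ring
  rw [h2, h] at h3
  simp [show n - 1 ≠ 0 by omega] at h3
  linarith

theorem merid_one_pos (hn : 2 ≤ n) : 0 < merid n (fun _ => 1) := by
  unfold merid
  refine intervalIntegral.intervalIntegral_pos_of_pos_on
    (merid_intervalIntegrable continuous_const _ _ _) (fun θ hθ => ?_) (by positivity)
  rw [one_mul]
  exact pow_pos (Real.sin_pos_of_pos_of_lt_pi hθ.1 (by linarith [hθ.2, Real.pi_pos])) _

theorem abs_merid_le {f : ℝ → ℝ} {C : ℝ} (hf : ∀ t, 0 ≤ t → t ≤ 1 → |f t| ≤ C) :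
    |merid n f| ≤ C * (Real.pi / 2) := by
  unfold merid
  have := intervalIntegral.norm_integral_le_of_norm_le_const (a := 0) (b := Real.pi / 2) (C := C)
    (f := fun θ => f (Real.cos θ) * Real.sin θ ^ (n - 2)) fun θ hθ => by
      rw [Set.uIoc_of_le (by positivity)] at hθ
      rw [norm_mul, norm_pow]
      have h1 : |f (Real.cos θ)| ≤ C :=
        hf _ (Real.cos_nonneg_of_mem_Icc ⟨by linarith [hθ.1, Real.pi_pos], hθ.2⟩) (Real.cos_le_one θ)
      have h2 : ‖Real.sin θ‖ ^ (n - 2) ≤ 1 := pow_le_one₀ (norm_nonneg _) (Real.abs_sin_le_one θ)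
      calc _ ≤ C * 1 := mul_le_mul h1 h2 (by positivity) ((abs_nonneg _).trans h1)
        _ = C := mul_one C
  rwa [sub_zero, abs_of_pos (by positivity : 0 < Real.pi / 2)] at this

/-- The normalizing constant in the slicing formula. -/
def sliceC (n : ℕ) : ℝ := (sphVol n).real Set.univ / merid n (fun _ => 1)

theorem sphVol_univ_pos [NeZero n] : 0 < (sphVol n).real Set.univ := by
  rw [sphVol, Measure.toSphere_real_apply_univ]
  refine mul_pos ?_ ?_
  · simpa using NeZero.pos n
  · exact ENNReal.toReal_pos (measure_ball_pos _ _ one_pos).ne' measure_ball_lt_top.ne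

theorem sliceC_pos [NeZero n] (hn : 2 ≤ n) : 0 < sliceC n := div_pos sphVol_univ_pos (merid_one_pos hn)

theorem sph_moment (hn : 2 ≤ n) {u : En n} (hu : ‖u‖ = 1) (p : ℕ) :
    ∫ v : Sph n, ⟪u, (v : En n)⟫_ℝ ^ (2 * p) ∂(sphVol n) = sliceC n * merid n fun t => t ^ (2 * p) := by
  induction p with
  | zero =>
    have := (merid_one_pos hn).ne'
    simp [sliceC, this]
  | succ p ih =>
    have h1 := sph_moment_succ hn hu p
    have h2 := merid_moment_succ hn p
    have h0 : (2 * (p : ℝ) + n) ≠ 0 := by positivity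
    refine mul_left_cancel₀ h0 ?_
    rw [show 2 * (p + 1) = 2 * p + 2 by ring, h1, ih]
    linear_combination (-(sliceC n)) * h2

theorem sph_slice_poly (hn : 2 ≤ n) {u : En n} (hu : ‖u‖ = 1) (P : Polynomial ℝ) :
    ∫ v : Sph n, P.eval (⟪u, (v : En n)⟫_ℝ ^ 2) ∂(sphVol n) =
      sliceC n * merid n fun t => P.eval (t ^ 2) := by
  induction P using Polynomial.induction_on' with
  | add P Q hP hQ =>
    have h1 := sph_integral_lin (P.continuous.comp (contPow (continuous_inner_sph u) 2))
      (Q.continuous.comp (contPow (continuous_inner_sph u) 2)) 1 1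
    have cP : Continuous fun t : ℝ => P.eval (t ^ 2) := P.continuous.comp (continuous_pow 2)
    have cQ : Continuous fun t : ℝ => Q.eval (t ^ 2) := Q.continuous.comp (continuous_pow 2)
    have h2 := merid_lin (n := n) cP cQ 1 1
    simp only [Function.comp, one_mul] at h1 h2
    simp only [Polynomial.eval_add]
    rw [h1, h2, hP, hQ]
    ring
  | monomial k a =>
    have h1 := sph_moment hn hu k
    have h2 := merid_lin (n := n) (f := fun t => t ^ (2 * k)) (g := fun _ => 0)
      (by fun_prop) continuous_const a 0
    simp only [zero_mul, add_zero] at h2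
    simp only [Polynomial.eval_monomial, ← pow_mul]
    rw [integral_const_mul, h1, h2]
    ring

theorem even_eq_abs {f : ℝ → ℝ} (he : ∀ t, f (-t) = f t) (t : ℝ) : f |t| = f t := by
  rcases abs_choice t with h | h <;> rw [h]
  exact he t

/-- Even continuous profiles are uniformly approximated on `[-1,1]` by even polynomials. -/
theorem exists_even_poly_near {f : ℝ → ℝ} (hf : Continuous f) (he : ∀ t, f (-t) = f t) {ε : ℝ}
    (hε : 0 < ε) : ∃ P : Polynomial ℝ, ∀ t, |t| ≤ 1 → |P.eval (t ^ 2) - f t| < ε := by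
  obtain ⟨P, hP⟩ := exists_polynomial_near_of_continuousOn 0 1 (fun s => f (Real.sqrt s))
    (hf.comp Real.continuous_sqrt).continuousOn ε hε
  refine ⟨P, fun t ht => ?_⟩
  have := hP (t ^ 2) ⟨sq_nonneg _, (sq_le_one_iff_abs_le_one _).2 ht⟩
  rwa [Real.sqrt_sq_eq_abs, even_eq_abs he] at this

/-- The slicing formula for even zonal functions. -/
theorem sph_slice [NeZero n] (hn : 2 ≤ n) {u : En n} (hu : ‖u‖ = 1) {f : ℝ → ℝ} (hf : Continuous f)
    (he : ∀ t, f (-t) = f t) :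
    ∫ v : Sph n, f ⟪u, (v : En n)⟫_ℝ ∂(sphVol n) = sliceC n * merid n f := by
  rw [← sub_eq_zero, ← abs_nonpos_iff]
  refine le_of_forall_pos_le_add fun ε hε => ?_
  set D := (sphVol n).real Set.univ + sliceC n * (Real.pi / 2) with hD
  have hDpos : 0 < D := add_pos sphVol_univ_pos (mul_pos (sliceC_pos hn) (by positivity))
  obtain ⟨P, hP⟩ := exists_even_poly_near hf he (div_pos hε hDpos)
  have cP : Continuous fun t : ℝ => P.eval (t ^ 2) := P.continuous.comp (continuous_pow 2)
  have h1 := sph_integral_lin (n := n) (hf.comp (continuous_inner_sph u))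
    (cP.comp (continuous_inner_sph u)) 1 (-1)
  have h2 := merid_lin (n := n) hf cP 1 (-1)
  simp only [Function.comp] at h1
  have b1 : |∫ v : Sph n, (1 * f ⟪u, (v : En n)⟫_ℝ + -1 * P.eval (⟪u, (v : En n)⟫_ℝ ^ 2)) ∂(sphVol n)|
      ≤ ε / D * (sphVol n).real Set.univ := abs_integral_sph_le fun v => by
    have := hP _ (abs_inner_sph_le hu v)
    rw [abs_sub_comm] at this
    refine le_trans (le_of_eq ?_) this.le
    congr 1; ring
  have b2 : |merid n fun t => 1 * f t + -1 * P.eval (t ^ 2)| ≤ ε / D * (Real.pi / 2) :=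
    abs_merid_le fun t h0 h1 => by
      have := hP t (by rwa [abs_of_nonneg h0])
      rw [abs_sub_comm] at this
      refine le_trans (le_of_eq ?_) this.le
      congr 1; ring
  rw [h1, sph_slice_poly hn hu] at b1
  rw [h2] at b2
  have b3 : |sliceC n * (1 * merid n f + -1 * merid n fun t => P.eval (t ^ 2))| ≤
      sliceC n * (ε / D * (Real.pi / 2)) := by
    rw [abs_mul, abs_of_pos (sliceC_pos hn)]
    exact mul_le_mul_of_nonneg_left b2 (sliceC_pos hn).le
  have : ε / D * (sphVol n).real Set.univ + sliceC n * (ε / D * (Real.pi / 2)) = ε := by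
    rw [show sliceC n * (ε / D * (Real.pi / 2)) = ε / D * (sliceC n * (Real.pi / 2)) by ring,
      ← mul_add, ← hD, div_mul_cancel₀ _ hDpos.ne']
  rw [zero_add, ← this]
  refine le_trans (le_of_eq ?_) ((abs_sub _ _).trans (add_le_add b1 b3))
  congr 1
  ring

/-- First derivative of the even profile `t ↦ P (t ^ 2)`. -/
def evD1 (P : Polynomial ℝ) (t : ℝ) : ℝ := 2 * t * P.derivative.eval (t ^ 2)

/-- Second derivative of the even profile `t ↦ P (t ^ 2)`. -/
def evD2 (P : Polynomial ℝ) (t : ℝ) : ℝ :=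
  2 * P.derivative.eval (t ^ 2) + 4 * t ^ 2 * P.derivative.derivative.eval (t ^ 2)

/-- Third derivative of the even profile `t ↦ P (t ^ 2)`. -/
def evD3 (P : Polynomial ℝ) (t : ℝ) : ℝ :=
  12 * t * P.derivative.derivative.eval (t ^ 2) +
    8 * t ^ 3 * P.derivative.derivative.derivative.eval (t ^ 2)

theorem hasDerivAt_eval_sq (P : Polynomial ℝ) (t : ℝ) :
    HasDerivAt (fun t => P.eval (t ^ 2)) (evD1 P t) t := by
  refine ((P.hasDerivAt (t ^ 2)).comp t (hasDerivAt_pow 2 t)).congr_deriv ?_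
  simp [evD1]
  ring

theorem hasDerivAt_evD1 (P : Polynomial ℝ) (t : ℝ) : HasDerivAt (evD1 P) (evD2 P t) t := by
  refine (((hasDerivAt_id t).const_mul 2).mul (hasDerivAt_eval_sq P.derivative t)).congr_deriv ?_
  simp [evD1, evD2]
  ring

theorem hasDerivAt_evD2 (P : Polynomial ℝ) (t : ℝ) : HasDerivAt (evD2 P) (evD3 P t) t := by
  refine (((hasDerivAt_eval_sq P.derivative t).const_mul 2).add
    (((hasDerivAt_pow 2 t).const_mul 4).mul
      (hasDerivAt_eval_sq P.derivative.derivative t))).congr_deriv ?_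
  simp [evD1, evD3]
  ring

theorem continuous_eval_sq (P : Polynomial ℝ) : Continuous fun t : ℝ => P.eval (t ^ 2) :=
  continuous_iff_continuousAt.2 fun t => (hasDerivAt_eval_sq P t).continuousAt

/-- The spherical Laplacian acting on even zonal polynomials, in the variable `X = t ^ 2`. -/
def zonalLap (n : ℕ) (P : Polynomial ℝ) : Polynomial ℝ :=
  (1 - Polynomial.X) * (2 * P.derivative + 4 * (Polynomial.X * P.derivative.derivative)) -
    Polynomial.C (2 * ((n : ℝ) - 1)) * (Polynomial.X * P.derivative)

theorem eval_zonalLap (P : Polynomial ℝ) (t : ℝ) :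
    (zonalLap n P).eval (t ^ 2) = (1 - t ^ 2) * evD2 P t - ((n : ℝ) - 1) * t * evD1 P t := by
  simp [zonalLap, evD1, evD2]
  ring

theorem coeff_zonalLap (P : Polynomial ℝ) (j : ℕ) :
    (zonalLap n P).coeff j = 2 * (j + 1) * (2 * j + 1) * P.coeff (j + 1) -
      2 * j * (2 * j + n - 2) * P.coeff j := by
  have e : zonalLap n P = Polynomial.C 2 * P.derivative - Polynomial.C 2 * (Polynomial.X * P.derivative)
      + Polynomial.C 4 * (Polynomial.X * P.derivative.derivative)
      - Polynomial.C 4 * (Polynomial.X * (Polynomial.X * P.derivative.derivative)) -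
    Polynomial.C (2 * ((n : ℝ) - 1)) * (Polynomial.X * P.derivative) := by
    rw [zonalLap, show (2 : Polynomial ℝ) = Polynomial.C 2 from rfl,
      show (4 : Polynomial ℝ) = Polynomial.C 4 from rfl]
    ring
  rw [e]
  simp only [Polynomial.coeff_sub, Polynomial.coeff_add, Polynomial.coeff_C_mul]
  rcases j with _ | _ | j
  · simp [Polynomial.coeff_derivative]
  · simp [Polynomial.coeff_derivative, Polynomial.coeff_X_mul]
    ring
  · simp only [Polynomial.coeff_derivative, Polynomial.coeff_X_mul]
    push_cast
    ring

/-- The coefficients of the even Legendre polynomial of degree `2 * m` in dimension `n`. -/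
def legCoeff (n m : ℕ) : ℕ → ℝ
  | 0 => 1
  | j + 1 => legCoeff n m j * (2 * j * (2 * j + n - 2) - 2 * m * (2 * m + n - 2)) /
      (2 * (j + 1) * (2 * j + 1))

/-- The even Legendre polynomial of degree `2 * m`, in the variable `X = t ^ 2`. -/
def legQ (n m : ℕ) : Polynomial ℝ :=
  ∑ j ∈ Finset.range (m + 1), Polynomial.monomial j (legCoeff n m j)

/-- The eigenvalue attached to `legQ n m`. -/
def legMu (n m : ℕ) : ℝ := 2 * m * (2 * m + n - 2)

theorem legCoeff_eq_zero (m j : ℕ) : legCoeff n m (m + 1 + j) = 0 := by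
  induction j with
  | zero => simp [legCoeff]
  | succ j ih => rw [← add_assoc, legCoeff, ih]; simp

theorem coeff_legQ (m j : ℕ) : (legQ n m).coeff j = legCoeff n m j := by
  simp only [legQ, Polynomial.finsetSum_coeff, Polynomial.coeff_monomial]
  rw [Finset.sum_ite_eq']
  split_ifs with h
  · rfl
  · rw [Finset.mem_range, not_lt] at h
    obtain ⟨k, rfl⟩ := Nat.exists_eq_add_of_le h
    exact (legCoeff_eq_zero m k).symm

theorem legCoeff_ne_zero (hn : 3 ≤ n) {m j : ℕ} (hj : j ≤ m) : legCoeff n m j ≠ 0 := by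
  have hn' : (3 : ℝ) ≤ n := by exact_mod_cast hn
  induction j with
  | zero => simp [legCoeff]
  | succ j ih =>
    rw [legCoeff]
    refine div_ne_zero (mul_ne_zero (ih (by omega)) (ne_of_lt ?_)) (by positivity)
    have h : (j : ℝ) + 1 ≤ m := by exact_mod_cast hj
    have : (0 : ℝ) ≤ j := Nat.cast_nonneg _
    nlinarith

theorem zonalLap_legQ (m : ℕ) : zonalLap n (legQ n m) = Polynomial.C (-legMu n m) * legQ n m := by
  ext j
  rw [coeff_zonalLap, Polynomial.coeff_C_mul, coeff_legQ, coeff_legQ, legCoeff, legMu]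
  have : (2 * ((j : ℝ) + 1) * (2 * j + 1)) ≠ 0 := by positivity
  field_simp
  ring

theorem natDegree_legQ (hn : 3 ≤ n) (m : ℕ) : (legQ n m).natDegree = m := by
  refine le_antisymm (Polynomial.natDegree_le_iff_coeff_eq_zero.2 fun j hj => ?_)
    (Polynomial.le_natDegree_of_ne_zero ?_)
  · rw [coeff_legQ]
    obtain ⟨k, rfl⟩ := Nat.exists_eq_add_of_lt hj
    have := legCoeff_eq_zero (n := n) m k
    rwa [show m + k + 1 = m + 1 + k by ring]
  · rw [coeff_legQ]
    exact legCoeff_ne_zero hn le_rfl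

theorem legMu_strictMono (hn : 3 ≤ n) : StrictMono (legMu n) := by
  have hn' : (3 : ℝ) ≤ n := by exact_mod_cast hn
  refine strictMono_nat_of_lt_succ fun m => ?_
  rw [legMu, legMu]
  push_cast
  have : (0 : ℝ) ≤ m := Nat.cast_nonneg _
  nlinarith

theorem legMu_ge (hn : 3 ≤ n) {m : ℕ} (hm : 1 ≤ m) : 2 * n ≤ legMu n m := by
  have := (legMu_strictMono hn).monotone hm
  refine le_trans (le_of_eq ?_) this
  simp [legMu]

theorem legQ_ode (m : ℕ) (t : ℝ) :
    (1 - t ^ 2) * evD2 (legQ n m) t - ((n : ℝ) - 1) * t * evD1 (legQ n m) t +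
      legMu n m * (legQ n m).eval (t ^ 2) = 0 := by
  rw [← eval_zonalLap, zonalLap_legQ]
  simp

theorem legQ_ode_deriv (m : ℕ) (t : ℝ) :
    (1 - t ^ 2) * evD3 (legQ n m) t - ((n : ℝ) + 1) * t * evD2 (legQ n m) t +
      (legMu n m - n + 1) * evD1 (legQ n m) t = 0 := by
  have h := ((((hasDerivAt_pow 2 t).const_sub 1).mul (hasDerivAt_evD2 (legQ n m) t)).sub
    (((hasDerivAt_id t).const_mul ((n : ℝ) - 1)).mul (hasDerivAt_evD1 (legQ n m) t))).add
    ((hasDerivAt_eval_sq (legQ n m) t).const_mul (legMu n m))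
  have h0 := h.unique ((hasDerivAt_const t (0 : ℝ)).congr_of_eventuallyEq
    (Eventually.of_forall fun s => by simpa using legQ_ode m s))
  simp at h0
  linear_combination h0

theorem merid_zonalLap_symm (hn : 2 ≤ n) (P Q : Polynomial ℝ) :
    merid n (fun t => (zonalLap n P).eval (t ^ 2) * Q.eval (t ^ 2)) =
      merid n (fun t => P.eval (t ^ 2) * (zonalLap n Q).eval (t ^ 2)) := by
  obtain ⟨k, rfl⟩ : ∃ k, n = k + 2 := ⟨n - 2, by omega⟩
  have hc : ∀ (f f' : ℝ → ℝ), (∀ t, HasDerivAt f (f' t) t) → ∀ θ,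
      HasDerivAt (fun θ => f (Real.cos θ)) (f' (Real.cos θ) * -Real.sin θ) θ :=
    fun f f' h θ => (h _).comp θ (Real.hasDerivAt_cos θ)
  have hd : ∀ θ : ℝ, HasDerivAt (fun θ => Real.sin θ ^ (k + 1) *
      (P.eval (Real.cos θ ^ 2) * evD1 Q (Real.cos θ) - Q.eval (Real.cos θ ^ 2) * evD1 P (Real.cos θ)))
      ((zonalLap (k + 2) P).eval (Real.cos θ ^ 2) * Q.eval (Real.cos θ ^ 2) * Real.sin θ ^ k -
        P.eval (Real.cos θ ^ 2) * (zonalLap (k + 2) Q).eval (Real.cos θ ^ 2) * Real.sin θ ^ k) θ := by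
    intro θ
    refine (((Real.hasDerivAt_sin θ).pow (k + 1)).mul
      (((hc _ _ (hasDerivAt_eval_sq P) θ).mul (hc _ _ (hasDerivAt_evD1 Q) θ)).sub
      ((hc _ _ (hasDerivAt_eval_sq Q) θ).mul (hc _ _ (hasDerivAt_evD1 P) θ)))).congr_deriv ?_
    have hs : Real.sin θ ^ 2 = 1 - Real.cos θ ^ 2 := Real.sin_sq θ
    rw [eval_zonalLap, eval_zonalLap, ← hs]
    simp
    ring
  have h := intervalIntegral.integral_eq_sub_of_hasDerivAt (a := 0) (b := Real.pi / 2)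
    (fun θ _ => hd θ) (by
      refine IntervalIntegrable.sub
        (merid_intervalIntegrable (f := fun t => (zonalLap (k + 2) P).eval (t ^ 2) * Q.eval (t ^ 2)) ?_ k _ _)
        (merid_intervalIntegrable (f := fun t => P.eval (t ^ 2) * (zonalLap (k + 2) Q).eval (t ^ 2)) ?_ k _ _)
      · exact contMul (continuous_eval_sq _) (continuous_eval_sq _)
      · exact contMul (continuous_eval_sq _) (continuous_eval_sq _))
  rw [intervalIntegral.integral_sub
    (merid_intervalIntegrable (f := fun t => (zonalLap (k + 2) P).eval (t ^ 2) * Q.eval (t ^ 2))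
      (contMul (continuous_eval_sq _) (continuous_eval_sq _)) k _ _)
    (merid_intervalIntegrable (f := fun t => P.eval (t ^ 2) * (zonalLap (k + 2) Q).eval (t ^ 2))
      (contMul (continuous_eval_sq _) (continuous_eval_sq _)) k _ _)] at h
  rw [← sub_eq_zero]
  simp only [merid, Nat.add_sub_cancel]
  rw [h]
  simp [evD1]

/-- Orthogonality of the even Legendre polynomials. -/
theorem merid_legQ_orthogonal (hn : 3 ≤ n) {l m : ℕ} (hlm : l ≠ m) :
    merid n (fun t => (legQ n l).eval (t ^ 2) * (legQ n m).eval (t ^ 2)) = 0 := by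
  have h := merid_zonalLap_symm (by omega : 2 ≤ n) (legQ n l) (legQ n m)
  have c := contMul (continuous_eval_sq (legQ n l)) (continuous_eval_sq (legQ n m))
  have h1 := merid_lin (n := n) c (continuous_const (y := (0 : ℝ))) (-legMu n l) 0
  have h2 := merid_lin (n := n) c (continuous_const (y := (0 : ℝ))) (-legMu n m) 0
  simp only [zonalLap_legQ, Polynomial.eval_mul, Polynomial.eval_C] at h
  have e1 : (fun t : ℝ => -legMu n l * (legQ n l).eval (t ^ 2) * (legQ n m).eval (t ^ 2)) =
      fun t => -legMu n l * ((legQ n l).eval (t ^ 2) * (legQ n m).eval (t ^ 2)) + 0 * 0 := by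
    ext t; ring
  have e2 : (fun t : ℝ => (legQ n l).eval (t ^ 2) * (-legMu n m * (legQ n m).eval (t ^ 2))) =
      fun t => -legMu n m * ((legQ n l).eval (t ^ 2) * (legQ n m).eval (t ^ 2)) + 0 * 0 := by
    ext t; ring
  rw [e1, e2, h1, h2] at h
  have hne : legMu n l ≠ legMu n m := (legMu_strictMono hn).injective.ne hlm
  have : (legMu n l - legMu n m) *
      merid n (fun t => (legQ n l).eval (t ^ 2) * (legQ n m).eval (t ^ 2)) = 0 := by
    linear_combination -h
  exact (mul_eq_zero.1 this).resolve_left (sub_ne_zero.2 hne)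

/-- Every polynomial of degree at most `k` is a combination of `legQ n 0, …, legQ n k`. -/
theorem exists_legQ_expansion (hn : 3 ≤ n) (k : ℕ) (P : Polynomial ℝ) (hP : P.natDegree ≤ k) :
    ∃ c : ℕ → ℝ, P = ∑ m ∈ Finset.range (k + 1), Polynomial.C (c m) * legQ n m := by
  induction k generalizing P with
  | zero =>
    refine ⟨fun _ => P.coeff 0, ?_⟩
    rw [Polynomial.eq_C_of_natDegree_le_zero hP]
    simp [legQ, legCoeff]
  | succ k ih =>
    set a := P.coeff (k + 1) / legCoeff n (k + 1) (k + 1) with ha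
    have hne := legCoeff_ne_zero hn (le_refl (k + 1))
    obtain ⟨c, hc⟩ := ih (P - Polynomial.C a * legQ n (k + 1)) (by
      refine Polynomial.natDegree_le_iff_coeff_eq_zero.2 fun j hj => ?_
      rw [Polynomial.coeff_sub, Polynomial.coeff_C_mul, coeff_legQ]
      rcases Nat.lt_or_ge (k + 1) j with h | h
      · rw [Polynomial.coeff_eq_zero_of_natDegree_lt (lt_of_le_of_lt hP h),
          ← coeff_legQ, Polynomial.coeff_eq_zero_of_natDegree_lt (by rwa [natDegree_legQ hn])]
        simp
      · obtain rfl : j = k + 1 := by omega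
        rw [ha, div_mul_cancel₀ _ hne, sub_self])
    refine ⟨fun m => if m = k + 1 then a else c m, ?_⟩
    rw [Finset.sum_range_succ]
    dsimp only
    rw [if_pos rfl, ← sub_eq_iff_eq_add, hc]
    refine Finset.sum_congr rfl fun m hm => ?_
    rw [if_neg (by have := Finset.mem_range.1 hm; omega)]

theorem le_of_hasDerivAt_nonneg {f f' : ℝ → ℝ} {a b : ℝ} (hab : a ≤ b)
    (h : ∀ x ∈ Set.Icc a b, HasDerivAt f (f' x) x) (h0 : ∀ x ∈ Set.Icc a b, 0 ≤ f' x) : f a ≤ f b := by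
  refine monotoneOn_of_deriv_nonneg (convex_Icc a b)
    (fun x hx => (h x hx).continuousAt.continuousWithinAt)
    (fun x hx => (h x (interior_subset hx)).differentiableAt.differentiableWithinAt)
    (fun x hx => ?_) (Set.left_mem_Icc.2 hab) (Set.right_mem_Icc.2 hab) hab
  rw [(h x (interior_subset hx)).deriv]
  exact h0 x (interior_subset hx)

/-- A solution of the even Legendre equation together with its derivatives. -/
structure LegSol (n : ℕ) (μ : ℝ) (f f1 f2 f3 : ℝ → ℝ) : Prop where
  d0 : ∀ t, HasDerivAt f (f1 t) t
  d1 : ∀ t, HasDerivAt f1 (f2 t) t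
  d2 : ∀ t, HasDerivAt f2 (f3 t) t
  ode : ∀ t, (1 - t ^ 2) * f2 t - ((n : ℝ) - 1) * t * f1 t + μ * f t = 0
  ode' : ∀ t, (1 - t ^ 2) * f3 t - ((n : ℝ) + 1) * t * f2 t + (μ - n + 1) * f1 t = 0
  zero : f1 0 = 0
  mu : 2 * n ≤ μ

theorem legSol_legQ (hn : 3 ≤ n) {m : ℕ} (hm : 1 ≤ m) :
    LegSol n (legMu n m) (fun t => (legQ n m).eval (t ^ 2)) (evD1 (legQ n m)) (evD2 (legQ n m))
      (evD3 (legQ n m)) :=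
  ⟨hasDerivAt_eval_sq _, hasDerivAt_evD1 _, hasDerivAt_evD2 _, legQ_ode m, legQ_ode_deriv m,
    by simp [evD1], legMu_ge hn hm⟩

namespace LegSol

variable {μ : ℝ} {f f1 f2 f3 : ℝ → ℝ}

theorem const_mul (h : LegSol n μ f f1 f2 f3) (c : ℝ) :
    LegSol n μ (fun t => c * f t) (fun t => c * f1 t) (fun t => c * f2 t) (fun t => c * f3 t) where
  d0 t := (h.d0 t).const_mul c
  d1 t := (h.d1 t).const_mul c
  d2 t := (h.d2 t).const_mul c
  ode t := by linear_combination c * h.ode t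
  ode' t := by linear_combination c * h.ode' t
  zero := by rw [h.zero, mul_zero]
  mu := h.mu

theorem cont (h : LegSol n μ f f1 f2 f3) : Continuous f :=
  continuous_iff_continuousAt.2 fun t => (h.d0 t).continuousAt

theorem cont1 (h : LegSol n μ f f1 f2 f3) : Continuous f1 :=
  continuous_iff_continuousAt.2 fun t => (h.d1 t).continuousAt

theorem sonin (h : LegSol n μ f f1 f2 f3) (hn : 3 ≤ n) {s t : ℝ} (hs : 0 ≤ s) (hst : s ≤ t) :
    f s ^ 2 + (1 - s ^ 2) * f1 s ^ 2 / μ ≤ f t ^ 2 + (1 - t ^ 2) * f1 t ^ 2 / μ := by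
  have hn' : (3 : ℝ) ≤ n := by exact_mod_cast hn
  have hμ : 0 < μ := by have := h.mu; linarith
  refine le_of_hasDerivAt_nonneg (f := fun t => f t ^ 2 + (1 - t ^ 2) * f1 t ^ 2 / μ)
    (f' := fun t => 2 * (n - 2) * t * f1 t ^ 2 / μ) hst (fun x _ => ?_) (fun x hx => ?_)
  · refine (((h.d0 x).pow 2).add
      ((((hasDerivAt_pow 2 x).const_sub 1).mul ((h.d1 x).pow 2)).div_const μ)).congr_deriv ?_
    have := h.ode x
    simp
    field_simp
    linear_combination f1 x * this
  · have : 0 ≤ x := hs.trans hx.1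
    have : (0 : ℝ) ≤ n - 2 := by linarith
    positivity

theorem sonin' (h : LegSol n μ f f1 f2 f3) (hn : 3 ≤ n) {s t : ℝ} (hs : 0 ≤ s) (hst : s ≤ t) :
    f1 s ^ 2 + (1 - s ^ 2) * f2 s ^ 2 / (μ - n + 1) ≤
      f1 t ^ 2 + (1 - t ^ 2) * f2 t ^ 2 / (μ - n + 1) := by
  have hn' : (3 : ℝ) ≤ n := by exact_mod_cast hn
  have hμ : 0 < μ - n + 1 := by have := h.mu; linarith
  refine le_of_hasDerivAt_nonneg (f := fun t => f1 t ^ 2 + (1 - t ^ 2) * f2 t ^ 2 / (μ - n + 1))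
    (f' := fun t => 2 * n * t * f2 t ^ 2 / (μ - n + 1)) hst (fun x _ => ?_) (fun x hx => ?_)
  · refine (((h.d1 x).pow 2).add
      ((((hasDerivAt_pow 2 x).const_sub 1).mul ((h.d2 x).pow 2)).div_const (μ - n + 1))).congr_deriv ?_
    have := h.ode' x
    simp
    field_simp
    linear_combination f2 x * this
  · have : 0 ≤ x := hs.trans hx.1
    positivity

theorem sq_le_one (h : LegSol n μ f f1 f2 f3) (hn : 3 ≤ n) {s : ℝ} (hs : 0 ≤ s) (hs1 : s ≤ 1) :
    f s ^ 2 ≤ f 1 ^ 2 := by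
  have hn' : (3 : ℝ) ≤ n := by exact_mod_cast hn
  have hμ : 0 < μ := by have := h.mu; linarith
  have h1 := h.sonin hn hs hs1
  have h2 : 0 ≤ (1 - s ^ 2) * f1 s ^ 2 / μ :=
    div_nonneg (mul_nonneg (by nlinarith) (sq_nonneg _)) hμ.le
  simp at h1
  linarith

theorem deriv_sq_le_one (h : LegSol n μ f f1 f2 f3) (hn : 3 ≤ n) {s : ℝ} (hs : 0 ≤ s) (hs1 : s ≤ 1) :
    f1 s ^ 2 ≤ f1 1 ^ 2 := by
  have hn' : (3 : ℝ) ≤ n := by exact_mod_cast hn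
  have hμ : 0 < μ - n + 1 := by have := h.mu; linarith
  have h1 := h.sonin' hn hs hs1
  have h2 : 0 ≤ (1 - s ^ 2) * f2 s ^ 2 / (μ - n + 1) :=
    div_nonneg (mul_nonneg (by nlinarith) (sq_nonneg _)) hμ.le
  simp at h1
  linarith

theorem deriv_one (h : LegSol n μ f f1 f2 f3) : ((n : ℝ) - 1) * f1 1 = μ * f 1 := by
  have := h.ode 1
  linarith

/-- The last critical point in `[0,1]` of a normalized solution. -/
theorem exists_last_critical (h : LegSol n μ f f1 f2 f3) (hn : 3 ≤ n) (h1 : f 1 = 1) :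
    ∃ m, 0 ≤ m ∧ m < 1 ∧ f1 m = 0 ∧ ∀ t, m ≤ t → t ≤ 1 → 0 ≤ f1 t := by
  have hn' : (3 : ℝ) ≤ n := by exact_mod_cast hn
  have hf1 : 0 < f1 1 := by
    have h2 := h.deriv_one
    have := h.mu
    rw [h1] at h2
    by_contra hc
    push Not at hc
    nlinarith
  set S : Set ℝ := {t ∈ Set.Icc (0 : ℝ) 1 | f1 t = 0} with hS
  have hcl : IsCompact S := by
    have : S = Set.Icc (0 : ℝ) 1 ∩ f1 ⁻¹' {0} := rfl
    rw [this]
    exact isCompact_Icc.inter_right (isClosed_singleton.preimage h.cont1)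
  have hne : S.Nonempty := ⟨0, ⟨le_rfl, zero_le_one⟩, h.zero⟩
  obtain ⟨⟨hm0, hm1⟩, hm⟩ := hcl.sSup_mem hne
  refine ⟨sSup S, hm0, lt_of_le_of_ne hm1 fun e => ?_, hm, fun t ht ht1 => ?_⟩
  · rw [e] at hm
    exact hf1.ne' hm
  · by_contra hc
    push Not at hc
    obtain ⟨s, hs, hs0⟩ := intermediate_value_Icc ht1 h.cont1.continuousOn
      (show (0 : ℝ) ∈ Set.Icc (f1 t) (f1 1) from ⟨hc.le, hf1.le⟩)
    have : s ≤ sSup S := le_csSup hcl.bddAbove ⟨⟨hm0.trans (ht.trans hs.1), hs.2⟩, hs0⟩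
    have e : s = t := le_antisymm (this.trans ht) hs.1
    rw [← e, hs0] at hc
    exact lt_irrefl _ hc

theorem deriv2_nonneg (h : LegSol n μ f f1 f2 f3) (hn : 3 ≤ n) {m : ℝ} (hm0 : 0 ≤ m)
    (hpos : ∀ t, m ≤ t → t ≤ 1 → 0 ≤ f1 t) {t : ℝ} (hmt : m ≤ t) (ht1 : t < 1) : 0 ≤ f2 t := by
  have hn' : (3 : ℝ) ≤ n := by exact_mod_cast hn
  have hμ : 0 < μ - n + 1 := by have := h.mu; linarith
  have ht0 : 0 ≤ t := hm0.trans hmt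
  have hθ0 : 0 < Real.arccos t := Real.arccos_pos.2 ht1
  have hθ1 : Real.arccos t ≤ Real.pi := Real.arccos_le_pi t
  have key := le_of_hasDerivAt_nonneg (a := 0) (b := Real.arccos t)
    (f := fun θ => Real.sin θ ^ (n + 1) * f2 (Real.cos θ))
    (f' := fun θ => Real.sin θ ^ n * ((μ - n + 1) * f1 (Real.cos θ))) hθ0.le (fun θ _ => by
      refine (((Real.hasDerivAt_sin θ).pow (n + 1)).mul
        ((h.d2 (Real.cos θ)).comp θ (Real.hasDerivAt_cos θ))).congr_deriv ?_
      have e := h.ode' (Real.cos θ)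
      have hs : Real.sin θ ^ 2 = 1 - Real.cos θ ^ 2 := Real.sin_sq θ
      rw [← hs] at e
      simp
      linear_combination (-Real.sin θ ^ n) * e) (fun θ hθ => by
      have hs : 0 ≤ Real.sin θ := Real.sin_nonneg_of_mem_Icc ⟨hθ.1, hθ.2.trans hθ1⟩
      have hc : t ≤ Real.cos θ := by
        rw [← Real.cos_arccos (by linarith) ht1.le]
        exact Real.cos_le_cos_of_nonneg_of_le_pi hθ.1 hθ1 hθ.2
      exact mul_nonneg (pow_nonneg hs _)
        (mul_nonneg hμ.le (hpos _ (hmt.trans hc) (Real.cos_le_one _))))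
  have hsin : 0 < Real.sin (Real.arccos t) := Real.sin_pos_of_pos_of_lt_pi hθ0
    (lt_of_le_of_ne hθ1 fun e => by
      have := Real.cos_arccos (by linarith : -1 ≤ t) ht1.le
      rw [e, Real.cos_pi] at this
      linarith)
  rw [Real.cos_arccos (by linarith) ht1.le] at key
  simp at key
  exact nonneg_of_mul_nonneg_right key (pow_pos hsin _)

theorem integral_sin_le (h : LegSol n μ f f1 f2 f3) (hn : 3 ≤ n) (h1 : f 1 = 1) :
    ((n : ℝ) - 1) * ∫ θ in (0 : ℝ)..(Real.pi / 2), f (Real.cos θ) * Real.sin θ ^ (n - 3) ≤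
      ∫ θ in (0 : ℝ)..(Real.pi / 2), Real.sin θ ^ (n - 3) := by
  have hn' : (3 : ℝ) ≤ n := by exact_mod_cast hn
  have hμ : 0 < μ := by have := h.mu; linarith
  have hc2 : Continuous fun θ : ℝ => Real.cos θ * f1 (Real.cos θ) * Real.sin θ ^ (n - 3) := by
    have := h.cont1
    fun_prop
  have hc1 : Continuous fun θ : ℝ => f (Real.cos θ) * Real.sin θ ^ (n - 3) := by
    have := h.cont
    fun_prop
  have hc0 : Continuous fun θ : ℝ => Real.sin θ ^ (n - 3) := by fun_prop
  have hd : ∀ θ : ℝ, HasDerivAt (fun θ => f1 (Real.cos θ) * Real.sin θ ^ (n - 2))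
      (μ * (f (Real.cos θ) * Real.sin θ ^ (n - 3)) -
        Real.cos θ * f1 (Real.cos θ) * Real.sin θ ^ (n - 3)) θ := by
    intro θ
    refine (((h.d1 (Real.cos θ)).comp θ (Real.hasDerivAt_cos θ)).mul
      ((Real.hasDerivAt_sin θ).pow (n - 2))).congr_deriv ?_
    obtain ⟨k, rfl⟩ : ∃ k, n = k + 3 := ⟨n - 3, by omega⟩
    have e := h.ode (Real.cos θ)
    have hs : Real.sin θ ^ 2 = 1 - Real.cos θ ^ 2 := Real.sin_sq θ
    rw [← hs] at e
    simp only [show k + 3 - 2 = k + 1 by omega, show k + 3 - 3 = k by omega, Nat.add_sub_cancel,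
      Function.comp]
    push_cast at e ⊢
    simp
    linear_combination (-Real.sin θ ^ k) * e
  have hI := intervalIntegral.integral_eq_sub_of_hasDerivAt (a := 0) (b := Real.pi / 2)
    (fun θ _ => hd θ) (((contConstMul μ hc1).sub hc2).intervalIntegrable _ _)
  rw [intervalIntegral.integral_sub ((contConstMul μ hc1).intervalIntegrable _ _)
    (hc2.intervalIntegrable _ _), intervalIntegral.integral_const_mul] at hI
  simp [h.zero, show n - 2 ≠ 0 by omega] at hI
  have hle : ∫ θ in (0 : ℝ)..(Real.pi / 2), Real.cos θ * f1 (Real.cos θ) * Real.sin θ ^ (n - 3) ≤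
      ∫ θ in (0 : ℝ)..(Real.pi / 2), (μ / (n - 1)) * Real.sin θ ^ (n - 3) := by
    refine intervalIntegral.integral_mono_on (by positivity) (hc2.intervalIntegrable _ _)
      ((contConstMul _ hc0).intervalIntegrable _ _) fun θ hθ => ?_
    have hs : 0 ≤ Real.sin θ := Real.sin_nonneg_of_mem_Icc ⟨hθ.1, by linarith [hθ.2, Real.pi_pos]⟩
    have hc : 0 ≤ Real.cos θ := Real.cos_nonneg_of_mem_Icc ⟨by linarith [hθ.1, Real.pi_pos], hθ.2⟩
    have hc1 := Real.cos_le_one θ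
    refine mul_le_mul_of_nonneg_right ?_ (pow_nonneg hs _)
    have e1 : f1 1 = μ / (n - 1) := by
      have := h.deriv_one
      rw [h1] at this
      rw [eq_div_iff (by linarith)]
      linarith
    have hf1 : 0 ≤ f1 1 := by rw [e1]; exact div_nonneg hμ.le (by linarith)
    rw [← e1]
    have := abs_le_of_sq_le_sq (h.deriv_sq_le_one hn hc hc1) hf1
    nlinarith [(le_abs_self _).trans this]
  rw [intervalIntegral.integral_const_mul] at hle
  have hn1 : (0 : ℝ) < n - 1 := by linarith
  have : μ * (∫ θ in (0 : ℝ)..(Real.pi / 2), f (Real.cos θ) * Real.sin θ ^ (n - 3)) ≤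
      μ * ((∫ θ in (0 : ℝ)..(Real.pi / 2), Real.sin θ ^ (n - 3)) / (n - 1)) := by
    calc _ = _ := sub_eq_zero.1 hI
      _ ≤ _ := hle
      _ = _ := by ring
  have := le_of_mul_le_mul_left this hμ
  rw [le_div_iff₀ hn1] at this
  linarith

end LegSol

/-- The tail integral along a quarter meridian. -/
def tailInt (n : ℕ) (e : ℝ → ℝ) (θ : ℝ) : ℝ :=
  ∫ α in θ..(Real.pi / 2), e (Real.cos α) * Real.sin α ^ (n - 3)

theorem hasDerivAt_tailInt {e : ℝ → ℝ} (he : Continuous e) (θ : ℝ) :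
    HasDerivAt (tailInt n e) (-(e (Real.cos θ) * Real.sin θ ^ (n - 3))) θ := by
  have c : Continuous fun α : ℝ => e (Real.cos α) * Real.sin α ^ (n - 3) := by fun_prop
  exact intervalIntegral.integral_hasDerivAt_left (c.intervalIntegrable _ _)
    c.aestronglyMeasurable.stronglyMeasurableAtFilter c.continuousAt

theorem tailInt_half_pi (e : ℝ → ℝ) : tailInt n e (Real.pi / 2) = 0 := intervalIntegral.integral_same

theorem continuous_tailInt {e : ℝ → ℝ} (he : Continuous e) : Continuous (tailInt n e) :=
  continuous_iff_continuousAt.2 fun θ => (hasDerivAt_tailInt he θ).continuousAt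

theorem tailInt_nonneg {e : ℝ → ℝ} {θ : ℝ} (h0 : 0 ≤ θ) (h1 : θ ≤ Real.pi / 2)
    (hpos : ∀ α, θ ≤ α → α ≤ Real.pi / 2 → 0 ≤ e (Real.cos α)) : 0 ≤ tailInt n e θ :=
  intervalIntegral.integral_nonneg h1 fun α hα => mul_nonneg (hpos α hα.1 hα.2)
    (pow_nonneg (Real.sin_nonneg_of_mem_Icc ⟨h0.trans hα.1, by linarith [hα.2, Real.pi_pos]⟩) _)

theorem meridian_integral_nonneg (hn : 3 ≤ n) {e w q : ℝ → ℝ} (he : Continuous e)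
    (hw : ∀ θ, HasDerivAt w (q θ * Real.cos θ) θ) (hw0 : w 0 = 0) (hqc : Continuous q)
    (hq : ∀ θ, 0 ≤ θ → θ ≤ Real.pi / 2 → 0 ≤ q θ)
    (hX : ∀ θ, 0 ≤ θ → θ ≤ Real.pi / 2 →
      0 ≤ ((n : ℝ) - 2) * Real.cos θ * tailInt n e θ + e (Real.cos θ) * Real.sin θ ^ (n - 2)) :
    0 ≤ ∫ θ in (0 : ℝ)..(Real.pi / 2),
      (((n : ℝ) - 2) * w θ * Real.sin θ ^ (n - 3) + q θ * Real.sin θ ^ (n - 2)) * e (Real.cos θ) := by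
  have hwc : Continuous w := continuous_iff_continuousAt.2 fun θ => (hw θ).continuousAt
  have cΨ := continuous_tailInt (n := n) he
  have c1 : Continuous fun θ => q θ * Real.cos θ * tailInt n e θ := by fun_prop
  have c2 : Continuous fun θ => w θ * (e (Real.cos θ) * Real.sin θ ^ (n - 3)) := by fun_prop
  have c3 : Continuous fun θ => q θ * (e (Real.cos θ) * Real.sin θ ^ (n - 2)) := by fun_prop
  have hd : ∀ θ : ℝ, HasDerivAt (fun θ => w θ * tailInt n e θ)
      (q θ * Real.cos θ * tailInt n e θ - w θ * (e (Real.cos θ) * Real.sin θ ^ (n - 3))) θ :=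
    fun θ => ((hw θ).mul (hasDerivAt_tailInt he θ)).congr_deriv (by ring)
  have hI := intervalIntegral.integral_eq_sub_of_hasDerivAt (a := 0) (b := Real.pi / 2)
    (fun θ _ => hd θ) ((c1.sub c2).intervalIntegrable _ _)
  rw [intervalIntegral.integral_sub (c1.intervalIntegrable _ _) (c2.intervalIntegrable _ _),
    tailInt_half_pi, hw0, mul_zero, zero_mul, sub_zero, sub_eq_zero] at hI
  have e1 : (∫ θ in (0 : ℝ)..(Real.pi / 2),
      (((n : ℝ) - 2) * w θ * Real.sin θ ^ (n - 3) + q θ * Real.sin θ ^ (n - 2)) * e (Real.cos θ)) =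
      ∫ θ in (0 : ℝ)..(Real.pi / 2), q θ *
        (((n : ℝ) - 2) * Real.cos θ * tailInt n e θ + e (Real.cos θ) * Real.sin θ ^ (n - 2)) := by
    have a1 : (∫ θ in (0 : ℝ)..(Real.pi / 2),
        (((n : ℝ) - 2) * w θ * Real.sin θ ^ (n - 3) + q θ * Real.sin θ ^ (n - 2)) * e (Real.cos θ)) =
        ∫ θ in (0 : ℝ)..(Real.pi / 2), (((n : ℝ) - 2) * (w θ * (e (Real.cos θ) * Real.sin θ ^ (n - 3))) +
          q θ * (e (Real.cos θ) * Real.sin θ ^ (n - 2))) :=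
      intervalIntegral.integral_congr fun θ _ => by ring
    have a2 : (∫ θ in (0 : ℝ)..(Real.pi / 2), q θ *
        (((n : ℝ) - 2) * Real.cos θ * tailInt n e θ + e (Real.cos θ) * Real.sin θ ^ (n - 2))) =
        ∫ θ in (0 : ℝ)..(Real.pi / 2), (((n : ℝ) - 2) * (q θ * Real.cos θ * tailInt n e θ) +
          q θ * (e (Real.cos θ) * Real.sin θ ^ (n - 2))) :=
      intervalIntegral.integral_congr fun θ _ => by ring
    rw [a1, a2, intervalIntegral.integral_add ((contConstMul _ c2).intervalIntegrable _ _)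
      (c3.intervalIntegrable _ _), intervalIntegral.integral_add
      ((contConstMul _ c1).intervalIntegrable _ _) (c3.intervalIntegrable _ _),
      intervalIntegral.integral_const_mul, intervalIntegral.integral_const_mul, hI]
  rw [e1]
  exact intervalIntegral.integral_nonneg (by positivity) fun θ hθ =>
    mul_nonneg (hq θ hθ.1 hθ.2) (hX θ hθ.1 hθ.2)

namespace LegSol

variable {μ : ℝ} {f f1 f2 f3 : ℝ → ℝ}

theorem weight_nonneg_neg (h : LegSol n μ f f1 f2 f3) (hn : 3 ≤ n)
    (hlow : ∀ t, 0 ≤ t → t ≤ 1 → -1 ≤ ((n : ℝ) - 1) * f t) {θ : ℝ} (h0 : 0 ≤ θ)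
    (hθ : θ ≤ Real.pi / 2) :
    0 ≤ ((n : ℝ) - 2) * Real.cos θ * tailInt n (fun t => 1 + ((n : ℝ) - 1) * f t) θ +
      (1 + ((n : ℝ) - 1) * f (Real.cos θ)) * Real.sin θ ^ (n - 2) := by
  have hn' : (3 : ℝ) ≤ n := by exact_mod_cast hn
  have hc : ∀ α, θ ≤ α → α ≤ Real.pi / 2 → 0 ≤ Real.cos α := fun α h1 h2 =>
    Real.cos_nonneg_of_mem_Icc ⟨by linarith [Real.pi_pos], h2⟩
  have he : ∀ α, θ ≤ α → α ≤ Real.pi / 2 → 0 ≤ 1 + ((n : ℝ) - 1) * f (Real.cos α) :=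
    fun α h1 h2 => by linarith [hlow _ (hc α h1 h2) (Real.cos_le_one α)]
  exact add_nonneg (mul_nonneg (mul_nonneg (by linarith) (hc θ le_rfl hθ)) (tailInt_nonneg h0 hθ he))
    (mul_nonneg (he θ le_rfl hθ)
      (pow_nonneg (Real.sin_nonneg_of_mem_Icc ⟨h0, by linarith [Real.pi_pos]⟩) _))

theorem weight_nonneg_pos (h : LegSol n μ f f1 f2 f3) (hn : 3 ≤ n) (h1 : f 1 = 1)
    (hlow : ∀ t, 0 ≤ t → t ≤ 1 → -1 ≤ ((n : ℝ) - 1) * f t) {θ : ℝ} (h0 : 0 ≤ θ)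
    (hθ : θ ≤ Real.pi / 2) :
    0 ≤ ((n : ℝ) - 2) * Real.cos θ * tailInt n (fun t => 1 - ((n : ℝ) - 1) * f t) θ +
      (1 - ((n : ℝ) - 1) * f (Real.cos θ)) * Real.sin θ ^ (n - 2) := by
  have hn' : (3 : ℝ) ≤ n := by exact_mod_cast hn
  have hμ : 0 < μ := by have := h.mu; linarith
  obtain ⟨m, hm0, hm1, hm, hpos⟩ := h.exists_last_critical hn h1
  have hfm : f m ≤ 0 := by
    have e := h.ode m
    rw [hm] at e
    have := h.deriv2_nonneg hn hm0 hpos le_rfl hm1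
    have h2 : 0 ≤ (1 - m ^ 2) * f2 m := mul_nonneg (by nlinarith) this
    by_contra hc
    push Not at hc
    have := mul_pos hμ hc
    linarith
  have hsmall : ∀ t, 0 ≤ t → t ≤ m → 0 ≤ 1 - ((n : ℝ) - 1) * f t := fun t ht htm => by
    have hs := h.sonin hn ht htm
    rw [hm] at hs
    have h2 : 0 ≤ (1 - t ^ 2) * f1 t ^ 2 / μ :=
      div_nonneg (mul_nonneg (by nlinarith) (sq_nonneg _)) hμ.le
    have h3 : f t ^ 2 ≤ (-f m) ^ 2 := by
      simp at hs
      rw [neg_sq]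
      linarith
    have h4 := (le_abs_self _).trans (abs_le_of_sq_le_sq h3 (by linarith))
    have h5 := hlow m hm0 hm1.le
    nlinarith
  have hc : ∀ α, 0 ≤ α → α ≤ Real.pi / 2 → 0 ≤ Real.cos α := fun α h1 h2 =>
    Real.cos_nonneg_of_mem_Icc ⟨by linarith [Real.pi_pos], h2⟩
  have hsin : ∀ α, 0 ≤ α → α ≤ Real.pi / 2 → 0 ≤ Real.sin α := fun α h1 h2 =>
    Real.sin_nonneg_of_mem_Icc ⟨h1, by linarith [Real.pi_pos]⟩
  rcases le_or_gt (Real.cos θ) m with hcm | hcm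
  · refine add_nonneg (mul_nonneg (mul_nonneg (by linarith) (hc θ h0 hθ)) (tailInt_nonneg h0 hθ
      fun α h1 h2 => hsmall _ (hc α (h0.trans h1) h2) ((Real.cos_le_cos_of_nonneg_of_le_pi h0
        (by linarith [Real.pi_pos]) h1).trans hcm))) (mul_nonneg (hsmall _ (hc θ h0 hθ) hcm)
        (pow_nonneg (hsin θ h0 hθ) _))
  · have hlarge : ∀ α ∈ Set.Icc (0 : ℝ) θ, m < Real.cos α := fun α hα =>
      hcm.trans_le (Real.cos_le_cos_of_nonneg_of_le_pi hα.1 (by linarith [Real.pi_pos]) hα.2)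
    have hdd : ∀ t, m ≤ t → t ≤ 1 → 0 ≤ 1 + ((n : ℝ) - 1) * (t * f1 t - f t) := by
      intro t htm ht1
      rcases ht1.lt_or_eq with ht1 | rfl
      · have := le_of_hasDerivAt_nonneg (f := fun t => 1 + ((n : ℝ) - 1) * (t * f1 t - f t))
          (f' := fun t => ((n : ℝ) - 1) * (t * f2 t)) htm (fun x _ =>
            ((((hasDerivAt_id x).mul (h.d1 x)).sub (h.d0 x)).const_mul ((n : ℝ) - 1)
              |>.const_add 1).congr_deriv (by simp)) (fun x hx =>
              mul_nonneg (by linarith) (mul_nonneg (hm0.trans hx.1)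
                (h.deriv2_nonneg hn hm0 hpos hx.1 (hx.2.trans_lt ht1))))
        simp only [hm] at this
        nlinarith
      · have h2 := h.deriv_one
        have h3 := h.mu
        rw [h1] at h2 ⊢
        nlinarith
    have hcont : Continuous fun t => 1 - ((n : ℝ) - 1) * f t := by
      have := h.cont
      fun_prop
    have hE := le_of_hasDerivAt_nonneg (a := 0) (b := θ)
      (f := fun α => ((n : ℝ) - 2) * tailInt n (fun t => 1 - ((n : ℝ) - 1) * f t) α +
        (1 - ((n : ℝ) - 1) * f (Real.cos α)) * Real.sin α ^ (n - 2) / Real.cos α)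
      (f' := fun α => Real.sin α ^ (n - 1) / Real.cos α ^ 2 *
        (1 + ((n : ℝ) - 1) * (Real.cos α * f1 (Real.cos α) - f (Real.cos α)))) h0 (fun α hα => by
          have hne : Real.cos α ≠ 0 := (hm0.trans_lt (hlarge α hα)).ne'
          refine (((hasDerivAt_tailInt (n := n) hcont α).const_mul ((n : ℝ) - 2)).add
            (((((((h.d0 (Real.cos α)).comp α (Real.hasDerivAt_cos α)).const_mul
              ((n : ℝ) - 1)).const_sub 1).mul ((Real.hasDerivAt_sin α).pow (n - 2))).div
              (Real.hasDerivAt_cos α) hne))).congr_deriv ?_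
          obtain ⟨k, rfl⟩ : ∃ k, n = k + 3 := ⟨n - 3, by omega⟩
          have hs : Real.sin α ^ 2 = 1 - Real.cos α ^ 2 := Real.sin_sq α
          simp only [show k + 3 - 2 = k + 1 by omega, show k + 3 - 3 = k by omega,
            show k + 3 - 1 = k + 2 by omega, Nat.add_sub_cancel, Function.comp]
          push_cast
          simp
          field_simp
          ring) (fun α hα =>
          mul_nonneg (div_nonneg (pow_nonneg (hsin α hα.1 (hα.2.trans hθ)) _) (sq_nonneg _))
            (hdd _ (hlarge α hα).le (Real.cos_le_one α)))
    have hΨ0 : 0 ≤ tailInt n (fun t => 1 - ((n : ℝ) - 1) * f t) 0 := by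
      have c0 : Continuous fun θ : ℝ => Real.sin θ ^ (n - 3) := by fun_prop
      have c1 : Continuous fun θ : ℝ => f (Real.cos θ) * Real.sin θ ^ (n - 3) := by
        have := h.cont
        fun_prop
      have e : tailInt n (fun t => 1 - ((n : ℝ) - 1) * f t) 0 =
          ∫ θ in (0 : ℝ)..(Real.pi / 2), (Real.sin θ ^ (n - 3) -
            ((n : ℝ) - 1) * (f (Real.cos θ) * Real.sin θ ^ (n - 3))) :=
        intervalIntegral.integral_congr fun θ _ => by simp only; ring
      rw [e, intervalIntegral.integral_sub (c0.intervalIntegrable _ _)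
        ((contConstMul _ c1).intervalIntegrable _ _), intervalIntegral.integral_const_mul]
      linarith [h.integral_sin_le hn h1]
    simp only [Real.sin_zero, zero_pow (show n - 2 ≠ 0 by omega), mul_zero, zero_div, add_zero] at hE
    have hE0 := (mul_nonneg (by linarith : (0 : ℝ) ≤ n - 2) hΨ0).trans hE
    have hcpos : 0 < Real.cos θ := hm0.trans_lt hcm
    have := mul_nonneg hE0 hcpos.le
    refine this.trans (le_of_eq ?_)
    field_simp

/-- The meridian form of the spectral gap. -/
theorem meridian_gap (h : LegSol n μ f f1 f2 f3) (hn : 3 ≤ n) (h1 : f 1 = 1)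
    (hlow : ∀ t, 0 ≤ t → t ≤ 1 → -1 ≤ ((n : ℝ) - 1) * f t) {w q : ℝ → ℝ}
    (hw : ∀ θ, HasDerivAt w (q θ * Real.cos θ) θ) (hw0 : w 0 = 0) (hqc : Continuous q)
    (hq : ∀ θ, 0 ≤ θ → θ ≤ Real.pi / 2 → 0 ≤ q θ) :
    ((n : ℝ) - 1) * |∫ θ in (0 : ℝ)..(Real.pi / 2),
      (((n : ℝ) - 2) * w θ * Real.sin θ ^ (n - 3) + q θ * Real.sin θ ^ (n - 2)) * f (Real.cos θ)| ≤
      ∫ θ in (0 : ℝ)..(Real.pi / 2),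
        (((n : ℝ) - 2) * w θ * Real.sin θ ^ (n - 3) + q θ * Real.sin θ ^ (n - 2)) := by
  have hn' : (3 : ℝ) ≤ n := by exact_mod_cast hn
  have hwc : Continuous w := continuous_iff_continuousAt.2 fun θ => (hw θ).continuousAt
  have hfc := h.cont
  have c0 : Continuous fun θ => ((n : ℝ) - 2) * w θ * Real.sin θ ^ (n - 3) +
      q θ * Real.sin θ ^ (n - 2) := by fun_prop
  have c1 : Continuous fun θ => (((n : ℝ) - 2) * w θ * Real.sin θ ^ (n - 3) +
      q θ * Real.sin θ ^ (n - 2)) * f (Real.cos θ) := by fun_prop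
  have k1 := meridian_integral_nonneg hn (e := fun t => 1 + ((n : ℝ) - 1) * f t) (by fun_prop) hw hw0
    hqc hq fun θ => h.weight_nonneg_neg hn hlow
  have k2 := meridian_integral_nonneg hn (e := fun t => 1 - ((n : ℝ) - 1) * f t) (by fun_prop) hw hw0
    hqc hq fun θ => h.weight_nonneg_pos hn h1 hlow
  have e1 : (∫ θ in (0 : ℝ)..(Real.pi / 2), (((n : ℝ) - 2) * w θ * Real.sin θ ^ (n - 3) +
      q θ * Real.sin θ ^ (n - 2)) * (1 + ((n : ℝ) - 1) * f (Real.cos θ))) =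
      ∫ θ in (0 : ℝ)..(Real.pi / 2), ((((n : ℝ) - 2) * w θ * Real.sin θ ^ (n - 3) +
      q θ * Real.sin θ ^ (n - 2)) + ((n : ℝ) - 1) * ((((n : ℝ) - 2) * w θ * Real.sin θ ^ (n - 3) +
      q θ * Real.sin θ ^ (n - 2)) * f (Real.cos θ))) :=
    intervalIntegral.integral_congr fun θ _ => by ring
  have e2 : (∫ θ in (0 : ℝ)..(Real.pi / 2), (((n : ℝ) - 2) * w θ * Real.sin θ ^ (n - 3) +
      q θ * Real.sin θ ^ (n - 2)) * (1 - ((n : ℝ) - 1) * f (Real.cos θ))) =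
      ∫ θ in (0 : ℝ)..(Real.pi / 2), ((((n : ℝ) - 2) * w θ * Real.sin θ ^ (n - 3) +
      q θ * Real.sin θ ^ (n - 2)) - ((n : ℝ) - 1) * ((((n : ℝ) - 2) * w θ * Real.sin θ ^ (n - 3) +
      q θ * Real.sin θ ^ (n - 2)) * f (Real.cos θ))) :=
    intervalIntegral.integral_congr fun θ _ => by ring
  rw [e1, intervalIntegral.integral_add (c0.intervalIntegrable _ _)
    ((contConstMul _ c1).intervalIntegrable _ _), intervalIntegral.integral_const_mul] at k1
  rw [e2, intervalIntegral.integral_sub (c0.intervalIntegrable _ _)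
    ((contConstMul _ c1).intervalIntegrable _ _), intervalIntegral.integral_const_mul] at k2
  rw [← abs_of_nonneg (by linarith : (0 : ℝ) ≤ (n : ℝ) - 1), ← abs_mul, abs_le]
  constructor <;> linarith

end LegSol

instance instIsOpenPosMeasureSphVol : (sphVol n).IsOpenPosMeasure :=
  inferInstanceAs ((volume : Measure (En n)).toSphere.IsOpenPosMeasure)

theorem sph_integral_swap {F : Sph n → Sph n → ℝ} (hF : Continuous fun p : Sph n × Sph n => F p.1 p.2) :
    ∫ u, (∫ v, F u v ∂(sphVol n)) ∂(sphVol n) = ∫ v, (∫ u, F u v ∂(sphVol n)) ∂(sphVol n) :=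
  integral_integral_swap_of_hasCompactSupport (f := F) hF (HasCompactSupport.of_compactSpace _)

theorem eq_zero_of_sph_integral_sq {f : Sph n → ℝ} (hf : Continuous f)
    (h : ∫ v, f v ^ 2 ∂(sphVol n) = 0) (v : Sph n) : f v = 0 := by
  have h1 := (integral_eq_zero_iff_of_nonneg (fun v => sq_nonneg (f v))
    (integrable_sph (contPow hf 2))).1 h
  have h2 := (Continuous.ae_eq_iff_eq (sphVol n) (contPow hf 2) continuous_const).1 h1
  have h3 : f v ^ 2 = 0 := congrFun h2 v
  exact (pow_eq_zero_iff two_ne_zero).1 h3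

theorem continuous_inner_sph_pair : Continuous fun p : Sph n × Sph n => ⟪(p.1 : En n), (p.2 : En n)⟫_ℝ :=
  (continuous_subtype_val.comp continuous_fst).inner (continuous_subtype_val.comp continuous_snd)

theorem continuous_zonal_poly (P : Polynomial ℝ) (u : En n) :
    Continuous fun v : Sph n => P.eval (⟪u, (v : En n)⟫_ℝ ^ 2) :=
  P.continuous.comp (contPow (continuous_inner_sph u) 2)

theorem sph_moment_pair_odd (hn : 2 ≤ n) {u e : En n} (hu : ‖u‖ = 1) (he : ‖e‖ = 1)
    (hue : ⟪u, e⟫_ℝ = 0) (κ : ℝ → ℝ) (m k : ℕ) (hk : Odd k) :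
    ∫ v : Sph n, κ ⟪u, (v : En n)⟫_ℝ * (⟪u, (v : En n)⟫_ℝ ^ m * ⟪e, (v : En n)⟫_ℝ ^ k) ∂(sphVol n) = 0 := by
  have h := sph_integral_pair hn hu he hue hu (e' := -e) (by rwa [norm_neg])
    (by rw [inner_neg_right, hue, neg_zero]) fun a b => κ a * (a ^ m * b ^ k)
  simp only [inner_neg_left, hk.neg_pow, mul_neg, integral_neg] at h
  linarith

/-- Zonal integral operators map even polynomials to even polynomials of no larger degree. -/
theorem zonal_monomial (hn : 2 ≤ n) {κ : ℝ → ℝ} (hκ : Continuous κ) (j : ℕ) :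
    ∃ R : Polynomial ℝ, R.natDegree ≤ j ∧ ∀ u w : En n, ‖u‖ = 1 → ‖w‖ = 1 →
      ∫ v : Sph n, κ ⟪u, (v : En n)⟫_ℝ * ⟪w, (v : En n)⟫_ℝ ^ (2 * j) ∂(sphVol n) =
        R.eval (⟪u, w⟫_ℝ ^ 2) := by
  obtain ⟨u₀, hu₀⟩ : ∃ u₀ : En n, ‖u₀‖ = 1 := ⟨EuclideanSpace.single ⟨0, by omega⟩ 1, by simp⟩
  obtain ⟨e₀, he₀, hue₀⟩ := exists_unit_perp hn u₀
  set M : ℕ → ℝ := fun m => ∫ v : Sph n, κ ⟪u₀, (v : En n)⟫_ℝ *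
    (⟪u₀, (v : En n)⟫_ℝ ^ m * ⟪e₀, (v : En n)⟫_ℝ ^ (2 * j - m)) ∂(sphVol n) with hM
  refine ⟨∑ m ∈ Finset.range (2 * j + 1), if Even m then
    Polynomial.C (((2 * j).choose m : ℝ) * M m) *
      (Polynomial.X ^ (m / 2) * (1 - Polynomial.X) ^ (j - m / 2)) else 0,
    Polynomial.natDegree_sum_le_of_forall_le _ _ fun m hm => ?_, fun u w hu hw => ?_⟩
  · split_ifs
    · refine (Polynomial.natDegree_C_mul_le _ _).trans (Polynomial.natDegree_mul_le.trans ?_)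
      have h1 : (1 - Polynomial.X : Polynomial ℝ).natDegree ≤ 1 :=
        (Polynomial.natDegree_sub_le _ _).trans (by simp)
      have h2 := Polynomial.natDegree_pow_le_of_le (j - m / 2) h1
      have h3 : (Polynomial.X ^ (m / 2) : Polynomial ℝ).natDegree ≤ m / 2 := by simp
      have := Finset.mem_range.1 hm
      omega
    · simp
  · obtain ⟨e, he, hue, hwe⟩ := exists_unit_decomp hn hu hw
    set s := ⟪u, w⟫_ℝ with hs
    set c := Real.sqrt (1 - s ^ 2) with hc
    have hs2 : s ^ 2 ≤ 1 := by
      rw [sq_le_one_iff_abs_le_one]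
      have := abs_real_inner_le_norm u w
      rwa [hu, hw, one_mul] at this
    have hc2 : c ^ 2 = 1 - s ^ 2 := Real.sq_sqrt (by linarith)
    have hexp : ∀ v : Sph n, κ ⟪u, (v : En n)⟫_ℝ * ⟪w, (v : En n)⟫_ℝ ^ (2 * j) =
        ∑ m ∈ Finset.range (2 * j + 1), (((2 * j).choose m : ℝ) * (s ^ m * c ^ (2 * j - m))) *
          (κ ⟪u, (v : En n)⟫_ℝ * (⟪u, (v : En n)⟫_ℝ ^ m * ⟪e, (v : En n)⟫_ℝ ^ (2 * j - m))) := by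
      intro v
      conv_lhs => rw [hwe]
      rw [inner_add_left, inner_smul_left, inner_smul_left, add_pow, Finset.mul_sum]
      refine Finset.sum_congr rfl fun m _ => ?_
      simp only [conj_trivial, mul_pow]
      ring
    have cκ : Continuous fun v : Sph n => κ ⟪u, (v : En n)⟫_ℝ := hκ.comp (continuous_inner_sph u)
    rw [sph_integral_congr hexp, integral_finsetSum _ fun m _ => (integrable_sph (contMul
      cκ (contMul (contPow (continuous_inner_sph u) m)
        (contPow (continuous_inner_sph e) _)))).const_mul _, Polynomial.eval_finsetSum]
    refine Finset.sum_congr rfl fun m hm => ?_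
    have hm' := Finset.mem_range.1 hm
    rw [integral_const_mul]
    split_ifs with hev
    · rw [sph_integral_pair hn hu he hue hu₀ he₀ hue₀ fun a b => κ a * (a ^ m * b ^ (2 * j - m))]
      obtain ⟨l, rfl⟩ := hev
      have e1 : (l + l) / 2 = l := by omega
      have e2 : 2 * j - (l + l) = 2 * (j - l) := by omega
      simp only [Polynomial.eval_mul, Polynomial.eval_C, Polynomial.eval_pow, Polynomial.eval_X,
        Polynomial.eval_sub, Polynomial.eval_one, e1, hM, ← hc2, ← pow_mul, e2]
      ring
    · rw [sph_moment_pair_odd hn hu he hue κ m (2 * j - m) (by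
        rw [Nat.not_even_iff_odd] at hev
        exact Nat.Even.sub_odd (by omega) (even_two_mul j) hev)]
      simp

theorem zonal_poly (hn : 2 ≤ n) {κ : ℝ → ℝ} (hκ : Continuous κ) (P : Polynomial ℝ) :
    ∃ R : Polynomial ℝ, R.natDegree ≤ P.natDegree ∧ ∀ u w : En n, ‖u‖ = 1 → ‖w‖ = 1 →
      ∫ v : Sph n, κ ⟪u, (v : En n)⟫_ℝ * P.eval (⟪w, (v : En n)⟫_ℝ ^ 2) ∂(sphVol n) =
        R.eval (⟪u, w⟫_ℝ ^ 2) := by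
  choose R hR h using zonal_monomial hn hκ
  refine ⟨∑ j ∈ Finset.range (P.natDegree + 1), Polynomial.C (P.coeff j) * R j,
    Polynomial.natDegree_sum_le_of_forall_le _ _ fun j hj =>
      (Polynomial.natDegree_C_mul_le _ _).trans ((hR j).trans (by
        have := Finset.mem_range.1 hj; omega)), fun u w hu hw => ?_⟩
  have hexp : ∀ v : Sph n, κ ⟪u, (v : En n)⟫_ℝ * P.eval (⟪w, (v : En n)⟫_ℝ ^ 2) =
      ∑ j ∈ Finset.range (P.natDegree + 1), P.coeff j *
        (κ ⟪u, (v : En n)⟫_ℝ * ⟪w, (v : En n)⟫_ℝ ^ (2 * j)) := by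
    intro v
    rw [Polynomial.eval_eq_sum_range, Finset.mul_sum]
    refine Finset.sum_congr rfl fun j _ => ?_
    rw [pow_mul]
    ring
  have cκ : Continuous fun v : Sph n => κ ⟪u, (v : En n)⟫_ℝ := hκ.comp (continuous_inner_sph u)
  rw [sph_integral_congr hexp, integral_finsetSum _ fun j _ => (integrable_sph (contMul
      cκ (contPow (continuous_inner_sph w) _))).const_mul _,
      Polynomial.eval_finsetSum]
  refine Finset.sum_congr rfl fun j _ => ?_
  rw [integral_const_mul, h j u w hu hw, Polynomial.eval_mul, Polynomial.eval_C]

theorem sph_legQ_orthogonal [NeZero n] (hn : 3 ≤ n) {m : ℕ} {P : Polynomial ℝ} (hP : P.natDegree < m)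
    {u : En n} (hu : ‖u‖ = 1) :
    ∫ v : Sph n, (legQ n m).eval (⟪u, (v : En n)⟫_ℝ ^ 2) * P.eval (⟪u, (v : En n)⟫_ℝ ^ 2) ∂(sphVol n) = 0 := by
  obtain ⟨c, hc⟩ := exists_legQ_expansion hn P.natDegree P le_rfl
  have hexp : ∀ v : Sph n, (legQ n m).eval (⟪u, (v : En n)⟫_ℝ ^ 2) * P.eval (⟪u, (v : En n)⟫_ℝ ^ 2) =
      ∑ l ∈ Finset.range (P.natDegree + 1), c l * ((legQ n m).eval (⟪u, (v : En n)⟫_ℝ ^ 2) *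
        (legQ n l).eval (⟪u, (v : En n)⟫_ℝ ^ 2)) := by
    intro v
    conv_lhs => rw [hc]
    rw [Polynomial.eval_finsetSum, Finset.mul_sum]
    refine Finset.sum_congr rfl fun j _ => ?_
    rw [Polynomial.eval_mul, Polynomial.eval_C]
    ring
  rw [sph_integral_congr hexp, integral_finsetSum _ fun j _ => (integrable_sph (contMul
    (continuous_zonal_poly _ u) (continuous_zonal_poly _ u))).const_mul _]
  refine Finset.sum_eq_zero fun l hl => ?_
  have hlm : m ≠ l := by have := Finset.mem_range.1 hl; omega
  rw [integral_const_mul, sph_slice (by omega : 2 ≤ n) hu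
    (f := fun t => (legQ n m).eval (t ^ 2) * (legQ n l).eval (t ^ 2))
    (contMul (continuous_eval_sq _) (continuous_eval_sq _)) (fun t => by simp only [neg_sq]),
    merid_legQ_orthogonal hn hlm, mul_zero, mul_zero]

theorem sph_legQ_orthogonal_pair [NeZero n] (hn : 3 ≤ n) {m : ℕ} {P : Polynomial ℝ}
    (hP : P.natDegree < m) {u w : En n} (hu : ‖u‖ = 1) (hw : ‖w‖ = 1) :
    ∫ v : Sph n, (legQ n m).eval (⟪u, (v : En n)⟫_ℝ ^ 2) * P.eval (⟪w, (v : En n)⟫_ℝ ^ 2) ∂(sphVol n) = 0 := by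
  obtain ⟨r, -, h⟩ := zonal_poly (by omega : 2 ≤ n) (continuous_eval_sq (legQ n m)) P
  obtain ⟨r', hr', h'⟩ := zonal_poly (by omega : 2 ≤ n) (continuous_eval_sq r) P
  have key : ∫ v : Sph n, r.eval (⟪u, (v : En n)⟫_ℝ ^ 2) ^ 2 ∂(sphVol n) = 0 := by
    calc ∫ v : Sph n, r.eval (⟪u, (v : En n)⟫_ℝ ^ 2) ^ 2 ∂(sphVol n)
        = ∫ v : Sph n, (∫ x : Sph n, r.eval (⟪u, (v : En n)⟫_ℝ ^ 2) *
            ((legQ n m).eval (⟪u, (x : En n)⟫_ℝ ^ 2) *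
              P.eval (⟪(v : En n), (x : En n)⟫_ℝ ^ 2)) ∂(sphVol n)) ∂(sphVol n) :=
          sph_integral_congr fun v => by rw [integral_const_mul, h u v hu (norm_sph v), sq]
      _ = ∫ x : Sph n, (∫ v : Sph n, r.eval (⟪u, (v : En n)⟫_ℝ ^ 2) *
            ((legQ n m).eval (⟪u, (x : En n)⟫_ℝ ^ 2) *
              P.eval (⟪(v : En n), (x : En n)⟫_ℝ ^ 2)) ∂(sphVol n)) ∂(sphVol n) :=
          sph_integral_swap (contMul ((continuous_zonal_poly r u).comp continuous_fst)
            (contMul ((continuous_zonal_poly _ u).comp continuous_snd)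
              (P.continuous.comp (contPow continuous_inner_sph_pair 2))))
      _ = ∫ x : Sph n, (legQ n m).eval (⟪u, (x : En n)⟫_ℝ ^ 2) *
            r'.eval (⟪u, (x : En n)⟫_ℝ ^ 2) ∂(sphVol n) :=
          sph_integral_congr fun x => by
            rw [← h' u x hu (norm_sph x), ← integral_const_mul]
            refine sph_integral_congr fun v => ?_
            rw [real_inner_comm (x : En n) (v : En n)]
            ring
      _ = 0 := sph_legQ_orthogonal hn (hr'.trans_lt hP) hu
  rw [h u w hu hw]
  exact eq_zero_of_sph_integral_sq (continuous_zonal_poly r u) key ⟨w, by simpa using hw⟩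

theorem legQ_eval_one_ne_zero (hn : 3 ≤ n) {m : ℕ} (hm : 1 ≤ m) : (legQ n m).eval 1 ≠ 0 := by
  have h := (legSol_legQ hn hm).sq_le_one hn le_rfl zero_le_one
  have h0 : (legQ n m).eval 0 = 1 := by
    rw [← Polynomial.coeff_zero_eq_eval_zero, coeff_legQ, legCoeff]
  intro h1
  norm_num [h0, h1] at h

/-- The even Legendre polynomial as a profile normalized at `1`. -/
def legF (n m : ℕ) (t : ℝ) : ℝ := ((legQ n m).eval 1)⁻¹ * (legQ n m).eval (t ^ 2)

theorem continuous_legF (m : ℕ) : Continuous (legF n m) := contConstMul _ (continuous_eval_sq _)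

theorem legF_neg (m : ℕ) (t : ℝ) : legF n m (-t) = legF n m t := by simp [legF]

theorem legF_one (hn : 3 ≤ n) {m : ℕ} (hm : 1 ≤ m) : legF n m 1 = 1 := by
  simp [legF, legQ_eval_one_ne_zero hn hm]

theorem legF_legSol (hn : 3 ≤ n) {m : ℕ} (hm : 1 ≤ m) : ∃ f1 f2 f3,
    LegSol n (legMu n m) (legF n m) f1 f2 f3 :=
  ⟨_, _, _, (legSol_legQ hn hm).const_mul _⟩

theorem continuous_legF_sph (m : ℕ) (u : En n) : Continuous fun v : Sph n => legF n m ⟪u, (v : En n)⟫_ℝ :=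
  (continuous_legF m).comp (continuous_inner_sph u)

/-- The Funk-Hecke formula for even zonal kernels. -/
theorem funk_hecke [NeZero n] (hn : 3 ≤ n) {κ : ℝ → ℝ} (hκ : Continuous κ) (he : ∀ t, κ (-t) = κ t)
    {m : ℕ} (hm : 1 ≤ m) {u w : En n} (hu : ‖u‖ = 1) (hw : ‖w‖ = 1) :
    ∫ v : Sph n, κ ⟪u, (v : En n)⟫_ℝ * legF n m ⟪w, (v : En n)⟫_ℝ ∂(sphVol n) =
      (sliceC n * merid n fun t => κ t * legF n m t) * legF n m ⟪u, w⟫_ℝ := by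
  obtain ⟨R, hR, h⟩ := zonal_poly (by omega : 2 ≤ n) hκ (legQ n m)
  rw [natDegree_legQ hn] at hR
  set c := R.coeff m / legCoeff n m m with hc
  have hne := legCoeff_ne_zero hn (le_refl m)
  set S := R - Polynomial.C c * legQ n m with hS
  have hSdeg : S.natDegree < m := by
    have hle : S.natDegree ≤ m - 1 → S.natDegree < m := fun h => by omega
    refine hle (Polynomial.natDegree_le_iff_coeff_eq_zero.2 fun j hj => ?_)
    rw [hS, Polynomial.coeff_sub, Polynomial.coeff_C_mul, coeff_legQ]
    rcases Nat.lt_or_ge m j with h | h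
    · rw [Polynomial.coeff_eq_zero_of_natDegree_lt (lt_of_le_of_lt hR h),
        ← coeff_legQ, Polynomial.coeff_eq_zero_of_natDegree_lt (by rwa [natDegree_legQ hn])]
      simp
    · obtain rfl : j = m := by omega
      rw [hc, div_mul_cancel₀ _ hne, sub_self]
  have hRS : ∀ z, ‖z‖ = 1 → ∫ v : Sph n, R.eval (⟪z, (v : En n)⟫_ℝ ^ 2) *
      S.eval (⟪z, (v : En n)⟫_ℝ ^ 2) ∂(sphVol n) = 0 := fun z hz => by
    calc ∫ x : Sph n, R.eval (⟪z, (x : En n)⟫_ℝ ^ 2) * S.eval (⟪z, (x : En n)⟫_ℝ ^ 2) ∂(sphVol n)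
        = ∫ x : Sph n, (∫ v : Sph n, S.eval (⟪z, (x : En n)⟫_ℝ ^ 2) *
            (κ ⟪z, (v : En n)⟫_ℝ * (legQ n m).eval (⟪(x : En n), (v : En n)⟫_ℝ ^ 2))
              ∂(sphVol n)) ∂(sphVol n) :=
          sph_integral_congr fun x => by rw [integral_const_mul, h z x hz (norm_sph x), mul_comm]
      _ = ∫ v : Sph n, (∫ x : Sph n, S.eval (⟪z, (x : En n)⟫_ℝ ^ 2) *
            (κ ⟪z, (v : En n)⟫_ℝ * (legQ n m).eval (⟪(x : En n), (v : En n)⟫_ℝ ^ 2))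
              ∂(sphVol n)) ∂(sphVol n) :=
          sph_integral_swap (contMul ((continuous_zonal_poly S z).comp continuous_fst)
            (contMul ((hκ.comp (continuous_inner_sph z)).comp continuous_snd)
              ((legQ n m).continuous.comp (contPow continuous_inner_sph_pair 2))))
      _ = ∫ v : Sph n, κ ⟪z, (v : En n)⟫_ℝ * 0 ∂(sphVol n) :=
          sph_integral_congr fun v => by
            rw [← sph_legQ_orthogonal_pair hn hSdeg (norm_sph v) hz, ← integral_const_mul]
            refine sph_integral_congr fun x => ?_
            rw [real_inner_comm (v : En n) (x : En n)]
            ring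
      _ = 0 := by simp
  have hS0 : ∀ z, ‖z‖ = 1 → ∀ x : Sph n, S.eval (⟪z, (x : En n)⟫_ℝ ^ 2) = 0 := fun z hz => by
    refine eq_zero_of_sph_integral_sq (continuous_zonal_poly S z) ?_
    have e : ∀ x : Sph n, S.eval (⟪z, (x : En n)⟫_ℝ ^ 2) ^ 2 =
        1 * (R.eval (⟪z, (x : En n)⟫_ℝ ^ 2) * S.eval (⟪z, (x : En n)⟫_ℝ ^ 2)) +
        (-c) * ((legQ n m).eval (⟪z, (x : En n)⟫_ℝ ^ 2) * S.eval (⟪z, (x : En n)⟫_ℝ ^ 2)) := by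
      intro x
      have : S.eval (⟪z, (x : En n)⟫_ℝ ^ 2) = R.eval (⟪z, (x : En n)⟫_ℝ ^ 2) -
          c * (legQ n m).eval (⟪z, (x : En n)⟫_ℝ ^ 2) := by simp [hS]
      rw [sq]
      nth_rewrite 1 [this]
      ring
    rw [sph_integral_congr e, sph_integral_lin (contMul (continuous_zonal_poly _ z)
      (continuous_zonal_poly _ z)) (contMul (continuous_zonal_poly _ z) (continuous_zonal_poly _ z)),
      hRS z hz, sph_legQ_orthogonal hn hSdeg hz]
    simp
  have hval : ∀ z x : En n, ‖z‖ = 1 → ‖x‖ = 1 →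
      ∫ v : Sph n, κ ⟪z, (v : En n)⟫_ℝ * legF n m ⟪x, (v : En n)⟫_ℝ ∂(sphVol n) =
        c * legF n m ⟪z, x⟫_ℝ := fun z x hz hx => by
    have e := hS0 z hz ⟨x, by simpa using hx⟩
    simp only [hS, Polynomial.eval_sub, Polynomial.eval_mul, Polynomial.eval_C] at e
    simp only [legF, mul_left_comm _ ((legQ n m).eval 1)⁻¹]
    rw [integral_const_mul, h z x hz hx, sub_eq_zero.1 e]
  have h1 := hval u u hu hu
  rw [real_inner_self_eq_norm_sq, hu, one_pow, legF_one hn hm, mul_one,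
    sph_slice (by omega : 2 ≤ n) hu (f := fun t => κ t * legF n m t)
      (contMul hκ (continuous_legF m)) (fun t => by simp only [he, legF_neg])] at h1
  rw [hval u w hu hw, h1]

theorem legF_abs_le_one (hn : 3 ≤ n) {m : ℕ} (hm : 1 ≤ m) {t : ℝ} (ht : |t| ≤ 1) : |legF n m t| ≤ 1 := by
  obtain ⟨f1, f2, f3, h⟩ := legF_legSol hn hm
  have h1 := h.sq_le_one hn (abs_nonneg t) ht
  rw [legF_one hn hm] at h1
  rw [← even_eq_abs (legF_neg m)]
  exact (sq_le_one_iff_abs_le_one _).1 (by simpa using h1)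

theorem merid_legF_sq_pos [NeZero n] (hn : 3 ≤ n) {m : ℕ} (hm : 1 ≤ m) :
    0 < sliceC n * merid n fun t => legF n m t * legF n m t := by
  obtain ⟨u, hu⟩ : ∃ u : En n, ‖u‖ = 1 := ⟨EuclideanSpace.single ⟨0, by omega⟩ 1, by simp⟩
  have e := sph_slice (by omega : 2 ≤ n) hu (f := fun t => legF n m t * legF n m t)
    (contMul (continuous_legF m) (continuous_legF m)) (fun t => by simp only [legF_neg])
  have e' : ∫ v : Sph n, legF n m ⟪u, (v : En n)⟫_ℝ ^ 2 ∂(sphVol n) =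
      sliceC n * merid n fun t => legF n m t * legF n m t := by
    rw [← e]; exact sph_integral_congr fun v => sq _
  rw [← e']
  refine lt_of_le_of_ne (integral_nonneg fun v => sq_nonneg _) fun h0 => ?_
  have h1 := eq_zero_of_sph_integral_sq (continuous_legF_sph m u) h0.symm ⟨u, by simpa using hu⟩
  simp only [real_inner_self_eq_norm_sq, hu, one_pow, legF_one hn hm] at h1
  exact one_ne_zero h1

theorem legF_sum_nonneg [NeZero n] (hn : 3 ≤ n) {m : ℕ} (hm : 1 ≤ m) {ι : Type*} [Fintype ι]
    {x : ι → En n} (hx : ∀ i, ‖x i‖ = 1) : 0 ≤ ∑ i, ∑ j, legF n m ⟪x i, x j⟫_ℝ := by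
  have h : ∫ v : Sph n, (∑ i, legF n m ⟪x i, (v : En n)⟫_ℝ) ^ 2 ∂(sphVol n) =
      (sliceC n * merid n fun t => legF n m t * legF n m t) * ∑ i, ∑ j, legF n m ⟪x i, x j⟫_ℝ := by
    have e : ∀ v : Sph n, (∑ i, legF n m ⟪x i, (v : En n)⟫_ℝ) ^ 2 =
        ∑ i, ∑ j, legF n m ⟪x i, (v : En n)⟫_ℝ * legF n m ⟪x j, (v : En n)⟫_ℝ := fun v => by
      rw [sq, Finset.sum_mul_sum]
    have hi : ∀ i j, Integrable (fun v : Sph n => legF n m ⟪x i, (v : En n)⟫_ℝ *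
        legF n m ⟪x j, (v : En n)⟫_ℝ) (sphVol n) := fun i j =>
      integrable_sph (contMul (continuous_legF_sph m _) (continuous_legF_sph m _))
    rw [sph_integral_congr e, integral_finsetSum _ fun i _ => integrable_finsetSum _ fun j _ => hi i j,
      Finset.mul_sum]
    refine Finset.sum_congr rfl fun i _ => ?_
    rw [integral_finsetSum _ fun j _ => hi i j, Finset.mul_sum]
    exact Finset.sum_congr rfl fun j _ => funk_hecke hn (continuous_legF m) (legF_neg m) hm (hx i) (hx j)
  exact nonneg_of_mul_nonneg_right (h ▸ integral_nonneg fun v => sq_nonneg _) (merid_legF_sq_pos hn hm)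

theorem exists_equiangular [NeZero n] {t : ℝ} (h0 : 0 ≤ t) (h1 : t ≤ 1) :
    ∃ x : Fin n → En n, ∀ i j, ⟪x i, x j⟫_ℝ = if i = j then 1 else t := by
  have hn : (0 : ℝ) < n := by exact_mod_cast Nat.pos_of_ne_zero (NeZero.ne n)
  set α := Real.sqrt (1 - t) with hα
  have hα2 : α ^ 2 = 1 - t := Real.sq_sqrt (by linarith)
  set γ := Real.sqrt (α ^ 2 + n * t) with hγ
  have hγ2 : γ ^ 2 = α ^ 2 + n * t := Real.sq_sqrt (by positivity)
  set β := (-α + γ) / n with hβ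
  have hβ2 : n * β ^ 2 + 2 * α * β = t := by
    have : n * β = -α + γ := by rw [hβ]; field_simp
    have h2 : n * (n * β ^ 2 + 2 * α * β) = n * t := by
      calc n * (n * β ^ 2 + 2 * α * β) = (n * β) ^ 2 + 2 * α * (n * β) := by ring
        _ = γ ^ 2 - α ^ 2 := by rw [this]; ring
        _ = n * t := by rw [hγ2]; ring
    exact mul_left_cancel₀ hn.ne' h2
  set s : En n := ∑ k : Fin n, EuclideanSpace.single k (1 : ℝ) with hs
  have hsc : ∀ k, s k = 1 := fun k => by simp [hs]
  refine ⟨fun i => α • EuclideanSpace.single i (1 : ℝ) + β • s, fun i j => ?_⟩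
  have e1 : ⟪s, s⟫_ℝ = n := by rw [PiLp.inner_apply]; simp [hsc]
  have e2 : ∀ i, ⟪s, EuclideanSpace.single i (1 : ℝ)⟫_ℝ = 1 := fun i => by
    simp [EuclideanSpace.inner_single_right, hsc]
  have e3 : ∀ i, ⟪EuclideanSpace.single i (1 : ℝ), s⟫_ℝ = 1 := fun i => by
    rw [real_inner_comm, e2]
  have e4 : ⟪(EuclideanSpace.single i (1 : ℝ) : En n), EuclideanSpace.single j (1 : ℝ)⟫_ℝ =
      if i = j then 1 else 0 := by
    simp [EuclideanSpace.inner_single_left, PiLp.single_apply]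
  simp only [inner_add_left, inner_add_right, real_inner_smul_left, real_inner_smul_right, e1, e2, e3, e4]
  split_ifs
  · linear_combination hβ2 + hα2
  · linear_combination hβ2

theorem legF_lower [NeZero n] (hn : 3 ≤ n) {m : ℕ} (hm : 1 ≤ m) {t : ℝ} (h0 : 0 ≤ t) (h1 : t ≤ 1) :
    -1 ≤ ((n : ℝ) - 1) * legF n m t := by
  obtain ⟨x, hx⟩ := exists_equiangular (n := n) h0 h1
  have hx1 : ∀ i, ‖x i‖ = 1 := fun i => by
    have := hx i i
    rw [real_inner_self_eq_norm_sq, if_pos rfl] at this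
    exact (pow_eq_one_iff_of_nonneg (norm_nonneg _) two_ne_zero).1 this
  have h := legF_sum_nonneg hn hm hx1
  have e : ∀ i j : Fin n, legF n m ⟪x i, x j⟫_ℝ = legF n m t + if i = j then 1 - legF n m t else 0 := by
    intro i j
    rw [hx]
    split_ifs
    · rw [legF_one hn hm]; ring
    · ring
  simp only [e, Finset.sum_add_distrib, Finset.sum_const, Finset.card_univ, Fintype.card_fin,
    nsmul_eq_mul, Finset.sum_ite_eq, Finset.mem_univ, if_true] at h
  have hn' : (0 : ℝ) < n := by exact_mod_cast (by omega : 0 < n)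
  have h2 : (n : ℝ) * (((n : ℝ) - 1) * legF n m t + 1) ≥ 0 := by linear_combination h
  have := nonneg_of_mul_nonneg_right h2 hn'
  linarith

theorem continuous_sph_integral {X : Type*} [TopologicalSpace X] [FirstCountableTopology X]
    [LocallyCompactSpace X] {F : X → Sph n → ℝ}
    (hF : Continuous fun p : X × Sph n => F p.1 p.2) : Continuous fun x => ∫ v, F x v ∂(sphVol n) := by
  have := continuous_parametric_integral_of_continuous (μ := sphVol n) (f := F) hF isCompact_univ
  simpa using this

/-- The zonal integral operator with profile `κ`. -/
def zonalT (κ : ℝ → ℝ) (φ : Sph n → ℝ) (u : En n) : ℝ :=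
  ∫ v : Sph n, κ ⟪u, (v : En n)⟫_ℝ * φ v ∂(sphVol n)

section zonalT

variable {κ κ' : ℝ → ℝ} {φ ψ : Sph n → ℝ}

theorem continuous_profile_pair (hκ : Continuous κ) :
    Continuous fun p : Sph n × Sph n => κ ⟪(p.1 : En n), (p.2 : En n)⟫_ℝ :=
  hκ.comp continuous_inner_sph_pair

theorem continuous_profile (hκ : Continuous κ) (u : En n) :
    Continuous fun v : Sph n => κ ⟪u, (v : En n)⟫_ℝ := hκ.comp (continuous_inner_sph u)

theorem continuous_zonalT (hκ : Continuous κ) (hφ : Continuous φ) :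
    Continuous fun u : Sph n => zonalT κ φ (u : En n) :=
  continuous_sph_integral (contMul (continuous_profile_pair hκ) (hφ.comp continuous_snd))

theorem zonalT_symm (hκ : Continuous κ) (hφ : Continuous φ) (hψ : Continuous ψ) :
    ∫ u : Sph n, zonalT κ φ (u : En n) * ψ u ∂(sphVol n) = ∫ u : Sph n, φ u * zonalT κ ψ (u : En n) ∂(sphVol n) := by
  unfold zonalT
  calc ∫ u : Sph n, (∫ v : Sph n, κ ⟪(u : En n), (v : En n)⟫_ℝ * φ v ∂(sphVol n)) * ψ u ∂(sphVol n)
      = ∫ u : Sph n, (∫ v : Sph n, κ ⟪(u : En n), (v : En n)⟫_ℝ * φ v * ψ u ∂(sphVol n)) ∂(sphVol n) :=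
        sph_integral_congr fun u => (integral_mul_const _ _).symm
    _ = ∫ v : Sph n, (∫ u : Sph n, κ ⟪(u : En n), (v : En n)⟫_ℝ * φ v * ψ u ∂(sphVol n)) ∂(sphVol n) :=
        sph_integral_swap (contMul (contMul (continuous_profile_pair hκ) (hφ.comp continuous_snd))
          (hψ.comp continuous_fst))
    _ = _ := sph_integral_congr fun v => by
        rw [← integral_const_mul]
        refine sph_integral_congr fun u => ?_
        rw [real_inner_comm (v : En n)]
        ring

theorem zonalT_legF [NeZero n] (hn : 3 ≤ n) (hκ : Continuous κ) (he : ∀ t, κ (-t) = κ t)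
    (hφ : Continuous φ) {m : ℕ} (hm : 1 ≤ m) {u : En n} (hu : ‖u‖ = 1) :
    zonalT κ (fun v : Sph n => zonalT (legF n m) φ (v : En n)) u =
      (sliceC n * merid n fun t => κ t * legF n m t) * zonalT (legF n m) φ u := by
  unfold zonalT
  calc ∫ v : Sph n, κ ⟪u, (v : En n)⟫_ℝ * (∫ w : Sph n, legF n m ⟪(v : En n), (w : En n)⟫_ℝ * φ w ∂(sphVol n)) ∂(sphVol n)
      = ∫ v : Sph n, (∫ w : Sph n, κ ⟪u, (v : En n)⟫_ℝ * (legF n m ⟪(v : En n), (w : En n)⟫_ℝ * φ w) ∂(sphVol n)) ∂(sphVol n) :=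
        sph_integral_congr fun v => (integral_const_mul _ _).symm
    _ = ∫ w : Sph n, (∫ v : Sph n, κ ⟪u, (v : En n)⟫_ℝ * (legF n m ⟪(v : En n), (w : En n)⟫_ℝ * φ w) ∂(sphVol n)) ∂(sphVol n) :=
        sph_integral_swap (contMul ((continuous_profile hκ u).comp continuous_fst)
          (contMul (continuous_profile_pair (continuous_legF m)) (hφ.comp continuous_snd)))
    _ = _ := by
        rw [← integral_const_mul]
        refine sph_integral_congr fun w => ?_
        rw [← mul_assoc, ← funk_hecke hn hκ he hm hu (norm_sph w), ← integral_mul_const]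
        refine sph_integral_congr fun v => ?_
        rw [real_inner_comm (w : En n)]
        ring

end zonalT

/-- Bessel inequality for finitely many orthogonal projections. -/
theorem sph_bessel {s : Finset ℕ} {g : ℕ → Sph n → ℝ} {φ : Sph n → ℝ} (hg : ∀ m, Continuous (g m))
    (hφ : Continuous φ) (ho : ∀ m ∈ s, ∀ l ∈ s, ∫ v, g m v * g l v ∂(sphVol n) =
      if m = l then ∫ v, φ v * g m v ∂(sphVol n) else 0) {c : ℕ → ℝ} {q : ℝ} (hc : ∀ m ∈ s, |c m| ≤ q) :
    ∫ v, (∑ m ∈ s, c m * g m v) ^ 2 ∂(sphVol n) ≤ q ^ 2 * ∫ v, φ v ^ 2 ∂(sphVol n) := by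
  set a : ℕ → ℝ := fun m => ∫ v, φ v * g m v ∂(sphVol n) with ha
  have hexp : ∀ c : ℕ → ℝ, ∫ v, (∑ m ∈ s, c m * g m v) ^ 2 ∂(sphVol n) = ∑ m ∈ s, c m ^ 2 * a m := by
    intro c
    have e : ∀ v, (∑ m ∈ s, c m * g m v) ^ 2 = ∑ m ∈ s, ∑ l ∈ s, c m * c l * (g m v * g l v) := fun v => by
      rw [sq, Finset.sum_mul_sum]
      exact Finset.sum_congr rfl fun m _ => Finset.sum_congr rfl fun l _ => by ring
    have hi : ∀ m l, Integrable (fun v => c m * c l * (g m v * g l v)) (sphVol n) := fun m l =>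
      (integrable_sph (contMul (hg m) (hg l))).const_mul _
    rw [sph_integral_congr e, integral_finsetSum _ fun i _ => integrable_finsetSum _ fun j _ => hi i j]
    refine Finset.sum_congr rfl fun m hm => ?_
    rw [integral_finsetSum _ fun j _ => hi m j, Finset.sum_eq_single m]
    · rw [integral_const_mul, ho m hm m hm, if_pos rfl, sq]
    · intro l hl hlm
      rw [integral_const_mul, ho m hm l hl, if_neg (Ne.symm hlm), mul_zero]
    · exact fun h => absurd hm h
  have ha0 : ∀ m ∈ s, 0 ≤ a m := fun m hm => by
    have := ho m hm m hm
    rw [if_pos rfl] at this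
    rw [ha]
    simp only
    rw [← this]
    exact integral_nonneg fun v => mul_self_nonneg _
  have hb : ∑ m ∈ s, a m ≤ ∫ v, φ v ^ 2 ∂(sphVol n) := by
    have cs : Continuous fun v => ∑ m ∈ s, 1 * g m v :=
      continuous_finsetSum _ fun m _ => contConstMul 1 (hg m)
    have h0 : 0 ≤ ∫ v, (φ v - ∑ m ∈ s, 1 * g m v) ^ 2 ∂(sphVol n) := integral_nonneg fun v => sq_nonneg _
    have e : ∀ v, (φ v - ∑ m ∈ s, 1 * g m v) ^ 2 =
        1 * (φ v ^ 2) + 1 * ((-2) * (φ v * ∑ m ∈ s, 1 * g m v) + 1 * (∑ m ∈ s, 1 * g m v) ^ 2) := fun v => by ring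
    rw [sph_integral_congr e, sph_integral_lin (contPow hφ 2) (contAdd (contConstMul _ (contMul hφ cs))
      (contConstMul _ (contPow cs 2))), sph_integral_lin (contMul hφ cs) (contPow cs 2), hexp] at h0
    have e2 : ∫ v, φ v * ∑ m ∈ s, 1 * g m v ∂(sphVol n) = ∑ m ∈ s, a m := by
      simp only [one_mul, Finset.mul_sum]
      exact integral_finsetSum _ fun m _ => integrable_sph (contMul hφ (hg m))
    rw [e2] at h0
    simp only [one_pow, one_mul] at h0
    linarith
  rw [hexp]
  calc ∑ m ∈ s, c m ^ 2 * a m ≤ ∑ m ∈ s, q ^ 2 * a m := Finset.sum_le_sum fun m hm =>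
        mul_le_mul_of_nonneg_right (sq_le_sq.2 ((hc m hm).trans (le_abs_self q))) (ha0 m hm)
    _ = q ^ 2 * ∑ m ∈ s, a m := (Finset.mul_sum _ _ _).symm
    _ ≤ _ := mul_le_mul_of_nonneg_left hb (sq_nonneg q)

theorem zonalT_add_poly {s : Finset ℕ} {φ : Sph n → ℝ} (hφ : Continuous φ) (c : ℕ → ℝ) (u : En n) :
    zonalT (fun t => ∑ m ∈ s, c m * legF n m t) φ u = ∑ m ∈ s, c m * zonalT (legF n m) φ u := by
  unfold zonalT
  have e : ∀ v : Sph n, (∑ m ∈ s, c m * legF n m ⟪u, (v : En n)⟫_ℝ) * φ v =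
      ∑ m ∈ s, c m * (legF n m ⟪u, (v : En n)⟫_ℝ * φ v) := fun v => by
    rw [Finset.sum_mul]
    exact Finset.sum_congr rfl fun m _ => mul_assoc _ _ _
  rw [sph_integral_congr e, integral_finsetSum _ fun m _ =>
    (integrable_sph (contMul (continuous_legF_sph m u) hφ)).const_mul _]
  exact Finset.sum_congr rfl fun m _ => integral_const_mul _ _

theorem merid_legF_orthogonal (hn : 3 ≤ n) {l m : ℕ} (hlm : l ≠ m) :
    merid n (fun t => legF n l t * legF n m t) = 0 := by
  have e : (fun t => legF n l t * legF n m t) = fun t => (((legQ n l).eval 1)⁻¹ * ((legQ n m).eval 1)⁻¹) *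
      ((legQ n l).eval (t ^ 2) * (legQ n m).eval (t ^ 2)) + 0 * 0 := by
    funext t
    simp only [legF]
    ring
  rw [e, merid_lin (contMul (continuous_eval_sq _) (continuous_eval_sq _))
    (continuous_const (y := (0 : ℝ))), merid_legQ_orthogonal hn hlm]
  ring

theorem exists_legF_expansion (hn : 3 ≤ n) (P : Polynomial ℝ) : ∃ (a : ℝ) (c : ℕ → ℝ) (s : Finset ℕ),
    (∀ m ∈ s, 1 ≤ m) ∧ ∀ t, P.eval (t ^ 2) = a + ∑ m ∈ s, c m * legF n m t := by
  obtain ⟨c, hc⟩ := exists_legQ_expansion hn P.natDegree P le_rfl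
  refine ⟨c 0 * (legQ n 0).coeff 0, fun m => c m * (legQ n m).eval 1, Finset.Icc 1 P.natDegree,
    fun m hm => (Finset.mem_Icc.1 hm).1, fun t => ?_⟩
  have h0 : (legQ n 0).eval (t ^ 2) = (legQ n 0).coeff 0 := by
    rw [Polynomial.eq_C_of_natDegree_eq_zero (natDegree_legQ hn 0)]
    simp
  conv_lhs => rw [hc]
  rw [Polynomial.eval_finsetSum, Finset.range_eq_Ico,
    Finset.sum_eq_sum_Ico_succ_bot (Nat.succ_pos _), Polynomial.eval_mul, Polynomial.eval_C, h0]
  congr 1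
  refine Finset.sum_congr (by ext; simp) fun m hm => ?_
  have hm1 : 1 ≤ m := (Finset.mem_Icc.1 hm).1
  have := legQ_eval_one_ne_zero hn hm1
  rw [Polynomial.eval_mul, Polynomial.eval_C, legF]
  field_simp

theorem zonalT_const (a : ℝ) {φ : Sph n → ℝ} (h0 : ∫ v, φ v ∂(sphVol n) = 0) (u : En n) :
    zonalT (fun _ => a) φ u = 0 := by
  unfold zonalT
  rw [integral_const_mul, h0, mul_zero]

theorem zonalT_add {κ κ' : ℝ → ℝ} {φ : Sph n → ℝ} (hκ : Continuous κ) (hκ' : Continuous κ')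
    (hφ : Continuous φ) (u : En n) :
    zonalT (fun t => κ t + κ' t) φ u = zonalT κ φ u + zonalT κ' φ u := by
  unfold zonalT
  rw [← integral_add (integrable_sph (contMul (continuous_profile hκ u) hφ))
    (integrable_sph (contMul (continuous_profile hκ' u) hφ))]
  exact sph_integral_congr fun v => add_mul _ _ _

theorem zonalT_poly_l2 [NeZero n] (hn : 3 ≤ n) (P : Polynomial ℝ) {q : ℝ}
    (hq : ∀ m, 1 ≤ m → |sliceC n * merid n fun t => P.eval (t ^ 2) * legF n m t| ≤ q)
    {φ : Sph n → ℝ} (hφ : Continuous φ) (h0 : ∫ v, φ v ∂(sphVol n) = 0) :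
    ∫ u : Sph n, zonalT (fun t => P.eval (t ^ 2)) φ (u : En n) ^ 2 ∂(sphVol n) ≤
      q ^ 2 * ∫ v, φ v ^ 2 ∂(sphVol n) := by
  obtain ⟨a, c, s, hs, hP⟩ := exists_legF_expansion hn P
  set ν : ℕ → ℝ := fun m => sliceC n * merid n fun t => legF n m t * legF n m t with hν
  have hν0 : ∀ m ∈ s, 0 < ν m := fun m hm => merid_legF_sq_pos hn (hs m hm)
  set g : ℕ → Sph n → ℝ := fun m u => (ν m)⁻¹ * zonalT (legF n m) φ (u : En n) with hgdef
  have hg : ∀ m, Continuous (g m) := fun m => contConstMul _ (continuous_zonalT (continuous_legF m) hφ)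
  have hsum : Continuous fun t => ∑ m ∈ s, c m * legF n m t :=
    continuous_finsetSum _ fun m _ => contConstMul _ (continuous_legF m)
  have e1 : ∀ u : Sph n, zonalT (fun t => P.eval (t ^ 2)) φ (u : En n) ^ 2 =
      (∑ m ∈ s, (c m * ν m) * g m u) ^ 2 := fun u => by
    have : (fun t => P.eval (t ^ 2)) = fun t => a + ∑ m ∈ s, c m * legF n m t := funext hP
    rw [this, zonalT_add continuous_const hsum hφ, zonalT_const a h0, zero_add, zonalT_add_poly hφ]
    congr 1
    refine Finset.sum_congr rfl fun m hm => ?_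
    have := (hν0 m hm).ne'
    simp only [hgdef]
    field_simp
  rw [sph_integral_congr e1]
  refine sph_bessel hg hφ (fun m hm l hl => ?_) fun m hm => ?_
  · have hnum := (hν0 m hm).ne'
    have hnul := (hν0 l hl).ne'
    have e2 : ∫ v, g m v * g l v ∂(sphVol n) =
        (ν m)⁻¹ * ((ν l)⁻¹ * ∫ v : Sph n, φ v * zonalT (legF n m)
          (fun w : Sph n => zonalT (legF n l) φ (w : En n)) (v : En n) ∂(sphVol n)) := by
      rw [← zonalT_symm (continuous_legF m) hφ (continuous_zonalT (continuous_legF l) hφ),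
        ← integral_const_mul, ← integral_const_mul]
      refine sph_integral_congr fun v => ?_
      simp only [hgdef]
      ring
    have e3 : ∀ v : Sph n, φ v * zonalT (legF n m)
        (fun w : Sph n => zonalT (legF n l) φ (w : En n)) (v : En n) =
        (sliceC n * merid n fun t => legF n m t * legF n l t) * (φ v * zonalT (legF n l) φ (v : En n)) :=
      fun v => by
        rw [zonalT_legF hn (continuous_legF m) (legF_neg m) hφ (hs l hl) (norm_sph v)]
        ring
    rw [e2, sph_integral_congr e3, integral_const_mul]
    split_ifs with h
    · subst h
      have e4 : ∀ v : Sph n, φ v * g m v = (ν m)⁻¹ * (φ v * zonalT (legF n m) φ (v : En n)) := fun v => by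
        simp only [hgdef]
        ring
      rw [sph_integral_congr e4, integral_const_mul]
      change (ν m)⁻¹ * ((ν m)⁻¹ * (ν m * _)) = _
      field_simp
    · rw [merid_legF_orthogonal hn h]
      ring
  · have e5 : sliceC n * merid n (fun t => P.eval (t ^ 2) * legF n m t) = c m * ν m := by
      obtain ⟨u, hu⟩ : ∃ u : En n, ‖u‖ = 1 := ⟨EuclideanSpace.single ⟨0, by omega⟩ 1, by simp⟩
      have two : 2 ≤ n := by omega
      have hm1 := hs m hm
      have i1 : ∀ l, ∫ v : Sph n, legF n l ⟪u, (v : En n)⟫_ℝ * legF n m ⟪u, (v : En n)⟫_ℝ ∂(sphVol n) =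
          sliceC n * merid n fun t => legF n l t * legF n m t := fun l =>
        sph_slice two hu (contMul (continuous_legF l) (continuous_legF m)) fun t => by simp only [legF_neg]
      rw [← sph_slice two hu (contMul (continuous_eval_sq P) (continuous_legF m)) fun t => by
        simp only [neg_sq, legF_neg]]
      have e6 : ∀ v : Sph n, P.eval (⟪u, (v : En n)⟫_ℝ ^ 2) * legF n m ⟪u, (v : En n)⟫_ℝ =
          (a * (legQ n 0).eval 1) / (legQ n 0).coeff 0 * (legF n 0 ⟪u, (v : En n)⟫_ℝ * legF n m ⟪u, (v : En n)⟫_ℝ) +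
          ∑ l ∈ s, c l * (legF n l ⟪u, (v : En n)⟫_ℝ * legF n m ⟪u, (v : En n)⟫_ℝ) := fun v => by
        have h00 : (legQ n 0).coeff 0 = 1 := by rw [coeff_legQ, legCoeff]
        have hC : legQ n 0 = Polynomial.C 1 := by
          rw [Polynomial.eq_C_of_natDegree_eq_zero (natDegree_legQ hn 0), h00]
        have hl0 : ∀ t, legF n 0 t = 1 := fun t => by simp [legF, hC]
        rw [hP, hl0, h00, hC, add_mul, Finset.sum_mul]
        simp only [Polynomial.eval_C]
        congr 1
        · ring
        · exact Finset.sum_congr rfl fun l _ => by ring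
      have ii : ∀ l, Integrable (fun v : Sph n => legF n l ⟪u, (v : En n)⟫_ℝ *
          legF n m ⟪u, (v : En n)⟫_ℝ) (sphVol n) := fun l =>
        integrable_sph (contMul (continuous_legF_sph l u) (continuous_legF_sph m u))
      rw [sph_integral_congr e6, integral_add ((ii 0).const_mul _)
        (integrable_finsetSum _ fun l _ => (ii l).const_mul _), integral_const_mul, i1,
        merid_legF_orthogonal hn (by omega : 0 ≠ m), integral_finsetSum _ fun l _ => (ii l).const_mul _,
        Finset.sum_eq_single m]
      · rw [integral_const_mul, i1]
        ring
      · intro l _ hl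
        rw [integral_const_mul, i1, merid_legF_orthogonal hn hl]
        ring
      · exact fun h => absurd hm h
    rw [← e5]
    exact hq m (hs m hm)

/-- An `L²` operator bound for even continuous zonal kernels on mean-zero functions. -/
theorem zonalT_l2 [NeZero n] (hn : 3 ≤ n) {κ : ℝ → ℝ} (hκ : Continuous κ) (he : ∀ t, κ (-t) = κ t) {q : ℝ}
    (hq : ∀ m, 1 ≤ m → |sliceC n * merid n fun t => κ t * legF n m t| ≤ q)
    {φ : Sph n → ℝ} (hφ : Continuous φ) (h0 : ∫ v, φ v ∂(sphVol n) = 0) :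
    ∫ u : Sph n, zonalT κ φ (u : En n) ^ 2 ∂(sphVol n) ≤ q ^ 2 * ∫ v, φ v ^ 2 ∂(sphVol n) := by
  obtain ⟨C, hC0, hC⟩ := exists_sph_bound hφ
  obtain ⟨B, hB0, hB⟩ := exists_sph_bound (continuous_zonalT hκ hφ)
  set V := (sphVol n).real Set.univ with hV
  have hV0 : 0 ≤ V := measureReal_nonneg
  have two : 2 ≤ n := by omega
  obtain ⟨u₀, hu₀⟩ : ∃ u : En n, ‖u‖ = 1 := ⟨EuclideanSpace.single ⟨0, by omega⟩ 1, by simp⟩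
  have key : ∀ ε > 0, ∫ u : Sph n, zonalT κ φ (u : En n) ^ 2 ∂(sphVol n) ≤
      (q + ε * V) ^ 2 * (∫ v, φ v ^ 2 ∂(sphVol n)) + (2 * B * (ε * C * V)) * V := by
    intro ε hε
    obtain ⟨P, hP⟩ := exists_even_poly_near hκ he hε
    have cP := continuous_eval_sq P
    have hd : ∀ u : Sph n, |zonalT κ φ (u : En n) - zonalT (fun t => P.eval (t ^ 2)) φ (u : En n)| ≤ ε * C * V := by
      intro u
      unfold zonalT
      rw [← integral_sub (integrable_sph (contMul (continuous_profile hκ u) hφ))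
        (integrable_sph (contMul (continuous_profile cP u) hφ))]
      refine abs_integral_sph_le fun v => ?_
      rw [← sub_mul, abs_mul, abs_sub_comm]
      exact mul_le_mul (hP _ (abs_inner_sph_le (norm_sph u) v)).le (hC v) (abs_nonneg _) hε.le
    have hqP : ∀ m, 1 ≤ m → |sliceC n * merid n fun t => P.eval (t ^ 2) * legF n m t| ≤ q + ε * V := by
      intro m hm
      have h1 : |(sliceC n * merid n fun t => P.eval (t ^ 2) * legF n m t) -
          sliceC n * merid n fun t => κ t * legF n m t| ≤ ε * V := by
        rw [← sph_slice two hu₀ (contMul cP (continuous_legF m)) fun t => by simp only [neg_sq, legF_neg],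
          ← sph_slice two hu₀ (contMul hκ (continuous_legF m)) fun t => by simp only [he, legF_neg],
          ← integral_sub (integrable_sph (contMul (continuous_profile cP u₀) (continuous_legF_sph m u₀)))
          (integrable_sph (contMul (continuous_profile hκ u₀) (continuous_legF_sph m u₀)))]
        refine abs_integral_sph_le fun v => ?_
        have hv := abs_inner_sph_le hu₀ v
        rw [← sub_mul, abs_mul]
        calc _ ≤ ε * 1 := mul_le_mul (hP _ hv).le (legF_abs_le_one hn hm hv) (abs_nonneg _) hε.le
          _ = ε := mul_one ε
      have h2 := hq m hm
      rw [abs_le] at h1 h2 ⊢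
      constructor <;> linarith [h1.1, h1.2, h2.1, h2.2]
    have hpt : ∀ u : Sph n, zonalT κ φ (u : En n) ^ 2 - zonalT (fun t => P.eval (t ^ 2)) φ (u : En n) ^ 2 ≤
        2 * B * (ε * C * V) := by
      intro u
      have h1 := hd u
      have h2 := hB u
      rw [Real.norm_eq_abs] at h2
      set x := zonalT κ φ (u : En n)
      set y := zonalT (fun t => P.eval (t ^ 2)) φ (u : En n)
      calc x ^ 2 - y ^ 2 ≤ 2 * (x * (x - y)) := by nlinarith [sq_nonneg (x - y)]
        _ ≤ 2 * (|x| * |x - y|) := by rw [← abs_mul]; linarith [le_abs_self (x * (x - y))]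
        _ ≤ 2 * (B * (ε * C * V)) := by gcongr
        _ = _ := by ring
    have h1 := zonalT_poly_l2 hn P hqP hφ h0
    have h2 : (∫ u : Sph n, zonalT κ φ (u : En n) ^ 2 ∂(sphVol n)) -
        ∫ u : Sph n, zonalT (fun t => P.eval (t ^ 2)) φ (u : En n) ^ 2 ∂(sphVol n) ≤ (2 * B * (ε * C * V)) * V := by
      rw [← integral_sub (integrable_sph (contPow (continuous_zonalT hκ hφ) 2))
        (integrable_sph (contPow (continuous_zonalT cP hφ) 2))]
      calc _ ≤ ∫ _ : Sph n, 2 * B * (ε * C * V) ∂(sphVol n) := integral_mono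
            (integrable_sph (Continuous.sub (contPow (continuous_zonalT hκ hφ) 2)
              (contPow (continuous_zonalT cP hφ) 2))) (integrable_const _) hpt
        _ = _ := by rw [integral_const, smul_eq_mul, mul_comm]
    linarith
  set Φ2 := ∫ v, φ v ^ 2 ∂(sphVol n)
  have hcont : Continuous fun ε : ℝ => (q + ε * V) ^ 2 * Φ2 + (2 * B * (ε * C * V)) * V := by fun_prop
  have hlim := (hcont.tendsto 0).mono_left (nhdsWithin_le_nhds (s := Set.Ioi 0))
  simp only [zero_mul, add_zero, mul_zero] at hlim
  exact ge_of_tendsto hlim (eventually_mem_nhdsWithin.mono fun ε hε => key ε hε)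

/-- The reflection exchanging the unit vector `v` and the pole. -/
def poleRefl (v : En n) : En n ≃ₗᵢ[ℝ] En n := (ℝ ∙ (v - pole n))ᗮ.reflection

theorem norm_pole [NeZero n] : ‖pole n‖ = 1 := by
  rw [pole, dif_pos (Nat.pos_of_ne_zero (NeZero.ne n))]
  simp

theorem poleRefl_self [NeZero n] {v : En n} (hv : ‖v‖ = 1) : poleRefl v v = pole n :=
  Submodule.reflection_sub (hv.trans norm_pole.symm)

theorem poleRefl_symm (v : En n) : (poleRefl v).symm = poleRefl v := Submodule.reflection_symm

theorem poleRefl_apply (v x : En n) :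
    poleRefl v x = x - (2 * (⟪v - pole n, x⟫_ℝ / ‖v - pole n‖ ^ 2)) • (v - pole n) := by
  rw [poleRefl, Submodule.reflection_orthogonal_apply, Submodule.reflection_singleton_apply, neg_sub,
    mul_smul, ofNat_smul_eq_nsmul ℝ 2]
  rfl

theorem inner_poleRefl_pole [NeZero n] {v : En n} (hv : ‖v‖ = 1) (x : En n) :
    ⟪poleRefl v x, pole n⟫_ℝ = ⟪x, v⟫_ℝ := by
  rw [← poleRefl_self hv, LinearIsometryEquiv.inner_map_map]

/-- The sphere with the pole removed. -/
def offPole (n : ℕ) : Set (Sph n) := {v | (v : En n) - pole n ≠ 0}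

theorem measurableSet_offPole : MeasurableSet (offPole n) :=
  (isOpen_ne.preimage (continuous_subtype_val.sub continuous_const)).measurableSet

theorem ae_offPole [NeZero n] (hn : 2 ≤ n) : ∀ᵐ v ∂(sphVol n), v ∈ offPole n := by
  set p : Sph n := ⟨pole n, by simpa using norm_pole⟩ with hp
  have h0 : sphVol n {p} = 0 := by
    rw [sphVol, Measure.toSphere_apply' _ (measurableSet_singleton p)]
    have hsub : Set.Ioo (0 : ℝ) 1 • ((fun x : Sph n => (x : En n)) '' {p}) ⊆
        ((ℝ ∙ pole n : Submodule ℝ (En n)) : Set (En n)) := by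
      rintro _ ⟨r, -, _, ⟨q, rfl, rfl⟩, rfl⟩
      exact Submodule.smul_mem _ r (Submodule.mem_span_singleton_self _)
    have htop : (ℝ ∙ pole n : Submodule ℝ (En n)) ≠ ⊤ := fun h => by
      have h1 := finrank_span_le_card (R := ℝ) ({pole n} : Set (En n))
      rw [h, finrank_top, finrank_euclideanSpace_fin] at h1
      simp at h1
      omega
    rw [measure_mono_null hsub (Measure.addHaar_submodule _ _ htop), mul_zero]
  have : ∀ᵐ v ∂(sphVol n), v ∉ ({p} : Set (Sph n)) := measure_eq_zero_iff_ae_notMem.1 h0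
  filter_upwards [this] with v hv h
  exact hv (Subtype.ext (sub_eq_zero.1 h))

theorem aestronglyMeasurable_offPole [NeZero n] (hn : 2 ≤ n) {E : Type*} [NormedAddCommGroup E] {f : Sph n → E}
    (hf : ContinuousOn f (offPole n)) : AEStronglyMeasurable f (sphVol n) := by
  have := hf.aestronglyMeasurable (μ := sphVol n) measurableSet_offPole
  rwa [Measure.restrict_eq_self_of_ae_mem (ae_offPole hn)] at this

theorem continuousOn_poleRefl {f : Sph n → En n} (hf : ContinuousOn f (offPole n)) :
    ContinuousOn (fun v : Sph n => poleRefl (v : En n) (f v)) (offPole n) := by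
  simp only [poleRefl_apply]
  have h1 : ContinuousOn (fun v : Sph n => (v : En n) - pole n) (offPole n) :=
    (continuous_subtype_val.sub continuous_const).continuousOn
  refine hf.sub (ContinuousOn.smul (continuousOn_const.mul ((h1.inner hf).div (h1.norm.pow 2) ?_)) h1)
  intro v hv
  exact pow_ne_zero 2 (norm_ne_zero_iff.2 hv)

theorem hasFDerivAt_sph_integral [NeZero n] (hn : 2 ≤ n) {E : Type*} [NormedAddCommGroup E] [NormedSpace ℝ E]
    {H : En n → Sph n → E} {H' : En n → Sph n → En n →L[ℝ] E}
    (hd : ∀ x, x ≠ 0 → ∀ v, HasFDerivAt (fun y => H y v) (H' x v) x)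
    (hc : ∀ x, x ≠ 0 → ContinuousOn (H x) (offPole n))
    (hc' : ∀ x, x ≠ 0 → ContinuousOn (H' x) (offPole n))
    {B : En n → ℝ} (hb : ∀ x, x ≠ 0 → ∀ v, ‖H x v‖ ≤ B x)
    {C : ℝ} (hC : ∀ x, x ≠ 0 → ∀ v, ‖H' x v‖ ≤ C * (1 + ‖x‖⁻¹)) {x : En n} (hx : x ≠ 0) :
    HasFDerivAt (fun y => ∫ v, H y v ∂(sphVol n)) (∫ v, H' x v ∂(sphVol n)) x := by
  have hx0 : 0 < ‖x‖ := norm_pos_iff.2 hx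
  have hs : {y : En n | ‖x‖ / 2 < ‖y‖} ∈ 𝓝 x :=
    (isOpen_lt continuous_const continuous_norm).mem_nhds (show ‖x‖ / 2 < ‖x‖ by linarith)
  have hne : ∀ y ∈ {y : En n | ‖x‖ / 2 < ‖y‖}, y ≠ 0 := fun y hy h => by
    simp only [Set.mem_ofPred_eq, h, norm_zero] at hy
    linarith
  refine hasFDerivAt_integral_of_dominated_of_fderiv_le (𝕜 := ℝ) (s := {y : En n | ‖x‖ / 2 < ‖y‖})
    (bound := fun _ => |C| * (1 + (‖x‖ / 2)⁻¹)) hs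
    (Filter.mem_of_superset hs fun y hy => aestronglyMeasurable_offPole hn (hc y (hne y hy)))
    (Integrable.of_bound (aestronglyMeasurable_offPole hn (hc x hx)) (B x) (Eventually.of_forall (hb x hx)))
    (aestronglyMeasurable_offPole hn (hc' x hx)) (Eventually.of_forall fun v y hy => ?_)
    (integrable_const _) (Eventually.of_forall fun v y hy => hd y (hne y hy) v)
  refine (hC y (hne y hy) v).trans ?_
  have h1 : ‖y‖⁻¹ ≤ (‖x‖ / 2)⁻¹ := inv_anti₀ (by linarith) (le_of_lt hy)
  have h2 : (0 : ℝ) ≤ ‖y‖⁻¹ := inv_nonneg.2 (norm_nonneg y)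
  calc C * (1 + ‖y‖⁻¹) ≤ |C| * (1 + ‖y‖⁻¹) := mul_le_mul_of_nonneg_right (le_abs_self C) (by linarith)
    _ ≤ _ := mul_le_mul_of_nonneg_left (by linarith) (abs_nonneg C)

/-- Average of the reflected copies of `N`, with weight `ψ`. -/
def avg (N : En n → ℝ) (ψ : Sph n → ℝ) (x : En n) : ℝ :=
  ∫ v : Sph n, ψ v * N (poleRefl (v : En n) x) ∂(sphVol n)

namespace IsC2Hom

variable {N : En n → ℝ} {ψ : Sph n → ℝ}

theorem exists_bound (h : IsC2Hom N) : ∃ C : ℝ, 0 ≤ C ∧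
    (∀ x, x ≠ 0 → |N x| ≤ C * ‖x‖) ∧ (∀ x, x ≠ 0 → ‖gradient N x‖ ≤ C) ∧
    ∀ x, x ≠ 0 → ‖hess N x‖ ≤ C * ‖x‖⁻¹ := by
  obtain ⟨C2, h2, b2⟩ := exists_sph_bound h.continuous_hess_sph
  have cg : Continuous fun u : Sph n => gradient N (u : En n) := continuous_iff_continuousAt.2 fun u =>
    ContinuousAt.comp (g := gradient N) (h.continuousAt_gradient (ne_zero_of_sph u))
      continuous_subtype_val.continuousAt
  have c0 : Continuous fun u : Sph n => N (u : En n) := continuous_iff_continuousAt.2 fun u =>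
    ContinuousAt.comp (g := N) (h.differentiableAt (ne_zero_of_sph u)).continuousAt
      continuous_subtype_val.continuousAt
  obtain ⟨C1, h1, b1⟩ := exists_sph_bound cg
  obtain ⟨C0, h0, b0⟩ := exists_sph_bound c0
  have hu : ∀ x : En n, x ≠ 0 → ∃ u : Sph n, x = ‖x‖ • (u : En n) := fun x hx =>
    ⟨⟨‖x‖⁻¹ • x, by simp [norm_smul, hx]⟩, by simp [smul_smul, hx]⟩
  refine ⟨C0 + C1 + C2, by positivity, fun x hx => ?_, fun x hx => ?_, fun x hx => ?_⟩ <;>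
  · obtain ⟨u, hxu⟩ := hu x hx
    have hx0 : 0 < ‖x‖ := norm_pos_iff.2 hx
    first
    | have hN : N x = ‖x‖ * N (u : En n) := by rw [← h.hom _ hx0, ← hxu]
      have := b0 u
      rw [Real.norm_eq_abs] at this
      rw [hN, abs_mul, abs_of_pos hx0, mul_comm]
      exact mul_le_mul_of_nonneg_right (by linarith) hx0.le
    | have hN : gradient N x = gradient N (u : En n) := by
        rw [← h.gradient_smul (ne_zero_of_sph u) hx0, ← hxu]
      rw [hN]
      exact (b1 u).trans (by linarith)
    | have hN : hess N x = ‖x‖⁻¹ • hess N (u : En n) := by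
        rw [← h.hess_smul (ne_zero_of_sph u) hx0, ← hxu]
      rw [hN, norm_smul, norm_inv, norm_norm, mul_comm]
      exact mul_le_mul_of_nonneg_right ((b2 u).trans (by linarith)) (inv_nonneg.2 hx0.le)

theorem norm_gradient_comp (h : IsC2Hom N) (ρ : En n ≃ₗᵢ[ℝ] En n) {x : En n} (hx : x ≠ 0) :
    ‖gradient (fun y => N (ρ y)) x‖ = ‖gradient N (ρ x)‖ := by
  rw [h.gradient_comp_isometry ρ hx, LinearIsometryEquiv.norm_map]

theorem norm_hess_comp_le (h : IsC2Hom N) (ρ : En n ≃ₗᵢ[ℝ] En n) {x : En n} (hx : x ≠ 0) :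
    ‖hess (fun y => N (ρ y)) x‖ ≤ ‖hess N (ρ x)‖ := by
  refine ContinuousLinearMap.opNorm_le_bound _ (norm_nonneg _) fun v => ?_
  rw [h.hess_comp_isometry ρ hx, LinearIsometryEquiv.norm_map]
  refine (ContinuousLinearMap.le_opNorm _ _).trans ?_
  rw [LinearIsometryEquiv.norm_map]

theorem norm_fderiv (h : IsC2Hom N) {x : En n} (hx : x ≠ 0) : ‖fderiv ℝ N x‖ = ‖gradient N x‖ := by
  rw [gradient, LinearIsometryEquiv.norm_map]



theorem continuousOn_comp_refl (h : IsC2Hom N) {x : En n} (hx : x ≠ 0) :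
    ContinuousOn (fun v : Sph n => N (poleRefl (v : En n) x)) (offPole n) := fun v hv =>
  ContinuousAt.comp_continuousWithinAt (g := N) (h.differentiableAt (by simpa using hx)).continuousAt
    (continuousOn_poleRefl continuousOn_const v hv)

theorem continuousOn_gradient_refl (h : IsC2Hom N) {x : En n} (hx : x ≠ 0) :
    ContinuousOn (fun v : Sph n => gradient (fun y => N (poleRefl (v : En n) y)) x) (offPole n) := by
  simp only [h.gradient_comp_isometry _ hx, poleRefl_symm]
  exact continuousOn_poleRefl fun v hv => ContinuousAt.comp_continuousWithinAt (g := gradient N)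
    (h.continuousAt_gradient (by simpa using hx)) (continuousOn_poleRefl continuousOn_const v hv)

theorem continuousOn_fderiv_refl (h : IsC2Hom N) {x : En n} (hx : x ≠ 0) :
    ContinuousOn (fun v : Sph n => fderiv ℝ (fun y => N (poleRefl (v : En n) y)) x) (offPole n) := by
  refine continuousOn_clm_apply.2 fun w => ?_
  simp only [← inner_gradient]
  exact (h.continuousOn_gradient_refl hx).inner continuousOn_const

theorem continuousOn_hess_refl (h : IsC2Hom N) {x : En n} (hx : x ≠ 0) :
    ContinuousOn (fun v : Sph n => hess (fun y => N (poleRefl (v : En n) y)) x) (offPole n) := by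
  refine continuousOn_clm_apply.2 fun w => ?_
  simp only [h.hess_comp_isometry _ hx, poleRefl_symm]
  refine continuousOn_poleRefl (ContinuousOn.clm_apply (fun v hv =>
    ContinuousAt.comp_continuousWithinAt (g := hess N)
    (h.continuousAt_hess (by simpa using hx)) (continuousOn_poleRefl continuousOn_const v hv))
    (continuousOn_poleRefl continuousOn_const))

end IsC2Hom

namespace IsC2Hom

variable {N : En n → ℝ} {ψ : Sph n → ℝ}

theorem exists_refl_bound (h : IsC2Hom N) : ∃ C : ℝ, 0 ≤ C ∧ ∀ x, x ≠ 0 → ∀ v : En n,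
    |N (poleRefl v x)| ≤ C * ‖x‖ ∧ ‖gradient (fun y => N (poleRefl v y)) x‖ ≤ C ∧
      ‖fderiv ℝ (fun y => N (poleRefl v y)) x‖ ≤ C ∧
      ‖hess (fun y => N (poleRefl v y)) x‖ ≤ C * ‖x‖⁻¹ := by
  obtain ⟨C, hC, b0, b1, b2⟩ := h.exists_bound
  refine ⟨C, hC, fun x hx v => ?_⟩
  have hr : poleRefl v x ≠ 0 := by simpa using hx
  have hg : ‖gradient (fun y => N (poleRefl v y)) x‖ ≤ C := by
    rw [h.norm_gradient_comp _ hx]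
    exact b1 _ hr
  refine ⟨by simpa using b0 _ hr, hg, ?_, ?_⟩
  · rwa [(h.comp_isometry (poleRefl v)).norm_fderiv hx]
  · have := (h.norm_hess_comp_le (poleRefl v) hx).trans (b2 _ hr)
    rwa [LinearIsometryEquiv.norm_map] at this

theorem integrable_refl [NeZero n] (hn : 2 ≤ n) {E : Type*} [NormedAddCommGroup E] [NormedSpace ℝ E]
    (hψ : Continuous ψ) {f : Sph n → E} (hf : ContinuousOn f (offPole n)) {C : ℝ} (hC : ∀ v, ‖f v‖ ≤ C) :
    Integrable (fun v => ψ v • f v) (sphVol n) := by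
  obtain ⟨D, hD, bD⟩ := exists_sph_bound hψ
  refine Integrable.of_bound (aestronglyMeasurable_offPole hn (hψ.continuousOn.smul hf)) (D * C)
    (Eventually.of_forall fun v => ?_)
  rw [norm_smul]
  exact mul_le_mul (bD v) (hC v) (norm_nonneg _) hD

theorem hasFDerivAt_avg [NeZero n] (hn : 2 ≤ n) (h : IsC2Hom N) (hψ : Continuous ψ) {x : En n} (hx : x ≠ 0) :
    HasFDerivAt (avg N ψ)
      (∫ v : Sph n, ψ v • fderiv ℝ (fun y => N (poleRefl (v : En n) y)) x ∂(sphVol n)) x := by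
  obtain ⟨C, hC, hb⟩ := h.exists_refl_bound
  obtain ⟨D, hD, bD⟩ := exists_sph_bound hψ
  refine hasFDerivAt_sph_integral hn (H := fun x v => ψ v * N (poleRefl (v : En n) x))
    (H' := fun x v => ψ v • fderiv ℝ (fun y => N (poleRefl (v : En n) y)) x)
    (fun y hy v => ((h.comp_isometry (poleRefl (v : En n))).differentiableAt hy).hasFDerivAt.const_mul (ψ v))
    (fun y hy => hψ.continuousOn.mul (h.continuousOn_comp_refl hy))
    (fun y hy => hψ.continuousOn.smul (h.continuousOn_fderiv_refl hy))
    (B := fun y => D * (C * ‖y‖)) (fun y hy v => ?_) (C := D * C) (fun y hy v => ?_) hx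
  · rw [norm_mul]
    exact mul_le_mul (bD v) (hb y hy v).1 (norm_nonneg _) hD
  · rw [norm_smul]
    refine (mul_le_mul (bD v) (hb y hy v).2.2.1 (norm_nonneg _) hD).trans ?_
    have : (0 : ℝ) ≤ ‖y‖⁻¹ := inv_nonneg.2 (norm_nonneg y)
    nlinarith [mul_nonneg (mul_nonneg hD hC) this]

theorem gradient_avg [NeZero n] (hn : 2 ≤ n) (h : IsC2Hom N) (hψ : Continuous ψ) {x : En n} (hx : x ≠ 0) :
    gradient (avg N ψ) x =
      ∫ v : Sph n, ψ v • gradient (fun y => N (poleRefl (v : En n) y)) x ∂(sphVol n) := by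
  obtain ⟨C, hC, hb⟩ := h.exists_refl_bound
  refine ext_inner_right ℝ fun w => ?_
  have i1 : Integrable (fun v : Sph n => ψ v • fderiv ℝ (fun y => N (poleRefl (v : En n) y)) x) (sphVol n) :=
    integrable_refl hn hψ (h.continuousOn_fderiv_refl hx) fun v => (hb x hx v).2.2.1
  have i2 : Integrable (fun v : Sph n => ψ v • gradient (fun y => N (poleRefl (v : En n) y)) x) (sphVol n) :=
    integrable_refl hn hψ (h.continuousOn_gradient_refl hx) fun v => (hb x hx v).2.1
  rw [inner_gradient, (h.hasFDerivAt_avg hn hψ hx).fderiv, ContinuousLinearMap.integral_apply i1,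
    real_inner_comm, ← integral_inner i2]
  refine integral_congr_ae (Eventually.of_forall fun v => ?_)
  simp only [smul_apply, real_inner_smul_right, smul_eq_mul]
  rw [real_inner_comm, inner_gradient]

theorem hasFDerivAt_gradient_avg [NeZero n] (hn : 2 ≤ n) (h : IsC2Hom N) (hψ : Continuous ψ) {x : En n}
    (hx : x ≠ 0) : HasFDerivAt (gradient (avg N ψ))
      (∫ v : Sph n, ψ v • hess (fun y => N (poleRefl (v : En n) y)) x ∂(sphVol n)) x := by
  obtain ⟨C, hC, hb⟩ := h.exists_refl_bound
  obtain ⟨D, hD, bD⟩ := exists_sph_bound hψ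
  have key := hasFDerivAt_sph_integral hn
    (H := fun x (v : Sph n) => ψ v • gradient (fun y => N (poleRefl (v : En n) y)) x)
    (H' := fun x (v : Sph n) => ψ v • hess (fun y => N (poleRefl (v : En n) y)) x)
    (fun y hy v => ((h.comp_isometry (poleRefl (v : En n))).hasFDerivAt_gradient hy).const_smul (ψ v))
    (fun y hy => hψ.continuousOn.smul (h.continuousOn_gradient_refl hy))
    (fun y hy => hψ.continuousOn.smul (h.continuousOn_hess_refl hy))
    (B := fun y => D * C) (fun y hy v => ?_) (C := D * C) (fun y hy v => ?_) hx
  · refine key.congr_of_eventuallyEq ?_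
    filter_upwards [isOpen_ne.mem_nhds hx] with y hy
    exact h.gradient_avg hn hψ hy
  · rw [norm_smul]
    exact mul_le_mul (bD v) (hb y hy v).2.1 (norm_nonneg _) hD
  · rw [norm_smul]
    refine (mul_le_mul (bD v) (hb y hy v).2.2.2 (norm_nonneg _) hD).trans ?_
    nlinarith [mul_nonneg hD hC]

theorem hess_avg [NeZero n] (hn : 2 ≤ n) (h : IsC2Hom N) (hψ : Continuous ψ) {x : En n}
    (hx : x ≠ 0) : hess (avg N ψ) x =
      ∫ v : Sph n, ψ v • hess (fun y => N (poleRefl (v : En n) y)) x ∂(sphVol n) :=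
  (h.hasFDerivAt_gradient_avg hn hψ hx).fderiv

theorem continuousAt_hess_avg [NeZero n] (hn : 2 ≤ n) (h : IsC2Hom N) (hψ : Continuous ψ) {x : En n}
    (hx : x ≠ 0) : ContinuousAt (hess (avg N ψ)) x := by
  obtain ⟨C, hC, hb⟩ := h.exists_refl_bound
  obtain ⟨D, hD, bD⟩ := exists_sph_bound hψ
  have hx0 : 0 < ‖x‖ := norm_pos_iff.2 hx
  have hs : {y : En n | ‖x‖ / 2 < ‖y‖} ∈ 𝓝 x :=
    (isOpen_lt continuous_const continuous_norm).mem_nhds (show ‖x‖ / 2 < ‖x‖ by linarith)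
  have hne : ∀ y ∈ {y : En n | ‖x‖ / 2 < ‖y‖}, y ≠ 0 := fun y hy h => by
    simp only [Set.mem_ofPred_eq, h, norm_zero] at hy
    linarith
  have key : ContinuousAt (fun x =>
      ∫ v : Sph n, ψ v • hess (fun y => N (poleRefl (v : En n) y)) x ∂(sphVol n)) x := by
    refine continuousAt_of_dominated (bound := fun _ => D * (C * (‖x‖ / 2)⁻¹)) ?_ ?_ (integrable_const _) ?_
    · filter_upwards [hs] with y hy
      exact aestronglyMeasurable_offPole hn (hψ.continuousOn.smul (h.continuousOn_hess_refl (hne y hy)))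
    · filter_upwards [hs] with y hy
      refine Eventually.of_forall fun v => ?_
      rw [norm_smul]
      refine mul_le_mul (bD v) (((hb y (hne y hy) v).2.2.2).trans ?_) (norm_nonneg _) hD
      exact mul_le_mul_of_nonneg_left (inv_anti₀ (by linarith) (le_of_lt hy)) hC
    · exact Eventually.of_forall fun v =>
        ContinuousAt.const_smul ((h.comp_isometry (poleRefl (v : En n))).continuousAt_hess hx) (ψ v)
  refine key.congr ?_
  filter_upwards [isOpen_ne.mem_nhds hx] with y hy
  exact (h.hess_avg hn hψ hy).symm

theorem isC2Hom_avg [NeZero n] (hn : 2 ≤ n) (h : IsC2Hom N) (hψ : Continuous ψ) : IsC2Hom (avg N ψ) := by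
  have ho : IsOpen ({0}ᶜ : Set (En n)) := isOpen_compl_singleton
  refine ⟨?_, fun c hc x => ?_⟩
  · have hG : ContDiffOn ℝ 1 (gradient (avg N ψ)) {0}ᶜ := by
      rw [show (1 : WithTop ℕ∞) = 0 + 1 from rfl, contDiffOn_succ_iff_fderiv_of_isOpen ho]
      refine ⟨fun x hx => (h.hasFDerivAt_gradient_avg hn hψ hx).differentiableAt.differentiableWithinAt,
        by simp, ?_⟩
      rw [contDiffOn_zero]
      exact fun x hx => (h.continuousAt_hess_avg hn hψ hx).continuousWithinAt
    rw [show (2 : WithTop ℕ∞) = 1 + 1 from by norm_num, contDiffOn_succ_iff_fderiv_of_isOpen ho]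
    refine ⟨fun x hx => (h.hasFDerivAt_avg hn hψ hx).differentiableAt.differentiableWithinAt, by simp, ?_⟩
    refine ((innerSL ℝ (E := En n)).contDiff.comp_contDiffOn hG).congr fun x _ => ?_
    ext w
    exact (inner_gradient _ _ _).symm
  · simp only [avg, map_smul, h.hom c hc]
    rw [← integral_const_mul]
    refine integral_congr_ae (Eventually.of_forall fun v => ?_)
    simp only
    ring

theorem exists_avg_bound [NeZero n] (hn : 2 ≤ n) (h : IsC2Hom N) : ∃ C : ℝ, 0 ≤ C ∧
    ∀ ψ : Sph n → ℝ, Continuous ψ → ∀ u : Sph n,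
      |avg N ψ u| ≤ C * ∫ v, |ψ v| ∂(sphVol n) ∧ ‖hess (avg N ψ) u‖ ≤ C * ∫ v, |ψ v| ∂(sphVol n) := by
  obtain ⟨C, hC, hb⟩ := h.exists_refl_bound
  refine ⟨C, hC, fun ψ hψ u => ⟨?_, ?_⟩⟩
  · rw [avg, ← integral_const_mul, ← Real.norm_eq_abs]
    refine norm_integral_le_of_norm_le ((integrable_sph hψ.abs).const_mul C)
      (Eventually.of_forall fun v => ?_)
    have := (hb u (ne_zero_of_sph u) v).1
    rw [norm_sph u, mul_one] at this
    rw [norm_mul, mul_comm]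
    exact mul_le_mul_of_nonneg_right this (abs_nonneg _)
  · rw [h.hess_avg hn hψ (ne_zero_of_sph u), ← integral_const_mul]
    refine norm_integral_le_of_norm_le ((integrable_sph hψ.abs).const_mul C)
      (Eventually.of_forall fun v => ?_)
    have := (hb u (ne_zero_of_sph u) v).2.2.2
    rw [norm_sph u, inv_one, mul_one] at this
    rw [norm_smul, mul_comm]
    exact mul_le_mul_of_nonneg_right this (abs_nonneg _)

end IsC2Hom

/-- A continuous even function which is invariant under the isometries fixing the pole
depends only on the height over the equator. -/
theorem exists_profile [NeZero n] (hn : 2 ≤ n) {F : En n → ℝ} (hc : ContinuousOn F {0}ᶜ)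
    (he : ∀ x, F (-x) = F x)
    (hinv : ∀ ρ : En n ≃ₗᵢ[ℝ] En n, ρ (pole n) = pole n → ∀ x, F (ρ x) = F x) :
    ∃ κ : ℝ → ℝ, Continuous κ ∧ (∀ t, κ (-t) = κ t) ∧ ∀ u : En n, ‖u‖ = 1 → F u = κ ⟪u, pole n⟫_ℝ := by
  obtain ⟨e, hne, hpe⟩ := exists_unit_perp hn (pole n)
  have hpole : ⟪pole n, pole n⟫_ℝ = 1 := by rw [real_inner_self_eq_norm_sq, norm_pole, one_pow]
  refine ⟨fun t => F (t • pole n + √(1 - t ^ 2) • e), ?_, fun t => ?_, fun u hu => ?_⟩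
  · have cv : Continuous fun t : ℝ => t • pole n + √(1 - t ^ 2) • e := by fun_prop
    refine continuous_iff_continuousAt.2 fun t => ?_
    refine ContinuousAt.comp (g := F) (hc.continuousAt (isOpen_compl_singleton.mem_nhds ?_))
      cv.continuousAt
    intro h0
    have h1 : ⟪pole n, t • pole n + √(1 - t ^ 2) • e⟫_ℝ = 0 := by
      rw [Set.mem_singleton_iff.1 h0, inner_zero_right]
    rw [inner_add_right, real_inner_smul_right, real_inner_smul_right, hpole, hpe] at h1
    have ht : t = 0 := by linarith
    subst ht
    have h2 : e = 0 := by simpa using h0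
    simp [h2] at hne
  · obtain ⟨ρ, h1, h2⟩ := exists_isometry_pair hn norm_pole hne hpe norm_pole
      (by rwa [norm_neg] : ‖-e‖ = 1) (by rw [inner_neg_right, hpe, neg_zero])
    simp only
    rw [← he, ← hinv ρ h1]
    congr 1
    simp [h1, h2, add_comm]
  · obtain ⟨e', hne', hpe', hu'⟩ := exists_unit_decomp hn norm_pole hu
    obtain ⟨ρ, h1, h2⟩ := exists_isometry_pair hn norm_pole hne' hpe' norm_pole hne hpe
    simp only
    rw [real_inner_comm]
    conv_lhs => rw [← hinv ρ h1, hu']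
    simp [h1, h2]

theorem mixedDens_neg [NeZero n] {Ks Ls : Fin n → ConvexBody (En n)} (hK : ∀ k, IsC2Hom (supp (Ks k)))
    (h : ∀ k x, supp (Ls k) x = supp (Ks k) (-x)) {u : En n} (hu : u ≠ 0) :
    mixedDens Ls u = mixedDens Ks (-u) := by
  have hh : ∀ k, hess (supp (Ls k)) u = hess (supp (Ks k)) (-u) := fun k => by
    ext1 v
    have h1 : supp (Ls k) = fun x => supp (Ks k) ((LinearIsometryEquiv.neg ℝ : En n ≃ₗᵢ[ℝ] En n) x) := by
      ext x
      simp [h]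
    rw [h1, (hK k).hess_comp_isometry _ hu]
    simp
  have hr : rankOne (-u) (-u) = rankOne u u := by
    ext1 v
    simp [rankOne]
  simp only [mixedDens, hh, hr]

theorem areaDens_neg [NeZero n] {K : ConvexBody (En n)} (hK : IsC2Hom (supp K)) (i : ℕ) {u : En n}
    (hu : u ≠ 0) : areaDens i (scale (-1) K) u = areaDens i K (-u) := by
  refine mixedDens_neg (isC2Hom_areaFam hK i) (fun k x => ?_) hu
  split_ifs
  · exact supp_neg K x
  · simp [supp_ball]

/-- Support functions of smooth origin symmetric bodies of revolution. -/
structure IsAxial (h : En n → ℝ) : Prop where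
  hom : IsC2Hom h
  smooth : ContDiffOn ℝ ((⊤ : ℕ∞) : WithTop ℕ∞) h {0}ᶜ
  even : ∀ x, h (-x) = h x
  inv : ∀ ρ : En n ≃ₗᵢ[ℝ] En n, ρ (pole n) = pole n → ∀ x, h (ρ x) = h x
  subadd : ∀ x y, h (x + y) ≤ h x + h y
  pos : ∀ u w : En n, ‖u‖ = 1 → w ≠ 0 → ⟪u, w⟫_ℝ = 0 → 0 < ⟪hess h u w, w⟫_ℝ

/-- An even regular Minkowski valuation is generated by an even smooth kernel. -/
theorem exists_even_kernel [NeZero n] (hn : 2 ≤ n) {i : ℕ} {Φ : ConvexBody (En n) → ConvexBody (En n)}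
    (heven : IsEven Φ) (hreg : CInfRegular i Φ) :
    ∃ (h : En n → ℝ) (κ : ℝ → ℝ), IsAxial h ∧ Continuous κ ∧ (∀ t, κ (-t) = κ t) ∧
      (∀ u : En n, ‖u‖ = 1 → h u = κ ⟪u, pole n⟫_ℝ) ∧
      ∀ K : ConvexBody (En n), IsC2Hom (supp K) → (∀ u : Sph n, 0 ≤ areaDens i K u) →
        ∀ u : En n, ‖u‖ = 1 →
          supp (Φ K) u = ∫ v : Sph n, κ ⟪u, (v : En n)⟫_ℝ * areaDens i K v ∂(sphVol n) := by
  obtain ⟨L, g, -, ⟨hsm, hpos⟩, hLg, hgen⟩ := hreg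
  set ν : En n ≃ₗᵢ[ℝ] En n := LinearIsometryEquiv.neg ℝ with hν
  have hνx : ∀ x : En n, ν x = -x := fun x => rfl
  have hL : IsC2Hom (supp L) := isC2Hom_supp (hsm.of_le (WithTop.coe_le_coe.2 (le_top : (2 : ℕ∞) ≤ ⊤)))
  have hL' : IsC2Hom fun x => supp L (ν x) := hL.comp_isometry ν
  have hne : ∀ {u : En n}, ‖u‖ = 1 → u ≠ 0 := fun hu h0 => by simp [h0] at hu
  set h : En n → ℝ := fun x => (1 / 2) * supp L x + (1 / 2) * supp L (ν x) with hh
  have hhom : IsC2Hom h := (hL.const_mul _).add (hL'.const_mul _)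
  have hinvL : ∀ ρ : En n ≃ₗᵢ[ℝ] En n, ρ (pole n) = pole n → ∀ x, supp L (ρ x) = supp L x := by
    intro ρ hρ x
    rcases eq_or_ne x 0 with rfl | hx
    · simp
    have hx0 : 0 < ‖x‖ := norm_pos_iff.2 hx
    have hu : ‖‖x‖⁻¹ • x‖ = 1 := by simp [norm_smul, hx]
    have hx' : x = ‖x‖ • (‖x‖⁻¹ • x) := by simp [smul_smul, hx]
    have key : supp L (ρ (‖x‖⁻¹ • x)) = supp L (‖x‖⁻¹ • x) := by
      rw [hLg _ (by rwa [LinearIsometryEquiv.norm_map]), hLg _ hu]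
      congr 1
      conv_lhs => rw [← hρ]
      rw [LinearIsometryEquiv.inner_map_map]
    rw [hx', map_smul, supp_smul L hx0.le, supp_smul L hx0.le, key]
  have hax : IsAxial h := by
    refine ⟨hhom, ?_, fun x => ?_, fun ρ hρ x => ?_, fun x y => ?_, fun u w hu hw huw => ?_⟩
    · have hm : ContDiffOn ℝ ((⊤ : ℕ∞) : WithTop ℕ∞) (fun x => supp L (ν x)) {0}ᶜ :=
        hsm.comp ν.contDiff.contDiffOn fun x hx => by simpa using hx
      exact (contDiffOn_const.mul hsm).add (contDiffOn_const.mul hm)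
    · simp only [hh, hνx, neg_neg]
      ring
    · simp only [hh, hνx, ← map_neg, hinvL ρ hρ]
    · have h1 := supp_add_le L x y
      have h2 := supp_add_le L (ν x) (ν y)
      simp only [hh, map_add]
      linarith
    · have p : ∀ u w : En n, ‖u‖ = 1 → w ≠ 0 → ⟪u, w⟫_ℝ = 0 → 0 < ⟪hess (supp L) u w, w⟫_ℝ :=
        fun u w hu hw huw => by
          rw [hL.inner_hess_eq_iterated (hne hu)]
          exact hpos u hu w hw huw
      rw [hh, (hL.const_mul _).hess_add (hL'.const_mul _) (hne hu), hL.hess_const_mul _ (hne hu),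
        hL'.hess_const_mul _ (hne hu), add_apply, smul_apply, smul_apply,
        hL.hess_comp_isometry ν (hne hu), inner_add_left, real_inner_smul_left, real_inner_smul_left,
        LinearIsometryEquiv.inner_map_eq_flip, LinearIsometryEquiv.symm_symm]
      have h1 := p u w hu hw huw
      have h2 := p (ν u) (ν w) (by simpa using hu) (by simpa using hw)
        (by rwa [LinearIsometryEquiv.inner_map_map])
      linarith
  obtain ⟨κ, hκc, hκe, hκ⟩ := exists_profile hn hhom.cd.continuousOn hax.even hax.inv
  refine ⟨h, κ, hax, hκc, hκe, hκ, fun K hK hD u hu => ?_⟩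
  have hr : ∀ v : Sph n, ‖poleRefl u v‖ = 1 := fun v => by
    rw [LinearIsometryEquiv.norm_map, norm_sph]
  have hg1 : ∀ v : Sph n, g ⟪u, (v : En n)⟫_ℝ = supp L (poleRefl u v) := fun v => by
    rw [hLg _ (hr v), inner_poleRefl_pole hu, real_inner_comm]
  have hg2 : ∀ v : Sph n, g (-⟪u, (v : En n)⟫_ℝ) = supp L (ν (poleRefl u v)) := fun v => by
    rw [hLg _ (by rw [LinearIsometryEquiv.norm_map, hr v]), hνx, inner_neg_left, inner_poleRefl_pole hu,
      real_inner_comm]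
  have hκv : ∀ v : Sph n, κ ⟪u, (v : En n)⟫_ℝ =
      (1 / 2) * g ⟪u, (v : En n)⟫_ℝ + (1 / 2) * g (-⟪u, (v : En n)⟫_ℝ) := fun v => by
    rw [hg1, hg2, real_inner_comm, ← inner_poleRefl_pole hu, ← hκ _ (hr v)]
  have hKn : IsC2Hom (supp (scale (-1) K)) := by
    have := hK.comp_isometry ν
    rwa [show (fun x => supp K (ν x)) = supp (scale (-1) K) from by
      ext x; rw [supp_neg, hνx]] at this
  have hDn : ∀ v : Sph n, 0 ≤ areaDens i (scale (-1) K) v := fun v => by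
    rw [areaDens_neg hK i (ne_zero_of_sph v)]
    exact hD ⟨-v, by simp⟩
  have e1 := supp_eq_integral hgen hK hD hu
  have e2 := supp_eq_integral hgen hKn hDn hu
  rw [heven K] at e2
  have e3 : ∫ v : Sph n, g ⟪u, (v : En n)⟫_ℝ * areaDens i (scale (-1) K) v ∂(sphVol n) =
      ∫ v : Sph n, g (-⟪u, (v : En n)⟫_ℝ) * areaDens i K v ∂(sphVol n) := by
    rw [← sph_integral_comp ν fun v => g (-⟪u, v⟫_ℝ) * areaDens i K v]
    refine sph_integral_congr fun v => ?_
    rw [areaDens_neg hK i (ne_zero_of_sph v), hνx, inner_neg_right, neg_neg]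
  rw [e3] at e2
  have c1 : Continuous fun v : Sph n => g ⟪u, (v : En n)⟫_ℝ * areaDens i K v := by
    simp only [hg1]
    exact ((continuous_supp L).comp ((poleRefl u).continuous.comp continuous_subtype_val)).mul
      (continuous_areaDens hK i)
  have c2 : Continuous fun v : Sph n => g (-⟪u, (v : En n)⟫_ℝ) * areaDens i K v := by
    simp only [hg2]
    exact ((continuous_supp L).comp (ν.continuous.comp ((poleRefl u).continuous.comp
      continuous_subtype_val))).mul (continuous_areaDens hK i)
  have e4 := sph_integral_lin c1 c2 (1 / 2) (1 / 2)
  rw [← e1, ← e2] at e4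
  rw [show supp (Φ K) u = 1 / 2 * supp (Φ K) u + 1 / 2 * supp (Φ K) u by ring, ← e4]
  refine sph_integral_congr fun v => ?_
  rw [hκv]
  ring

theorem merid_legF (hn : 3 ≤ n) {m : ℕ} (hm : 1 ≤ m) : merid n (legF n m) = 0 := by
  have h0 : ∀ t, legF n 0 t = 1 := fun t => by
    have hC : legQ n 0 = Polynomial.C 1 := by
      rw [Polynomial.eq_C_of_natDegree_eq_zero (natDegree_legQ hn 0), coeff_legQ, legCoeff]
    simp [legF, hC]
  have := merid_legF_orthogonal hn (l := 0) (m := m) (by omega)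
  simpa only [h0, one_mul] using this

/-- The one homogeneous extension of the trace of the Hessian. -/
def trKer (h : En n → ℝ) (x : En n) : ℝ := ‖x‖ ^ 2 * trL n (hess h x)

theorem trKer_sph (h : En n → ℝ) {u : En n} (hu : ‖u‖ = 1) : trKer h u = trL n (hess h u) := by
  rw [trKer, hu, one_pow, one_mul]

theorem trL_conj {A B : En n →L[ℝ] En n} (ρ : En n ≃ₗᵢ[ℝ] En n) (h : ∀ v, B v = ρ.symm (A (ρ v))) :
    trL n B = trL n A := by
  rw [trL_eq_sum B (EuclideanSpace.basisFun (Fin n) ℝ),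
    trL_eq_sum A ((EuclideanSpace.basisFun (Fin n) ℝ).map ρ)]
  refine Finset.sum_congr rfl fun j _ => ?_
  rw [h, OrthonormalBasis.map_apply, LinearIsometryEquiv.inner_map_eq_flip, LinearIsometryEquiv.symm_symm]

theorem trL_hess_comp {N : En n → ℝ} (h : IsC2Hom N) (ρ : En n ≃ₗᵢ[ℝ] En n) {x : En n} (hx : x ≠ 0) :
    trL n (hess (fun y => N (ρ y)) x) = trL n (hess N (ρ x)) :=
  trL_conj ρ (h.hess_comp_isometry ρ hx)

namespace IsAxial

variable {h : En n → ℝ}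

theorem isC2Hom_trKer (H : IsAxial h) : IsC2Hom (trKer h) := by
  have ho : IsOpen ({0}ᶜ : Set (En n)) := isOpen_compl_singleton
  refine ⟨?_, fun c hc x => ?_⟩
  · have h4 : ContDiffOn ℝ 4 h {0}ᶜ := H.smooth.of_le (WithTop.coe_le_coe.2 (le_top : (4 : ℕ∞) ≤ ⊤))
    have h3 : ContDiffOn ℝ 3 (fderiv ℝ h) {0}ᶜ := h4.fderiv_of_isOpen ho (by norm_num)
    have hg : ContDiffOn ℝ 3 (gradient h) {0}ᶜ := by
      rw [gradient_eq_comp]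
      exact (LinearIsometryEquiv.contDiff _).comp_contDiffOn h3
    have h2 : ContDiffOn ℝ 2 (hess h) {0}ᶜ := hg.fderiv_of_isOpen ho (by norm_num)
    exact (contDiff_norm_sq ℝ).contDiffOn.mul ((trL n).contDiff.comp_contDiffOn h2)
  · rcases eq_or_ne x 0 with rfl | hx
    · simp [trKer]
    · rw [trKer, trKer, H.hom.hess_smul hx hc, map_smul, norm_smul, Real.norm_of_nonneg hc.le, smul_eq_mul]
      field_simp

theorem trKer_comp (H : IsAxial h) (ρ : En n ≃ₗᵢ[ℝ] En n) (hρ : ∀ x, h (ρ x) = h x) (x : En n) :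
    trKer h (ρ x) = trKer h x := by
  rcases eq_or_ne x 0 with rfl | hx
  · simp
  · have := trL_hess_comp H.hom ρ hx
    simp only [hρ] at this
    rw [trKer, trKer, LinearIsometryEquiv.norm_map, ← this]

theorem exists_trKer_profile [NeZero n] (hn : 2 ≤ n) (H : IsAxial h) :
    ∃ κ : ℝ → ℝ, Continuous κ ∧ (∀ t, κ (-t) = κ t) ∧
      ∀ u : En n, ‖u‖ = 1 → trKer h u = κ ⟪u, pole n⟫_ℝ :=
  exists_profile hn H.isC2Hom_trKer.cd.continuousOn
    (fun x => H.trKer_comp (LinearIsometryEquiv.neg ℝ) (fun x => by simpa using H.even x) x)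
    fun ρ hρ x => H.trKer_comp ρ (H.inv ρ hρ) x

theorem inner_gradient_eq_zero (H : IsAxial h) {x f : En n} (hx : x ≠ 0)
    (hf : ⟪f, x⟫_ℝ = 0) (hp : ⟪f, pole n⟫_ℝ = 0) : ⟪gradient h x, f⟫_ℝ = 0 := by
  set ρ : En n ≃ₗᵢ[ℝ] En n := (ℝ ∙ f)ᗮ.reflection with hρ
  have fix : ∀ y, ⟪f, y⟫_ℝ = 0 → ρ y = y := fun y hy => by
    rw [hρ, Submodule.reflection_eq_self_iff, Submodule.mem_orthogonal_singleton_iff_inner_right, hy]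
  have hfl : ρ f = -f := Submodule.reflection_orthogonalComplement_singleton_eq_neg f
  have hg := H.hom.gradient_comp_isometry ρ hx
  simp only [H.inv ρ (fix _ hp), fix x hf] at hg
  have h1 : ⟪gradient h x, f⟫_ℝ = ⟪gradient h x, ρ f⟫_ℝ := by
    conv_lhs => rw [hg]
    rw [LinearIsometryEquiv.inner_map_eq_flip, LinearIsometryEquiv.symm_symm]
  rw [hfl, inner_neg_right] at h1
  linarith

end IsAxial

/-- The meridian through the unit vector `e`. -/
def merC (e : En n) (θ : ℝ) : En n := Real.cos θ • pole n + Real.sin θ • e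

/-- The velocity of the meridian through the unit vector `e`. -/
def merT (e : En n) (θ : ℝ) : En n := -Real.sin θ • pole n + Real.cos θ • e

theorem hasDerivAt_merC (e : En n) (θ : ℝ) : HasDerivAt (merC e) (merT e θ) θ :=
  ((Real.hasDerivAt_cos θ).smul_const (pole n)).add ((Real.hasDerivAt_sin θ).smul_const e)

theorem continuous_merC (e : En n) : Continuous (merC e) := by
  unfold merC
  fun_prop

theorem continuous_merT (e : En n) : Continuous (merT e) := by
  unfold merT
  fun_prop

theorem mer_decomp (e : En n) (θ : ℝ) : e = Real.sin θ • merC e θ + Real.cos θ • merT e θ := by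
  have := Real.sin_sq_add_cos_sq θ
  calc e = (Real.sin θ ^ 2 + Real.cos θ ^ 2) • e := by rw [this, one_smul]
    _ = _ := by
      simp only [merC, merT]
      module

section Meridian

variable [NeZero n] {h : En n → ℝ} {e : En n}

theorem inner_pole_self : ⟪pole n, pole n⟫_ℝ = 1 := by
  rw [real_inner_self_eq_norm_sq, norm_pole, one_pow]

theorem inner_mer (he : ‖e‖ = 1) (hpe : ⟪pole n, e⟫_ℝ = 0) (a b c d : ℝ) :
    ⟪a • pole n + b • e, c • pole n + d • e⟫_ℝ = a * c + b * d := by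
  have hep : ⟪e, pole n⟫_ℝ = 0 := by rw [real_inner_comm, hpe]
  have hee : ⟪e, e⟫_ℝ = 1 := by rw [real_inner_self_eq_norm_sq, he, one_pow]
  simp only [inner_add_left, inner_add_right, real_inner_smul_left, real_inner_smul_right,
    inner_pole_self, hpe, hep, hee]
  ring

theorem norm_merC (he : ‖e‖ = 1) (hpe : ⟪pole n, e⟫_ℝ = 0) (θ : ℝ) : ‖merC e θ‖ = 1 := by
  have : ‖merC e θ‖ ^ 2 = 1 := by
    rw [← real_inner_self_eq_norm_sq, merC, inner_mer he hpe]
    nlinarith [Real.sin_sq_add_cos_sq θ]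
  exact (pow_eq_one_iff_of_nonneg (norm_nonneg _) two_ne_zero).1 this

theorem norm_merT (he : ‖e‖ = 1) (hpe : ⟪pole n, e⟫_ℝ = 0) (θ : ℝ) : ‖merT e θ‖ = 1 := by
  have : ‖merT e θ‖ ^ 2 = 1 := by
    rw [← real_inner_self_eq_norm_sq, merT, inner_mer he hpe]
    nlinarith [Real.sin_sq_add_cos_sq θ]
  exact (pow_eq_one_iff_of_nonneg (norm_nonneg _) two_ne_zero).1 this

theorem inner_merC_merT (he : ‖e‖ = 1) (hpe : ⟪pole n, e⟫_ℝ = 0) (θ : ℝ) :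
    ⟪merC e θ, merT e θ⟫_ℝ = 0 := by
  rw [merC, merT, inner_mer he hpe]
  ring

theorem merC_ne_zero (he : ‖e‖ = 1) (hpe : ⟪pole n, e⟫_ℝ = 0) (θ : ℝ) : merC e θ ≠ 0 := fun h0 => by
  have := norm_merC he hpe θ
  simp [h0] at this

theorem inner_merC_pole (hpe : ⟪pole n, e⟫_ℝ = 0) (θ : ℝ) :
    ⟪merC e θ, pole n⟫_ℝ = Real.cos θ := by
  have hep : ⟪e, pole n⟫_ℝ = 0 := by rw [real_inner_comm, hpe]
  rw [merC, inner_add_left, real_inner_smul_left, real_inner_smul_left, inner_pole_self, hep]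
  ring

/-- The radius of curvature along the meridian. -/
def merQ (h : En n → ℝ) (e : En n) (θ : ℝ) : ℝ := ⟪hess h (merC e θ) (merT e θ), merT e θ⟫_ℝ

/-- The derivative of `h` along the meridian in direction `e`. -/
def merW (h : En n → ℝ) (e : En n) (θ : ℝ) : ℝ := ⟪gradient h (merC e θ), e⟫_ℝ

namespace IsAxial

theorem hasDerivAt_merW (H : IsAxial h) (he : ‖e‖ = 1) (hpe : ⟪pole n, e⟫_ℝ = 0) (θ : ℝ) :
    HasDerivAt (merW h e) (merQ h e θ * Real.cos θ) θ := by
  have hne := merC_ne_zero he hpe θ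
  have h1 : HasDerivAt (fun θ => gradient h (merC e θ)) (hess h (merC e θ) (merT e θ)) θ :=
    (H.hom.hasFDerivAt_gradient hne).comp_hasDerivAt θ (hasDerivAt_merC e θ)
  have h2 := h1.inner ℝ (hasDerivAt_const θ e)
  refine h2.congr_deriv ?_
  have h3 : ⟪hess h (merC e θ) (merT e θ), merC e θ⟫_ℝ = 0 := by
    rw [H.hom.hess_symm hne, H.hom.hess_self hne, inner_zero_right]
  have h4 := congrArg (fun z => ⟪hess h (merC e θ) (merT e θ), z⟫_ℝ) (mer_decomp e θ)
  simp only [inner_add_right, real_inner_smul_right, h3] at h4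
  rw [inner_zero_right, zero_add, h4, merQ]
  ring

theorem merW_zero (H : IsAxial h) (hpe : ⟪pole n, e⟫_ℝ = 0) : merW h e 0 = 0 := by
  have hc : merC e 0 = pole n := by simp [merC]
  have hp : pole n ≠ 0 := fun h0 => by
    have := norm_pole (n := n)
    simp [h0] at this
  have hep : ⟪e, pole n⟫_ℝ = 0 := by rw [real_inner_comm, hpe]
  rw [merW, hc]
  exact H.inner_gradient_eq_zero hp hep hep

theorem continuous_merQ (H : IsAxial h) (he : ‖e‖ = 1) (hpe : ⟪pole n, e⟫_ℝ = 0) :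
    Continuous (merQ h e) := by
  have h1 : Continuous fun θ => hess h (merC e θ) := continuous_iff_continuousAt.2 fun θ =>
    ContinuousAt.comp (g := hess h) (H.hom.continuousAt_hess (merC_ne_zero he hpe θ))
      (continuous_merC e).continuousAt
  exact (h1.clm_apply (continuous_merT e)).inner (continuous_merT e)

theorem exists_merQ_lower (H : IsAxial h) (he : ‖e‖ = 1) (hpe : ⟪pole n, e⟫_ℝ = 0) :
    ∃ ε > 0, ∀ θ, 0 ≤ θ → θ ≤ Real.pi / 2 → ε ≤ merQ h e θ := by
  obtain ⟨x, -, hx⟩ := isCompact_Icc.exists_isMinOn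
    (Set.nonempty_Icc.2 (by positivity : (0 : ℝ) ≤ Real.pi / 2)) (H.continuous_merQ he hpe).continuousOn
  refine ⟨merQ h e x, H.pos _ _ (norm_merC he hpe x) (fun h0 => ?_) (inner_merC_merT he hpe x),
    fun θ h0 h1 => hx ⟨h0, h1⟩⟩
  have := norm_merT he hpe x
  simp [h0] at this

theorem sin_mul_hess_perp (H : IsAxial h) (he : ‖e‖ = 1) (hpe : ⟪pole n, e⟫_ℝ = 0) {f : En n}
    (hf : ‖f‖ = 1) (hpf : ⟪pole n, f⟫_ℝ = 0) (hef : ⟪e, f⟫_ℝ = 0) (θ : ℝ) :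
    Real.sin θ * ⟪hess h (merC e θ) f, f⟫_ℝ = merW h e θ := by
  set a : ℝ → En n := fun s => Real.cos s • e + Real.sin s • f with ha
  set b : ℝ → En n := fun s => -Real.sin s • e + Real.cos s • f with hb
  have hfp : ⟪f, pole n⟫_ℝ = 0 := by rw [real_inner_comm, hpf]
  have hep : ⟪e, pole n⟫_ℝ = 0 := by rw [real_inner_comm, hpe]
  have hfe : ⟪f, e⟫_ℝ = 0 := by rw [real_inner_comm, hef]
  have hee : ⟪e, e⟫_ℝ = 1 := by rw [real_inner_self_eq_norm_sq, he, one_pow]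
  have hff : ⟪f, f⟫_ℝ = 1 := by rw [real_inner_self_eq_norm_sq, hf, one_pow]
  have han : ∀ s, ‖a s‖ = 1 := fun s => by
    have : ‖a s‖ ^ 2 = 1 := by
      rw [← real_inner_self_eq_norm_sq]
      simp only [ha, inner_add_left, inner_add_right, real_inner_smul_left, real_inner_smul_right, hee, hff,
        hef, hfe]
      nlinarith [Real.sin_sq_add_cos_sq s]
    exact (pow_eq_one_iff_of_nonneg (norm_nonneg _) two_ne_zero).1 this
  have hap : ∀ s, ⟪pole n, a s⟫_ℝ = 0 := fun s => by
    simp [ha, inner_add_right, real_inner_smul_right, hpe, hpf]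
  have hz : ∀ s, ⟪gradient h (merC (a s) θ), b s⟫_ℝ = 0 := fun s => by
    refine H.inner_gradient_eq_zero (merC_ne_zero (han s) (hap s) θ) ?_ ?_
    · simp only [ha, hb, merC, inner_add_left, inner_add_right, real_inner_smul_left,
        real_inner_smul_right, hee, hff, hef, hfe, hep, hfp]
      ring
    · simp [hb, inner_add_left, real_inner_smul_left, hep, hfp]
  have da : HasDerivAt a f 0 := by
    refine (((Real.hasDerivAt_cos 0).smul_const e).add ((Real.hasDerivAt_sin 0).smul_const f)).congr_deriv ?_
    simp
  have db : HasDerivAt b (-e) 0 := by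
    refine (((Real.hasDerivAt_sin 0).neg.smul_const e).add
      ((Real.hasDerivAt_cos 0).smul_const f)).congr_deriv ?_
    simp
  have dm : HasDerivAt (fun s => merC (a s) θ) (Real.sin θ • f) 0 :=
    (da.const_smul (Real.sin θ)).const_add (Real.cos θ • pole n)
  have a0 : a 0 = e := by simp [ha]
  have b0 : b 0 = f := by simp [hb]
  have hg : HasFDerivAt (gradient h) (hess h (merC e θ)) (merC (a 0) θ) := by
    rw [a0]
    exact H.hom.hasFDerivAt_gradient (merC_ne_zero he hpe θ)
  have h1 : HasDerivAt (fun s => gradient h (merC (a s) θ)) (hess h (merC e θ) (Real.sin θ • f)) 0 :=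
    HasFDerivAt.comp_hasDerivAt (l := gradient h) 0 hg dm
  have h2 := h1.inner ℝ db
  simp only [hz] at h2
  have h3 := h2.unique (hasDerivAt_const (0 : ℝ) (0 : ℝ))
  rw [a0, b0, map_smul, real_inner_smul_left, inner_neg_right] at h3
  rw [merW]
  linarith

theorem sin_mul_trL (H : IsAxial h) (hn : 2 ≤ n) (he : ‖e‖ = 1) (hpe : ⟪pole n, e⟫_ℝ = 0) (θ : ℝ) :
    Real.sin θ * trL n (hess h (merC e θ)) =
      ((n : ℝ) - 2) * merW h e θ + Real.sin θ * merQ h e θ := by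
  have hij : (⟨0, by omega⟩ : Fin n) ≠ ⟨1, by omega⟩ := by simp
  obtain ⟨b, hb0, hb1⟩ := exists_basis_pair (norm_merC he hpe θ) (norm_merT he hpe θ)
    (inner_merC_merT he hpe θ) hij
  set i : Fin n := ⟨0, by omega⟩
  set j : Fin n := ⟨1, by omega⟩
  have hterm : ∀ k, Real.sin θ * ⟪hess h (merC e θ) (b k), b k⟫_ℝ = merW h e θ +
      ((if k = i then -merW h e θ else 0) +
        if k = j then Real.sin θ * merQ h e θ - merW h e θ else 0) := fun k => by
    by_cases hki : k = i
    · rw [if_pos hki, if_neg (by rw [hki]; exact hij), hki, hb0, H.hom.hess_self (merC_ne_zero he hpe θ)]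
      simp
    by_cases hkj : k = j
    · rw [if_neg hki, if_pos hkj, hkj, hb1, merQ]
      ring
    · have o1 : ⟪merC e θ, b k⟫_ℝ = 0 := by
        rw [← hb0]
        exact b.orthonormal.2 (Ne.symm hki)
      have o2 : ⟪merT e θ, b k⟫_ℝ = 0 := by
        rw [← hb1]
        exact b.orthonormal.2 (Ne.symm hkj)
      have o3 : ⟪e, b k⟫_ℝ = 0 := by
        rw [mer_decomp e θ, inner_add_left, real_inner_smul_left, real_inner_smul_left, o1, o2]
        ring
      have o4 : ⟪pole n, b k⟫_ℝ = 0 := by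
        have : pole n = Real.cos θ • merC e θ - Real.sin θ • merT e θ := by
          have h1 := Real.sin_sq_add_cos_sq θ
          calc pole n = (Real.sin θ ^ 2 + Real.cos θ ^ 2) • pole n := by rw [h1, one_smul]
            _ = _ := by
              simp only [merC, merT]
              module
        rw [this, inner_sub_left, real_inner_smul_left, real_inner_smul_left, o1, o2]
        ring
      rw [if_neg hki, if_neg hkj, H.sin_mul_hess_perp he hpe (b.orthonormal.1 k) o4 o3]
      ring
  rw [trL_eq_sum _ b, Finset.mul_sum, Finset.sum_congr rfl fun k _ => hterm k, Finset.sum_add_distrib,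
    Finset.sum_add_distrib, Finset.sum_const, Finset.sum_ite_eq', Finset.sum_ite_eq', Finset.card_univ,
    Fintype.card_fin, nsmul_eq_mul]
  simp only [Finset.mem_univ, if_true]
  ring

end IsAxial

end Meridian

section Gap

variable [NeZero n] {h : En n → ℝ}

theorem IsAxial.exists_gap (H : IsAxial h) (hn : 3 ≤ n) {κ : ℝ → ℝ} (hc : Continuous κ)
    (hκ : ∀ u : En n, ‖u‖ = 1 → trKer h u = κ ⟪u, pole n⟫_ℝ) :
    ∃ η > 0, ∀ m, 1 ≤ m →
      ((n : ℝ) - 1) * |merid n fun t => κ t * legF n m t| ≤ merid n κ - η := by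
  have hn2 : 2 ≤ n := by omega
  have hn' : (3 : ℝ) ≤ n := by exact_mod_cast hn
  obtain ⟨e, he, hpe⟩ := exists_unit_perp hn2 (pole n)
  obtain ⟨ε, hε, hq⟩ := H.exists_merQ_lower he hpe
  have cone := continuous_const (X := ℝ) (y := (1 : ℝ))
  refine ⟨ε * ((n : ℝ) - 1) * merid n fun _ => 1,
    mul_pos (mul_pos hε (by linarith)) (merid_one_pos hn2), fun m hm => ?_⟩
  obtain ⟨f1, f2, f3, hS⟩ := legF_legSol hn hm
  have key := hS.meridian_gap hn (legF_one hn hm) (fun t h0 h1 => legF_lower hn hm h0 h1)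
    (w := fun θ => merW h e θ - ε * Real.sin θ) (q := fun θ => merQ h e θ - ε)
    (fun θ => ((H.hasDerivAt_merW he hpe θ).sub ((Real.hasDerivAt_sin θ).const_mul ε)).congr_deriv
      (by ring)) (by simp [H.merW_zero hpe]) ((H.continuous_merQ he hpe).sub continuous_const)
    (fun θ h0 h1 => sub_nonneg.2 (hq θ h0 h1))
  have hpt : ∀ θ, ((n : ℝ) - 2) * (merW h e θ - ε * Real.sin θ) * Real.sin θ ^ (n - 3) +
      (merQ h e θ - ε) * Real.sin θ ^ (n - 2) =
      (κ (Real.cos θ) - ε * ((n : ℝ) - 1)) * Real.sin θ ^ (n - 2) := fun θ => by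
    have h1 := H.sin_mul_trL hn2 he hpe θ
    rw [← trKer_sph h (norm_merC he hpe θ), hκ _ (norm_merC he hpe θ), inner_merC_pole hpe] at h1
    have h2 : Real.sin θ ^ (n - 2) = Real.sin θ * Real.sin θ ^ (n - 3) := by
      rw [← pow_succ']
      congr 1
      omega
    rw [h2]
    linear_combination (-Real.sin θ ^ (n - 3)) * h1
  simp only [hpt] at key
  have e1 := merid_lin (n := n) (contMul hc (continuous_legF (n := n) m)) (continuous_legF (n := n) m) 1
    (-(ε * ((n : ℝ) - 1)))
  have e2 := merid_lin (n := n) hc cone 1 (-(ε * ((n : ℝ) - 1)))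
  rw [merid_legF hn hm] at e1
  have k1 : (∫ θ in (0 : ℝ)..(Real.pi / 2), (κ (Real.cos θ) - ε * ((n : ℝ) - 1)) * Real.sin θ ^ (n - 2) *
      legF n m (Real.cos θ)) = merid n fun t => κ t * legF n m t := by
    rw [show (merid n fun t => κ t * legF n m t) =
      1 * (merid n fun t => κ t * legF n m t) + -(ε * ((n : ℝ) - 1)) * 0 by ring, ← e1, merid]
    refine intervalIntegral.integral_congr fun θ _ => ?_
    ring
  have k2 : (∫ θ in (0 : ℝ)..(Real.pi / 2), (κ (Real.cos θ) - ε * ((n : ℝ) - 1)) * Real.sin θ ^ (n - 2)) =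
      merid n κ - ε * ((n : ℝ) - 1) * merid n fun _ => 1 := by
    rw [show (merid n κ - ε * ((n : ℝ) - 1) * merid n fun _ => 1) =
      1 * merid n κ + -(ε * ((n : ℝ) - 1)) * merid n fun _ => 1 by ring, ← e2, merid]
    refine intervalIntegral.integral_congr fun θ _ => ?_
    ring
  rwa [k1, k2] at key

theorem IsAxial.integral_trL (H : IsAxial h) (hn : 2 ≤ n) {κ κ₁ : ℝ → ℝ}
    (hκ : ∀ u : En n, ‖u‖ = 1 → h u = κ ⟪u, pole n⟫_ℝ)
    (hκ₁ : ∀ u : En n, ‖u‖ = 1 → trKer h u = κ₁ ⟪u, pole n⟫_ℝ)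
    {K : ConvexBody (En n)} (hK : IsC2Hom (supp K)) {u : En n} (hu : ‖u‖ = 1) :
    ∫ v : Sph n, κ ⟪u, (v : En n)⟫_ℝ * trL n (hess (fun x => supp K x - ‖x‖) v) ∂(sphVol n) =
      ∫ v : Sph n, (supp K v - 1) * κ₁ ⟪u, (v : En n)⟫_ℝ ∂(sphVol n) := by
  obtain ⟨L, hL⟩ := exists_supp_eq_of_subadditive (H.hom.comp_isometry (poleRefl u))
    (fun x y => by rw [map_add]; exact H.subadd _ _)
  have hLh : IsC2Hom (supp L) := by
    rw [hL]
    exact H.hom.comp_isometry (poleRefl u)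
  have key := integral_trL_sub_norm_comm hn hK hLh
  have hr : ∀ v : Sph n, ‖poleRefl u v‖ = 1 := fun v => by
    rw [LinearIsometryEquiv.norm_map, norm_sph]
  rw [hL] at key
  convert key using 1
  · refine sph_integral_congr fun v => ?_
    change _ = h (poleRefl u v) * _
    rw [hκ _ (hr v), inner_poleRefl_pole hu, real_inner_comm]
  · refine sph_integral_congr fun v => ?_
    rw [trL_hess_comp H.hom _ (ne_zero_of_sph v), ← trKer_sph h (hr v), hκ₁ _ (hr v),
      inner_poleRefl_pole hu, real_inner_comm]

theorem IsAxial.integral_profile (H : IsAxial h) (hn : 2 ≤ n) {κ κ₁ : ℝ → ℝ}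
    (hκ : ∀ u : En n, ‖u‖ = 1 → h u = κ ⟪u, pole n⟫_ℝ)
    (hκ₁ : ∀ u : En n, ‖u‖ = 1 → trKer h u = κ₁ ⟪u, pole n⟫_ℝ) {u : En n} (hu : ‖u‖ = 1) :
    ((n : ℝ) - 1) * (∫ v : Sph n, κ ⟪u, (v : En n)⟫_ℝ ∂(sphVol n)) =
      ∫ v : Sph n, κ₁ ⟪u, (v : En n)⟫_ℝ ∂(sphVol n) := by
  have hs : supp (scale 2 (ballB n)) = fun x : En n => 2 * ‖x‖ := by
    ext x
    rw [supp_scale, supp_smul _ (by norm_num), supp_ball]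
  have hK : IsC2Hom (supp (scale 2 (ballB n))) := by
    rw [hs]
    exact isC2Hom_norm.const_mul 2
  have key := H.integral_trL hn hκ hκ₁ hK hu
  rw [hs] at key
  rw [← integral_const_mul]
  convert key using 1
  · refine sph_integral_congr fun v => ?_
    rw [show (fun x : En n => 2 * ‖x‖ - ‖x‖) = fun x => ‖x‖ by ext; ring, trL_hess_norm, mul_comm]
  · refine sph_integral_congr fun v => ?_
    change _ = (2 * ‖(v : En n)‖ - 1) * _
    rw [norm_sph]
    ring

/-- The kernel of an even regular valuation, together with its spectral gap. -/
structure IsKernel (i : ℕ) (Φ : ConvexBody (En n) → ConvexBody (En n)) (h : En n → ℝ) (κ₁ : ℝ → ℝ)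
    (a q : ℝ) : Prop where
  axial : IsAxial h
  cont : Continuous κ₁
  even : ∀ t, κ₁ (-t) = κ₁ t
  profile : ∀ u : En n, ‖u‖ = 1 → trKer h u = κ₁ ⟪u, pole n⟫_ℝ
  q_nonneg : 0 ≤ q
  q_lt : q < a
  gap : ∀ m, 1 ≤ m → |sliceC n * merid n fun t => κ₁ t * legF n m t| ≤ q
  repr : ∀ K : ConvexBody (En n), IsC2Hom (supp K) → (∀ u : Sph n, 0 ≤ areaDens i K u) →
    ∀ R : Sph n → ℝ, (∀ v : Sph n, R v = areaDens i K v - 1 -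
      i / ((n : ℝ) - 1) * trL n (hess (fun x => supp K x - ‖x‖) v)) →
    ∀ x, supp (Φ K) x = a * ‖x‖ +
      (i / ((n : ℝ) - 1) * avg (trKer h) (fun v => supp K v - 1) x + avg h R x)

theorem continuous_trL_hess_sub {K : ConvexBody (En n)} (hK : IsC2Hom (supp K)) :
    Continuous fun v : Sph n => trL n (hess (fun x => supp K x - ‖x‖) v) :=
  continuous_trL_hess (hK.sub isC2Hom_norm)

theorem exists_isKernel (hn : 3 ≤ n) {i : ℕ} {Φ : ConvexBody (En n) → ConvexBody (En n)}
    (heven : IsEven Φ) (hreg : CInfRegular i Φ) : ∃ h κ₁ a q, IsKernel i Φ h κ₁ a q := by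
  have hn2 : 2 ≤ n := by omega
  have hn' : (3 : ℝ) ≤ n := by exact_mod_cast hn
  obtain ⟨h, κ, H, hκc, hκe, hκ, hrep⟩ := exists_even_kernel hn2 heven hreg
  obtain ⟨κ₁, hc, he, hκ₁⟩ := H.exists_trKer_profile hn2
  obtain ⟨η, hη, hgap⟩ := H.exists_gap hn hc hκ₁
  have hS := sliceC_pos (n := n) hn2
  set a := sliceC n * merid n κ with ha
  have ha1 : ((n : ℝ) - 1) * a = sliceC n * merid n κ₁ := by
    have := H.integral_profile hn2 hκ hκ₁ (norm_pole (n := n))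
    rwa [sph_slice hn2 norm_pole hκc hκe, sph_slice hn2 norm_pole hc he] at this
  have hn1 : (0 : ℝ) < (n : ℝ) - 1 := by linarith
  have hgap' : ∀ m, 1 ≤ m → |sliceC n * merid n fun t => κ₁ t * legF n m t| ≤
      a - sliceC n * η / ((n : ℝ) - 1) := fun m hm => by
    have h1 := mul_le_mul_of_nonneg_left (hgap m hm) hS.le
    rw [abs_mul, abs_of_pos hS, le_sub_iff_add_le, ← le_sub_iff_add_le', div_le_iff₀ hn1]
    linarith
  refine ⟨h, κ₁, a, a - sliceC n * η / ((n : ℝ) - 1), H, hc, he, hκ₁,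
    (abs_nonneg _).trans (hgap' 1 le_rfl), sub_lt_self _ (div_pos (mul_pos hS hη) hn1), hgap', ?_⟩
  intro K hK hD R hR x
  have hRc : Continuous R := by
    rw [show R = fun v => _ from funext hR]
    exact ((continuous_areaDens hK i).sub continuous_const).sub
      (contConstMul _ (continuous_trL_hess_sub hK))
  have unit : ∀ u : En n, ‖u‖ = 1 → supp (Φ K) u = a +
      (i / ((n : ℝ) - 1) * avg (trKer h) (fun v => supp K v - 1) u + avg h R u) := fun u hu => by
    have hr : ∀ v : Sph n, ‖poleRefl (v : En n) u‖ = 1 := fun v => by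
      rw [LinearIsometryEquiv.norm_map, hu]
    have cκ := continuous_profile hκc u
    have e1 : avg (trKer h) (fun v => supp K v - 1) u =
        ∫ v : Sph n, (supp K v - 1) * κ₁ ⟪u, (v : En n)⟫_ℝ ∂(sphVol n) :=
      sph_integral_congr fun v => by rw [hκ₁ _ (hr v), inner_poleRefl_pole (norm_sph v)]
    have e2 : avg h R u = ∫ v : Sph n, κ ⟪u, (v : En n)⟫_ℝ * R v ∂(sphVol n) :=
      sph_integral_congr fun v => by rw [hκ _ (hr v), inner_poleRefl_pole (norm_sph v), mul_comm]
    have e3 := sph_integral_lin (contMul cκ (continuous_trL_hess_sub hK)) (contMul cκ hRc)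
      (i / ((n : ℝ) - 1)) 1
    have e4 := sph_integral_lin cκ (((contConstMul (i / ((n : ℝ) - 1))
      (contMul cκ (continuous_trL_hess_sub hK)))).add (contConstMul 1 (contMul cκ hRc))) 1 1
    rw [hrep K hK hD u hu, e1, ← H.integral_trL hn2 hκ hκ₁ hK hu, e2, ha,
      ← sph_slice hn2 hu hκc hκe]
    have e5 : ∀ v : Sph n, κ ⟪u, (v : En n)⟫_ℝ * areaDens i K v = 1 * κ ⟪u, (v : En n)⟫_ℝ +
        1 * (i / ((n : ℝ) - 1) * (κ ⟪u, (v : En n)⟫_ℝ * trL n (hess (fun x => supp K x - ‖x‖) v)) +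
          1 * (κ ⟪u, (v : En n)⟫_ℝ * R v)) := fun v => by
      rw [hR v]
      ring
    simp only [one_mul] at e3 e4
    rw [sph_integral_congr e5]
    simp only [one_mul]
    exact e4.trans (by rw [← e3]; rfl)
  have hφc : Continuous fun v : Sph n => supp K v - 1 := (continuous_supp_sph K).sub continuous_const
  have hA := H.isC2Hom_trKer.isC2Hom_avg hn2 hφc
  have hB := H.hom.isC2Hom_avg hn2 hRc
  rcases eq_or_ne x 0 with rfl | hx
  · rw [supp_zero, hA.zero, hB.zero]
    simp
  · have hx0 : 0 < ‖x‖ := norm_pos_iff.2 hx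
    have hu : ‖‖x‖⁻¹ • x‖ = 1 := by simp [norm_smul, hx]
    have hx' : x = ‖x‖ • (‖x‖⁻¹ • x) := by simp [smul_smul, hx]
    have key := unit _ hu
    have s1 : supp (Φ K) x = ‖x‖ * supp (Φ K) (‖x‖⁻¹ • x) := by
      rw [← supp_smul _ hx0.le, ← hx']
    have s2 : avg (trKer h) (fun v => supp K v - 1) x =
        ‖x‖ * avg (trKer h) (fun v => supp K v - 1) (‖x‖⁻¹ • x) := by
      rw [← hA.hom _ hx0, ← hx']
    have s3 : avg h R x = ‖x‖ * avg h R (‖x‖⁻¹ • x) := by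
      rw [← hB.hom _ hx0, ← hx']
    rw [s1, s2, s3, key]
    ring

theorem IsKernel.avg_trKer {i : ℕ} {Φ : ConvexBody (En n) → ConvexBody (En n)} {κ₁ : ℝ → ℝ} {a q : ℝ}
    (k : IsKernel i Φ h κ₁ a q) (ψ : Sph n → ℝ) (u : Sph n) : avg (trKer h) ψ u = zonalT κ₁ ψ u :=
  sph_integral_congr fun v => by
    rw [k.profile _ (by rw [LinearIsometryEquiv.norm_map, norm_sph]), inner_poleRefl_pole (norm_sph v),
      mul_comm]

end Gap

section Near

theorem integral_abs_le_of_l2 [NeZero n] {f : Sph n → ℝ} (hf : Continuous f) {A : ℝ} (hA : 0 ≤ A)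
    (h : ∫ u, f u ^ 2 ∂(sphVol n) ≤ A ^ 2) :
    ∫ u, |f u| ∂(sphVol n) ≤ √((sphVol n).real Set.univ) * A := by
  set V := (sphVol n).real Set.univ with hV
  have hVp : 0 < V := sphVol_univ_pos
  set S := ∫ u, |f u| ∂(sphVol n) with hS
  have cabs : Continuous fun u => |f u| := hf.abs
  have csq : Continuous fun u => f u ^ 2 := contPow hf 2
  have h0 : 0 ≤ ∫ u, (|f u| - S / V) ^ 2 ∂(sphVol n) := integral_nonneg fun u => sq_nonneg _
  have h1 := sph_integral_lin csq cabs 1 (-2 * (S / V))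
  have h2 := sph_integral_lin (contAdd (contConstMul 1 csq) (contConstMul (-2 * (S / V)) cabs))
    (continuous_const (y := (1 : ℝ))) 1 ((S / V) ^ 2)
  have h3 : ∫ u, (|f u| - S / V) ^ 2 ∂(sphVol n) =
      (∫ u, f u ^ 2 ∂(sphVol n)) - 2 * (S / V) * S + (S / V) ^ 2 * V := by
    have e : ∀ u, (|f u| - S / V) ^ 2 =
        1 * (1 * f u ^ 2 + -2 * (S / V) * |f u|) + (S / V) ^ 2 * 1 := fun u => by
      rw [← sq_abs (f u)]
      ring
    rw [sph_integral_congr e, h2, h1]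
    simp only [integral_const, smul_eq_mul, mul_one, ← hV, ← hS]
    ring
  rw [h3] at h0
  have h4 : S ^ 2 ≤ V * A ^ 2 := by
    have e : (∫ u, f u ^ 2 ∂(sphVol n)) - 2 * (S / V) * S + (S / V) ^ 2 * V =
        (∫ u, f u ^ 2 ∂(sphVol n)) - S ^ 2 / V := by
      field_simp
      ring
    rw [e] at h0
    rw [← div_le_iff₀' hVp]
    linarith
  refine abs_le_of_sq_le_sq' ?_ (mul_nonneg (Real.sqrt_nonneg _) hA) |>.2
  rwa [mul_pow, Real.sq_sqrt hVp.le]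

theorem l2_add_le [NeZero n] {f g : Sph n → ℝ} (hf : Continuous f) (hg : Continuous g) {A B : ℝ}
    (hA : 0 ≤ A) (hB : 0 ≤ B) (h : ∫ u, f u ^ 2 ∂(sphVol n) ≤ A ^ 2) (hgB : ∀ u, |g u| ≤ B) :
    ∫ u, (f u + g u) ^ 2 ∂(sphVol n) ≤ (A + √((sphVol n).real Set.univ) * B) ^ 2 := by
  have h1 := integral_abs_le_of_l2 hf hA h
  set V := (sphVol n).real Set.univ with hV
  have hVp : 0 < V := sphVol_univ_pos
  have cabs : Continuous fun u => |f u| := hf.abs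
  have csq : Continuous fun u => f u ^ 2 := contPow hf 2
  have csum := contAdd (contConstMul 1 csq) (contConstMul (2 * B) cabs)
  have h2 := sph_integral_lin csq cabs 1 (2 * B)
  have h3 := sph_integral_lin csum (continuous_const (y := (1 : ℝ))) 1 (B ^ 2)
  have h4 : ∫ u, (f u + g u) ^ 2 ∂(sphVol n) ≤
      ∫ u, (1 * (1 * f u ^ 2 + 2 * B * |f u|) + B ^ 2 * 1) ∂(sphVol n) := by
    refine integral_mono (integrable_sph (contPow (contAdd hf hg) 2))
      (integrable_sph (contAdd (contConstMul 1 csum) continuous_const)) fun u => ?_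
    have a1 : f u * g u ≤ |f u| * B :=
      (le_abs_self _).trans (by rw [abs_mul]; exact mul_le_mul_of_nonneg_left (hgB u) (abs_nonneg _))
    have a2 : g u ^ 2 ≤ B ^ 2 := sq_le_sq.2 (by rw [abs_of_nonneg hB]; exact hgB u)
    change (f u + g u) ^ 2 ≤ 1 * (1 * f u ^ 2 + 2 * B * |f u|) + B ^ 2 * 1
    linarith [sq (f u + g u)]
  rw [h3, h2] at h4
  simp only [integral_const, smul_eq_mul, mul_one, ← hV] at h4
  have h5 : (√V * B) ^ 2 = B ^ 2 * V := by rw [mul_pow, Real.sq_sqrt hVp.le, mul_comm]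
  have h6 := mul_le_mul_of_nonneg_left h1 (show 0 ≤ 2 * B by linarith)
  calc _ ≤ _ := h4
    _ ≤ A ^ 2 + 2 * A * (√V * B) + (√V * B) ^ 2 := by rw [h5]; linarith
    _ = _ := by ring

/-- `K` is close to the unit ball: up to `e` in `L²` and up to `E` in `C²`. -/
structure Near (K : ConvexBody (En n)) (e E : ℝ) : Prop where
  c2 : IsC2Hom (supp K)
  mean : ∫ v : Sph n, (supp K v - 1) ∂(sphVol n) = 0
  l2 : ∫ v : Sph n, (supp K v - 1) ^ 2 ∂(sphVol n) ≤ e ^ 2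
  sup : ∀ u : Sph n, |supp K u - 1| ≤ E
  hess : ∀ u : Sph n, ‖hess (supp K) u - hess (fun x => ‖x‖) u‖ ≤ E

theorem continuous_supp_sub_one (K : ConvexBody (En n)) :
    Continuous fun v : Sph n => supp K v - 1 := (continuous_supp_sph K).sub continuous_const

theorem supp_scale_nonneg {c : ℝ} (hc : 0 ≤ c) (K : ConvexBody (En n)) :
    supp (scale c K) = fun x => c * supp K x := by
  ext x
  rw [supp_scale, supp_smul _ hc]

theorem scale_scale {c d : ℝ} (hc : 0 ≤ c) (hd : 0 ≤ d) (K : ConvexBody (En n)) :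
    scale c (scale d K) = scale (c * d) K := by
  refine supp_injective fun x => ?_
  rw [supp_scale_nonneg hc, supp_scale_nonneg hd, supp_scale_nonneg (mul_nonneg hc hd)]
  exact (mul_assoc c d _).symm

theorem C2dist_bounds {K : ConvexBody (En n)} (hK : IsC2Hom (supp K)) {ε : ℝ}
    (h : C2dist (supp K) (supp (ballB n)) < ε) (u : Sph n) :
    |supp K u - 1| ≤ ε ∧ ‖hess (supp K) u - hess (fun x => ‖x‖) u‖ ≤ ε := by
  have hB := isC2Hom_supp_ball (n := n)
  have ho : IsOpen ({0}ᶜ : Set (En n)) := isOpen_compl_singleton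
  have cit : ∀ {N : En n → ℝ}, IsC2Hom N → Continuous fun u : Sph n => iteratedFDeriv ℝ 2 N u :=
    fun hN => continuous_iff_continuousAt.2 fun u =>
      ContinuousAt.comp (g := iteratedFDeriv ℝ 2 _)
        (((hN.contDiffAt (ne_zero_of_sph u)).continuousAt_iteratedFDeriv (k := 2) le_rfl))
        continuous_subtype_val.continuousAt
  have cfd : ∀ {N : En n → ℝ}, IsC2Hom N → Continuous fun u : Sph n => fderiv ℝ N u :=
    fun hN => continuous_iff_continuousAt.2 fun u =>
      ContinuousAt.comp (g := fderiv ℝ _)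
        (hN.differentiableAt_fderiv (ne_zero_of_sph u)).continuousAt
        continuous_subtype_val.continuousAt
  have hc : Continuous fun u : Sph n => (|supp K (u : En n) - supp (ballB n) (u : En n)| +
      ‖fderiv ℝ (supp K) (u : En n) - fderiv ℝ (supp (ballB n)) (u : En n)‖ +
      ‖iteratedFDeriv ℝ 2 (supp K) (u : En n) - iteratedFDeriv ℝ 2 (supp (ballB n)) (u : En n)‖) :=
    (((continuous_supp_sph K).sub (continuous_supp_sph _)).abs.add ((cfd hK).sub (cfd hB)).norm).add
      ((cit hK).sub (cit hB)).norm
  have hb : BddAbove (Set.range fun u : Sph n => (|supp K (u : En n) - supp (ballB n) (u : En n)| +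
      ‖fderiv ℝ (supp K) (u : En n) - fderiv ℝ (supp (ballB n)) (u : En n)‖ +
      ‖iteratedFDeriv ℝ 2 (supp K) (u : En n) - iteratedFDeriv ℝ 2 (supp (ballB n)) (u : En n)‖)) :=
    (isCompact_range hc).bddAbove
  have hu := (le_ciSup hb u).trans h.le
  have n1 := abs_nonneg (supp K (u : En n) - supp (ballB n) (u : En n))
  have n2 := norm_nonneg (fderiv ℝ (supp K) (u : En n) - fderiv ℝ (supp (ballB n)) (u : En n))
  have n3 := norm_nonneg
    (iteratedFDeriv ℝ 2 (supp K) (u : En n) - iteratedFDeriv ℝ 2 (supp (ballB n)) (u : En n))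
  have hε : 0 ≤ ε := by linarith
  refine ⟨?_, ?_⟩
  · rw [supp_ball, norm_sph] at *
    linarith
  · rw [show (fun x : En n => ‖x‖) = supp (ballB n) from (funext supp_ball).symm]
    refine ContinuousLinearMap.opNorm_le_of_re_inner_le hε fun v w hv hw => ?_
    have h0 := ne_zero_of_sph u
    have e : ⟪(hess (supp K) u - hess (supp (ballB n)) u) v, w⟫_ℝ =
        (iteratedFDeriv ℝ 2 (supp K) u - iteratedFDeriv ℝ 2 (supp (ballB n)) u) ![v, w] := by
      rw [sub_apply, inner_sub_left, hK.inner_hess_eq_iterated h0, hB.inner_hess_eq_iterated h0]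
      rfl
    change ⟪(hess (supp K) u - hess (supp (ballB n)) u) v, w⟫_ℝ ≤ ε
    rw [e]
    refine (Real.le_norm_self _).trans ((ContinuousMultilinearMap.le_opNorm _ _).trans ?_)
    simp only [Fin.prod_univ_two, Matrix.cons_val_zero, Matrix.cons_val_one, hv, hw, mul_one]
    linarith

theorem exists_near [NeZero n] : ∃ C > 0, ∀ (K : ConvexBody (En n)) (ε : ℝ), ε ≤ 1 / 2 →
    IsC2Hom (supp K) → C2dist (supp K) (supp (ballB n)) < ε →
    ∃ b > 0, Near (scale b K) (C * ε) (C * ε) := by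
  set V := (sphVol n).real Set.univ with hV
  have hVp : 0 < V := sphVol_univ_pos
  obtain ⟨H, hH0, hH⟩ := exists_sph_bound (isC2Hom_norm (n := n)).continuous_hess_sph
  refine ⟨√V * 4 + 4 + 2 * (1 + H), by positivity, fun K ε hε2 hK hd => ?_⟩
  have hb := C2dist_bounds hK hd
  have hε : 0 ≤ ε := (abs_nonneg _).trans (hb ⟨EuclideanSpace.single 0 1, by simp⟩).1
  set μ := (∫ v : Sph n, supp K v ∂(sphVol n)) / V with hμ
  have i1 : ∫ v : Sph n, (supp K v - 1) ∂(sphVol n) = V * (μ - 1) := by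
    rw [integral_sub (integrable_sph (continuous_supp_sph K)) (integrable_const _)]
    simp only [integral_const, smul_eq_mul, mul_one, ← hV]
    rw [mul_sub, hμ, mul_div_cancel₀ _ hVp.ne', mul_one]
  have hμ1 : |μ - 1| ≤ ε := by
    have := abs_integral_sph_le fun u => (hb u).1
    rw [i1, abs_mul, abs_of_pos hVp, mul_comm] at this
    exact le_of_mul_le_mul_right this hVp
  have hμh : 1 / 2 ≤ μ := by linarith [(abs_le.1 hμ1).1]
  have hμp : 0 < μ := by linarith
  have hinv : μ⁻¹ ≤ 2 := by
    rw [show (2 : ℝ) = (1 / 2)⁻¹ by norm_num]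
    exact inv_anti₀ (by norm_num) hμh
  have hinv0 : 0 < μ⁻¹ := inv_pos.2 hμp
  have hs := supp_scale_nonneg hinv0.le K
  have hpt : ∀ u : Sph n, supp (scale μ⁻¹ K) u - 1 = μ⁻¹ * ((supp K u - 1) - (μ - 1)) := fun u => by
    rw [hs]
    field_simp
    ring
  have hsup : ∀ u : Sph n, |supp (scale μ⁻¹ K) u - 1| ≤ 4 * ε := fun u => by
    rw [hpt, abs_mul, abs_of_pos hinv0]
    have h1 := (abs_sub (supp K u - 1) (μ - 1)).trans (add_le_add (hb u).1 hμ1)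
    calc _ ≤ 2 * (ε + ε) := mul_le_mul hinv h1 (abs_nonneg _) (by norm_num)
      _ = _ := by ring
  have hle : 4 * ε ≤ (√V * 4 + 4 + 2 * (1 + H)) * ε :=
    mul_le_mul_of_nonneg_right (by linarith [Real.sqrt_nonneg V]) hε
  refine ⟨μ⁻¹, hinv0, ?_, ?_, ?_, fun u => (hsup u).trans hle, fun u => ?_⟩
  · rw [hs]
    exact hK.const_mul _
  · rw [sph_integral_congr hpt, integral_const_mul,
      integral_sub (integrable_sph (continuous_supp_sub_one K)) (integrable_const _), i1]
    simp only [integral_const, smul_eq_mul, ← hV, sub_self, mul_zero]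
  · have := l2_add_le (n := n) (f := fun _ => 0) continuous_const
      (continuous_supp_sub_one (scale μ⁻¹ K)) le_rfl (by positivity) (by simp) hsup
    simp only [zero_add] at this
    refine this.trans (pow_le_pow_left₀ (by positivity) ?_ 2)
    rw [← hV, ← mul_assoc]
    exact mul_le_mul_of_nonneg_right (by linarith) hε
  · rw [hs, hK.hess_const_mul _ (ne_zero_of_sph u)]
    have e : μ⁻¹ • hess (supp K) (u : En n) - hess (fun x => ‖x‖) (u : En n) =
        μ⁻¹ • ((hess (supp K) (u : En n) - hess (fun x => ‖x‖) (u : En n)) -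
          (μ - 1) • hess (fun x => ‖x‖) (u : En n)) := by
      rw [smul_sub, smul_sub, smul_smul, mul_sub, inv_mul_cancel₀ hμp.ne']
      module
    rw [e, norm_smul, Real.norm_of_nonneg hinv0.le]
    have h1 : ‖(hess (supp K) (u : En n) - hess (fun x => ‖x‖) (u : En n)) -
          (μ - 1) • hess (fun x => ‖x‖) (u : En n)‖ ≤ ε + ε * H := by
      refine (norm_sub_le _ _).trans (add_le_add (hb u).2 ?_)
      rw [norm_smul, Real.norm_eq_abs]
      exact mul_le_mul hμ1 (hH u) (norm_nonneg _) hε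
    calc _ ≤ 2 * (ε + ε * H) := mul_le_mul hinv h1 (norm_nonneg _) (by norm_num)
      _ = 2 * (1 + H) * ε := by ring
      _ ≤ _ := mul_le_mul_of_nonneg_right (by linarith [Real.sqrt_nonneg V]) hε

end Near

section Step

variable [NeZero n]

theorem exists_areaDens_remainder (hn : 2 ≤ n) {i : ℕ} (hi : i ≤ n - 1) :
    ∃ δ > (0 : ℝ), ∃ C ≥ (0 : ℝ), ∀ (K : ConvexBody (En n)) (e E : ℝ), Near K e E → 0 ≤ E → E ≤ δ →
      (∀ u : Sph n, 0 ≤ areaDens i K u) ∧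
      ∀ v : Sph n, |areaDens i K v - 1 -
        i / ((n : ℝ) - 1) * trL n (hess (fun x => supp K x - ‖x‖) v)| ≤ C * E ^ 2 := by
  obtain ⟨δ, hδ, C, hC, key⟩ := areaDens_expansion hn hi
  set c : ℝ := i / ((n : ℝ) - 1) with hc
  have hT : 0 ≤ |c| * ‖trL n‖ := by positivity
  refine ⟨min (min δ 1) (1 / (1 + |c| * ‖trL n‖ + C)), by positivity, C, hC,
    fun K e E hK hE hEδ => ?_⟩
  have hE1 : E ≤ δ := hEδ.trans ((min_le_left _ _).trans (min_le_left _ _))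
  have hE2 : E ≤ 1 := hEδ.trans ((min_le_left _ _).trans (min_le_right _ _))
  have hE3 : E * (1 + |c| * ‖trL n‖ + C) ≤ 1 := by
    rw [← le_div_iff₀ (by positivity)]
    exact hEδ.trans (min_le_right _ _)
  have hsub : ∀ v : Sph n, hess (fun x => supp K x - ‖x‖) v = hess (supp K) v - hess (fun x => ‖x‖) v :=
    fun v => hK.c2.hess_sub isC2Hom_norm (ne_zero_of_sph v)
  have hR : ∀ v : Sph n, |areaDens i K v - 1 -
      c * trL n (hess (fun x => supp K x - ‖x‖) v)| ≤ C * E ^ 2 := fun v => by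
    rw [hsub]
    exact (key K hK.c2 v ((hK.hess v).trans hE1)).trans
      (mul_le_mul_of_nonneg_left (pow_le_pow_left₀ (norm_nonneg _) (hK.hess v) 2) hC)
  refine ⟨fun u => ?_, hR⟩
  have h1 := (abs_le.1 (hR u)).1
  have h2 : |c * trL n (hess (fun x => supp K x - ‖x‖) u)| ≤ |c| * ‖trL n‖ * E := by
    rw [abs_mul, mul_assoc, hsub]
    exact mul_le_mul_of_nonneg_left (((trL n).le_opNorm _).trans
      (mul_le_mul_of_nonneg_left (hK.hess u) (norm_nonneg _))) (abs_nonneg _)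
  have h3 := (abs_le.1 h2).1
  have h4 : C * E ^ 2 ≤ C * E := mul_le_mul_of_nonneg_left (by nlinarith) hC
  nlinarith

theorem integral_zonalT_eq_zero (hn : 2 ≤ n) {κ : ℝ → ℝ} (hκ : Continuous κ) (he : ∀ t, κ (-t) = κ t)
    {φ : Sph n → ℝ} (hφ : Continuous φ) (h0 : ∫ v, φ v ∂(sphVol n) = 0) :
    ∫ u : Sph n, zonalT κ φ (u : En n) ∂(sphVol n) = 0 := by
  have h1 := zonalT_symm hκ hφ (continuous_const (y := (1 : ℝ)))
  simp only [mul_one] at h1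
  rw [h1, sph_integral_congr (g := fun u => φ u * (sliceC n * merid n κ)) fun u => ?_,
    integral_mul_const, h0, zero_mul]
  rw [zonalT, ← sph_slice hn (norm_sph u) hκ he]
  simp only [mul_one]

theorem IsKernel.exists_step {i : ℕ} {Φ : ConvexBody (En n) → ConvexBody (En n)} {h : En n → ℝ}
    {κ₁ : ℝ → ℝ} {a q : ℝ} (k : IsKernel i Φ h κ₁ a q) (hn : 3 ≤ n) (hi : i ≤ n - 1) :
    ∃ θ : ℝ, 0 ≤ θ ∧ θ < 1 ∧ ∃ δ > (0 : ℝ), ∃ M ≥ (0 : ℝ), ∀ (K : ConvexBody (En n)) (e E : ℝ),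
      Near K e E → 0 ≤ e → 0 ≤ E → E ≤ δ →
      ∃ b > 0, Near (scale b (Φ K)) (θ * e + M * E ^ 2) (M * (e + E ^ 2)) := by
  have hn2 : 2 ≤ n := by omega
  have hn' : (3 : ℝ) ≤ n := by exact_mod_cast hn
  obtain ⟨δ₀, hδ₀, C, hC, hexp⟩ := exists_areaDens_remainder hn2 hi
  obtain ⟨C₁, hC₁, hA⟩ := k.axial.isC2Hom_trKer.exists_avg_bound hn2
  obtain ⟨C₂, hC₂, hB⟩ := k.axial.hom.exists_avg_bound hn2
  obtain ⟨H, hH0, hH⟩ := exists_sph_bound (isC2Hom_norm (n := n)).continuous_hess_sph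
  set V := (sphVol n).real Set.univ with hV
  have hVp : 0 < V := sphVol_univ_pos
  set c : ℝ := i / ((n : ℝ) - 1) with hc
  have hc0 : 0 ≤ c := div_nonneg (Nat.cast_nonneg _) (by linarith)
  have hc1 : c ≤ 1 := by
    rw [hc, div_le_one (by linarith)]
    have : (i : ℝ) + 1 ≤ n := by exact_mod_cast (by omega : i + 1 ≤ n)
    linarith
  set P := C₂ * (C * V) with hP
  have hP0 : 0 ≤ P := by positivity
  set r := (a + q) / 2 with hr
  have hq := k.q_nonneg
  have hqa := k.q_lt
  have hrp : 0 < r := by linarith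
  have hri : 0 ≤ r⁻¹ := (inv_pos.2 hrp).le
  set M₁ := √V * (r⁻¹ * (2 * P)) with hM₁
  set M₂ := r⁻¹ * (C₁ * √V + P * (2 + H)) with hM₂
  have hM₁0 : 0 ≤ M₁ := by positivity
  have hM₂0 : 0 ≤ M₂ := by positivity
  refine ⟨r⁻¹ * q, mul_nonneg hri hq, ?_, min δ₀ (min 1 ((a - q) / 2 / (P + 1))), ?_, M₁ + M₂,
    add_nonneg hM₁0 hM₂0, fun K e E hK he hE hEδ => ?_⟩
  · rw [inv_mul_lt_iff₀ hrp]
    linarith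
  · have : 0 < a - q := by linarith
    positivity
  obtain ⟨hD, hRb⟩ := hexp K e E hK hE (hEδ.trans (min_le_left _ _))
  have hE1 : E ≤ 1 := hEδ.trans ((min_le_right _ _).trans (min_le_left _ _))
  have hEP : E * (P + 1) ≤ (a - q) / 2 := by
    rw [← le_div_iff₀ (by positivity)]
    exact hEδ.trans ((min_le_right _ _).trans (min_le_right _ _))
  set R : Sph n → ℝ := fun v => areaDens i K v - 1 - c * trL n (hess (fun x => supp K x - ‖x‖) v) with hR
  have hRc : Continuous R := ((continuous_areaDens hK.c2 i).sub continuous_const).sub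
      (contConstMul _ (continuous_trL_hess_sub hK.c2))
  set φ : Sph n → ℝ := fun v => supp K v - 1 with hφ
  have hφc : Continuous φ := continuous_supp_sub_one K
  set A := avg (trKer h) φ with hAdef
  set B := avg h R with hBdef
  have hAh : IsC2Hom A := k.axial.isC2Hom_trKer.isC2Hom_avg hn2 hφc
  have hBh : IsC2Hom B := k.axial.hom.isC2Hom_avg hn2 hRc
  have hrepr : supp (Φ K) = fun x => a * ‖x‖ + (c * A x + B x) :=
    funext (k.repr K hK.c2 hD R fun v => rfl)
  have hRi : ∫ v, |R v| ∂(sphVol n) ≤ C * V * E ^ 2 := by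
    have := abs_integral_sph_le (f := fun v => |R v|) (C := C * E ^ 2) fun v => by
      rw [abs_abs]
      exact hRb v
    refine (le_abs_self _).trans (this.trans (le_of_eq ?_))
    rw [← hV]
    ring
  have hφi : ∫ v, |φ v| ∂(sphVol n) ≤ √V * e := integral_abs_le_of_l2 hφc he hK.l2
  have bB : ∀ u : Sph n, |B u| ≤ P * E ^ 2 ∧ ‖hess B u‖ ≤ P * E ^ 2 := fun u => by
    have e1 : C₂ * ∫ v, |R v| ∂(sphVol n) ≤ P * E ^ 2 := by
      rw [hP, mul_assoc]
      exact mul_le_mul_of_nonneg_left hRi hC₂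
    exact ⟨(hB R hRc u).1.trans e1, (hB R hRc u).2.trans e1⟩
  have bA : ∀ u : Sph n, |A u| ≤ C₁ * √V * e ∧ ‖hess A u‖ ≤ C₁ * √V * e := fun u => by
    have e1 : C₁ * ∫ v, |φ v| ∂(sphVol n) ≤ C₁ * √V * e := by
      rw [mul_assoc]
      exact mul_le_mul_of_nonneg_left hφi hC₁
    exact ⟨(hA φ hφc u).1.trans e1, (hA φ hφc u).2.trans e1⟩
  have hAz : ∀ u : Sph n, A u = zonalT κ₁ φ u := fun u => k.avg_trKer φ u
  have cA : Continuous fun u : Sph n => A u := by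
    simp only [hAz]
    exact continuous_zonalT k.cont hφc
  have cB : Continuous fun u : Sph n => B u := by
    have e1 : (fun u : Sph n => B u) = fun u : Sph n => supp (Φ K) u - (a + c * A u) := by
      ext u
      rw [hrepr]
      simp only [norm_sph]
      ring
    rw [e1]
    exact (continuous_supp_sph _).sub (contAdd continuous_const (contConstMul c cA))
  have iA : ∫ u : Sph n, A u ∂(sphVol n) = 0 := by
    rw [sph_integral_congr hAz]
    exact integral_zonalT_eq_zero hn2 k.cont k.even hφc hK.mean
  set β := (∫ u : Sph n, B u ∂(sphVol n)) / V with hβ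
  have hβV : ∫ u : Sph n, B u ∂(sphVol n) = V * β := by
    rw [hβ, mul_div_cancel₀ _ hVp.ne']
  have hβb : |β| ≤ P * E ^ 2 := by
    have := abs_integral_sph_le fun u => (bB u).1
    rw [hβV, abs_mul, abs_of_pos hVp, mul_comm] at this
    exact le_of_mul_le_mul_right this hVp
  set μ := a + β with hμ
  have hPE : P * E ^ 2 ≤ (a - q) / 2 := by nlinarith
  have hμr : r ≤ μ := by
    have := (abs_le.1 hβb).1
    linarith
  have hμp : 0 < μ := hrp.trans_le hμr
  have hμi : 0 < μ⁻¹ := inv_pos.2 hμp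
  have hir : μ⁻¹ ≤ r⁻¹ := inv_anti₀ hrp hμr
  have hs : supp (scale μ⁻¹ (Φ K)) = fun x => μ⁻¹ * (a * ‖x‖ + (c * A x + B x)) := by
    rw [supp_scale_nonneg hμi.le, hrepr]
  have hpt : ∀ u : Sph n, supp (scale μ⁻¹ (Φ K)) u - 1 = μ⁻¹ * c * A u + μ⁻¹ * (B u - β) := fun u => by
    have e1 : a = μ - β := by rw [hμ]; ring
    rw [hs]
    simp only [norm_sph]
    rw [e1]
    field_simp
    ring
  have bBβ : ∀ u : Sph n, |B u - β| ≤ 2 * P * E ^ 2 := fun u =>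
    (abs_sub _ _).trans (by linarith [(bB u).1])
  have cBβ : Continuous fun u : Sph n => B u - β := cB.sub continuous_const
  have hμc : μ⁻¹ * c ≤ r⁻¹ := (mul_le_of_le_one_right hμi.le hc1).trans hir
  have hμc0 : 0 ≤ μ⁻¹ * c := mul_nonneg hμi.le hc0
  refine ⟨μ⁻¹, hμi, ?_, ?_, ?_, fun u => ?_, fun u => ?_⟩
  · rw [hs]
    exact ((isC2Hom_norm.const_mul a).add ((hAh.const_mul c).add hBh)).const_mul μ⁻¹
  · rw [sph_integral_congr hpt, sph_integral_lin cA cBβ, iA,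
      integral_sub (integrable_sph cB) (integrable_const _), hβV]
    simp only [integral_const, smul_eq_mul, ← hV, sub_self, mul_zero, add_zero]
  · rw [sph_integral_congr fun u => by rw [hpt u]]
    have e1 : ∫ u : Sph n, (μ⁻¹ * c * A u) ^ 2 ∂(sphVol n) ≤ (r⁻¹ * q * e) ^ 2 := by
      simp only [mul_pow _ (A _), integral_const_mul]
      have e2 : ∫ u : Sph n, A u ^ 2 ∂(sphVol n) ≤ q ^ 2 * e ^ 2 := by
        rw [sph_integral_congr fun u => by rw [hAz u]]
        exact (zonalT_l2 hn k.cont k.even k.gap hφc hK.mean).trans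
          (mul_le_mul_of_nonneg_left hK.l2 (sq_nonneg q))
      calc _ ≤ r⁻¹ ^ 2 * (q ^ 2 * e ^ 2) := mul_le_mul (pow_le_pow_left₀ hμc0 hμc 2) e2
            (integral_nonneg fun u => sq_nonneg _) (sq_nonneg _)
        _ = _ := by ring
    have e3 : ∀ u : Sph n, |μ⁻¹ * (B u - β)| ≤ r⁻¹ * (2 * P * E ^ 2) := fun u => by
      rw [abs_mul, abs_of_pos hμi]
      exact mul_le_mul hir (bBβ u) (abs_nonneg _) hri
    refine (l2_add_le (contConstMul _ cA) (contConstMul _ cBβ)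
      (mul_nonneg (mul_nonneg hri hq) he) (by positivity) e1 e3).trans
      (pow_le_pow_left₀ (by positivity) ?_ 2)
    have e4 : √V * (r⁻¹ * (2 * P * E ^ 2)) = M₁ * E ^ 2 := by rw [hM₁]; ring
    rw [← hV, e4]
    have : 0 ≤ M₂ * E ^ 2 := by positivity
    linarith
  · rw [hpt]
    have e1 : |μ⁻¹ * c * A u| ≤ r⁻¹ * (C₁ * √V * e) := by
      rw [abs_mul, abs_of_nonneg hμc0]
      exact mul_le_mul hμc (bA u).1 (abs_nonneg _) hri
    have e2 : |μ⁻¹ * (B u - β)| ≤ r⁻¹ * (2 * P * E ^ 2) := by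
      rw [abs_mul, abs_of_pos hμi]
      exact mul_le_mul hir (bBβ u) (abs_nonneg _) hri
    refine (abs_add_le _ _).trans ((add_le_add e1 e2).trans ?_)
    have e3 : 0 ≤ M₁ * (e + E ^ 2) := by positivity
    have e4 : 0 ≤ r⁻¹ * (C₁ * √V * E ^ 2 + P * (2 + H) * e + P * H * E ^ 2) := by positivity
    have e5 : M₂ * (e + E ^ 2) = r⁻¹ * (C₁ * √V * e) + r⁻¹ * (2 * P * E ^ 2) +
      r⁻¹ * (C₁ * √V * E ^ 2 + P * (2 + H) * e + P * H * E ^ 2) := by rw [hM₂]; ring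
    linarith
  · have h0 := ne_zero_of_sph u
    have e0 : hess (supp (scale μ⁻¹ (Φ K))) u - hess (fun x => ‖x‖) u =
        (μ⁻¹ * c) • hess A u + μ⁻¹ • (hess B u - β • hess (fun x => ‖x‖) u) := by
      rw [hs, ((isC2Hom_norm.const_mul a).add ((hAh.const_mul c).add hBh)).hess_const_mul _ h0,
        (isC2Hom_norm.const_mul a).hess_add ((hAh.const_mul c).add hBh) h0,
        isC2Hom_norm.hess_const_mul _ h0, (hAh.const_mul c).hess_add hBh h0, hAh.hess_const_mul _ h0]
      have e1 : a = μ - β := by rw [hμ]; ring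
      rw [e1]
      simp only [smul_add, smul_smul, smul_sub, mul_sub, inv_mul_cancel₀ hμp.ne']
      module
    rw [e0]
    have e1 : ‖(μ⁻¹ * c) • hess A u‖ ≤ r⁻¹ * (C₁ * √V * e) := by
      rw [norm_smul, Real.norm_of_nonneg hμc0]
      exact mul_le_mul hμc (bA u).2 (norm_nonneg _) hri
    have e2 : ‖μ⁻¹ • (hess B u - β • hess (fun x => ‖x‖) u)‖ ≤ r⁻¹ * (P * E ^ 2 + P * E ^ 2 * H) := by
      rw [norm_smul, Real.norm_of_nonneg hμi.le]
      refine mul_le_mul hir ((norm_sub_le _ _).trans (add_le_add (bB u).2 ?_)) (norm_nonneg _) hri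
      rw [norm_smul]
      exact mul_le_mul hβb (hH u) (norm_nonneg _) (by positivity)
    refine (norm_add_le _ _).trans ((add_le_add e1 e2).trans ?_)
    have e3 : 0 ≤ M₁ * (e + E ^ 2) := by positivity
    have e4 : 0 ≤ r⁻¹ * (C₁ * √V * E ^ 2 + P * (2 + H) * e + P * E ^ 2) := by positivity
    have e5 : M₂ * (e + E ^ 2) = r⁻¹ * (C₁ * √V * e) + r⁻¹ * (P * E ^ 2 + P * E ^ 2 * H) +
      r⁻¹ * (C₁ * √V * E ^ 2 + P * (2 + H) * e + P * E ^ 2) := by rw [hM₂]; ring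
    linarith

end Step

section Iteration

theorem Near.hausdorffDist_le {K : ConvexBody (En n)} {e E : ℝ} (hK : Near K e E) (hE : 0 ≤ E) :
    hausdorffDist (K : Set (En n)) (closedBall (0 : En n) 1) ≤ E :=
  hausdorffDist_le_of_supp (L := ballB n) hE fun u hu => by
    rw [supp_ball, hu]
    exact hK.sup ⟨u, by simpa using hu⟩

theorem exists_radius_of_step {i : ℕ} {Φ : ConvexBody (En n) → ConvexBody (En n)}
    (hdeg : HasDegree i Φ) {θ δ M : ℝ} (hθ0 : 0 ≤ θ) (hθ1 : θ < 1) (hδ : 0 < δ) (hM : 0 ≤ M)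
    (step : ∀ (K : ConvexBody (En n)) (e E : ℝ), Near K e E → 0 ≤ e → 0 ≤ E → E ≤ δ →
      ∃ b > 0, Near (scale b (Φ K)) (θ * e + M * E ^ 2) (M * (e + E ^ 2))) :
    ∃ η > 0, ∀ (K : ConvexBody (En n)) (b e : ℝ), 0 < b → 0 ≤ e → e ≤ η → Near (scale b K) e e →
      ∃ γs : ℕ → ℝ, (∀ m, 0 < γs m) ∧
        Tendsto (fun m => hausdorffDist
            ((scale (γs m) (Φ^[m] K) : ConvexBody (En n)) : Set (En n))
            (closedBall (0 : En n) 1)) atTop (𝓝 0) := by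
  obtain ⟨ρ, hρ0, hρ1, hρθ⟩ : ∃ ρ : ℝ, 0 < ρ ∧ ρ < 1 ∧ θ < ρ :=
    ⟨(1 + θ) / 2, by linarith, by linarith, by linarith⟩
  set l := (ρ - θ) / (M + 1) with hl
  have hl0 : 0 < l := div_pos (by linarith) (by linarith)
  have hlM : θ + l * M ≤ ρ := by
    have : l * (M + 1) = ρ - θ := div_mul_cancel₀ _ (by linarith)
    linarith
  set s := min δ (ρ * l / (M * (1 + l) + 1)) with hs
  have hs0 : 0 < s := by positivity
  have hsδ : s ≤ δ := min_le_left _ _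
  have hsl : s * (M * (1 + l) + 1) ≤ ρ * l := by
    rw [← le_div_iff₀ (by positivity)]
    exact min_le_right _ _
  refine ⟨l * s / (1 + l), by positivity, fun K b e hb he heη hK => ?_⟩
  have inv : ∀ m : ℕ, ∃ c > 0, ∃ e E : ℝ, 0 ≤ e ∧ 0 ≤ E ∧ e + l * E ≤ l * s * ρ ^ m ∧
      Near (scale c (Φ^[m] K)) e E := fun m => by
    induction m with
    | zero =>
      refine ⟨b, hb, e, e, he, he, ?_, hK⟩
      rw [le_div_iff₀ (by positivity)] at heη
      rw [pow_zero]
      linarith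
    | succ m ih =>
      obtain ⟨c, hc, e, E, he, hE, hle, hN⟩ := ih
      have hpow : ρ ^ m ≤ 1 := pow_le_one₀ hρ0.le hρ1.le
      have hEs : E ≤ s := by
        have h1 : l * E ≤ l * s := by
          have : l * s * ρ ^ m ≤ l * s * 1 := mul_le_mul_of_nonneg_left hpow (by positivity)
          linarith
        exact le_of_mul_le_mul_left h1 hl0
      obtain ⟨b, hb, hN'⟩ := step _ e E hN he hE (hEs.trans hsδ)
      refine ⟨b * c ^ i, by positivity, ?_, ?_, ?_, ?_, ?_, ?_⟩
      · exact θ * e + M * E ^ 2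
      · exact M * (e + E ^ 2)
      · positivity
      · positivity
      · have h1 : E * (M * (1 + l)) ≤ ρ * l := by
          have : E * (M * (1 + l)) ≤ s * (M * (1 + l)) := mul_le_mul_of_nonneg_right hEs (by positivity)
          linarith
        have h2 : E * (E * (M * (1 + l))) ≤ E * (ρ * l) := mul_le_mul_of_nonneg_left h1 hE
        have h3 : (θ + l * M) * e ≤ ρ * e := mul_le_mul_of_nonneg_right hlM he
        have h4 : ρ * (e + l * E) ≤ ρ * (l * s * ρ ^ m) := mul_le_mul_of_nonneg_left hle hρ0.le
        rw [pow_succ ρ]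
        linarith
      · rwa [hdeg _ _ hc.le, scale_scale hb.le (by positivity), ← Function.iterate_succ_apply' Φ] at hN'
  choose γs hγ e E he hE hle hN using inv
  refine ⟨γs, hγ, squeeze_zero (fun m => hausdorffDist_nonneg) (fun m => ?_)
    (show Tendsto (fun m : ℕ => s * ρ ^ m) atTop (𝓝 0) by
      simpa using (tendsto_pow_atTop_nhds_zero_of_lt_one hρ0.le hρ1).const_mul s)⟩
  refine ((hN m).hausdorffDist_le (hE m)).trans (le_of_mul_le_mul_left ?_ hl0)
  linarith [hle m, he m]

end Iteration

/-- **Theorem 1.** Iterations of a `C^∞₊` regular, translation invariant, even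
Minkowski valuation of degree `2 ≤ i ≤ n-1` commuting with `SO(n)` converge, after
rescaling, to the unit ball, for any body in a `C²`-neighborhood of the ball. -/
theorem iterations_converge_CInf_regular
    (n i : ℕ) (hn : 3 ≤ n) (hi₁ : 2 ≤ i) (hi₂ : i ≤ n - 1)
    (Φ : ConvexBody (En n) → ConvexBody (En n))
    (hval : IsMinkowskiValuation Φ)
    (htrans : TranslationInvariant Φ)
    (hdeg : HasDegree i Φ)
    (hrot : RotationEquivariant Φ)
    (heven : IsEven Φ)
    (hreg : CInfRegular i Φ) :
    ∃ ε > (0 : ℝ), ∀ K : ConvexBody (En n),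
      ContDiffOn ℝ 2 (supp K) {0}ᶜ →
      (∃ γ : ℝ, 0 < γ ∧ C2dist (supp (scale γ K)) (supp (ballB n)) < ε) →
      ∃ γs : ℕ → ℝ, (∀ m, 0 < γs m) ∧
        Tendsto (fun m => hausdorffDist
            ((scale (γs m) (Φ^[m] K) : ConvexBody (En n)) : Set (En n))
            (closedBall (0 : En n) 1)) atTop (𝓝 0) := by
  have : NeZero n := ⟨by omega⟩
  obtain ⟨h, κ₁, a, q, k⟩ := exists_isKernel hn heven hreg
  obtain ⟨θ, hθ0, hθ1, δ, hδ, M, hM, step⟩ := k.exists_step hn hi₂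
  obtain ⟨η, hη, key⟩ := exists_radius_of_step hdeg hθ0 hθ1 hδ hM step
  obtain ⟨C, hC, start⟩ := exists_near (n := n)
  refine ⟨min (1 / 2) (η / C), by positivity, fun K hK => ?_⟩
  rintro ⟨γ, hγ, hd⟩
  have hγK : IsC2Hom (supp (scale γ K)) := by
    rw [supp_scale_nonneg hγ.le]
    exact (isC2Hom_supp hK).const_mul γ
  obtain ⟨b, hb, hN⟩ := start _ _ (min_le_left _ _) hγK hd
  rw [scale_scale hb.le hγ.le] at hN
  refine key K _ _ (mul_pos hb hγ) (by positivity) ?_ hN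
  rw [← le_div_iff₀' hC]
  exact min_le_right _ _

end MinkIter
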